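/- There exists an absolute constant c such that for every polynomial f ∈ ℤ[y_1,y_2,y_3] of degree d ≥ 5 whose homogeneous part of highest degree is irreducible over the algebraic closure of ℚ, and every real B ≥ 1, one has N_aff(f,B) ≤ c·d^{14}·B. -/

import Mathlib

/-- The number of integer points `x ∈ ℤ^N` with `|x_i| ≤ B` for all `i` and `f(x) = 0`. -/
noncomputable def Naff {N : ℕ} (f : MvPolynomial (Fin N) ℤ) (B : ℝ) : ℕ :=
  Set.ncard {x : Fin N → ℤ | (∀ i, |(x i : ℝ)| ≤ B) ∧ MvPolynomial.eval x f = 0}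

set_option linter.unusedSimpArgs false

section
open MvPolynomial

lemma monCard (r N : ℕ) : Nat.card {n : Fin r →₀ ℕ | (n.sum fun _ e => e) ≤ N} = (N + r).choose r := by
  have key : ∀ N, {n : Fin r →₀ ℕ | (n.sum fun _ e => e) ≤ N} =
      ↑((Finset.range (N+1)).biUnion fun s => (Finset.univ : Finset (Fin r)).finsuppAntidiag s) := by
    intro N; ext n
    simp [Finset.mem_finsuppAntidiag, Finsupp.sum_fintype, Nat.lt_succ_iff]
  rw [key]
  simp only [Nat.card_eq_fintype_card, SetLike.coe_sort_coe, Fintype.card_coe]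
  rw [Finset.card_biUnion]
  · induction N with
    | zero => simp
    | succ N ih =>
      rw [Finset.sum_range_succ, ih, Finset.card_finsuppAntidiag_nat_eq_choose]
      simp only [Finset.card_univ, Fintype.card_fin]
      have e1 : r + (N + 1) - 1 = N + r := by omega
      rw [e1, ← Nat.choose_symm_add (a := N) (b := r), show N + 1 + r = (N + r) + 1 by ring,
        ← Nat.choose_succ_succ' (N+r) N, show N + r + 1 = (N + 1) + r by ring,
        Nat.choose_symm_add (a := N+1) (b := r)]
  · intro a _ b _ hab
    rw [Function.onFun, Finset.disjoint_left]
    intro x hx hy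
    simp [Finset.mem_finsuppAntidiag] at hx hy
    omega

lemma finrank_rtd (k : Type*) [Field k] (r N : ℕ) :
    Module.finrank k (restrictTotalDegree (Fin r) k N) = (N + r).choose r := by
  rw [← monCard]
  exact Module.finrank_eq_nat_card_basis (basisRestrictSupport k _)


lemma finrank_map_mul {k : Type*} [Field k] {r : ℕ} {F : MvPolynomial (Fin r) k} (hF : F ≠ 0)
    (V : Submodule k (MvPolynomial (Fin r) k)) :
    Module.finrank k (V.map (LinearMap.mulLeft k F)) = Module.finrank k V := by
  refine LinearEquiv.finrank_eq (Submodule.equivMapOfInjective _ ?_ V).symm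
  intro a b h
  exact mul_left_cancel₀ hF h

/-- General Bezout-type dimension count. -/
lemma bez_general {k : Type*} [Field k] {r : ℕ} {F G : MvPolynomial (Fin r) k} (hF : F ≠ 0) (hG : G ≠ 0)
    (hFG : IsRelPrime F G) {N : ℕ} (hN : F.totalDegree + G.totalDegree ≤ N)
    {ι : Type*} [Fintype ι] (h : ι → MvPolynomial (Fin r) k) (hdeg : ∀ i, (h i).totalDegree ≤ N)
    (hind : ∀ c : ι → k, (∑ i, c i • h i) ∈ Ideal.span {F, G} → c = 0) :
    Fintype.card ι + (N - F.totalDegree + r).choose r + (N - G.totalDegree + r).choose r ≤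
      (N + r).choose r + (N - F.totalDegree - G.totalDegree + r).choose r := by
  set d := F.totalDegree
  set e := G.totalDegree
  set U₁ := (restrictTotalDegree (Fin r) k (N - d)).map (LinearMap.mulLeft k F) with hU₁
  set U₂ := (restrictTotalDegree (Fin r) k (N - e)).map (LinearMap.mulLeft k G) with hU₂
  set U₃ := (restrictTotalDegree (Fin r) k (N - d - e)).map (LinearMap.mulLeft k (F*G)) with hU₃
  set H := Submodule.span k (Set.range h) with hH
  have hinf : U₁ ⊓ U₂ ≤ U₃ := by
    rintro x ⟨⟨a, ha, rfl⟩, ⟨b, hb, hab⟩⟩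
    simp only [LinearMap.mulLeft_apply] at hab
    have h1 : G ∣ F * a := ⟨b, hab.symm⟩
    have h2 : G ∣ a := hFG.symm.dvd_of_dvd_mul_left h1
    obtain ⟨c, rfl⟩ := h2
    refine ⟨c, ?_, by simp [mul_assoc]⟩
    by_cases hc : c = 0
    · subst hc; exact Submodule.zero_mem _
    have ha' : (G * c).totalDegree ≤ N - d := (mem_restrictTotalDegree _ _ _).1 ha
    refine (mem_restrictTotalDegree _ _ _).2 ?_
    rw [totalDegree_mul_of_isDomain hG hc] at ha'
    omega
  have hle1 : U₁ ≤ restrictTotalDegree (Fin r) k N := by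
    rintro x ⟨a, ha, rfl⟩
    have ha' := (mem_restrictTotalDegree _ _ _).1 ha
    refine (mem_restrictTotalDegree _ _ _).2 ((totalDegree_mul _ _).trans ?_)
    omega
  have hle2 : U₂ ≤ restrictTotalDegree (Fin r) k N := by
    rintro x ⟨a, ha, rfl⟩
    have ha' := (mem_restrictTotalDegree _ _ _).1 ha
    refine (mem_restrictTotalDegree _ _ _).2 ((totalDegree_mul _ _).trans ?_)
    omega
  have hle3 : H ≤ restrictTotalDegree (Fin r) k N := by
    rw [hH, Submodule.span_le]
    rintro _ ⟨i, rfl⟩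
    exact (mem_restrictTotalDegree _ _ _).2 (hdeg i)
  have hUI : ∀ x ∈ U₁ ⊔ U₂, x ∈ Ideal.span {F, G} := by
    intro x hx
    obtain ⟨y, ⟨a, _, rfl⟩, z, ⟨b, _, rfl⟩, rfl⟩ := Submodule.mem_sup.1 hx
    refine Ideal.add_mem _ (Ideal.mul_mem_right _ _ (Ideal.subset_span (by simp)))
      (Ideal.mul_mem_right _ _ (Ideal.subset_span (by simp)))
  have hli : LinearIndependent k h := by
    rw [Fintype.linearIndependent_iff]
    intro g hg i
    have := hind g (by rw [hg]; exact Ideal.zero_mem _)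
    exact congrFun this i
  have hdis : Disjoint H (U₁ ⊔ U₂) := by
    rw [Submodule.disjoint_def]
    intro x hx hx2
    obtain ⟨c, rfl⟩ := (Submodule.mem_span_range_iff_exists_fun k).1 hx
    have := hind c (hUI _ hx2)
    simp [this]
  have f1 : FiniteDimensional k U₁ := Submodule.finiteDimensional_of_le hle1
  have f2 : FiniteDimensional k U₂ := Submodule.finiteDimensional_of_le hle2
  have f3 : FiniteDimensional k H := Submodule.finiteDimensional_of_le hle3
  have e1 := Submodule.finrank_sup_add_finrank_inf_eq U₁ U₂
  have e2 := Submodule.finrank_sup_add_finrank_inf_eq H (U₁ ⊔ U₂)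
  rw [hdis.eq_bot, finrank_bot, add_zero] at e2
  have e3 : Module.finrank k (H ⊔ (U₁ ⊔ U₂) : Submodule k _) ≤ _ :=
    Submodule.finrank_mono (sup_le hle3 (sup_le hle1 hle2))
  have e4 := finrank_span_eq_card hli
  have e5 : Module.finrank k (U₁ ⊓ U₂ : Submodule k _) ≤ _ := Submodule.finrank_mono hinf
  rw [hU₁, hU₂, finrank_map_mul hF, finrank_map_mul hG, finrank_rtd, finrank_rtd, ← hU₁, ← hU₂] at e1
  rw [hU₃, finrank_map_mul (mul_ne_zero hF hG), finrank_rtd] at e5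
  rw [finrank_rtd] at e3
  rw [← hH] at e4
  omega

lemma choose2 (n : ℕ) : 2 * (n + 2).choose 2 = (n+2)*(n+1) := by
  rw [Nat.choose_two_right, Nat.mul_div_cancel']
  · simp
  · have := Nat.even_mul_succ_self (n+1)
    have h2 := this.two_dvd
    rw [mul_comm] at h2; simpa using h2

lemma choose3 (n : ℕ) : 6 * (n + 3).choose 3 = (n+3)*(n+2)*(n+1) := by
  have := Nat.add_one_mul_choose_eq (n+2) 2
  have h2 := choose2 n
  nlinarith

/-- Bezout in the plane. -/
lemma bez2 {k : Type*} [Field k] {F G : MvPolynomial (Fin 2) k} (hF : F ≠ 0) (hG : G ≠ 0)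
    (hFG : IsRelPrime F G) {ι : Type*} [Fintype ι] (h : ι → MvPolynomial (Fin 2) k)
    (hind : ∀ c : ι → k, (∑ i, c i • h i) ∈ Ideal.span {F, G} → c = 0) :
    Fintype.card ι ≤ F.totalDegree * G.totalDegree := by
  have := bez_general hF hG hFG (N := F.totalDegree + G.totalDegree + ∑ i, (h i).totalDegree)
    (by omega) h (fun i => le_trans (Finset.single_le_sum (f := fun i => (h i).totalDegree)
      (fun _ _ => Nat.zero_le _) (Finset.mem_univ i)) (by omega)) hind
  set M := ∑ i, (h i).totalDegree
  set d := F.totalDegree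
  set e := G.totalDegree
  rw [show d + e + M - d = e + M by omega, show d + e + M - e = d + M by omega,
    show e + M - e = M by omega] at this
  have a1 := choose2 (e+M)
  have a2 := choose2 (d+M)
  have a3 := choose2 M
  have a4 := choose2 (d+e+M)
  nlinarith

lemma bez3 {k : Type*} [Field k] {F G : MvPolynomial (Fin 3) k} (hF : F ≠ 0) (hG : G ≠ 0)
    (hFG : IsRelPrime F G) {N : ℕ} (hN : F.totalDegree + G.totalDegree ≤ N)
    {ι : Type*} [Fintype ι] (h : ι → MvPolynomial (Fin 3) k) (hdeg : ∀ i, (h i).totalDegree ≤ N)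
    (hind : ∀ c : ι → k, (∑ i, c i • h i) ∈ Ideal.span {F, G} → c = 0) :
    Fintype.card ι ≤ F.totalDegree * G.totalDegree * (N + 2) := by
  have := bez_general hF hG hFG hN h hdeg hind
  set d := F.totalDegree
  set e := G.totalDegree
  obtain ⟨M, rfl⟩ := Nat.exists_eq_add_of_le hN
  rw [show d + e + M - d = e + M by omega, show d + e + M - e = d + M by omega,
    show e + M - e = M by omega] at this
  have a1 := choose3 (e+M)
  have a2 := choose3 (d+M)
  have a3 := choose3 M
  have a4 := choose3 (d+e+M)
  have h6 : 6 * Fintype.card ι + (e+M+3)*(e+M+2)*(e+M+1) + (d+M+3)*(d+M+2)*(d+M+1)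
    ≤ (d+e+M+3)*(d+e+M+2)*(d+e+M+1) + (M+3)*(M+2)*(M+1) := by omega
  have : 6 * Fintype.card ι ≤ 6 * (d * e * (d + e + M + 2)) := by
    zify at h6 ⊢
    nlinarith [mul_nonneg (mul_nonneg (Int.natCast_nonneg d) (Int.natCast_nonneg e)) (Int.natCast_nonneg (d+e))]
  omega

end

section
open MvPolynomial

lemma exists_sep {k : Type*} [Field k] {r : ℕ} (P Q : Fin r → k) (h : P ≠ Q) :
    ∃ l : MvPolynomial (Fin r) k, eval Q l = 0 ∧ eval P l ≠ 0 := by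
  obtain ⟨i, hi⟩ := Function.ne_iff.1 h
  exact ⟨X i - C (Q i), by simp, by simpa [sub_eq_zero] using hi⟩

/-- number of common zeros -/
lemma bez2_points {k : Type*} [Field k] {F G : MvPolynomial (Fin 2) k} (hF : F ≠ 0) (hG : G ≠ 0)
    (hFG : IsRelPrime F G) (S : Finset (Fin 2 → k)) (hS : ∀ P ∈ S, eval P F = 0 ∧ eval P G = 0) :
    S.card ≤ F.totalDegree * G.totalDegree := by
  classical
  have hex : ∀ P Q : Fin 2 → k, ∃ l : MvPolynomial (Fin 2) k, P ≠ Q → eval Q l = 0 ∧ eval P l ≠ 0 := by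
    intro P Q
    by_cases h : P = Q
    · exact ⟨0, fun h' => absurd h h'⟩
    · obtain ⟨l, hl⟩ := exists_sep P Q h
      exact ⟨l, fun _ => hl⟩
  choose l hl using hex
  have := bez2 hF hG hFG (ι := S) (fun P => ∏ Q ∈ S.erase P, l P Q) ?_
  · simpa using this
  intro c hc
  obtain ⟨a, b, hab⟩ := Ideal.mem_span_pair.1 hc
  funext P
  have h2 := congrArg (eval (P : Fin 2 → k)) hab
  simp only [map_add, map_mul, hS P P.2, map_sum, smul_eval, mul_zero, add_zero, map_prod] at h2
  rw [Finset.sum_eq_single P] at h2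
  · have h3 := h2.symm
    rw [mul_eq_zero] at h3
    refine h3.resolve_right ?_
    change _ ≠ _
    rw [Finset.prod_ne_zero_iff]
    intro Q hQ
    exact (hl P Q (Finset.ne_of_mem_erase hQ).symm).2
  · intro Q _ hQ
    have hQ' : (Q : Fin 2 → k) ≠ P := fun h => hQ (Subtype.ext h)
    rw [Finset.prod_eq_zero (Finset.mem_erase.2 ⟨hQ'.symm, P.2⟩) (hl Q P hQ').1, mul_zero]
  · simp

lemma bez2_elim {k : Type*} [Field k] {F G : MvPolynomial (Fin 2) k} (hF : F ≠ 0) (hG : G ≠ 0)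
    (hFG : IsRelPrime F G) : ∃ q : Polynomial k, q ≠ 0 ∧ q.natDegree ≤ F.totalDegree * G.totalDegree ∧
      Polynomial.aeval (X 1 : MvPolynomial (Fin 2) k) q ∈ Ideal.span {F, G} := by
  by_contra! hcon
  have := bez2 hF hG hFG (ι := Fin (F.totalDegree * G.totalDegree + 1)) (fun i => X 1 ^ (i:ℕ)) ?_
  · simp at this
  intro c hc
  by_contra hne
  set q : Polynomial k := ∑ i : Fin (F.totalDegree * G.totalDegree + 1), Polynomial.C (c i) * Polynomial.X ^ (i:ℕ) with hq
  have hco : ∀ i : Fin (F.totalDegree * G.totalDegree + 1), q.coeff (i:ℕ) = c i := by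
    intro i
    simp only [hq, Polynomial.finsetSum_coeff, Polynomial.coeff_C_mul, Polynomial.coeff_X_pow]
    rw [Finset.sum_eq_single i]
    · simp
    · intro j _ hj
      rw [if_neg, mul_zero]
      exact fun h => hj (Fin.ext h.symm)
    · simp
  refine hcon q ?_ ?_ ?_
  · rintro h0
    apply hne; funext i; rw [← hco, h0]; simp
  · refine Polynomial.natDegree_sum_le_of_forall_le _ _ fun i _ => ?_
    exact (Polynomial.natDegree_C_mul_X_pow_le _ _).trans (Nat.lt_succ_iff.1 i.2)
  · convert hc using 1
    simp [hq, MvPolynomial.smul_eq_C_mul, algebraMap_eq]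

lemma bez3_elim {k : Type*} [Field k] {F G : MvPolynomial (Fin 3) k} (hF : F ≠ 0) (hG : G ≠ 0)
    (hFd : 1 ≤ F.totalDegree) (hGd : 1 ≤ G.totalDegree)
    (hFG : IsRelPrime F G) : ∃ q : MvPolynomial (Fin 2) k, q ≠ 0 ∧
      q.totalDegree ≤ 2 * (F.totalDegree * G.totalDegree) ∧
      rename Fin.succ q ∈ Ideal.span {F, G} := by
  by_contra! hcon
  set d := F.totalDegree
  set e := G.totalDegree
  set V := restrictTotalDegree (Fin 2) k (2 * (d * e))
  let b := Module.finBasis k V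
  have hinj := rename_injective (R := k) (Fin.succ : Fin 2 → Fin 3) (Fin.succ_injective 2)
  have := bez3 hF hG hFG (N := 2 * (d * e)) (by change d + e ≤ _; nlinarith)
    (ι := Fin (Module.finrank k V)) (fun i => rename Fin.succ (b i : MvPolynomial (Fin 2) k)) ?_ ?_
  · rw [Fintype.card_fin, finrank_rtd] at this
    have h2 := choose2 (2 * (d * e))
    change _ ≤ d * e * _ at this
    nlinarith
  · intro i
    refine (totalDegree_rename_le _ _).trans ?_
    exact (mem_restrictTotalDegree _ _ _).1 (b i).2
  · intro c hc
    by_contra hne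
    set q : V := ∑ i, c i • b i with hq
    have hq0 : q ≠ 0 := by
      intro h0
      apply hne; funext i
      exact Fintype.linearIndependent_iff.1 b.linearIndependent c h0 i
    refine hcon q (fun h => hq0 (Subtype.ext h)) ((mem_restrictTotalDegree _ _ _).1 q.2) ?_
    convert hc using 1
    simp [hq]

section V
variable {k A K : Type*} [Field k] [CommRing A] [Algebra k A] [Field K]
  (D : Derivation k A A) (ev : A →+* K)

def VV (n : ℕ) (h : A) : Prop := ∀ i < n, ev (D^[i] h) = 0

variable {D ev}
lemma VV_succ {n : ℕ} {h : A} : VV D ev (n+1) h ↔ ev h = 0 ∧ VV D ev n (D h) := by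
  constructor
  · intro H
    refine ⟨H 0 (by omega), fun i hi => ?_⟩
    have := H (i+1) (by omega)
    simpa [Function.iterate_succ_apply] using this
  · rintro ⟨h0, H⟩ i hi
    cases i with
    | zero => simpa using h0
    | succ i => simpa [Function.iterate_succ_apply] using H i (by omega)

lemma VV_mono {m n : ℕ} {h : A} (hmn : m ≤ n) (H : VV D ev n h) : VV D ev m h :=
  fun i hi => H i (by omega)

lemma VV_zero {n : ℕ} : VV D ev n (0:A) := by
  intro i _
  rw [iterate_map_zero]; simp

lemma VV_add {n : ℕ} {g h : A} (H : VV D ev n h) (H' : VV D ev n g) : VV D ev n (h + g) := by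
  intro i hi
  rw [iterate_map_add, map_add, H i hi, H' i hi, add_zero]

lemma VV_sum {n : ℕ} {ι : Type*} {s : Finset ι} {h : ι → A} (H : ∀ i ∈ s, VV D ev n (h i)) :
    VV D ev n (∑ i ∈ s, h i) := by
  classical
  induction s using Finset.induction_on with
  | empty => simpa using VV_zero
  | insert a s ha ih =>
    rw [Finset.sum_insert ha]
    exact VV_add (H a (by simp)) (ih fun i hi => H i (by simp [hi]))

lemma VV_mul {n : ℕ} {h : A} (g : A) (H : VV D ev n h) : VV D ev n (h * g) := by
  induction n generalizing h g with
  | zero => intro i hi; omega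
  | succ n ih =>
    obtain ⟨h0, H1⟩ := VV_succ.1 H
    refine VV_succ.2 ⟨by simp [h0], ?_⟩
    rw [Derivation.leibniz, smul_eq_mul, smul_eq_mul]
    refine VV_add (ih _ (VV_mono (by omega) H)) ?_
    rw [mul_comm]
    exact ih _ H1

lemma VV_lam {n : ℕ} {l h : A} (hl : ev l = 0) (H : VV D ev n h) : VV D ev (n+1) (l * h) := by
  induction n generalizing h with
  | zero => exact VV_succ.2 ⟨by simp [hl], fun i hi => by omega⟩
  | succ n ih =>
    obtain ⟨h0, H1⟩ := VV_succ.1 H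
    refine VV_succ.2 ⟨by simp [hl], ?_⟩
    rw [Derivation.leibniz, smul_eq_mul, smul_eq_mul]
    exact VV_add (ih H1) (VV_mul _ H)

lemma VV_pow {n : ℕ} {l : A} (hl : ev l = 0) : VV D ev n (l ^ n) := by
  induction n with
  | zero => intro i hi; omega
  | succ n ih => rw [pow_succ']; exact VV_lam hl ih

lemma VV_top {n : ℕ} {h : A} (g : A) (H : VV D ev n h) :
    ev (D^[n] (h * g)) = ev (D^[n] h) * ev g := by
  induction n generalizing h g with
  | zero => simp
  | succ n ih =>
    obtain ⟨h0, H1⟩ := VV_succ.1 H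
    rw [Function.iterate_succ_apply, Function.iterate_succ_apply, Derivation.leibniz, smul_eq_mul,
      smul_eq_mul, iterate_map_add, map_add, mul_comm g, ih _ H1,
      VV_mul (D g) H n (by omega), zero_add]

lemma VV_top_lam {n : ℕ} {l h : A} (hl : ev l = 0) (H : VV D ev n h) :
    ev (D^[n+1] (l * h)) = (n+1) * ev (D l) * ev (D^[n] h) := by
  induction n generalizing h with
  | zero => simp [hl]; ring
  | succ n ih =>
    obtain ⟨h0, H1⟩ := VV_succ.1 H
    rw [Function.iterate_succ_apply, Derivation.leibniz, smul_eq_mul,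
      smul_eq_mul, iterate_map_add, map_add, ih H1, VV_top _ H]
    simp only [Function.iterate_succ_apply]
    push_cast; ring

lemma VV_top_pow {n : ℕ} {l : A} (hl : ev l = 0) :
    ev (D^[n] (l ^ n)) = (n.factorial : K) * ev (D l) ^ n := by
  induction n with
  | zero => simp
  | succ n ih =>
    rw [pow_succ', VV_top_lam hl (VV_pow hl), ih, Nat.factorial_succ]
    push_cast; ring

end V

/-- the Jacobian derivation attached to `F` -/
noncomputable def jacD {k : Type*} [Field k] (F : MvPolynomial (Fin 2) k) :
    Derivation k (MvPolynomial (Fin 2) k) (MvPolynomial (Fin 2) k) :=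
  pderiv 0 F • pderiv 1 - pderiv 1 F • pderiv 0

lemma jacD_apply {k : Type*} [Field k] (F g : MvPolynomial (Fin 2) k) :
    jacD F g = pderiv 0 F * pderiv 1 g - pderiv 1 F * pderiv 0 g := rfl

lemma jacD_self {k : Type*} [Field k] (F : MvPolynomial (Fin 2) k) : jacD F F = 0 := by
  rw [jacD_apply]; ring

lemma jacD_X1 {k : Type*} [Field k] (F : MvPolynomial (Fin 2) k) : jacD F (X 1) = pderiv 0 F := by
  rw [jacD_apply]; simp [pderiv_X]

lemma VV_F {k : Type*} [Field k] {F : MvPolynomial (Fin 2) k} {P : Fin 2 → k} (h : eval P F = 0)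
    (n : ℕ) : VV (jacD F) (eval P) n F := by
  intro i _
  cases i with
  | zero => simpa using h
  | succ i => rw [Function.iterate_succ_apply, jacD_self, iterate_map_zero]; simp

/-- multiplicity lemma -/
lemma mult_bound {k : Type*} [Field k] {F G : MvPolynomial (Fin 2) k} (hF : Irreducible F)
    (hFG : ¬ F ∣ G) (S : Finset (Fin 2 → k)) (M : ℕ)
    (hM : ∀ i : ℕ, 0 < i → i < M → (i : k) ≠ 0)
    (hS : ∀ P ∈ S, eval P F = 0 ∧ eval P (pderiv 0 F) ≠ 0 ∧ VV (jacD F) (eval P) M G) :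
    S.card * M ≤ F.totalDegree * G.totalDegree := by
  classical
  have hG0 : G ≠ 0 := fun h => hFG (h ▸ dvd_zero F)
  have hrel : IsRelPrime F G := (hF.dvd_or_isRelPrime (n := G)).resolve_left hFG
  have hfac : ∀ i < M, ((i.factorial : ℕ) : k) ≠ 0 := by
    intro i
    induction i with
    | zero => simp
    | succ i ih =>
      intro hi
      rw [Nat.factorial_succ, Nat.cast_mul]
      exact mul_ne_zero (hM _ (by omega) hi) (ih (by omega))
  have hex : ∀ P Q : Fin 2 → k, ∃ l : MvPolynomial (Fin 2) k, P ≠ Q → eval Q l = 0 ∧ eval P l ≠ 0 := by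
    intro P Q
    by_cases h : P = Q
    · exact ⟨0, fun h' => absurd h h'⟩
    · obtain ⟨l, hl⟩ := exists_sep P Q h
      exact ⟨l, fun _ => hl⟩
  choose l hl using hex
  set u : (Fin 2 → k) → MvPolynomial (Fin 2) k := fun P => ∏ Q ∈ S.erase P, l P Q ^ M with hu
  have hu1 : ∀ P, eval P (u P) ≠ 0 := by
    intro P
    rw [hu]; simp only [map_prod, map_pow]
    rw [Finset.prod_ne_zero_iff]
    intro Q hQ
    exact pow_ne_zero _ (hl P Q (Finset.ne_of_mem_erase hQ).symm).2
  have hu2 : ∀ P ∈ S, ∀ Q, Q ≠ P → VV (jacD F) (eval P) M (u Q) := by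
    intro P hP Q hQ
    rw [hu]; simp only
    rw [← Finset.mul_prod_erase _ _ (Finset.mem_erase.2 ⟨hQ.symm, hP⟩)]
    exact VV_mul _ (VV_pow (hl Q P hQ).1)
  have := bez2 hF.ne_zero hG0 hrel (ι := S × Fin M)
    (fun x => (X 1 - C ((x.1 : Fin 2 → k) 1)) ^ (x.2 : ℕ) * u x.1) ?_
  · simpa using this
  intro c hc
  obtain ⟨a, b, hab⟩ := Ideal.mem_span_pair.1 hc
  have key : ∀ P : S, ∀ i : ℕ, ∀ hi : i < M, c (P, ⟨i, hi⟩) = 0 := by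
    intro P
    obtain ⟨hP1, hP2, hP3⟩ := hS P P.2
    set D := jacD F
    set ev := eval (P : Fin 2 → k)
    have hV1 : VV D ev M (∑ x : S × Fin M, c x • ((X 1 - C ((x.1 : Fin 2 → k) 1)) ^ (x.2 : ℕ) * u x.1)) := by
      rw [← hab, mul_comm a, mul_comm b]
      exact VV_add (VV_mul _ (VV_F hP1 M)) (VV_mul _ hP3)
    rw [Fintype.sum_prod_type, ← Finset.add_sum_erase _ _ (Finset.mem_univ P)] at hV1
    have hV2 : VV D ev M (∑ Q ∈ Finset.univ.erase P, ∑ y : Fin M,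
        c (Q, y) • ((X 1 - C ((Q : Fin 2 → k) 1)) ^ (y : ℕ) * u Q)) := by
      refine VV_sum fun Q hQ => VV_sum fun y _ => ?_
      rw [MvPolynomial.smul_eq_C_mul, ← mul_assoc, mul_comm _ (u _)]
      refine VV_mul _ (hu2 P P.2 Q fun h => (Finset.ne_of_mem_erase hQ) (Subtype.ext h))
    have hV3 : VV D ev M (∑ y : Fin M,
        (X 1 - C ((P : Fin 2 → k) 1)) ^ (y : ℕ) * (C (c (P, y)) * u P)) := by
      have h4 := VV_add hV1 (VV_mul (-1) hV2)
      convert h4 using 1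
      simp only [MvPolynomial.smul_eq_C_mul]
      ring_nf
      refine Finset.sum_congr rfl fun y _ => by ring
    have hl0 : ev (X 1 - C ((P : Fin 2 → k) 1)) = 0 := by simp [ev]
    have hDl : ev (D (X 1 - C ((P : Fin 2 → k) 1))) ≠ 0 := by
      simp only [D, map_sub, jacD_X1]
      have : jacD F (C ((P : Fin 2 → k) 1)) = 0 := by simp [jacD_apply]
      rw [this]; simpa using hP2
    intro i
    induction i using Nat.strong_induction_on with
    | _ i ih =>
    intro hi
    have h5 := hV3 i hi
    have h6 : D^[i] (∑ y : Fin M, (X 1 - C ((P : Fin 2 → k) 1)) ^ (y : ℕ) * (C (c (P, y)) * u P))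
      = ∑ y : Fin M, D^[i] ((X 1 - C ((P : Fin 2 → k) 1)) ^ (y : ℕ) * (C (c (P, y)) * u P)) := by
      have := map_sum ((D : MvPolynomial (Fin 2) k →ₗ[k] MvPolynomial (Fin 2) k) ^ i)
        (fun y : Fin M => (X 1 - C ((P : Fin 2 → k) 1)) ^ (y : ℕ) * (C (c (P, y)) * u P)) Finset.univ
      simp only [Module.End.pow_apply] at this
      exact this
    rw [h6, map_sum, Finset.sum_eq_single ⟨i, hi⟩] at h5
    · rw [VV_top _ (VV_pow hl0), VV_top_pow hl0] at h5
      simp only [mul_eq_zero, map_mul] at h5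
      rcases h5 with h | h | h
      · rcases h with h | h
        · exact absurd h (hfac i hi)
        · exact absurd h (pow_ne_zero _ hDl)
      · simpa [ev] using h
      · exact absurd h (hu1 P)
    · intro j _ hj
      have hji : (j : ℕ) ≠ i := fun h => hj (Fin.ext h)
      rcases lt_or_gt_of_ne hji with h | h
      · rw [ih j h j.2]; simp
      · exact VV_mul _ (VV_pow (n := (j:ℕ)) hl0) i h
    · simp
  funext ⟨P, i⟩
  exact key P i i.2

end

section
open MvPolynomial

lemma degree_eq_sum' {r : ℕ} (m : Fin r →₀ ℕ) : (m.sum fun _ e => e) = m.degree := rfl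

lemma tdeg_lt {r : ℕ} {R : Type*} [CommSemiring R] {p : MvPolynomial (Fin r) R} {m : Fin r →₀ ℕ}
    {d : ℕ} (h : p.totalDegree ≤ d) (hm : coeff m p ≠ 0) : m.degree ≤ d :=
  (le_totalDegree (mem_support_iff.2 hm)).trans h

lemma tdeg_le_iff {r : ℕ} {R : Type*} [CommSemiring R] {p : MvPolynomial (Fin r) R} {d : ℕ} :
    p.totalDegree ≤ d ↔ ∀ m, coeff m p ≠ 0 → m.degree ≤ d := by
  constructor
  · intro h m hm; exact tdeg_lt h hm
  · intro h
    rw [totalDegree, Finset.sup_le_iff]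
    intro m hm
    exact h m (mem_support_iff.1 hm)

lemma tdeg_pderiv {r : ℕ} {R : Type*} [CommSemiring R] (p : MvPolynomial (Fin r) R) (i : Fin r) :
    (pderiv i p).totalDegree ≤ p.totalDegree - 1 := by
  rw [tdeg_le_iff]
  intro m hm
  rw [coeff_pderiv] at hm
  have : coeff (m + Finsupp.single i 1) p ≠ 0 := by
    intro h; rw [h] at hm; simp at hm
  have := tdeg_lt le_rfl this
  simp at this
  omega

lemma top_pderiv0 {r : ℕ} {R : Type*} [CommSemiring R] (p : MvPolynomial (Fin (r+1)) R) (d : ℕ) :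
    coeff (Finsupp.single 0 d) (pderiv 0 p) = (d + 1 : R) * coeff (Finsupp.single 0 (d+1)) p := by
  rw [coeff_pderiv, ← Finsupp.single_add]
  simp [mul_comm]

/-- specialise all but the first variable -/
noncomputable def spec0 {r : ℕ} {R : Type*} [CommSemiring R] (y : Fin r → R) :
    MvPolynomial (Fin (r+1)) R →ₐ[R] Polynomial R :=
  aeval (Fin.cons Polynomial.X (fun i => Polynomial.C (y i)))

lemma eval_spec0 {r : ℕ} {R : Type*} [CommSemiring R] (y : Fin r → R) (x : R)
    (F : MvPolynomial (Fin (r+1)) R) : (spec0 y F).eval x = eval (Fin.cons x y) F := by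
  unfold spec0
  induction F using MvPolynomial.induction_on with
  | C a => simp
  | add p q hp hq => simp [hp, hq]
  | mul_X p i hp =>
    simp only [map_mul, aeval_X, Polynomial.eval_mul, hp, eval_X]
    refine Fin.cases ?_ (fun j => ?_) i <;> simp

lemma spec0_monomial {r : ℕ} {R : Type*} [CommSemiring R] (y : Fin r → R) (m : Fin (r+1) →₀ ℕ) (a : R) :
    spec0 y (monomial m a) = Polynomial.C (a * ∏ i, y i ^ m i.succ) * Polynomial.X ^ (m 0) := by
  unfold spec0
  rw [aeval_monomial, Finsupp.prod_fintype _ _ (by simp), Fin.prod_univ_succ]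
  simp [Polynomial.algebraMap_eq]
  ring

lemma spec0_natDegree {r : ℕ} {R : Type*} [CommSemiring R] (y : Fin r → R)
    {F : MvPolynomial (Fin (r+1)) R} {d : ℕ} (h : F.totalDegree ≤ d) : (spec0 y F).natDegree ≤ d := by
  rw [F.as_sum, map_sum]
  refine Polynomial.natDegree_sum_le_of_forall_le _ _ fun m hm => ?_
  rw [spec0_monomial]
  refine (Polynomial.natDegree_C_mul_X_pow_le _ _).trans ?_
  exact (Finsupp.le_degree 0 m).trans (tdeg_lt h (mem_support_iff.1 hm))

lemma spec0_coeff {r : ℕ} {R : Type*} [CommSemiring R] (y : Fin r → R)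
    {F : MvPolynomial (Fin (r+1)) R} {d : ℕ} (h : F.totalDegree ≤ d) :
    (spec0 y F).coeff d = coeff (Finsupp.single 0 d) F := by
  conv_lhs => rw [F.as_sum, map_sum]
  rw [Polynomial.finsetSum_coeff]
  simp only [spec0_monomial, Polynomial.coeff_C_mul, Polynomial.coeff_X_pow]
  rw [Finset.sum_eq_single (Finsupp.single 0 d)]
  · simp [Finsupp.single_apply]
  · intro m hm hne
    rw [if_neg, mul_zero]
    intro h0
    apply hne
    have hd := tdeg_lt h (mem_support_iff.1 hm)
    rw [Finsupp.degree_eq_sum, Fin.sum_univ_succ, ← h0] at hd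
    have : ∑ i : Fin r, m i.succ = 0 := by omega
    rw [Finset.sum_eq_zero_iff] at this
    ext i
    refine Fin.cases ?_ (fun j => ?_) i
    · simp [h0]
    · simp [this j (Finset.mem_univ _), Finsupp.single_apply, (Fin.succ_ne_zero j).symm]
  · intro hm
    rw [notMem_support_iff.1 hm]; simp

lemma top_mul {r : ℕ} {R : Type*} [CommSemiring R] {a b : MvPolynomial (Fin (r+1)) R} {i j : ℕ}
    (ha : a.totalDegree ≤ i) (hb : b.totalDegree ≤ j) :
    coeff (Finsupp.single 0 (i+j)) (a * b) =
      coeff (Finsupp.single 0 i) a * coeff (Finsupp.single 0 j) b := by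
  have hab := (totalDegree_mul a b).trans (add_le_add ha hb)
  rw [← spec0_coeff 0 hab, ← spec0_coeff 0 ha, ← spec0_coeff 0 hb, map_mul,
    Polynomial.coeff_mul_add_eq_of_natDegree_le (spec0_natDegree _ ha) (spec0_natDegree _ hb)]

lemma dvd_tdeg_eq_zero {r : ℕ} {R : Type*} [CommRing R] [IsDomain R] {F g : MvPolynomial (Fin r) R}
    (hd : g.totalDegree < F.totalDegree) (h : F ∣ g) : g = 0 := by
  by_contra hg
  obtain ⟨c, rfl⟩ := h
  have hF : F ≠ 0 := fun h => hg (by simp [h])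
  have hc : c ≠ 0 := fun h => hg (by simp [h])
  rw [totalDegree_mul_of_isDomain hF hc] at hd
  omega

lemma pderiv0_ne_zero {r : ℕ} {R : Type*} [CommRing R] [IsDomain R] {F : MvPolynomial (Fin (r+1)) R} {d : ℕ}
    (hd : 1 ≤ d) (hdR : (d : R) ≠ 0) (htop : coeff (Finsupp.single 0 d) F ≠ 0) : pderiv 0 F ≠ 0 := by
  intro h
  have := top_pderiv0 F (d-1)
  rw [h] at this
  rw [coeff_zero, show ((d-1 : ℕ) : R) + 1 = d by
    rw [← Nat.cast_succ, Nat.succ_eq_add_one, Nat.sub_add_cancel hd], Nat.sub_add_cancel hd] at this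
  exact mul_ne_zero hdR htop this.symm

end

section
open MvPolynomial

lemma pderiv_comm {r : ℕ} {R : Type*} [CommSemiring R] (p : MvPolynomial (Fin r) R) (i j : Fin r) :
    pderiv i (pderiv j p) = pderiv j (pderiv i p) := by
  by_cases hij : i = j
  · subst hij; rfl
  ext m
  simp only [coeff_pderiv]
  rw [add_right_comm]
  simp [Finsupp.single_apply, hij, Ne.symm hij, Ne.symm (Ne.symm hij)]
  ring

/-- Ruppert's operator -/
noncomputable def rupT {R : Type*} [CommRing R] (F g0 g1 : MvPolynomial (Fin 2) R) : MvPolynomial (Fin 2) R :=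
  F * (pderiv 1 g0 - pderiv 0 g1) - g0 * pderiv 1 F + g1 * pderiv 0 F

/-- kernel is trivial for absolutely irreducible polynomials -/
lemma rup_hard {k : Type*} [Field k] [IsAlgClosed k] [CharZero k] {F g0 g1 : MvPolynomial (Fin 2) k}
    {d : ℕ} (hd1 : 1 ≤ d) (hF : Irreducible F) (hd : F.totalDegree = d)
    (htop : coeff (Finsupp.single 0 d) F ≠ 0)
    (h0 : g0.totalDegree < d) (h1 : g1.totalDegree < d) (hn : coeff (Finsupp.single 0 (d-1)) g0 = 0)
    (hT : rupT F g0 g1 = 0) : g0 = 0 ∧ g1 = 0 := by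
  classical
  set b := pderiv 0 F with hb
  have hdk : (d : k) ≠ 0 := by exact_mod_cast (by omega : d ≠ 0)
  have hb0 : b ≠ 0 := pderiv0_ne_zero hd1 hdk htop
  have hbd : b.totalDegree < d := by have := tdeg_pderiv F 0; rw [hd] at this; rw [← hb] at this; omega
  have hFb : ¬ F ∣ b := fun h => hb0 (dvd_tdeg_eq_zero (by omega) h)
  -- a good point
  obtain ⟨P, hP1, hP2⟩ : ∃ P : Fin 2 → k, eval P F = 0 ∧ eval P b ≠ 0 := by
    by_contra! hcon
    have hroot : ∀ y : k, ∃ x : k, eval (Fin.cons x (fun _ : Fin 1 => y)) F = 0 := by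
      intro y
      have hdeg : (spec0 (fun _ : Fin 1 => y) F).degree ≠ 0 := by
        have hc := spec0_coeff (fun _ : Fin 1 => y) hd.le
        intro h
        have h2 := Polynomial.natDegree_eq_of_degree_eq_some (n := 0) h
        have : (spec0 (fun _ : Fin 1 => y) F).coeff d = 0 :=
          Polynomial.coeff_eq_zero_of_natDegree_lt (by omega)
        exact htop (hc ▸ this)
      obtain ⟨x, hx⟩ := IsAlgClosed.exists_root _ hdeg
      exact ⟨x, by rw [← eval_spec0]; exact hx⟩
    choose x hx using hroot
    let e : ℕ → (Fin 2 → k) := fun n => Fin.cons (x n) (fun _ : Fin 1 => (n : k))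
    have he : Function.Injective e := by
      intro m n hmn
      have := congrFun hmn 1
      simp only [e] at this
      have h2 : (m : k) = n := this
      exact_mod_cast h2
    have := bez2_points hF.ne_zero hb0 ((hF.dvd_or_isRelPrime (n := b)).resolve_left hFb)
      ((Finset.range (F.totalDegree * b.totalDegree + 1)).image e) (by
        intro Q hQ
        obtain ⟨n, _, rfl⟩ := Finset.mem_image.1 hQ
        exact ⟨hx n, hcon _ (hx n)⟩)
    rw [Finset.card_image_of_injective _ he] at this
    simp at this
  -- key congruences
  set D := jacD F with hD
  have hT' : F * (pderiv 1 g0 - pderiv 0 g1) = g0 * pderiv 1 F - g1 * b := by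
    unfold rupT at hT; linear_combination hT
  have k1 : F ∣ b * D g0 - g0 * D b := by
    have e1 := congrArg (pderiv 0) hT'
    simp only [Derivation.leibniz, map_sub, smul_eq_mul] at e1
    rw [← hb] at e1
    have hcomm : pderiv 0 (pderiv 1 F) = pderiv 1 b := pderiv_comm F 0 1 
    rw [hcomm] at e1
    rw [hD, jacD_apply, jacD_apply, ← hb]
    refine ⟨-b * pderiv 0 (pderiv 1 g0) + b * pderiv 0 (pderiv 0 g1) +
       pderiv 0 b * (pderiv 1 g0 - pderiv 0 g1), ?_⟩
    linear_combination b * e1 - pderiv 0 b * hT'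
  set c := eval P g0 / eval P b with hc
  set ψ := g0 - C c * b with hψ
  have hDC : D (C c) = 0 := by rw [hD, jacD_apply]; simp
  have k2 : F ∣ b * D ψ - ψ * D b := by
    convert k1 using 1
    rw [hψ, map_sub, Derivation.leibniz, hDC]; simp only [smul_eq_mul]; ring
  have hψP : eval P ψ = 0 := by
    rw [hψ]; simp only [map_sub, map_mul, eval_C, hc]; field_simp; ring
  have hDF : D F = 0 := jacD_self F
  have k3 : ∀ n : ℕ, ∃ s t, b ^ n * D^[n] ψ = ψ * s + F * t := by
    intro n
    induction n with
    | zero => exact ⟨1, 0, by simp⟩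
    | succ n ih =>
      obtain ⟨s, t, hst⟩ := ih
      obtain ⟨u, hu⟩ := k2
      have e1 := congrArg D hst
      simp only [Derivation.leibniz, map_add, smul_eq_mul, hDF, Derivation.leibniz_pow] at e1
      rw [Function.iterate_succ_apply']
      refine ⟨-(n : MvPolynomial (Fin 2) k) * D b * s + D b * s + b * D s,
        -(n : MvPolynomial (Fin 2) k) * D b * t + u * s + b * D t, ?_⟩
      rcases n with _ | n
      · simp only [pow_zero, zero_add, pow_one, Nat.cast_zero, zero_nsmul, mul_zero, add_zero, one_mul] at e1 hst ⊢
        linear_combination b * e1 + hu * s 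
      · simp only [nsmul_eq_mul, Nat.add_sub_cancel] at e1
        linear_combination b * e1 + hu * s - ((n+1 : ℕ) : MvPolynomial (Fin 2) k) * D b * hst
  have hFψ : F ∣ ψ := by
    by_contra hnd
    have := mult_bound hF hnd {P} (F.totalDegree * ψ.totalDegree + 1)
      (fun i hi _ => by exact_mod_cast (by omega : i ≠ 0)) (by
        intro Q hQ
        rw [Finset.mem_singleton] at hQ; subst hQ
        refine ⟨hP1, hP2, fun n _ => ?_⟩
        obtain ⟨s, t, hst⟩ := k3 n
        have h2 := congrArg (eval Q) hst
        simp only [map_mul, map_add, map_pow, hψP, hP1, zero_mul, add_zero, mul_eq_zero] at h2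
        exact h2.resolve_left (pow_ne_zero _ hP2))
    simp at this
  have hCb : (C c * b).totalDegree < d :=
    lt_of_le_of_lt (totalDegree_mul _ _) (by rw [totalDegree_C]; omega)
  have hψ0 : ψ = 0 := by
    refine dvd_tdeg_eq_zero ?_ hFψ
    rw [hd]
    exact lt_of_le_of_lt (totalDegree_sub _ _) (max_lt h0 hCb)
  have hg0 : g0 = C c * b := sub_eq_zero.1 hψ0
  have hc0 : c = 0 := by
    rw [hg0, coeff_C_mul, top_pderiv0, Nat.sub_add_cancel hd1] at hn
    rw [show ((d-1 : ℕ) : k) + 1 = d by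
      rw [← Nat.cast_succ, Nat.succ_eq_add_one, Nat.sub_add_cancel hd1]] at hn
    simpa [hdk, htop] using hn
  have hg00 : g0 = 0 := by rw [hg0, hc0]; simp
  refine ⟨hg00, ?_⟩
  rw [hg00] at hT'
  have hdv : F ∣ g1 * b := ⟨pderiv 0 g1, by simp at hT'; linear_combination -hT'⟩
  have := (((hF.dvd_or_isRelPrime (n := b)).resolve_left hFb).dvd_of_dvd_mul_right hdv)
  exact dvd_tdeg_eq_zero (by omega) this

/-- reducible polynomials have a non trivial kernel -/
lemma rup_easy {k : Type*} [Field k] {F : MvPolynomial (Fin 2) k}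
    {d : ℕ} (hd1 : 1 ≤ d) (hd : F.totalDegree = d) (hch : ∀ i : ℕ, 0 < i → i ≤ d → (i : k) ≠ 0)
    (htop : coeff (Finsupp.single 0 d) F ≠ 0) (hF : ¬ Irreducible F) :
    ∃ g0 g1 : MvPolynomial (Fin 2) k, g0.totalDegree < d ∧ g1.totalDegree < d ∧
      coeff (Finsupp.single 0 (d-1)) g0 = 0 ∧ rupT F g0 g1 = 0 ∧ g0 ≠ 0 := by
  have hF0 : F ≠ 0 := by rintro rfl; simp at htop
  have hFu : ¬ IsUnit F := by
    intro h
    obtain ⟨u, _, rfl⟩ := MvPolynomial.isUnit_iff_eq_C_of_isReduced.1 h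
    simp at hd; omega
  obtain ⟨a, ha, b, rfl⟩ := WfDvdMonoid.exists_irreducible_factor hFu hF0
  have ha0 : a ≠ 0 := left_ne_zero_of_mul hF0
  have hb0 : b ≠ 0 := right_ne_zero_of_mul hF0
  rw [totalDegree_mul_of_isDomain ha0 hb0] at hd
  set i := a.totalDegree with hi
  set j := b.totalDegree with hj
  have hbu : ¬ IsUnit b := by
    intro hu; exact hF ((irreducible_mul_isUnit hu).2 ha)
  have hi1 : 1 ≤ i := by
    by_contra h
    have := totalDegree_eq_zero_iff_eq_C.1 (show a.totalDegree = 0 by omega)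
    rw [this] at ha
    refine ha.not_isUnit ((isUnit_iff_ne_zero.2 ?_).map C)
    intro h0; rw [h0, C_0] at this; exact ha0 this
  have hj1 : 1 ≤ j := by
    by_contra h
    have := totalDegree_eq_zero_iff_eq_C.1 (show b.totalDegree = 0 by omega)
    rw [this] at hbu
    refine hbu ((isUnit_iff_ne_zero.2 ?_).map C)
    intro h0; rw [h0, C_0] at this; exact hb0 this
  rw [← hd, top_mul hi.ge hj.ge] at htop
  have hα := left_ne_zero_of_mul htop
  have hβ := right_ne_zero_of_mul htop
  have hpa : ∀ s, (pderiv s a).totalDegree ≤ i - 1 := fun s => tdeg_pderiv a s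
  have hpb : ∀ s, (pderiv s b).totalDegree ≤ j - 1 := fun s => tdeg_pderiv b s
  have ha00 : pderiv 0 a ≠ 0 := pderiv0_ne_zero hi1 (hch i (by omega) (by omega)) hα
  by_cases hab : a ∣ b
  · obtain ⟨b', rfl⟩ := hab
    have hb'0 : b' ≠ 0 := right_ne_zero_of_mul hb0
    have hj' : j = i + b'.totalDegree := by rw [hj, totalDegree_mul_of_isDomain ha0 hb'0]
    have hdd : ∀ s, (b' * pderiv s a).totalDegree < d - 1 := fun s => by
      have := totalDegree_mul b' (pderiv s a)
      have := hpa s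
      omega
    refine ⟨b' * pderiv 0 a, b' * pderiv 1 a, (hdd 0).trans (by omega), (hdd 1).trans (by omega), ?_, ?_,
      mul_ne_zero hb'0 ha00⟩
    · refine coeff_eq_zero_of_totalDegree_lt ?_
      have := hdd 0
      rwa [show (∑ i ∈ (Finsupp.single (0 : Fin 2) (d-1)).support, (Finsupp.single (0 : Fin 2) (d-1)) i) = d - 1
        from Finsupp.degree_single _ _]
    · unfold rupT
      simp only [Derivation.leibniz, smul_eq_mul, pderiv_comm a 0 1]
      ring
  · have hdd : ∀ s, (C (j:k) * (b * pderiv s a) - C (i:k) * (a * pderiv s b)).totalDegree < d := fun s => by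
      refine lt_of_le_of_lt (totalDegree_sub _ _) (max_lt ?_ ?_)
      · refine lt_of_le_of_lt (totalDegree_mul _ _) ?_
        have := totalDegree_mul b (pderiv s a)
        have := hpa s
        rw [totalDegree_C]; omega
      · refine lt_of_le_of_lt (totalDegree_mul _ _) ?_
        have := totalDegree_mul a (pderiv s b)
        have := hpb s
        rw [totalDegree_C]; omega
    refine ⟨_, _, hdd 0, hdd 1, ?_, ?_, ?_⟩
    · rw [coeff_sub, coeff_C_mul, coeff_C_mul, show d - 1 = j + (i - 1) by omega, top_mul hj.ge (hpa 0),
        show j + (i - 1) = i + (j-1) by omega, top_mul hi.ge (hpb 0), top_pderiv0, top_pderiv0,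
        Nat.sub_add_cancel hi1, Nat.sub_add_cancel hj1,
        show ((i-1 : ℕ) : k) + 1 = i by
          rw [← Nat.cast_succ, Nat.succ_eq_add_one, Nat.sub_add_cancel hi1],
        show ((j-1 : ℕ) : k) + 1 = j by
          rw [← Nat.cast_succ, Nat.succ_eq_add_one, Nat.sub_add_cancel hj1]]
      ring
    · unfold rupT
      simp only [Derivation.leibniz, smul_eq_mul, map_sub, pderiv_comm a 0 1, pderiv_comm b 0 1, pderiv_C]
      ring
    · intro h
      have h1 : a ∣ b * pderiv 0 a := by
        have : C (j:k) * (b * pderiv 0 a) = a * (C (i:k) * pderiv 0 b) := by linear_combination h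
        have h2 : b * pderiv 0 a = C ((j:k)⁻¹) * (C (j:k) * (b * pderiv 0 a)) := by
          rw [← mul_assoc, ← C_mul, inv_mul_cancel₀ (hch j (by omega) (by omega)), C_1, one_mul]
        rw [h2, this]
        exact ⟨C ((j:k)⁻¹) * (C (i:k) * pderiv 0 b), by ring⟩
      have h3 := (((ha.dvd_or_isRelPrime (n := b)).resolve_left hab).dvd_of_dvd_mul_left h1)
      refine ha00 (dvd_tdeg_eq_zero ?_ h3)
      have := hpa 0
      omega

end

section
open MvPolynomial

/-- exponents of degree `< d` -/
noncomputable def Mon (d : ℕ) : Finset (Fin 2 →₀ ℕ) :=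
  (Finset.range d).biUnion fun s => (Finset.univ : Finset (Fin 2)).finsuppAntidiag s

lemma mem_Mon {d : ℕ} {m : Fin 2 →₀ ℕ} : m ∈ Mon d ↔ m.degree < d := by
  simp [Mon, Finset.mem_finsuppAntidiag, Finsupp.degree_eq_sum]

lemma totalDegree_map_le {r : ℕ} {R S : Type*} [CommSemiring R] [CommSemiring S] (φ : R →+* S)
    (p : MvPolynomial (Fin r) R) : (map φ p).totalDegree ≤ p.totalDegree :=
  tdeg_le_iff.2 fun m hm => tdeg_lt le_rfl (fun h => hm (by rw [coeff_map, h, map_zero]))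

lemma sum_Mon {R : Type*} [CommSemiring R] {p : MvPolynomial (Fin 2) R} {d : ℕ} (h : p.totalDegree < d) :
    p = ∑ m ∈ Mon d, monomial m (coeff m p) := by
  conv_lhs => rw [p.as_sum]
  refine Finset.sum_subset (fun m hm => mem_Mon.2 ?_) (fun m _ hm => ?_)
  · exact lt_of_le_of_lt (tdeg_lt le_rfl (mem_support_iff.1 hm)) h
  · rw [notMem_support_iff.1 hm]; simp

abbrev RCols (d : ℕ) := {m // m ∈ (Mon d).erase (Finsupp.single 0 (d-1))} ⊕ {m // m ∈ Mon d}
abbrev RRows (d : ℕ) := {m // m ∈ Mon (2*d)}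

noncomputable def re0 (R : Type*) [CommRing R] (d : ℕ) : RCols d → MvPolynomial (Fin 2) R
  | Sum.inl m => monomial m.1 1
  | Sum.inr _ => 0
noncomputable def re1 (R : Type*) [CommRing R] (d : ℕ) : RCols d → MvPolynomial (Fin 2) R
  | Sum.inl _ => 0
  | Sum.inr m => monomial m.1 1

noncomputable def rupMat {R : Type*} [CommRing R] (d : ℕ) (F : MvPolynomial (Fin 2) R) :
    Matrix (RRows d) (RCols d) R := fun r c => coeff r.1 (rupT F (re0 R d c) (re1 R d c))

noncomputable def rupDelta {R : Type*} [CommRing R] (d : ℕ) (F : MvPolynomial (Fin 2) R) : R :=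
  ((rupMat d F).transpose * rupMat d F).det

lemma rupT_map {R S : Type*} [CommRing R] [CommRing S] (φ : R →+* S) (F g0 g1 : MvPolynomial (Fin 2) R) :
    rupT (map φ F) (map φ g0) (map φ g1) = map φ (rupT F g0 g1) := by
  simp only [rupT, pderiv_map, map_add, map_sub, map_mul]

lemma rupMat_map {R S : Type*} [CommRing R] [CommRing S] (φ : R →+* S) (d : ℕ)
    (F : MvPolynomial (Fin 2) R) : rupMat d (map φ F) = (rupMat d F).map φ := by
  ext r c
  simp only [rupMat, Matrix.map_apply]
  rw [← coeff_map, ← rupT_map]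
  congr 2 <;> cases c <;> simp [re0, re1]

lemma rupDelta_map {R S : Type*} [CommRing R] [CommRing S] (φ : R →+* S) (d : ℕ)
    (F : MvPolynomial (Fin 2) R) : rupDelta d (map φ F) = φ (rupDelta d F) := by
  unfold rupDelta
  rw [rupMat_map, RingHom.map_det, RingHom.mapMatrix_apply, Matrix.map_mul, Matrix.transpose_map]

lemma rupT_lin {R : Type*} [CommRing R] (F : MvPolynomial (Fin 2) R) {ι : Type*} (s : Finset ι)
    (v : ι → R) (a b : ι → MvPolynomial (Fin 2) R) :
    rupT F (∑ i ∈ s, v i • a i) (∑ i ∈ s, v i • b i) = ∑ i ∈ s, v i • rupT F (a i) (b i) := by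
  classical
  induction s using Finset.induction_on with
  | empty => simp [rupT]
  | insert i s hi ih =>
    rw [Finset.sum_insert hi, Finset.sum_insert hi, Finset.sum_insert hi, ← ih]
    simp only [rupT, map_add, MvPolynomial.smul_eq_C_mul, pderiv_C_mul]
    ring

lemma rupMat_mulVec {R : Type*} [CommRing R] (d : ℕ) (F : MvPolynomial (Fin 2) R) (v : RCols d → R)
    (r : RRows d) : (rupMat d F).mulVec v r =
      coeff r.1 (rupT F (∑ c, v c • re0 R d c) (∑ c, v c • re1 R d c)) := by
  rw [rupT_lin, coeff_sum]
  simp [Matrix.mulVec, dotProduct, rupMat, mul_comm]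

lemma re0_sum {R : Type*} [CommRing R] (d : ℕ) (v : RCols d → R) : (∑ c, v c • re0 R d c)
    = ∑ m : {m // m ∈ (Mon d).erase (Finsupp.single 0 (d-1))}, monomial m.1 (v (Sum.inl m)) := by
  rw [Fintype.sum_sum_type]; simp [re0, smul_monomial]

lemma re1_sum {R : Type*} [CommRing R] (d : ℕ) (v : RCols d → R) : (∑ c, v c • re1 R d c)
    = ∑ m : {m // m ∈ Mon d}, monomial m.1 (v (Sum.inr m)) := by
  rw [Fintype.sum_sum_type]; simp [re1, smul_monomial]

lemma tdeg_sum_mon {R : Type*} [CommRing R] {d : ℕ} (hd : 1 ≤ d) {s : Finset (Fin 2 →₀ ℕ)} (hs : s ⊆ Mon d)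
    (v : {m // m ∈ s} → R) : (∑ m : {m // m ∈ s}, monomial m.1 (v m)).totalDegree < d := by
  rw [Nat.lt_iff_le_pred hd]
  refine totalDegree_finsetSum_le fun m _ => ?_
  refine (totalDegree_monomial_le _ _).trans ?_
  have := mem_Mon.1 (hs m.2)
  change m.1.degree ≤ _; omega

lemma coeff_sum_mon {R : Type*} [CommRing R] {s : Finset (Fin 2 →₀ ℕ)}
    (v : {m // m ∈ s} → R) (n) (hn : n ∈ s) : coeff n (∑ m : {m // m ∈ s}, monomial m.1 (v m)) = v ⟨n, hn⟩ := by
  classical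
  rw [coeff_sum, Finset.sum_eq_single ⟨n, hn⟩]
  · simp
  · intro b _ hb
    rw [coeff_monomial, if_neg]
    exact fun h => hb (Subtype.ext h)
  · simp

lemma coeff_sum_mon' {R : Type*} [CommRing R] {s : Finset (Fin 2 →₀ ℕ)}
    (v : {m // m ∈ s} → R) (n) (hn : n ∉ s) : coeff n (∑ m : {m // m ∈ s}, monomial m.1 (v m)) = 0 := by
  classical
  rw [coeff_sum, Finset.sum_eq_zero]
  intro b _
  rw [coeff_monomial, if_neg]
  rintro rfl; exact hn b.2

lemma rup_irred {k : Type*} [Field k] {F : MvPolynomial (Fin 2) k}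
    {d : ℕ} (hd1 : 1 ≤ d) (hd : F.totalDegree = d) (hch : ∀ i : ℕ, 0 < i → i ≤ d → (i : k) ≠ 0)
    (htop : coeff (Finsupp.single 0 d) F ≠ 0) (hΔ : rupDelta d F ≠ 0) : Irreducible F := by
  by_contra hF
  obtain ⟨g0, g1, h0, h1, hn, hT, hne⟩ := rup_easy hd1 hd hch htop hF
  apply hΔ
  unfold rupDelta
  rw [← Matrix.exists_mulVec_eq_zero_iff]
  let v : RCols d → k := Sum.elim (fun m => coeff m.1 g0) (fun m => coeff m.1 g1)
  have e0 : (∑ c, v c • re0 k d c) = g0 := by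
    rw [re0_sum]
    conv_rhs => rw [sum_Mon h0, ← Finset.sum_erase (Mon d) (a := Finsupp.single 0 (d-1)) (by rw [hn]; simp)]
    exact Finset.sum_coe_sort ((Mon d).erase (Finsupp.single 0 (d-1))) (fun m => monomial m (coeff m g0))
  have e1 : (∑ c, v c • re1 k d c) = g1 := by
    rw [re1_sum]
    conv_rhs => rw [sum_Mon h1]
    exact Finset.sum_coe_sort (Mon d) (fun m => monomial m (coeff m g1))
  refine ⟨v, ?_, ?_⟩
  · rintro hv
    rw [hv] at e0
    exact hne (by simpa using e0.symm)
  · rw [← Matrix.mulVec_mulVec]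
    have : (rupMat d F).mulVec v = 0 := by
      funext r
      rw [rupMat_mulVec, e0, e1, hT]; simp
    rw [this]; simp

lemma rup_ne {F : MvPolynomial (Fin 2) ℤ} {d : ℕ} (hd1 : 1 ≤ d) (hd : F.totalDegree ≤ d)
    (hirr : Irreducible (map (Int.castRingHom (AlgebraicClosure ℚ)) F))
    (htop : coeff (Finsupp.single 0 d) F ≠ 0) : rupDelta d F ≠ 0 := by
  intro h0
  set k := AlgebraicClosure ℚ
  have h1 : rupDelta d (map (Int.castRingHom ℚ) F) = 0 := by rw [rupDelta_map, h0]; simp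
  set G := map (Int.castRingHom ℚ) F with hG
  unfold rupDelta at h1
  obtain ⟨v, hv0, hv⟩ := Matrix.exists_mulVec_eq_zero_iff.2 h1
  have h2 : (rupMat d G).mulVec v = 0 := by
    have : v ∈ LinearMap.ker ((rupMat d G).transpose * rupMat d G).mulVecLin := by
      rw [LinearMap.mem_ker, Matrix.mulVecLin_apply]; exact hv
    rw [Matrix.ker_mulVecLin_transpose_mul_self] at this
    simpa using this
  set g0 := ∑ c, v c • re0 ℚ d c with hg0
  set g1 := ∑ c, v c • re1 ℚ d c with hg1
  have d0 : g0.totalDegree < d := by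
    rw [hg0, re0_sum]; exact tdeg_sum_mon hd1 (Finset.erase_subset _ _) _
  have d1 : g1.totalDegree < d := by
    rw [hg1, re1_sum]; exact tdeg_sum_mon hd1 (Finset.Subset.refl _) _
  have dG : G.totalDegree ≤ d := (totalDegree_map_le _ _).trans hd
  have hTd : (rupT G g0 g1).totalDegree < 2 * d := by
    unfold rupT
    have a1 := tdeg_pderiv g0 1
    have a2 := tdeg_pderiv g1 0
    have a3 := tdeg_pderiv G 1
    have a4 := tdeg_pderiv G 0
    have b1 := totalDegree_sub (pderiv 1 g0) (pderiv 0 g1)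
    have b2 := totalDegree_mul G (pderiv 1 g0 - pderiv 0 g1)
    have b3 := totalDegree_mul g0 (pderiv 1 G)
    have b4 := totalDegree_mul g1 (pderiv 0 G)
    refine lt_of_le_of_lt (totalDegree_add _ _) (max_lt (lt_of_le_of_lt (totalDegree_sub _ _) (max_lt ?_ ?_)) ?_)
    · have : max (pderiv 1 g0).totalDegree (pderiv 0 g1).totalDegree < d := by
        apply max_lt <;> omega
      omega
    · omega
    · omega
  have hT : rupT G g0 g1 = 0 := by
    rw [sum_Mon hTd]
    refine Finset.sum_eq_zero fun m hm => ?_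
    have := congrFun h2 ⟨m, hm⟩
    rw [rupMat_mulVec] at this
    simp only [Pi.zero_apply] at this
    rw [this]; simp
  let φ : ℚ →+* k := algebraMap ℚ k
  have hφ : Function.Injective φ := φ.injective
  have hFG : map (Int.castRingHom k) F = map φ G := by
    rw [hG, map_map]; congr 1
  rw [hFG] at hirr
  have htop' : coeff (Finsupp.single 0 d) (map φ G) ≠ 0 := by
    rw [← hFG, coeff_map]
    simpa using htop
  have hdd : (map φ G).totalDegree = d := by
    refine le_antisymm ((totalDegree_map_le _ _).trans dG) ?_
    have := le_totalDegree (mem_support_iff.2 htop')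
    simpa [degree_eq_sum'] using this
  have := rup_hard hd1 hirr hdd htop' (g0 := map φ g0) (g1 := map φ g1)
    (lt_of_le_of_lt (totalDegree_map_le _ _) d0) (lt_of_le_of_lt (totalDegree_map_le _ _) d1)
    (by
      rw [coeff_map, hg0, re0_sum, coeff_sum_mon' _ _ (Finset.notMem_erase _ _)]; simp)
    (by rw [rupT_map, hT]; simp)
  have z0 : g0 = 0 := map_injective φ hφ (by simpa using this.1)
  have z1 : g1 = 0 := map_injective φ hφ (by simpa using this.2)
  apply hv0
  funext c
  rcases c with m | m
  · have := coeff_sum_mon (fun m => v (Sum.inl m)) m.1 m.2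
    rw [← re0_sum, ← hg0, z0] at this
    simpa using this.symm
  · have := coeff_sum_mon (fun m => v (Sum.inr m)) m.1 m.2
    rw [← re1_sum, ← hg1, z1] at this
    simpa using this.symm

/-- universal form of the Ruppert determinant -/
noncomputable def rupP (d : ℕ) : MvPolynomial (Fin 2 →₀ ℕ) ℤ :=
  rupDelta d (∑ m ∈ Mon (d+1), monomial m (X m))

lemma rupP_spec {R : Type*} [CommRing R] {d : ℕ} {F : MvPolynomial (Fin 2) R} (h : F.totalDegree ≤ d) :
    rupDelta d F = aeval (fun m => coeff m F) (rupP d) := by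
  unfold rupP
  have := rupDelta_map (aeval (R := ℤ) (fun m => coeff m F)).toRingHom d (∑ m ∈ Mon (d+1), monomial m (X m))
  rw [map_sum] at this
  simp only [map_monomial, AlgHom.toRingHom_eq_coe, RingHom.coe_coe, aeval_X] at this
  rw [← sum_Mon (Nat.lt_succ_iff.2 h)] at this
  exact this

lemma poly_val_bound {σ : Type*} (p : MvPolynomial σ ℤ) : ∃ C κ : ℕ, ∀ (x : σ → ℤ) (H : ℤ), 1 ≤ H →
    (∀ m, |x m| ≤ H) → |aeval x p| ≤ C * H ^ κ := by
  induction p using MvPolynomial.induction_on with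
  | C a => exact ⟨a.natAbs, 0, fun x H _ _ => by simp⟩
  | add p q hp hq =>
    obtain ⟨c1, k1, h1⟩ := hp
    obtain ⟨c2, k2, h2⟩ := hq
    refine ⟨c1 + c2, k1 + k2, fun x H hH hx => ?_⟩
    rw [map_add]
    refine (abs_add_le _ _).trans ?_
    have a1 := h1 x H hH hx
    have a2 := h2 x H hH hx
    have b1 : H ^ k1 ≤ H ^ (k1 + k2) := pow_le_pow_right₀ hH (by omega)
    have b2 : H ^ k2 ≤ H ^ (k1 + k2) := pow_le_pow_right₀ hH (by omega)
    push_cast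
    nlinarith [mul_le_mul_of_nonneg_left b1 (Int.natCast_nonneg c1), mul_le_mul_of_nonneg_left b2 (Int.natCast_nonneg c2)]
  | mul_X p i hp =>
    obtain ⟨c1, k1, h1⟩ := hp
    refine ⟨c1, k1 + 1, fun x H hH hx => ?_⟩
    rw [map_mul, aeval_X, abs_mul, pow_succ, ← mul_assoc]
    exact mul_le_mul (h1 x H hH hx) (hx i) (abs_nonneg _) (by positivity)

lemma poly_deg_bound {σ : Type*} (p : MvPolynomial σ ℤ) : ∃ κ : ℕ, ∀ (x : σ → Polynomial ℤ) (e : ℕ),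
    (∀ m, (x m).natDegree ≤ e) → (aeval x p).natDegree ≤ κ * e := by
  induction p using MvPolynomial.induction_on with
  | C a => exact ⟨0, fun x e _ => by simp⟩
  | add p q hp hq =>
    obtain ⟨k1, h1⟩ := hp
    obtain ⟨k2, h2⟩ := hq
    refine ⟨k1 + k2, fun x e hx => ?_⟩
    rw [map_add]
    refine (Polynomial.natDegree_add_le _ _).trans ?_
    have a1 := h1 x e hx
    have a2 := h2 x e hx
    rw [add_mul]
    apply max_le <;> omega
  | mul_X p i hp =>
    obtain ⟨k1, h1⟩ := hp
    refine ⟨k1 + 1, fun x e hx => ?_⟩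
    rw [map_mul, aeval_X, add_mul, one_mul]
    exact Polynomial.natDegree_mul_le.trans (add_le_add (h1 x e hx) (hx i))

end

section
open MvPolynomial

/-- forget the last exponent -/
noncomputable def pm (m : Fin 3 →₀ ℕ) : Fin 2 →₀ ℕ := Finsupp.equivFunOnFinite.symm ![m 0, m 1]
/-- add a last exponent so that the degree is `i` -/
noncomputable def up (i : ℕ) (m : Fin 2 →₀ ℕ) : Fin 3 →₀ ℕ :=
  Finsupp.equivFunOnFinite.symm ![m 0, m 1, i - m.degree]

@[simp] lemma pm_zero (m) : pm m 0 = m 0 := rfl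
@[simp] lemma pm_one (m) : pm m 1 = m 1 := rfl
@[simp] lemma up_zero (i m) : up i m 0 = m 0 := rfl
@[simp] lemma up_one (i m) : up i m 1 = m 1 := rfl
@[simp] lemma up_two (i m) : up i m 2 = i - m.degree := rfl

lemma deg2 (m : Fin 2 →₀ ℕ) : m.degree = m 0 + m 1 := by
  rw [Finsupp.degree_eq_sum, Fin.sum_univ_two]
lemma deg3 (m : Fin 3 →₀ ℕ) : m.degree = m 0 + m 1 + m 2 := by
  rw [Finsupp.degree_eq_sum, Fin.sum_univ_three]

lemma pm_up (i m) : pm (up i m) = m := by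
  ext j; fin_cases j <;> simp

noncomputable def dehom (k : Type*) [CommRing k] : MvPolynomial (Fin 3) k →ₐ[k] MvPolynomial (Fin 2) k :=
  aeval ![X 0, X 1, 1]

lemma mono2 {k : Type*} [CommRing k] (m : Fin 2 →₀ ℕ) (a : k) :
    monomial m a = C a * (X 0 ^ m 0 * X 1 ^ m 1) := by
  rw [monomial_eq, Finsupp.prod_fintype _ _ (by simp), Fin.prod_univ_two]

lemma mono3 {k : Type*} [CommRing k] (m : Fin 3 →₀ ℕ) (a : k) :
    monomial m a = C a * (X 0 ^ m 0 * X 1 ^ m 1 * X 2 ^ m 2) := by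
  rw [monomial_eq, Finsupp.prod_fintype _ _ (by simp), Fin.prod_univ_three]

lemma dehom_monomial {k : Type*} [CommRing k] (m : Fin 3 →₀ ℕ) (a : k) :
    dehom k (monomial m a) = monomial (pm m) a := by
  rw [mono2, mono3]
  simp [dehom, algebraMap_eq]

lemma dehom_coeff {k : Type*} [CommRing k] {f : MvPolynomial (Fin 3) k} {n : ℕ} (hf : f.IsHomogeneous n)
    (m : Fin 3 →₀ ℕ) (hm : m.degree = n) : coeff (pm m) (dehom k f) = coeff m f := by
  classical
  conv_lhs => rw [f.as_sum, map_sum, coeff_sum]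
  rw [Finset.sum_eq_single m]
  · rw [dehom_monomial, coeff_monomial, if_pos rfl]
  · intro b hb hne
    rw [dehom_monomial, coeff_monomial, if_neg]
    intro h
    apply hne
    have h1 : b.degree = n := (hf.degree_eq_sum_deg_support hb).symm
    have h0 := congrArg (fun q => q 0) h
    have h2 := congrArg (fun q => q 1) h
    simp at h0 h2
    rw [deg3] at h1 hm
    ext j; fin_cases j
    · exact h0
    · exact h2
    · simp; omega
  · intro h; rw [notMem_support_iff.1 h]; simp

lemma dehom_inj {k : Type*} [CommRing k] {f : MvPolynomial (Fin 3) k} {n : ℕ} (hf : f.IsHomogeneous n)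
    (h0 : dehom k f = 0) : f = 0 := by
  ext m
  by_cases hm : m.degree = n
  · rw [← dehom_coeff hf m hm, h0]; simp
  · rw [hf.coeff_eq_zero hm]; simp

noncomputable def homz {k : Type*} [CommRing k] (i : ℕ) (a : MvPolynomial (Fin 2) k) : MvPolynomial (Fin 3) k :=
  ∑ m ∈ a.support, monomial (up i m) (coeff m a)

lemma dehom_homz {k : Type*} [CommRing k] (i : ℕ) (a : MvPolynomial (Fin 2) k) : dehom k (homz i a) = a := by
  unfold homz
  rw [map_sum]
  simp only [dehom_monomial, pm_up]
  exact a.as_sum.symm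

lemma homz_hom {k : Type*} [CommRing k] {i : ℕ} {a : MvPolynomial (Fin 2) k} (h : a.totalDegree ≤ i) :
    (homz i a).IsHomogeneous i := by
  refine IsHomogeneous.sum _ _ _ fun m hm => isHomogeneous_monomial _ ?_
  have := tdeg_lt h (mem_support_iff.1 hm)
  rw [deg3]; simp
  rw [deg2] at this ⊢
  omega

lemma isUnit_of_tdeg_zero {r : ℕ} {k : Type*} [Field k] {a : MvPolynomial (Fin r) k} (h0 : a ≠ 0)
    (h : a.totalDegree = 0) : IsUnit a := by
  rw [totalDegree_eq_zero_iff_eq_C] at h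
  rw [h]
  refine (isUnit_iff_ne_zero.2 ?_).map C
  intro h1; rw [h1, C_0] at h; exact h0 h

lemma dehom_tdeg {k : Type*} [CommRing k] {f : MvPolynomial (Fin 3) k} {n : ℕ} (hf : f.totalDegree ≤ n) :
    (dehom k f).totalDegree ≤ n := by
  rw [f.as_sum, map_sum]
  refine totalDegree_finsetSum_le fun m hm => ?_
  rw [dehom_monomial]
  refine (totalDegree_monomial_le _ _).trans ?_
  change (pm m).degree ≤ n
  have := tdeg_lt hf (mem_support_iff.1 hm)
  rw [deg3] at this; rw [deg2]; simp; omega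

lemma dehom_top {k : Type*} [CommRing k] {f : MvPolynomial (Fin 3) k} {n : ℕ} (hf : f.IsHomogeneous n) :
    coeff (Finsupp.single 0 n) (dehom k f) = coeff (Finsupp.single 0 n) f := by
  rw [← dehom_coeff hf (Finsupp.single 0 n) (by simp)]
  congr 1
  ext j; fin_cases j <;> simp

lemma dehom_irred {k : Type*} [Field k] {f : MvPolynomial (Fin 3) k} {d : ℕ} (hd : 1 ≤ d)
    (hf : f.IsHomogeneous d)
    (hirr : Irreducible f) (htop : coeff (Finsupp.single 0 d) f ≠ 0) : Irreducible (dehom k f) := by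
  have ht : (dehom k f).totalDegree = d := by
    refine le_antisymm (dehom_tdeg hf.totalDegree_le) ?_
    rw [← dehom_top hf] at htop
    have := le_totalDegree (mem_support_iff.2 htop)
    rwa [degree_eq_sum', Finsupp.degree_single] at this
  have hne : dehom k f ≠ 0 := by intro h; rw [h] at ht; simp at ht; omega
  refine ⟨?_, ?_⟩
  · intro hu
    obtain ⟨u, _, h⟩ := MvPolynomial.isUnit_iff_eq_C_of_isReduced.1 hu
    rw [h] at ht; simp at ht; omega
  · intro a b hab
    have ha0 : a ≠ 0 := by rintro rfl; simp [hab] at hne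
    have hb0 : b ≠ 0 := by rintro rfl; simp [hab] at hne
    have hdd : a.totalDegree + b.totalDegree = d := by
      rw [← totalDegree_mul_of_isDomain ha0 hb0, ← hab, ht]
    have hfac : f = homz a.totalDegree a * homz b.totalDegree b := by
      rw [← sub_eq_zero]
      refine dehom_inj (n := d) (hf.sub ?_) ?_
      · rw [← hdd]; exact (homz_hom le_rfl).mul (homz_hom le_rfl)
      · rw [map_sub, map_mul, dehom_homz, dehom_homz, hab, sub_self]
    rcases hirr.isUnit_or_isUnit hfac with hu | hu
    · left; have := hu.map (dehom k); rwa [dehom_homz] at this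
    · right; have := hu.map (dehom k); rwa [dehom_homz] at this

end

section
open MvPolynomial

/-- linear algebra: find a combination divisible by `F` -/
lemma exists_dvd {k : Type*} [Field k] {F : MvPolynomial (Fin 2) k} (hF : F ≠ 0) {n d M : ℕ}
    (hd1 : 1 ≤ d) (hd : F.totalDegree = d) (hdn : d ≤ n) {ι : Type*} [Fintype ι]
    (g : Fin M → ι → MvPolynomial (Fin 2) k) (hdeg : ∀ a i, (g a i).totalDegree ≤ n)
    (hcard : M * (d * (n + 1)) < Fintype.card ι) :
    ∃ c : ι → k, c ≠ 0 ∧ ∀ a, F ∣ ∑ i, c i • g a i := by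
  classical
  let V := restrictTotalDegree (Fin 2) k n
  let U := restrictTotalDegree (Fin 2) k (n - d)
  have hmemg : ∀ (c : ι → k) a, ∑ i, c i • g a i ∈ V := fun c a =>
    V.sum_mem fun i _ => V.smul_mem _ ((mem_restrictTotalDegree _ _ _).2 (hdeg a i))
  have hmemF : ∀ u : U, F * (u : MvPolynomial (Fin 2) k) ∈ V := by
    intro u
    refine (mem_restrictTotalDegree _ _ _).2 ((totalDegree_mul _ _).trans ?_)
    have := (mem_restrictTotalDegree _ _ _).1 u.2
    omega
  let Φ : ((ι → k) × (Fin M → U)) →ₗ[k] (Fin M → V) :=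
    { toFun := fun x a => ⟨∑ i, x.1 i • g a i - F * (x.2 a : MvPolynomial (Fin 2) k),
        V.sub_mem (hmemg _ _) (hmemF _)⟩
      map_add' := by
        intro x y; funext a; ext1
        simp [add_smul, Finset.sum_add_distrib]; ring
      map_smul' := by
        intro t x; funext a; ext1
        simp [mul_smul, Finset.smul_sum, smul_sub] }
  have hfr : Module.finrank k (Fin M → V) < Module.finrank k ((ι → k) × (Fin M → U)) := by
    rw [Module.finrank_prod, Module.finrank_pi_fintype, Module.finrank_pi_fintype, Module.finrank_pi_fintype]
    simp only [V, U, finrank_rtd, Module.finrank_self, mul_one, Finset.sum_const, Finset.card_univ, Fintype.card_fin, smul_eq_mul]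
    obtain ⟨e, rfl⟩ := Nat.exists_eq_add_of_le hdn
    have h1 := choose2 (d + e)
    have h2 := choose2 e
    rw [show d + e - d = e by omega]
    have h3 : (d + e + 2).choose 2 ≤ d * (d + e + 1) + (e+2).choose 2 := by nlinarith
    calc M * (d+e+2).choose 2 ≤ M * (d * (d + e + 1) + (e+2).choose 2) := Nat.mul_le_mul_left _ h3
      _ = M * (d * (d + e + 1)) + M * (e+2).choose 2 := by ring
      _ < _ := by omega
  have : FiniteDimensional k V := inferInstanceAs (Module.Finite k (restrictTotalDegree (Fin 2) k n))
  have : FiniteDimensional k U := inferInstanceAs (Module.Finite k (restrictTotalDegree (Fin 2) k (n-d)))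
  obtain ⟨x, hx, hx0⟩ := (Submodule.ne_bot_iff _).1 (LinearMap.ker_ne_bot_of_finrank_lt (f := Φ) hfr)
  have hx1 : ∀ a, ∑ i, x.1 i • g a i = F * (x.2 a : MvPolynomial (Fin 2) k) := by
    intro a
    have := congrArg Subtype.val (congrFun (LinearMap.mem_ker.1 hx) a)
    simpa [Φ, sub_eq_zero] using this
  refine ⟨x.1, ?_, fun a => ⟨_, hx1 a⟩⟩
  intro h0
  apply hx0
  refine Prod.ext h0 (funext fun a => ?_)
  have := hx1 a
  rw [h0] at this
  simp [hF] at this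
  simpa using this

/-- Frobenius-type linear independence over `p`-th powers -/
lemma frob_indep {p : ℕ} [Fact p.Prime] {F : MvPolynomial (Fin 2) (ZMod p)} (hF : Irreducible F)
    (h0 : ¬ F ∣ pderiv 0 F) (n : ℕ) (hn : n < p) : ∀ h : ℕ → MvPolynomial (Fin 2) (ZMod p),
    F ∣ ∑ l ∈ Finset.range (n+1), h l ^ p * X 1 ^ l → ∀ l ≤ n, F ∣ h l := by
  have hprime : Prime F := hF.prime
  induction n with
  | zero =>
    intro h hd l hl
    obtain rfl : l = 0 := by omega
    simp at hd
    exact hprime.dvd_of_dvd_pow hd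
  | succ n ih =>
    intro h hd
    have key : ∀ l ≤ n, F ∣ h (l+1) := by
      have h1 : F ∣ ∑ l ∈ Finset.range (n+1), (((l+1 : ℕ) : MvPolynomial (Fin 2) (ZMod p)) * h (l+1)) ^ p * X 1 ^ l := by
        obtain ⟨r, hr⟩ := hd
        have h2 := congrArg (jacD F) hr
        rw [Derivation.leibniz, jacD_self, map_sum, Finset.sum_range_succ'] at h2
        have h3 : ∀ (g : MvPolynomial (Fin 2) (ZMod p)) (l : ℕ),
            jacD F (g ^ p * X 1 ^ (l+1)) = pderiv 0 F * ((((l+1 : ℕ) : MvPolynomial (Fin 2) (ZMod p)) * g) ^ p * X 1 ^ l) := by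
          intro g l
          rw [Derivation.leibniz, Derivation.leibniz_pow, Derivation.leibniz_pow, jacD_X1]
          have : (((l+1 : ℕ) : MvPolynomial (Fin 2) (ZMod p))) ^ p = ((l+1 : ℕ) : MvPolynomial (Fin 2) (ZMod p)) := by
            rw [← map_natCast (C : ZMod p →+* MvPolynomial (Fin 2) (ZMod p)), ← map_pow, ZMod.pow_card]
          have hp0 : (p : MvPolynomial (Fin 2) (ZMod p)) = 0 := CharP.cast_eq_zero _ p
          rw [mul_pow, this]
          simp only [smul_eq_mul, nsmul_eq_mul, hp0]
          simp
          ring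
        simp only [h3] at h2
        have h4 : jacD F (h 0 ^ p * X 1 ^ 0) = 0 := by
          have hp0 : (p : MvPolynomial (Fin 2) (ZMod p)) = 0 := CharP.cast_eq_zero _ p
          rw [pow_zero, mul_one, Derivation.leibniz_pow, nsmul_eq_mul, hp0, zero_mul]
        rw [h4, ← Finset.mul_sum] at h2
        have h5 : F ∣ pderiv 0 F * ∑ l ∈ Finset.range (n+1), (((l+1 : ℕ) : MvPolynomial (Fin 2) (ZMod p)) * h (l+1)) ^ p * X 1 ^ l :=
          ⟨jacD F r, by simpa using h2⟩
        exact (hprime.dvd_or_dvd h5).resolve_left h0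
      intro l hl
      have h6 := ih (by omega) _ h1 l hl
      refine (hprime.dvd_or_dvd h6).resolve_left ?_
      intro h7
      have hne : ((l+1 : ℕ) : ZMod p) ≠ 0 := by
        intro h8
        rw [ZMod.natCast_eq_zero_iff] at h8
        exact absurd (Nat.le_of_dvd (by omega) h8) (by omega)
      rw [← map_natCast (C : ZMod p →+* MvPolynomial (Fin 2) (ZMod p))] at h7
      exact hF.not_isUnit (isUnit_of_dvd_unit h7 ((isUnit_iff_ne_zero.2 hne).map C))
    intro l hl
    cases l with
    | succ l => exact key l (by omega)
    | zero =>
      rw [Finset.sum_range_succ'] at hd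
      have h2 : F ∣ ∑ k ∈ Finset.range (n + 1), h (k + 1) ^ p * X 1 ^ (k + 1) :=
        Finset.dvd_sum fun l hl => Dvd.dvd.mul_right (dvd_pow (key l (by simpa [Nat.lt_succ_iff] using hl)) (Fact.out : p.Prime).ne_zero) _
      have h3 := (dvd_add_right h2).1 hd
      simp at h3
      exact hprime.dvd_of_dvd_pow h3

lemma not_dvd_of_degreeOf {k : Type*} [Field k] {r d : ℕ} {F P : MvPolynomial (Fin (r+1)) k}
    (htop : coeff (Finsupp.single 0 d) F ≠ 0) (hP : P ≠ 0) (hdeg : degreeOf 0 P < d) : ¬ F ∣ P := by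
  rintro ⟨Q, rfl⟩
  rw [degreeOf_mul_eq (left_ne_zero_of_mul hP) (right_ne_zero_of_mul hP)] at hdeg
  have := monomial_le_degreeOf 0 (mem_support_iff.2 htop)
  simp at this
  omega

lemma tdeg_of_top {k : Type*} [CommSemiring k] {r d : ℕ} {F : MvPolynomial (Fin (r+1)) k}
    (h : F.totalDegree ≤ d) (htop : coeff (Finsupp.single 0 d) F ≠ 0) : F.totalDegree = d := by
  refine le_antisymm h ?_
  have := le_totalDegree (mem_support_iff.2 htop)
  simpa [degree_eq_sum'] using this

end

section
open MvPolynomial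

lemma stepanov_ne_aux {p d a : ℕ} [Fact p.Prime] {A K : Type} [CommRing A] [IsDomain A] [Field K] [Algebra A K]
    [IsFractionRing A K] {F : MvPolynomial (Fin 2) (ZMod p)} (hd1 : 1 ≤ d)
    (hd : F.totalDegree = d) (htop : coeff (Finsupp.single 0 d) F ≠ 0) (hΔ : rupDelta d F ≠ 0)
    (hp : d * (a + d) < p) (g : Fin a × Fin d → MvPolynomial (Fin 2) (ZMod p))
    (hdvd : F ∣ ∑ x : Fin a × Fin d, X 1 ^ (x.1 : ℕ) * X 0 ^ (x.2 : ℕ) * g x ^ p) (x : Fin a × Fin d)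
    (π : MvPolynomial (Fin 2) (ZMod p) →+* A) (hπs : Function.Surjective π) (hπ : ∀ q, π q = 0 ↔ F ∣ q) :
    F ∣ g x := by
  classical
  have hdp : d < p := by nlinarith
  have hch : ∀ i, 0 < i → i ≤ d → ((i:ℕ) : ZMod p) ≠ 0 := by
    intro i hi hid h8
    rw [ZMod.natCast_eq_zero_iff] at h8
    exact absurd (Nat.le_of_dvd hi h8) (by omega)
  have hirr : Irreducible F := rup_irred hd1 hd hch htop hΔ
  have hprime : Prime F := hirr.prime
  have hF0 : ¬ F ∣ pderiv 0 F := by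
    intro h
    have := dvd_tdeg_eq_zero (by have := tdeg_pderiv F 0; omega) h
    exact pderiv0_ne_zero hd1 (hch d hd1 le_rfl) htop this
  let j : A →+* K := algebraMap A K
  have hj : Function.Injective j := IsFractionRing.injective A K
  let φ : ZMod p →+* K := (j.comp π).comp C
  have hφ : Function.Injective φ := φ.injective
  have : CharP K p := charP_of_injective_ringHom hφ p
  have : ExpChar K p := ExpChar.prime Fact.out
  by_contra hx
  let γ : Fin a × Fin d → K := fun x => j (π (g x))
  have hγ : γ x ≠ 0 := by
    intro h; exact hx ((hπ _).1 (hj (by simpa [γ] using h)))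
  let Ft := MvPolynomial.map φ F
  let mm : Fin a × Fin d → (Fin 2 →₀ ℕ) := fun x => Finsupp.single 1 (x.1:ℕ) + Finsupp.single 0 (x.2 : ℕ)
  have hmm : Function.Injective mm := by
    rintro ⟨x, y⟩ ⟨x', y'⟩ h
    have h1 := congrArg (fun q => q 1) h
    have h2 := congrArg (fun q => q 0) h
    simp [mm] at h1 h2
    simp [Fin.ext_iff, h1, h2]
  let Pt : MvPolynomial (Fin 2) K := ∑ x, monomial (mm x) (γ x)
  have hPc : coeff (mm x) Pt = γ x := by
    simp only [Pt, coeff_sum, coeff_monomial, hmm.eq_iff]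
    simp
  have hPt0 : Pt ≠ 0 := fun h => hγ (by rw [← hPc, h, coeff_zero])
  have hPdeg : Pt.totalDegree ≤ a + d := by
    refine totalDegree_finsetSum_le fun x _ => (totalDegree_monomial_le _ _).trans ?_
    change (mm x).degree ≤ _
    simp [mm]
    have := x.1.2; have := x.2.2; omega
  have hPdeg0 : degreeOf 0 Pt < d := by
    have : degreeOf 0 Pt ≤ d - 1 := by
      refine degreeOf_le_iff.2 fun m hm => ?_
      have : ∃ y, m = mm y := by
        by_contra hcon
        push Not at hcon
        apply mem_support_iff.1 hm
        simp only [Pt, coeff_sum, coeff_monomial]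
        exact Finset.sum_eq_zero fun y _ => if_neg fun h => hcon y h.symm
      obtain ⟨y, rfl⟩ := this
      simp [mm]; have := y.2.2; omega
    omega
  have hFtop : coeff (Finsupp.single 0 d) Ft ≠ 0 := by
    simp only [Ft, coeff_map]; exact fun h => htop (hφ (by rw [h, map_zero]))
  have hFtd : Ft.totalDegree = d := tdeg_of_top (hd ▸ totalDegree_map_le _ _) hFtop
  have hFtirr : Irreducible Ft := by
    refine rup_irred hd1 hFtd ?_ hFtop ?_
    · intro i hi hid h
      apply hch i hi hid
      apply hφ; rw [map_natCast, h, map_zero]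
    · rw [rupDelta_map]; exact fun h => hΔ (hφ (by rw [h, map_zero]))
  have hnd : ¬ Ft ∣ Pt := not_dvd_of_degreeOf hFtop hPt0 hPdeg0
  obtain ⟨q, hq0, hqd, hqm⟩ := bez2_elim hFtirr.ne_zero hPt0 ((hFtirr.dvd_or_isRelPrime (n := Pt)).resolve_left hnd)
  have hqp : q.natDegree < p := lt_of_le_of_lt (hqd.trans (by rw [hFtd]; exact Nat.mul_le_mul_left _ hPdeg)) hp
  let e : MvPolynomial (Fin 2) K →+* K := eval₂Hom (frobenius K p) (fun i => j (π (X i)))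
  have heF : e Ft = 0 := by
    have : (e.comp (MvPolynomial.map φ)) = j.comp π := by
      apply MvPolynomial.ringHom_ext
      · intro r
        simp only [RingHom.comp_apply, map_C, e, eval₂Hom_C]
        rw [frobenius_def, ← map_pow, ZMod.pow_card]; rfl
      · intro i
        simp [e]
    have h := congrArg (fun h => h F) this
    simp only [RingHom.comp_apply] at h
    show e (MvPolynomial.map φ F) = 0
    rw [h, (hπ F).2 dvd_rfl, map_zero]
  have heP : e Pt = 0 := by
    have h := congrArg j ((hπ _).2 hdvd)
    rw [map_zero] at h
    rw [← h]
    simp only [Pt, map_sum, map_mul, map_pow]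
    refine Finset.sum_congr rfl fun y _ => ?_
    rw [mono2]
    simp only [e, map_mul, map_pow, eval₂Hom_C, eval₂Hom_X', frobenius_def, mm, γ]
    simp
    ring
  have heq : e (Polynomial.aeval (X 1) q) = 0 := by
    obtain ⟨u, v, huv⟩ := Ideal.mem_span_pair.1 hqm
    rw [← huv, map_add, map_mul, map_mul, heF, heP]; simp
  obtain ⟨b, hb, hbq⟩ := IsLocalization.integerNormalization_spec (nonZeroDivisors A) (S := K) q
  set Q := IsLocalization.integerNormalization (nonZeroDivisors A) q with hQ
  have hbK : j b ≠ 0 := by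
    intro h
    exact nonZeroDivisors.ne_zero hb (hj (by rw [h, map_zero]))
  have hQc : ∀ l, j (Q.coeff l) = j b * q.coeff l := by
    intro l
    have := congrArg (fun r => r.coeff l) hbq
    simp only [Polynomial.coeff_map, Polynomial.coeff_smul] at this
    rw [this, Algebra.smul_def]
  choose h hh using fun l => hπs (Q.coeff l)
  have hfin : F ∣ ∑ l ∈ Finset.range (q.natDegree+1), h l ^ p * X 1 ^ l := by
    rw [← hπ]
    apply hj
    rw [map_zero, map_sum, map_sum]
    have : ∀ l, j (π (h l ^ p * X 1 ^ l)) = (j b)^p * e (C (q.coeff l) * X 1 ^ l) := by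
      intro l
      simp only [map_mul, map_pow, e, eval₂Hom_C, eval₂Hom_X', frobenius_def]
      rw [show π (h l) = Q.coeff l from hh l, hQc]; ring
    simp only [this]
    rw [← Finset.mul_sum, ← map_sum]
    have h9 : Polynomial.aeval (X 1 : MvPolynomial (Fin 2) K) q = ∑ l ∈ Finset.range (q.natDegree+1), C (q.coeff l) * X 1 ^ l := by
      rw [Polynomial.aeval_eq_sum_range]
      simp only [MvPolynomial.smul_eq_C_mul]
    rw [← h9, heq, mul_zero]
  have hres := frob_indep hirr hF0 _ hqp h hfin q.natDegree le_rfl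
  have h10 : j (Q.coeff q.natDegree) = 0 := by
    rw [← hh, (hπ _).2 hres, map_zero]
  rw [hQc] at h10
  rcases mul_eq_zero.1 h10 with h | h
  · exact hbK h
  · exact hq0 (Polynomial.leadingCoeff_eq_zero.1 h)

lemma stepanov_ne {p d a : ℕ} [Fact p.Prime] {F : MvPolynomial (Fin 2) (ZMod p)} (hd1 : 1 ≤ d)
    (hd : F.totalDegree = d) (htop : coeff (Finsupp.single 0 d) F ≠ 0) (hΔ : rupDelta d F ≠ 0)
    (hp : d * (a + d) < p) (g : Fin a × Fin d → MvPolynomial (Fin 2) (ZMod p))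
    (hirr : Irreducible F)
    (hdvd : F ∣ ∑ x : Fin a × Fin d, X 1 ^ (x.1 : ℕ) * X 0 ^ (x.2 : ℕ) * g x ^ p) (x : Fin a × Fin d) :
    F ∣ g x := by
  have hprime : Prime F := hirr.prime
  have hI : (Ideal.span {F}).IsPrime := (Ideal.span_singleton_prime hprime.ne_zero).2 hprime
  have : IsDomain (MvPolynomial (Fin 2) (ZMod p) ⧸ Ideal.span {F}) := Ideal.Quotient.isDomain _
  refine stepanov_ne_aux (K := FractionRing (MvPolynomial (Fin 2) (ZMod p) ⧸ Ideal.span {F}))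
    hd1 hd htop hΔ hp g hdvd x (Ideal.Quotient.mk (Ideal.span {F}))
    Ideal.Quotient.mk_surjective fun q => ?_
  rw [Ideal.Quotient.eq_zero_iff_mem, Ideal.mem_span_singleton]

lemma tdeg_jacD {k : Type*} [Field k] {F g : MvPolynomial (Fin 2) k} :
    (jacD F g).totalDegree ≤ F.totalDegree + g.totalDegree := by
  rw [jacD_apply]
  have h0 := tdeg_pderiv F 0
  have h1 := tdeg_pderiv F 1
  have h2 := tdeg_pderiv g 0
  have h3 := tdeg_pderiv g 1
  refine (totalDegree_sub _ _).trans (max_le ?_ ?_)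
  · refine (totalDegree_mul _ _).trans (by omega)
  · refine (totalDegree_mul _ _).trans (by omega)

lemma tdeg_jacD_iter {k : Type*} [Field k] {F g : MvPolynomial (Fin 2) k} (n : ℕ) :
    ((jacD F)^[n] g).totalDegree ≤ n * F.totalDegree + g.totalDegree := by
  induction n with
  | zero => simp
  | succ n ih =>
    rw [Function.iterate_succ_apply']
    have := tdeg_jacD (F := F) (g := (jacD F)^[n] g)
    nlinarith

lemma jacD_iter_pow {p : ℕ} [Fact p.Prime] (F μ ν : MvPolynomial (Fin 2) (ZMod p)) (n : ℕ) :
    (jacD F)^[n] (μ * ν ^ p) = (jacD F)^[n] μ * ν ^ p := by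
  induction n with
  | zero => rfl
  | succ n ih =>
    have hp0 : (p : MvPolynomial (Fin 2) (ZMod p)) = 0 := CharP.cast_eq_zero _ p
    rw [Function.iterate_succ_apply', Function.iterate_succ_apply', ih, Derivation.leibniz, Derivation.leibniz_pow,
      nsmul_eq_mul, hp0, zero_mul, smul_zero, zero_add, smul_eq_mul, mul_comm]

lemma jacD_iter_sum {k : Type*} [Field k] {F : MvPolynomial (Fin 2) k} (n : ℕ) {ι : Type*} [Fintype ι]
    (c : ι → k) (g : ι → MvPolynomial (Fin 2) k) :
    (jacD F)^[n] (∑ i, c i • g i) = ∑ i, c i • (jacD F)^[n] (g i) := by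
  have := map_sum ((jacD F : MvPolynomial (Fin 2) k →ₗ[k] MvPolynomial (Fin 2) k) ^ n)
    (fun i => c i • g i) Finset.univ
  simp only [map_smul, Module.End.pow_apply] at this
  exact this

/-- Stepanov's bound for plane curves -/
lemma stepanov {p d m : ℕ} [Fact p.Prime] {F : MvPolynomial (Fin 2) (ZMod p)} (hd1 : 1 ≤ d)
    (hd : F.totalDegree = d) (htop : coeff (Finsupp.single 0 d) F ≠ 0) (hΔ : rupDelta d F ≠ 0)
    (hm : 1 ≤ m)
    (hp : d * ((m * (m + 3 + 2 * d + m * d * d) + 1) + d) < p) (S : Finset (Fin 2 → ZMod p))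
    (hS : ∀ P ∈ S, eval P F = 0 ∧ eval P (pderiv 0 F) ≠ 0) :
    S.card * m ≤ p * (m + 1 + d) + ((m * (m + 3 + 2 * d + m * d * d) + 1) + d) := by
  classical
  obtain ⟨a, ha⟩ : ∃ a, a = m * (m + 3 + 2 * d + m * d * d) + 1 := ⟨_, rfl⟩
  rw [← ha] at hp ⊢
  have hdp : d < p := by nlinarith
  have hmp : d * m < p := by
    refine lt_of_le_of_lt (Nat.mul_le_mul_left d ?_) hp
    rw [ha]; nlinarith [Nat.zero_le (2*d + m*d*d)]
  have hch : ∀ i, 0 < i → i < p → ((i:ℕ) : ZMod p) ≠ 0 := by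
    intro i hi hid h8
    rw [ZMod.natCast_eq_zero_iff] at h8
    exact absurd (Nat.le_of_dvd hi h8) (by omega)
  have hirr : Irreducible F := rup_irred hd1 hd (fun i hi hid => hch i hi (by omega)) htop hΔ
  let ι := (Fin a × Fin d) × (Fin (m+1) × Fin d)
  let μ : Fin a × Fin d → MvPolynomial (Fin 2) (ZMod p) := fun x => X 1 ^ (x.1:ℕ) * X 0 ^ (x.2:ℕ)
  let ν : Fin (m+1) × Fin d → MvPolynomial (Fin 2) (ZMod p) := fun x => X 1 ^ (x.1:ℕ) * X 0 ^ (x.2:ℕ)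
  have hμ : ∀ x, (μ x).totalDegree ≤ a + d := by
    intro x
    refine (totalDegree_mul _ _).trans ?_
    rw [totalDegree_X_pow, totalDegree_X_pow]
    have := x.1.2; have := x.2.2; omega
  have hν : ∀ x, (ν x).totalDegree ≤ m + d := by
    intro x
    refine (totalDegree_mul _ _).trans ?_
    rw [totalDegree_X_pow, totalDegree_X_pow]
    have := x.1.2; have := x.2.2; omega
  obtain ⟨c, hc0, hc⟩ := exists_dvd hirr.ne_zero (n := a + m + 2 * d + d * m * d) (M := d * m) hd1 hd
    (by omega) (ι := ι) (fun k x => (jacD F)^[k] (μ x.1) * ν x.2) (by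
      intro k x
      refine (totalDegree_mul _ _).trans ?_
      have h1 := tdeg_jacD_iter (F := F) (g := μ x.1) (k:ℕ)
      have h2 := hμ x.1
      have h3 := hν x.2
      have h4 : (k:ℕ) * d ≤ d * m * d := Nat.mul_le_mul_right _ (by have := k.2; omega)
      rw [hd] at h1
      omega) (by
      simp only [ι, Fintype.card_prod, Fintype.card_fin]
      have : m * (a + m + 2 * d + d * m * d + 1) < a * (m+1) := by
        have : a * (m+1) = a * m + a := by ring
        rw [this]
        nth_rewrite 3 [ha]
        nlinarith
      calc d * m * (d * (a + m + 2 * d + d * m * d + 1)) = d * d * (m * (a + m + 2 * d + d * m * d + 1)) := by ring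
        _ < d * d * (a * (m+1)) := Nat.mul_lt_mul_of_pos_left this (by positivity)
        _ = _ := by ring)
  let G : MvPolynomial (Fin 2) (ZMod p) := ∑ x : ι, c x • (μ x.1 * ν x.2 ^ p)
  have hFG : ¬ F ∣ G := by
    intro h
    let g : Fin a × Fin d → MvPolynomial (Fin 2) (ZMod p) := fun x => ∑ y, c (x, y) • ν y
    have hg : G = ∑ x : Fin a × Fin d, X 1 ^ (x.1 : ℕ) * X 0 ^ (x.2 : ℕ) * g x ^ p := by
      simp only [G, ι]
      rw [Fintype.sum_prod_type]
      refine Finset.sum_congr rfl fun x _ => ?_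
      simp only [g]
      rw [sum_pow_char p, Finset.mul_sum]
      refine Finset.sum_congr rfl fun y _ => ?_
      rw [smul_pow, ZMod.pow_card, mul_smul_comm]
    rw [hg] at h
    apply hc0
    funext ⟨x, y⟩
    have h1 := stepanov_ne hd1 hd htop hΔ hp g hirr h x
    have hcoef : ∀ z, coeff (Finsupp.single 1 (z.1:ℕ) + Finsupp.single 0 (z.2:ℕ)) (g x) = c (x, z) := by
      intro z
      simp only [g, coeff_sum, coeff_smul, ν, X_pow_eq_monomial, monomial_mul, coeff_monomial]
      rw [Finset.sum_eq_single z]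
      · simp
      · intro b _ hb
        rw [if_neg]; · simp
        intro h
        apply hb
        have h1 := congrArg (fun q => q 1) h
        have h2 := congrArg (fun q => q 0) h
        simp at h1 h2
        ext <;> simp [h1, h2]
      · simp
    have hg0 : g x = 0 := by
      by_contra hne
      refine not_dvd_of_degreeOf htop hne ?_ h1
      have : degreeOf 0 (g x) ≤ d - 1 := by
        refine degreeOf_le_iff.2 fun m hm => ?_
        have h2 := support_sum hm
        simp only [Finset.mem_biUnion, Finset.mem_univ, true_and] at h2
        obtain ⟨z, hz⟩ := h2
        have h3 := support_smul hz
        simp only [ν, X_pow_eq_monomial, monomial_mul] at h3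
        have h4 := support_monomial_subset h3
        rw [Finset.mem_singleton] at h4
        rw [h4]; simp
        have := z.2.2; omega
      omega
    rw [← hcoef, hg0]; simp
  have hdegG : G.totalDegree ≤ a + d + p * (m + d) := by
    refine totalDegree_finsetSum_le fun x _ => (totalDegree_smul_le _ _).trans ?_
    refine (totalDegree_mul _ _).trans (add_le_add (hμ _) ?_)
    exact (totalDegree_pow _ _).trans (Nat.mul_le_mul_left _ (hν _))
  have hmb := mult_bound hirr hFG S (d * m) (fun i hi hi2 => hch i hi (by omega)) (by
    intro P hP
    refine ⟨(hS P hP).1, (hS P hP).2, ?_⟩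
    intro i hi
    simp only [G]
    rw [jacD_iter_sum]
    simp only [jacD_iter_pow]
    obtain ⟨r, hr⟩ := hc ⟨i, hi⟩
    have h1 := congrArg (eval P) hr
    rw [map_mul, (hS P hP).1, zero_mul] at h1
    rw [← h1, map_sum, map_sum]
    refine Finset.sum_congr rfl fun x _ => ?_
    simp only [smul_eval, map_mul, map_pow, ZMod.pow_card])
  rw [hd] at hmb
  have h2 : d * (S.card * m) ≤ d * (a + d + p * (m+d)) := by
    calc d * (S.card * m) = S.card * (d * m) := by ring
      _ ≤ _ := hmb
      _ ≤ _ := Nat.mul_le_mul_left _ hdegG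
  have h3 := Nat.le_of_mul_le_mul_left h2 hd1
  nlinarith

end

section
open MvPolynomial

/-- the family of (rescaled) slices -/
noncomputable def slice {R : Type*} [CommRing R] (d : ℕ) (f : MvPolynomial (Fin 3) R) :
    MvPolynomial (Fin 2) (Polynomial R) :=
  ∑ m ∈ f.support, monomial (pm m) (Polynomial.C (coeff m f) * Polynomial.X ^ (d - m.degree))

lemma slice_tdeg {R : Type*} [CommRing R] {d : ℕ} {f : MvPolynomial (Fin 3) R} (hf : f.totalDegree ≤ d) :
    (slice d f).totalDegree ≤ d := by
  refine totalDegree_finsetSum_le fun m hm => (totalDegree_monomial_le _ _).trans ?_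
  have := tdeg_lt hf (mem_support_iff.1 hm)
  rw [deg3] at this
  change (pm m).degree ≤ d
  rw [deg2]; simp; omega

lemma slice_natDegree {R : Type*} [CommRing R] {d : ℕ} {f : MvPolynomial (Fin 3) R} (m : Fin 2 →₀ ℕ) :
    (coeff m (slice d f)).natDegree ≤ d := by
  classical
  simp only [slice, coeff_sum, coeff_monomial]
  refine Polynomial.natDegree_sum_le_of_forall_le _ _ fun x _ => ?_
  split_ifs
  · exact (Polynomial.natDegree_C_mul_X_pow_le _ _).trans (by omega)
  · simp

lemma slice_top {R : Type*} [CommRing R] {d : ℕ} {f : MvPolynomial (Fin 3) R} (hf : f.totalDegree ≤ d) :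
    coeff (Finsupp.single 0 d) (slice d f) = Polynomial.C (coeff (Finsupp.single 0 d) f) := by
  classical
  simp only [slice, coeff_sum, coeff_monomial]
  rw [Finset.sum_eq_single (Finsupp.single 0 d)]
  · rw [if_pos]
    · simp
    · ext j; fin_cases j <;> simp
  · intro b hb hne
    rw [if_neg]
    intro h
    apply hne
    have h1 := tdeg_lt hf (mem_support_iff.1 hb)
    have h0 := congrArg (fun q => q 0) h
    have h2 := congrArg (fun q => q 1) h
    simp at h0 h2
    rw [deg3] at h1
    ext j; fin_cases j
    · simpa using h0
    · simpa using h2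
    · simp; omega
  · intro h; rw [notMem_support_iff.1 h]; simp

lemma slice_zero {R : Type*} [CommRing R] {d : ℕ} {f : MvPolynomial (Fin 3) R} (hf : f.totalDegree ≤ d) :
    MvPolynomial.map (Polynomial.evalRingHom 0) (slice d f) = dehom R (homogeneousComponent d f) := by
  classical
  have : homogeneousComponent d f = ∑ m ∈ f.support, monomial m (if m.degree = d then coeff m f else 0) := by
    rw [homogeneousComponent_apply, Finset.sum_filter]
    refine Finset.sum_congr rfl fun m _ => ?_
    split_ifs <;> simp
  rw [this, slice, map_sum, map_sum]
  refine Finset.sum_congr rfl fun m hm => ?_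
  rw [dehom_monomial, map_monomial]
  congr 1
  have h1 := tdeg_lt hf (mem_support_iff.1 hm)
  split_ifs with h
  · simp [h]
  · have : d - m.degree ≠ 0 := by omega
    simp [this]

lemma slice_eval {k : Type*} [Field k] {d : ℕ} {f : MvPolynomial (Fin 3) k} (hf : f.totalDegree ≤ d) (u : k)
    (hu : u ≠ 0) (P : Fin 3 → k) (hP : P 2 = u⁻¹) :
    eval ![u * P 0, u * P 1] (MvPolynomial.map (Polynomial.evalRingHom u) (slice d f)) = u ^ d * eval P f := by
  conv_rhs => rw [f.as_sum, map_sum, Finset.mul_sum]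
  rw [slice, map_sum, map_sum]
  refine Finset.sum_congr rfl fun m hm => ?_
  have h1 := tdeg_lt hf (mem_support_iff.1 hm)
  rw [map_monomial, mono2, mono3]
  simp [hP]
  rw [deg3] at h1 ⊢
  have : u ^ d = u ^ (d - (m 0 + m 1 + m 2)) * u ^ (m 0) * u ^ (m 1) * u ^ (m 2) := by
    rw [← pow_add, ← pow_add, ← pow_add]; congr 1; omega
  rw [this]; field_simp; try ring

lemma slice_pderiv {k : Type*} [Field k] {d : ℕ} {f : MvPolynomial (Fin 3) k} (hf : f.totalDegree ≤ d) (u : k)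
    (hu : u ≠ 0) (P : Fin 3 → k) (hP : P 2 = u⁻¹) :
    u * eval ![u * P 0, u * P 1] (pderiv 0 (MvPolynomial.map (Polynomial.evalRingHom u) (slice d f)))
      = u ^ d * eval P (pderiv 0 f) := by
  conv_rhs => rw [f.as_sum, map_sum, map_sum, Finset.mul_sum]
  rw [slice, map_sum, map_sum, map_sum, Finset.mul_sum]
  refine Finset.sum_congr rfl fun m hm => ?_
  have h1 := tdeg_lt hf (mem_support_iff.1 hm)
  rw [map_monomial, pderiv_monomial, pderiv_monomial, mono2, mono3]
  by_cases h0 : m 0 = 0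
  · simp [h0]
  simp [hP]
  rw [deg3] at h1 ⊢
  have : u ^ d = u ^ (d - (m 0 + m 1 + m 2)) * (u * u ^ (m 0 - 1)) * u ^ (m 1) * u ^ (m 2) := by
    rw [← pow_succ', ← pow_add, ← pow_add, ← pow_add]; congr 1; omega
  rw [this]; field_simp; try ring

lemma slice_map {R S : Type*} [CommRing R] [CommRing S] (φ : R →+* S) (d : ℕ) (f : MvPolynomial (Fin 3) R) :
    slice d (MvPolynomial.map φ f) = MvPolynomial.map (Polynomial.mapRingHom φ) (slice d f) := by
  rw [slice, slice, map_sum]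
  rw [Finset.sum_subset (support_map_subset φ f)]
  · refine Finset.sum_congr rfl fun m _ => ?_
    rw [map_monomial]; simp [coeff_map]
  · intro m _ hm
    rw [notMem_support_iff.1 hm]; simp

/-- a fibre over the projection forgetting `X0` has at most `d` points -/
lemma fiber_le {k : Type*} [Field k] {r d : ℕ} {f : MvPolynomial (Fin (r+1)) k} (hf : f.totalDegree ≤ d)
    (htop : coeff (Finsupp.single 0 d) f ≠ 0) (y : Fin r → k) (S : Finset (Fin (r+1) → k))
    (hS : ∀ P ∈ S, eval P f = 0 ∧ Fin.tail P = y) : S.card ≤ d := by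
  classical
  have h0 : spec0 y f ≠ 0 := by
    intro h
    have := spec0_coeff y hf
    rw [h] at this; exact htop (by simpa using this.symm)
  have h1 : S.card ≤ (spec0 y f).roots.toFinset.card := by
    refine Finset.card_le_card_of_injOn (fun P => P 0) ?_ ?_
    · intro P hP
      simp only [Finset.mem_coe, Multiset.mem_toFinset, Polynomial.mem_roots h0, Polynomial.IsRoot.def]
      rw [eval_spec0, ← (hS P hP).2, Fin.cons_self_tail]
      exact (hS P hP).1
    · intro P hP Q hQ h
      rw [← Fin.cons_self_tail P, ← Fin.cons_self_tail Q, (hS P hP).2, (hS Q hQ).2]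
      simp only at h; rw [h]
  exact h1.trans ((Multiset.toFinset_card_le _).trans ((Polynomial.card_roots' _).trans (spec0_natDegree y hf)))

lemma surf_mod (d : ℕ) (hd1 : 1 ≤ d) : ∃ Y0 : ℕ, ∀ f : MvPolynomial (Fin 3) ℤ, f.totalDegree ≤ d →
    ∀ p : ℕ, [Fact p.Prime] → Y0 ≤ p → ((coeff (Finsupp.single 0 d) f : ℤ) : ZMod p) ≠ 0 →
    ((rupDelta d (dehom ℤ (homogeneousComponent d f)) : ℤ) : ZMod p) ≠ 0 →
    ∀ S : Finset (Fin 3 → ZMod p),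
    (∀ P ∈ S, eval P (MvPolynomial.map (Int.castRingHom (ZMod p)) f) = 0 ∧
      eval P (pderiv 0 (MvPolynomial.map (Int.castRingHom (ZMod p)) f)) ≠ 0) →
    20 * S.card ≤ 21 * p ^ 2 := by
  classical
  obtain ⟨κ, hκ⟩ := poly_deg_bound (rupP d)
  obtain ⟨m, hm⟩ : ∃ m, m = 40 * (d + 1) := ⟨_, rfl⟩
  obtain ⟨E, hE⟩ : ∃ E, E = (m * (m + 3 + 2 * d + m * d * d) + 1) + d := ⟨_, rfl⟩
  refine ⟨d * E + 40 * (E + (1 + κ * d) * d) + 1, ?_⟩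
  intro f hf p _ hpY hc0 hΔ S hS
  have hp : d * E < p := by omega
  set φ := Int.castRingHom (ZMod p)
  set fb := MvPolynomial.map φ f with hfb
  have hfbd : fb.totalDegree ≤ d := (totalDegree_map_le _ _).trans hf
  have hfbt : coeff (Finsupp.single 0 d) fb ≠ 0 := by rw [hfb, coeff_map]; exact hc0
  set δ : Polynomial (ZMod p) := Polynomial.map φ (rupDelta d (slice d f)) with hδ
  have hδd : δ.natDegree ≤ κ * d := by
    refine Polynomial.natDegree_map_le.trans ?_
    rw [rupP_spec (slice_tdeg hf)]
    exact hκ _ _ fun m => slice_natDegree m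
  have hδe : ∀ u : ZMod p, δ.eval u = rupDelta d (MvPolynomial.map (Polynomial.evalRingHom u) (slice d fb)) := by
    intro u
    rw [hfb, slice_map, rupDelta_map, rupDelta_map]; rfl
  have hδ0 : δ ≠ 0 := by
    intro h
    apply hΔ
    have h1 := hδe 0
    rw [h, hfb, slice_map, map_map] at h1
    have h2 : (Polynomial.evalRingHom 0).comp (Polynomial.mapRingHom φ) = φ.comp (Polynomial.evalRingHom 0) := by
      apply Polynomial.ringHom_ext
      · intro a; simp
      · simp
    rw [h2, ← map_map, slice_zero hf, rupDelta_map] at h1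
    simpa using h1.symm
  let bad : Finset (ZMod p) := insert 0 (δ.roots.toFinset.image fun u => u⁻¹)
  have hbad : bad.card ≤ 1 + κ * d := by
    refine (Finset.card_insert_le _ _).trans ?_
    have : (δ.roots.toFinset.image fun u => u⁻¹).card ≤ κ * d :=
      Finset.card_image_le.trans ((Multiset.toFinset_card_le _).trans ((Polynomial.card_roots' _).trans hδd))
    omega
  let Sl : ZMod p → Finset (Fin 3 → ZMod p) := fun t => S.filter fun P => P 2 = t
  have hgood : ∀ t, t ∉ bad → (Sl t).card * m ≤ p * (m + 1 + d) + E := by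
    intro t ht
    simp only [bad, Finset.mem_insert, Finset.mem_image, Multiset.mem_toFinset, not_or] at ht
    obtain ⟨ht0, ht1⟩ := ht
    have hu : t⁻¹ ≠ 0 := inv_ne_zero ht0
    set F := MvPolynomial.map (Polynomial.evalRingHom t⁻¹) (slice d fb) with hF
    have htop : coeff (Finsupp.single 0 d) F ≠ 0 := by
      rw [hF, coeff_map, slice_top hfbd]; simpa using hfbt
    have hFd : F.totalDegree = d := tdeg_of_top ((totalDegree_map_le _ _).trans (slice_tdeg hfbd)) htop
    have hFΔ : rupDelta d F ≠ 0 := by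
      rw [hF, ← hδe]
      intro h
      exact ht1 ⟨t⁻¹, by rw [Polynomial.mem_roots hδ0]; exact h, inv_inv t⟩
    have h1 := stepanov (m := m) hd1 hFd htop hFΔ (by omega) (by rw [← hE]; exact hp)
      ((Sl t).image fun P => ![t⁻¹ * P 0, t⁻¹ * P 1]) (by
        intro Q hQ
        obtain ⟨P, hP, rfl⟩ := Finset.mem_image.1 hQ
        simp only [Sl, Finset.mem_filter] at hP
        have hP2 : P 2 = t⁻¹⁻¹ := by rw [hP.2, inv_inv]
        obtain ⟨e1, e2⟩ := hS P hP.1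
        refine ⟨?_, ?_⟩
        · rw [hF, slice_eval hfbd _ hu P hP2, e1, mul_zero]
        · intro h
          have h3 := slice_pderiv hfbd _ hu P hP2
          rw [← hF, h, mul_zero] at h3
          exact mul_ne_zero (pow_ne_zero d hu) e2 h3.symm)
    rw [Finset.card_image_of_injOn, ← hE] at h1
    · exact h1
    · intro P hP Q hQ h
      simp only [Sl, Finset.coe_filter, Set.mem_setOf_eq] at hP hQ
      have e0 := congrFun h 0
      have e1 := congrFun h 1
      simp [ht0] at e0 e1
      funext i; fin_cases i
      · exact e0
      · exact e1
      · exact hP.2.trans hQ.2.symm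
  have hall : ∀ t, (Sl t).card ≤ p * d := by
    intro t
    rw [Finset.card_eq_sum_card_fiberwise (f := fun P => P 1) (t := Finset.univ) (by simp)]
    refine (Finset.sum_le_card_nsmul _ _ d ?_).trans (by simp [ZMod.card])
    intro y _
    refine fiber_le hfbd hfbt ![y, t] _ ?_
    intro P hP
    simp only [Sl, Finset.mem_filter] at hP
    refine ⟨(hS P hP.1.1).1, ?_⟩
    funext i; fin_cases i
    · exact hP.2
    · exact hP.1.2
  have htot : S.card = ∑ t, (Sl t).card :=
    Finset.card_eq_sum_card_fiberwise (by simp)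
  have hsum : S.card * m ≤ p * (p * (m + 1 + d) + E) + (1 + κ * d) * (p * d * m) := by
    rw [htot, Finset.sum_mul, ← Finset.sum_compl_add_sum bad]
    refine add_le_add ?_ ?_
    · refine (Finset.sum_le_card_nsmul _ _ (p * (m + 1 + d) + E) fun t ht => hgood t (Finset.mem_compl.1 ht)).trans ?_
      rw [smul_eq_mul]
      refine Nat.mul_le_mul_right _ ((Finset.card_le_univ _).trans (by rw [ZMod.card]))
    · refine (Finset.sum_le_card_nsmul _ _ (p * d * m) fun t _ => Nat.mul_le_mul_right _ (hall t)).trans ?_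
      rw [smul_eq_mul]
      exact Nat.mul_le_mul_right _ hbad
  have hm1 : 40 * (m + 1 + d) = 41 * m := by omega
  have hmpos : 0 < m := by omega
  have hEp : 40 * (E + (1 + κ * d) * d) ≤ p := by omega
  have : (40 * S.card) * m ≤ (42 * p ^ 2) * m := by
    calc (40 * S.card) * m = 40 * (S.card * m) := by ring
      _ ≤ 40 * (p * (p * (m + 1 + d) + E) + (1 + κ * d) * (p * d * m)) := Nat.mul_le_mul_left _ hsum
      _ = p * p * (40 * (m + 1 + d)) + p * (40 * (E * 1 + (1 + κ * d) * d * m)) := by ring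
      _ ≤ p * p * (41 * m) + p * (40 * (E * m + (1 + κ * d) * d * m)) := by
        rw [hm1]; gcongr; exact hmpos
      _ = p * p * (41 * m) + p * (40 * (E + (1 + κ * d) * d)) * m := by ring
      _ ≤ p * p * (41 * m) + p * p * m := by gcongr
      _ = _ := by ring
  have := Nat.le_of_mul_le_mul_right this hmpos
  omega

end

section
open MvPolynomial

lemma primes_count : ∃ P0 : ℕ, ∀ P : ℕ, P0 ≤ P →
    (P : ℝ) ≤ (((Finset.Ioc P (8 * P)).filter Nat.Prime).card : ℝ) * Real.log (8 * P) := by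
  have h1 : (fun n : ℕ => Real.log ((n:ℝ) + 1) + 2 * Real.sqrt n * Real.log n) =o[Filter.atTop] fun n : ℕ => (n:ℝ) := by
    refine Asymptotics.IsLittleO.add ?_ ?_
    · have h := (Real.isLittleO_log_id_atTop).comp_tendsto
        (Filter.tendsto_atTop_add_const_right _ (1:ℝ) tendsto_natCast_atTop_atTop)
      refine h.trans_isBigO ?_
      refine Asymptotics.IsBigO.of_bound 2 ?_
      filter_upwards [Filter.eventually_ge_atTop 1] with n hn
      have : (1:ℝ) ≤ n := by exact_mod_cast hn
      simp only [Function.comp, id, Real.norm_eq_abs]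
      rw [abs_of_nonneg (by positivity), abs_of_nonneg (by positivity)]; linarith
    · have h := (isLittleO_log_rpow_atTop (r := 1/2) (by norm_num)).comp_tendsto (tendsto_natCast_atTop_atTop (R := ℝ))
      have h2 := (Asymptotics.isBigO_refl (fun n : ℕ => 2 * Real.sqrt n) Filter.atTop).mul_isLittleO h
      refine h2.trans_isBigO (Asymptotics.IsBigO.of_bound 2 ?_)
      filter_upwards with n
      simp only [Function.comp, Real.norm_eq_abs]
      rw [← Real.sqrt_eq_rpow, mul_assoc, Real.mul_self_sqrt (by positivity), abs_of_nonneg (by positivity), abs_of_nonneg (by positivity)]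
  have h2 := h1.bound (show (0:ℝ) < Real.log 2 / 2 by have := Real.log_pos (show (1:ℝ) < 2 by norm_num); positivity)
  obtain ⟨N, hN⟩ := Filter.eventually_atTop.1 h2
  refine ⟨max N 1, fun P hP => ?_⟩
  have hP1 : 1 ≤ P := le_trans (le_max_right _ _) hP
  have hPr : (1:ℝ) ≤ P := by exact_mod_cast hP1
  have h3 := hN (8 * P) (by have := le_trans (le_max_left _ _) hP; omega)
  have h4 := Chebyshev.theta_ge (8 * P)
  have h5 := Chebyshev.theta_le_log4_mul_x (x := (P:ℝ)) (by positivity)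
  have hl4 : Real.log 4 = 2 * Real.log 2 := by
    rw [show (4:ℝ) = 2 ^ 2 by norm_num, Real.log_pow]; norm_num
  have hl2 : 0.69 < Real.log 2 := by have := Real.log_two_gt_d9; linarith
  rw [Real.norm_eq_abs, Real.norm_eq_abs, abs_of_nonneg (show (0:ℝ) ≤ ((8 * P : ℕ):ℝ) by positivity)] at h3
  have h6 := (abs_le.1 h3).2
  have h7 : Chebyshev.theta ((8 * P : ℕ) : ℝ) - Chebyshev.theta P ≤
      (((Finset.Ioc P (8 * P)).filter Nat.Prime).card : ℝ) * Real.log (8 * P) := by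
    rw [Chebyshev.theta, Chebyshev.theta, Nat.floor_natCast, Nat.floor_natCast]
    have hu : (Finset.Ioc 0 (8 * P)).filter Nat.Prime = (Finset.Ioc 0 P).filter Nat.Prime ∪ (Finset.Ioc P (8 * P)).filter Nat.Prime := by
      rw [← Finset.filter_union, Finset.Ioc_union_Ioc_eq_Ioc (by omega) (by omega)]
    rw [hu, Finset.sum_union]
    · rw [add_sub_cancel_left, ← nsmul_eq_mul]
      refine Finset.sum_le_card_nsmul _ _ _ fun q hq => ?_
      simp at hq
      exact Real.log_le_log (by exact_mod_cast hq.2.pos) (by exact_mod_cast hq.1.2)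
    · rw [Finset.disjoint_left]; intro q hq hq2
      simp at hq hq2; omega
  push_cast at *
  nlinarith

lemma mertens : ∃ C : ℝ, 0 ≤ C ∧ ∀ N : ℕ, 1 ≤ N →
    Real.log N - C ≤ ∑ p ∈ (Finset.Ioc 0 N).filter Nat.Prime, Real.log p / p := by
  have hs : Summable fun n : ℕ => 4 * (1 / (n:ℝ) ^ (3/2 : ℝ)) :=
    (Real.summable_one_div_nat_rpow.2 (by norm_num)).mul_left 4
  refine ⟨1 + ∑' n : ℕ, 4 * (1 / (n:ℝ) ^ (3/2 : ℝ)), by positivity, ?_⟩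
  intro N hN
  have hNr : (1:ℝ) ≤ N := by exact_mod_cast hN
  set T := (Finset.Ioc 0 N).filter Nat.Prime with hT
  have h1 : Real.log (N.factorial) = ∑ p ∈ T, (N.factorial.factorization p : ℝ) * Real.log p := by
    conv_lhs => rw [← Nat.prod_factorization_pow_eq_self N.factorial_ne_zero]
    rw [Finsupp.prod, Nat.cast_prod, Real.log_prod]
    · rw [Finset.sum_subset (s₂ := T)]
      · refine Finset.sum_congr rfl fun p _ => ?_
        push_cast; rw [Real.log_pow]
      · intro p hp
        have hp' := Nat.prime_of_mem_primeFactors (Nat.support_factorization _ ▸ hp)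
        have := Nat.dvd_of_mem_primeFactors (Nat.support_factorization _ ▸ hp)
        rw [hT]; simp
        exact ⟨⟨hp'.pos, (hp'.dvd_factorial).1 this⟩, hp'⟩
      · intro p _ hp
        rw [Finsupp.notMem_support_iff.1 hp]; simp
    · intro p hp
      have hp' := Nat.prime_of_mem_primeFactors (Nat.support_factorization _ ▸ hp)
      have := hp'.pos
      positivity
  have h2 : (N:ℝ) * Real.log N - N ≤ Real.log (N.factorial) := by
    have h := Stirling.le_log_factorial_stirling (n := N) (by omega)
    have hl : 0 ≤ Real.log N := Real.log_nonneg hNr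
    have : 0 ≤ Real.log (2 * Real.pi) := Real.log_nonneg (by have := Real.pi_gt_three; linarith)
    linarith
  have h3 : ∀ p ∈ T, (N.factorial.factorization p : ℝ) * Real.log p ≤
      N * (Real.log p / p + 4 * (1 / (p:ℝ) ^ (3/2 : ℝ))) := by
    intro p hp
    simp [hT] at hp
    have hp2 := hp.2.two_le
    have hp2r : (2:ℝ) ≤ p := by exact_mod_cast hp2
    have : Fact p.Prime := ⟨hp.2⟩
    have h4 : (p - 1) * N.factorial.factorization p ≤ N := by
      have := sub_one_mul_padicValNat_factorial_lt_of_ne_zero p (n := N) (by omega)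
      rw [Nat.factorization_def _ hp.2]; omega
    have h5 : ((p:ℝ) - 1) * N.factorial.factorization p ≤ N := by
      have : (((p - 1 : ℕ) : ℝ)) * N.factorial.factorization p ≤ N := by exact_mod_cast h4
      rwa [Nat.cast_sub (by omega), Nat.cast_one] at this
    have hlog : 0 ≤ Real.log p := Real.log_nonneg (by linarith)
    have h6 : (N.factorial.factorization p : ℝ) ≤ N / (p - 1) := by
      rw [le_div_iff₀ (by linarith)]; linarith
    have h7 : Real.log p ≤ 2 * (p:ℝ) ^ (1/2 : ℝ) := by
      have := Real.log_le_rpow_div (x := (p:ℝ)) (ε := 1/2) (by positivity) (by norm_num)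
      linarith
    have h8 : Real.log p / (p - 1) ≤ Real.log p / p + 4 * (1 / (p:ℝ) ^ (3/2 : ℝ)) := by
      have e : Real.log p / (p - 1) = Real.log p / p + Real.log p / (p * (p - 1)) := by
        have : (p:ℝ) - 1 ≠ 0 := by linarith
        field_simp; ring
      rw [e]
      gcongr
      have e2 : (p:ℝ) ^ (3/2 : ℝ) * (p:ℝ) ^ (1/2:ℝ) = p * p := by
        rw [← Real.rpow_add (by positivity)]; norm_num; ring
      rw [div_le_iff₀ (by nlinarith)]
      have hpos : 0 < (p:ℝ) ^ (3/2 : ℝ) := by positivity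
      rw [mul_one_div, div_mul_eq_mul_div, le_div_iff₀ hpos]
      have : Real.log p * (p:ℝ) ^ (3/2:ℝ) ≤ 2 * (p * p) := by
        rw [← e2]; nlinarith
      nlinarith
    calc _ ≤ N / (p - 1) * Real.log p := by gcongr
      _ = N * (Real.log p / (p - 1)) := by ring
      _ ≤ _ := by gcongr
  have h4 : (N:ℝ) * Real.log N - N ≤ N * (∑ p ∈ T, Real.log p / p + ∑' n : ℕ, 4 * (1 / (n:ℝ) ^ (3/2 : ℝ))) := by
    refine h2.trans ?_
    rw [h1]
    refine (Finset.sum_le_sum h3).trans ?_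
    rw [← Finset.mul_sum, Finset.sum_add_distrib]
    gcongr
    exact hs.sum_le_tsum _ (fun i _ => by positivity)
  have h5 : (N:ℝ) * (Real.log N - 1) ≤ N * (∑ p ∈ T, Real.log p / p + ∑' n : ℕ, 4 * (1 / (n:ℝ) ^ (3/2 : ℝ))) := by linarith
  have := le_of_mul_le_mul_left h5 (by linarith)
  linarith

end

section
open MvPolynomial

lemma gain_abstract {ι Cl I : Type*} [Fintype ι] [DecidableEq ι] [Fintype I] [DecidableEq I] [DecidableEq Cl]
    (M : Matrix ι ι ℤ) (q W : ℕ) (good : Finset ι) (cls : ι → Cl) (w : I → ℕ) (hw : ∀ a, w a ≤ W)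
    (a : Cl → I → ι → ℤ) (m : ι → I → ℤ) (hm : ∀ i α, (q:ℤ) ^ (w α) ∣ m i α)
    (hM : ∀ i ∈ good, ∀ e, (q:ℤ) ^ W ∣ M i e - ∑ α, m i α * a (cls i) α e) :
    (q:ℤ) ^ (W * good.card - (good.image cls).card * ∑ α, (W - w α)) ∣ M.det := by
  classical
  choose r hr using fun (x : good × ι) => hM x.1 x.1.2 x.2
  let sc : ι → Option I → ℤ := fun i o => if i ∈ good then (match o with
    | none => (q:ℤ) ^ W
    | some α => m i α) else (match o with | none => 1 | some _ => 0)
  let vec : ι → Option I → ι → ℤ := fun i o e => if h : i ∈ good then (match o with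
    | none => r (⟨i, h⟩, e)
    | some α => a (cls i) α e) else M i e
  have hdec : ∀ i, M i = ∑ o, (fun e => sc i o * vec i o e) := by
    intro i
    funext e
    rw [Finset.sum_apply, Fintype.sum_option]
    by_cases h : i ∈ good
    · have := hr (⟨i, h⟩, e)
      simp only at this
      simp [sc, vec, h, ← this]
    · simp [sc, vec, h]
  have hexp : M.det = ∑ σ : ι → Option I, Matrix.det (Matrix.of fun i e => sc i (σ i) * vec i (σ i) e) := by
    have h1 := (Matrix.detRowAlternating (n := ι) (R := ℤ)).toMultilinearMap.map_sum
      (fun i (o : Option I) => (fun e => sc i o * vec i o e : ι → ℤ))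
    simp only [← hdec] at h1
    exact h1
  rw [hexp]
  refine Finset.dvd_sum fun σ _ => ?_
  have hdet := Matrix.det_mul_column (fun i => sc i (σ i)) (Matrix.of fun i e => vec i (σ i) e)
  simp only [Matrix.of_apply] at hdet
  rw [hdet]
  by_cases hinj : ∃ i ∈ good, ∃ i' ∈ good, i ≠ i' ∧ cls i = cls i' ∧ σ i = σ i' ∧ σ i ≠ none
  · obtain ⟨i, hi, i', hi', hne, hc, hs, hn⟩ := hinj
    rw [Matrix.det_zero_of_row_eq hne, mul_zero]; · exact dvd_zero _
    funext e
    obtain ⟨α, hα⟩ := Option.ne_none_iff_exists'.1 hn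
    simp only [Matrix.of_apply, vec, hi, hi', dif_pos, ← hs, hα, hc]
  · push Not at hinj
    refine Dvd.dvd.mul_right ?_ _
    have h2 : (q:ℤ) ^ (∑ i ∈ good, (match σ i with | none => W | some α => w α)) ∣ ∏ i, sc i (σ i) := by
      rw [← Finset.prod_mul_prod_compl good, ← Finset.prod_pow_eq_pow_sum]
      refine Dvd.dvd.mul_right (Finset.prod_dvd_prod_of_dvd _ _ fun i hi => ?_) _
      simp only [sc, hi, if_true]
      cases σ i with
      | none => exact dvd_rfl
      | some α => exact hm i α
    refine (pow_dvd_pow _ ?_).trans h2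
    have h3 : W * good.card = ∑ i ∈ good, (match σ i with | none => W | some α => w α) +
        ∑ i ∈ good, (match σ i with | none => 0 | some α => W - w α) := by
      rw [← Finset.sum_add_distrib, mul_comm, ← smul_eq_mul, ← Finset.sum_const]
      refine Finset.sum_congr rfl fun i _ => ?_
      cases σ i with
      | none => simp
      | some α => have := hw α; simp; omega
    have h4 : ∑ i ∈ good, (match σ i with | none => 0 | some α => W - w α) ≤
        (good.image cls).card * ∑ α, (W - w α) := by
      have h5 : ∑ i ∈ good, (match σ i with | none => 0 | some α => W - w α) =
          ∑ i ∈ good, ∑ c ∈ good.image cls, ∑ α, if cls i = c ∧ σ i = some α then W - w α else 0 := by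
        refine Finset.sum_congr rfl fun i hi => ?_
        rw [Finset.sum_eq_single (cls i)]
        · cases σ i with
          | none => simp
          | some α => simp
        · intro b _ hb
          refine Finset.sum_eq_zero fun α _ => if_neg fun h => hb h.1.symm
        · intro h; exact absurd (Finset.mem_image_of_mem _ hi) h
      rw [h5, Finset.sum_comm, ← smul_eq_mul, ← Finset.sum_const]
      refine Finset.sum_le_sum fun c _ => ?_
      rw [Finset.sum_comm]
      refine Finset.sum_le_sum fun α _ => ?_
      rw [← Finset.sum_filter, Finset.sum_const, smul_eq_mul]
      have : (good.filter fun i => cls i = c ∧ σ i = some α).card ≤ 1 := by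
        rw [Finset.card_le_one]
        intro i hi i' hi'
        simp only [Finset.mem_filter] at hi hi'
        by_contra hne
        have := hinj i hi.1 i' hi'.1 hne (hi.2.1.trans hi'.2.1.symm) (hi.2.2.trans hi'.2.2.symm)
        rw [hi.2.2] at this; simp at this
      nlinarith [Nat.zero_le (W - w α)]
    omega

lemma eval_congr_dvd {A : Type*} [CommRing A] {σ : Type*} (q : A) (f : MvPolynomial σ A) (x b : σ → A)
    (h : ∀ i, q ∣ x i - b i) : q ∣ eval x f - eval b f := by
  induction f using MvPolynomial.induction_on with
  | C a => simp
  | add f g hf hg =>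
    rw [map_add, map_add, add_sub_add_comm]; exact dvd_add hf hg
  | mul_X f i hf =>
    rw [map_mul, map_mul, eval_X, eval_X]
    have : eval x f * x i - eval b f * b i = (eval x f - eval b f) * x i + eval b f * (x i - b i) := by ring
    rw [this]
    exact dvd_add (hf.mul_right _) ((h i).mul_left _)

lemma spec0_derivative {r : ℕ} {R : Type*} [CommRing R] (y : Fin r → R) (f : MvPolynomial (Fin (r+1)) R) :
    Polynomial.derivative (spec0 y f) = spec0 y (pderiv 0 f) := by
  induction f using MvPolynomial.induction_on' with
  | monomial m a =>
    rw [pderiv_monomial, spec0_monomial, spec0_monomial, Polynomial.derivative_C_mul_X_pow]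
    simp
    ring
  | add p q hp hq => simp [hp, hq]

lemma taylor0 {r : ℕ} {A : Type*} [CommRing A] (f : MvPolynomial (Fin (r+1)) A) (y : Fin r → A) (x z : A) :
    ∃ k, eval (Fin.cons z y) f = eval (Fin.cons x y) f + (z - x) * eval (Fin.cons x y) (pderiv 0 f) + k * (z - x) ^ 2 := by
  obtain ⟨k, hk⟩ := (spec0 y f).binomExpansion x (z - x)
  refine ⟨k, ?_⟩
  rw [add_sub_cancel, spec0_derivative, eval_spec0, eval_spec0, eval_spec0] at hk
  rw [hk]; ring

/-- polynomial version of Hensel's lemma -/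
lemma hensel {r : ℕ} {A : Type*} [CommRing A] (q : A) (W : ℕ) (f : MvPolynomial (Fin (r+1)) A)
    (b : Fin (r+1) → A) (hb : IsUnit (eval b (pderiv 0 f))) :
    ∃ φ : MvPolynomial (Fin r) A, ∀ x : Fin (r+1) → A, eval x f = 0 → (∀ i, q ∣ x i - b i) →
      q ^ W ∣ x 0 - eval (fun i => x i.succ - b i.succ) φ := by
  obtain ⟨c, hc⟩ := hb.exists_left_inv
  have key : ∀ k : ℕ, ∃ φ : MvPolynomial (Fin r) A, ∀ x : Fin (r+1) → A, eval x f = 0 → (∀ i, q ∣ x i - b i) →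
      q ^ (k+1) ∣ x 0 - eval (fun i => x i.succ - b i.succ) φ := by
    intro k
    induction k with
    | zero => exact ⟨C (b 0), fun x _ hx => by simpa using hx 0⟩
    | succ k ih =>
      obtain ⟨φ, hφ⟩ := ih
      refine ⟨φ - C c * aeval (Fin.cons φ (fun i => X i + C (b i.succ)) : Fin (r+1) → MvPolynomial (Fin r) A) f, ?_⟩
      intro x hx hxb
      set u : Fin r → A := fun i => x i.succ - b i.succ with hu
      set z := eval u φ with hz
      have h1 : eval u (aeval (Fin.cons φ (fun i => X i + C (b i.succ)) : Fin (r+1) → MvPolynomial (Fin r) A) f)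
          = eval (Fin.cons z (Fin.tail x)) f := by
        have : (eval u).comp (aeval (Fin.cons φ (fun i => X i + C (b i.succ)) : Fin (r+1) → MvPolynomial (Fin r) A) : _ →ₐ[A] _).toRingHom
            = eval (Fin.cons z (Fin.tail x)) := by
          apply MvPolynomial.ringHom_ext
          · intro a; simp [algebraMap_eq]
          · intro i
            refine Fin.cases ?_ (fun i => ?_) i
            · simp [hz]
            · simp [hu, Fin.tail]
        exact congrArg (fun h => h f) this
      obtain ⟨t, ht⟩ := taylor0 f (Fin.tail x) (x 0) z
      rw [Fin.cons_self_tail, hx, zero_add] at ht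
      rw [map_sub, map_mul, eval_C, h1, ht, ← hz]
      obtain ⟨s, hs⟩ := hφ x hx hxb
      rw [← hu, ← hz] at hs
      obtain ⟨v, hv⟩ := eval_congr_dvd q (pderiv 0 f) x b hxb
      have hz2 : z - x 0 = - (q ^ (k+1) * s) := by rw [← hs]; ring
      have hd : eval x (pderiv 0 f) = eval b (pderiv 0 f) + q * v := by rw [← hv]; ring
      refine ⟨s * (-c * v) + c * t * q ^ k * s ^ 2, ?_⟩
      rw [hz2, hd]
      have : x 0 = z + q ^ (k+1) * s := by rw [← hs]; ring
      rw [this]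
      have e : q ^ (k+1) * s * (c * eval b (pderiv 0 f)) = q ^ (k+1) * s := by rw [hc, mul_one]
      linear_combination (-1 : A) * e
  cases W with
  | zero => exact ⟨0, fun x _ _ => by simp⟩
  | succ k => exact key k

/-- exponents of degree `< W` -/
def MonR (r W : ℕ) : Finset (Fin r →₀ ℕ) :=
  (Finset.range W).biUnion fun s => (Finset.univ : Finset (Fin r)).finsuppAntidiag s

lemma mem_MonR {r W : ℕ} {m : Fin r →₀ ℕ} : m ∈ MonR r W ↔ m.degree < W := by
  simp [MonR, Finset.mem_finsuppAntidiag, Finsupp.degree_eq_sum]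

lemma card_MonR (r k : ℕ) : (MonR r (k+1)).card = (k + r).choose r := by
  have h : {n : Fin r →₀ ℕ | (n.sum fun _ e => e) ≤ k} = ↑(MonR r (k+1)) := by
    ext m
    rw [Set.mem_ofPred_eq, Finset.mem_coe, mem_MonR, Nat.lt_succ_iff]; rfl
  rw [← monCard, h, Nat.card_eq_fintype_card]
  simp

lemma sum_MonR (r W : ℕ) : ∑ α ∈ MonR r W, (W - α.degree) = (W + r).choose (r+1) := by
  induction W with
  | zero => simp [MonR]
  | succ W ih =>
    have h1 : ∑ α ∈ MonR r (W+1), (W + 1 - α.degree) = ∑ α ∈ MonR r (W+1), (W - α.degree) + (MonR r (W+1)).card := by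
      rw [Finset.card_eq_sum_ones, ← Finset.sum_add_distrib]
      refine Finset.sum_congr rfl fun α hα => ?_
      have := mem_MonR.1 hα; omega
    have h2 : ∑ α ∈ MonR r (W+1), (W - α.degree) = ∑ α ∈ MonR r W, (W - α.degree) := by
      symm
      refine Finset.sum_subset (fun α hα => mem_MonR.2 (by have := mem_MonR.1 hα; omega)) fun α _ hα => ?_
      rw [mem_MonR] at hα; omega
    rw [h1, h2, ih, card_MonR, show W + 1 + r = (W + r) + 1 by ring, Nat.choose_succ_succ' (W+r) r]
    ring

lemma det_gain_abs {r : ℕ} {A : Type*} [CommRing A] {ι Cl : Type*} [Fintype ι] [DecidableEq ι] [DecidableEq Cl]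
    (M : Matrix ι ι ℤ) (q W : ℕ) (hq0 : (q : A) ^ W = 0) (hlift : ∀ a : A, ∃ z : ℤ, (z : A) = a)
    (hdvdA : ∀ z : ℤ, (z : A) = 0 → (q:ℤ) ^ W ∣ z) (f : MvPolynomial (Fin (r+1)) A)
    (g : ι → MvPolynomial (Fin (r+1)) A) (x : ι → Fin (r+1) → A) (l : ι → A)
    (good : Finset ι) (cls : ι → Cl)
    (hM : ∀ i ∈ good, ∀ e, (M i e : A) = l i * eval (x i) (g e))
    (hcls : ∀ i ∈ good, ∀ i' ∈ good, cls i = cls i' → ∀ j, (q : A) ∣ x i j - x i' j)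
    (hf : ∀ i ∈ good, eval (x i) f = 0) (hf' : ∀ i ∈ good, IsUnit (eval (x i) (pderiv 0 f))) (n : ℕ)
    (hn : (good.image cls).card ≤ n) :
    (q:ℤ) ^ (W * good.card - n * (W + r).choose (r+1)) ∣ M.det := by
  classical
  by_cases hne : good.Nonempty
  swap
  · rw [Finset.not_nonempty_iff_eq_empty] at hne
    rw [hne]; simp
  obtain ⟨i0, hi0⟩ := hne
  let rep : Cl → ι := fun c => if h : ∃ i ∈ good, cls i = c then h.choose else i0
  have hrep : ∀ i ∈ good, rep (cls i) ∈ good ∧ cls (rep (cls i)) = cls i := by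
    intro i hi
    have h : ∃ i' ∈ good, cls i' = cls i := ⟨i, hi, rfl⟩
    simp only [rep, dif_pos h]
    exact h.choose_spec
  have hrep2 : ∀ c, rep c ∈ good := by
    intro c
    by_cases h : ∃ i ∈ good, cls i = c
    · simp only [rep, dif_pos h]; exact h.choose_spec.1
    · simp only [rep, dif_neg h]; exact hi0
  let b : Cl → Fin (r+1) → A := fun c => x (rep c)
  have hb : ∀ i ∈ good, ∀ j, (q : A) ∣ x i j - b (cls i) j := fun i hi j =>
    hcls i hi _ (hrep i hi).1 (hrep i hi).2.symm j
  choose φ hφ using fun c => hensel (q : A) W f (b c) (hf' _ (hrep2 c))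
  have hx0 : ∀ i ∈ good, x i 0 = eval (fun j => x i j.succ - b (cls i) j.succ) (φ (cls i)) := by
    intro i hi
    have := hφ (cls i) (x i) (hf i hi) (hb i hi)
    rw [hq0, zero_dvd_iff, sub_eq_zero] at this
    exact this
  let ψ : Cl → ι → MvPolynomial (Fin r) A := fun c e =>
    aeval (Fin.cons (φ c) (fun i => X i + C (b c i.succ)) : Fin (r+1) → MvPolynomial (Fin r) A) (g e)
  have hψ : ∀ i ∈ good, ∀ e, eval (x i) (g e) = eval (fun j => x i j.succ - b (cls i) j.succ) (ψ (cls i) e) := by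
    intro i hi e
    have : (eval fun j => x i j.succ - b (cls i) j.succ).comp
        (aeval (Fin.cons (φ (cls i)) (fun j => X j + C (b (cls i) j.succ)) : Fin (r+1) → MvPolynomial (Fin r) A) : _ →ₐ[A] _).toRingHom
            = eval (x i) := by
      apply MvPolynomial.ringHom_ext
      · intro a; simp [algebraMap_eq]
      · intro j
        refine Fin.cases ?_ (fun j => ?_) j
        · simp [← hx0 i hi]
        · simp
    exact (congrArg (fun h => h (g e)) this).symm
  have hdvd : ∀ (i : ι) (j : Fin (r+1)), ∃ t, i ∈ good → x i j - b (cls i) j = q * t := by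
    intro i j
    by_cases hi : i ∈ good
    · obtain ⟨t, ht⟩ := hb i hi j
      exact ⟨t, fun _ => ht⟩
    · exact ⟨0, fun h => absurd h hi⟩
  choose t ht using hdvd
  choose lift hlift using hlift
  have key := gain_abstract (I := MonR r W) M q W good cls (fun α => (α : Fin r →₀ ℕ).degree)
    (fun α => (mem_MonR.1 α.2).le) (fun c α e => lift (coeff α (ψ c e)))
    (fun i α => (q:ℤ) ^ (α : Fin r →₀ ℕ).degree * lift (l i * ∏ j, t i j.succ ^ (α : Fin r →₀ ℕ) j))
    (fun i α => Dvd.intro _ rfl) ?_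
  · refine (pow_dvd_pow _ ?_).trans key
    have h1 : ∑ α : MonR r W, (W - (α : Fin r →₀ ℕ).degree) = (W + r).choose (r+1) := by
      rw [← sum_MonR]
      exact Finset.sum_coe_sort (MonR r W) (fun α => W - α.degree)
    rw [h1]
    exact Nat.sub_le_sub_left (Nat.mul_le_mul_right _ hn) _
  · intro i hi e
    apply hdvdA
    push_cast
    rw [hM i hi, hψ i hi, sub_eq_zero, eval_eq']
    simp only [hlift]
    rw [Finset.sum_coe_sort (MonR r W) (fun α => (q:A) ^ (α : Fin r →₀ ℕ).degree * (l i * ∏ j, t i j.succ ^ (α : Fin r →₀ ℕ) j) * coeff α (ψ (cls i) e)),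
      Finset.mul_sum]
    have hterm : ∀ α : Fin r →₀ ℕ, l i * (coeff α (ψ (cls i) e) * ∏ j, (x i j.succ - b (cls i) j.succ) ^ α j) =
      (q:A) ^ (α : Fin r →₀ ℕ).degree * (l i * ∏ j, t i j.succ ^ (α : Fin r →₀ ℕ) j) * coeff α (ψ (cls i) e) := by
      intro α
      have : ∏ j, (x i j.succ - b (cls i) j.succ) ^ α j = (q:A) ^ α.degree * ∏ j, t i j.succ ^ α j := by
        rw [Finsupp.degree_eq_sum, ← Finset.prod_pow_eq_pow_sum, ← Finset.prod_mul_distrib]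
        refine Finset.prod_congr rfl fun j _ => ?_
        rw [ht i j.succ hi, mul_pow]
      rw [this]; ring
    simp only [hterm]
    refine (Finset.sum_subset (Finset.subset_union_left (s₂ := MonR r W)) ?_).trans
      (Finset.sum_subset (Finset.subset_union_right (s₁ := (ψ (cls i) e).support)) ?_).symm
    · intro α _ hα
      rw [notMem_support_iff.1 hα, mul_zero]
    · intro α _ hα
      rw [mem_MonR, not_lt] at hα
      rw [← Nat.sub_add_cancel hα, pow_add, hq0]; simp

lemma det_gain {r : ℕ} {ι Cl : Type*} [Fintype ι] [DecidableEq ι] [DecidableEq Cl]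
    (M : Matrix ι ι ℤ) (q W : ℕ) (f : MvPolynomial (Fin (r+1)) (ZMod (q ^ W)))
    (g : ι → MvPolynomial (Fin (r+1)) (ZMod (q ^ W))) (x : ι → Fin (r+1) → ZMod (q ^ W)) (l : ι → ZMod (q ^ W))
    (good : Finset ι) (cls : ι → Cl)
    (hM : ∀ i ∈ good, ∀ e, (M i e : ZMod (q ^ W)) = l i * eval (x i) (g e))
    (hcls : ∀ i ∈ good, ∀ i' ∈ good, cls i = cls i' → ∀ j, (q : ZMod (q ^ W)) ∣ x i j - x i' j)
    (hf : ∀ i ∈ good, eval (x i) f = 0) (hf' : ∀ i ∈ good, IsUnit (eval (x i) (pderiv 0 f))) (n : ℕ)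
    (hn : (good.image cls).card ≤ n) :
    (q:ℤ) ^ (W * good.card - n * (W + r).choose (r+1)) ∣ M.det := by
  refine det_gain_abs M q W ?_ ZMod.intCast_surjective (fun z hz => ?_) f g x l good cls hM hcls hf hf' n hn
  · have := ZMod.natCast_self (q ^ W); push_cast at this; exact this
  · have := (ZMod.intCast_zmod_eq_zero_iff_dvd z (q ^ W)).1 hz
    push_cast at this; exact this

end

section
open MvPolynomial

/-- If all maximal minors vanish, the columns are linearly dependent on `S`. -/
lemma vanish_vec {α ι : Type*} [Fintype ι] [DecidableEq ι] (S : Set α) (M : α → ι → ℤ)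
    (h : ∀ T : ι → α, (∀ i, T i ∈ S) → Matrix.det (Matrix.of fun i e => M (T i) e) = 0) :
    ∃ c : ι → ℚ, c ≠ 0 ∧ ∀ P ∈ S, ∑ e, c e * (M P e : ℚ) = 0 := by
  classical
  let row : α → (ι → ℚ) := fun P e => (M P e : ℚ)
  by_cases htop : Submodule.span ℚ (row '' S) = ⊤
  · exfalso
    obtain ⟨b, hb1, hb2, hb3⟩ := exists_linearIndependent ℚ (row '' S)
    rw [htop] at hb2
    let bas := Module.Basis.mk hb3 (by rw [Subtype.range_coe, hb2])
    have hfin : Fintype b := FiniteDimensional.fintypeBasisIndex bas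
    have hcard : Fintype.card ι = Fintype.card b := by
      have h1 := Module.finrank_eq_card_basis bas
      rw [Module.finrank_fintype_fun_eq_card] at h1
      exact h1
    let eq := Fintype.equivOfCardEq hcard
    choose T hT hT2 using fun i : ι => hb1 (eq i).2
    have h0 := h T hT
    have hli : LinearIndependent ℚ (fun i => row (T i)) := by
      have : (fun i => row (T i)) = (fun x : b => (x : ι → ℚ)) ∘ eq := by
        funext i; exact hT2 i
      rw [this]
      exact hb3.comp _ eq.injective
    have h2 : IsUnit (Matrix.of fun i e => (M (T i) e : ℚ)) := Matrix.linearIndependent_rows_iff_isUnit.1 hli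
    rw [Matrix.isUnit_iff_isUnit_det] at h2
    apply h2.ne_zero
    have h3 : (Matrix.of fun i e => (M (T i) e : ℚ)) = (Int.castRingHom ℚ).mapMatrix (Matrix.of fun i e => M (T i) e) := by
      ext i e; simp
    rw [h3, ← RingHom.map_det, h0, map_zero]
  · obtain ⟨φ, hφ, hle⟩ := Submodule.exists_le_ker_of_lt_top _ (lt_top_iff_ne_top.2 htop)
    refine ⟨fun e => φ (Pi.single e 1), ?_, ?_⟩
    · intro h0
      apply hφ
      apply LinearMap.pi_ext'
      intro i
      ext
      simpa using congrFun h0 i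
    · intro P hP
      have : φ (row P) = 0 := hle (Submodule.subset_span ⟨P, hP, rfl⟩)
      rw [← this, pi_eq_sum_univ (row P), map_sum]
      refine Finset.sum_congr rfl fun e _ => ?_
      rw [map_smul, smul_eq_mul, mul_comm]
      congr 1
      refine congrArg φ ?_
      funext j
      simp [Pi.single_apply, eq_comm]

lemma det_le_prod {ι : Type*} [Fintype ι] [DecidableEq ι] (M : Matrix ι ι ℤ) (b : ι → ℕ)
    (hb : ∀ i e, |M i e| ≤ b e) : |M.det| ≤ ((Fintype.card ι).factorial * ∏ e, b e : ℕ) := by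
  rw [Matrix.det_apply]
  refine (Finset.abs_sum_le_sum_abs _ _).trans ?_
  have : ∀ σ ∈ (Finset.univ : Finset (Equiv.Perm ι)), |Equiv.Perm.sign σ • ∏ i, M (σ i) i| ≤ ∏ e, (b e : ℤ) := by
    intro σ _
    have h1 : |Equiv.Perm.sign σ • ∏ i, M (σ i) i| = |∏ i, M (σ i) i| := by
      rcases Int.units_eq_one_or (Equiv.Perm.sign σ) with h | h <;> simp [h]
    rw [h1, Finset.abs_prod]
    exact Finset.prod_le_prod (fun _ _ => abs_nonneg _) fun i _ => hb _ _
  refine (Finset.sum_le_sum this).trans ?_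
  rw [Finset.sum_const, Finset.card_univ, Fintype.card_perm]
  push_cast
  simp

/-- columns: `X_0`-exponent `< J`, other exponents of degree `≤ m`. -/
def Col (r J m : ℕ) : Type := Fin J × MonR r (m+1)

instance (r J m : ℕ) : Fintype (Col r J m) := inferInstanceAs (Fintype (Fin J × MonR r (m+1)))
noncomputable instance (r J m : ℕ) : DecidableEq (Col r J m) := Classical.decEq _

noncomputable def Col.ex {r J m : ℕ} (e : Col r J m) : Fin (r+1) →₀ ℕ := Finsupp.cons e.1 e.2.1

lemma Col.ex_inj {r J m : ℕ} : Function.Injective (Col.ex : Col r J m → _) := by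
  intro a b h
  have h0 : a.1 = b.1 := by
    have := congrArg (fun e => e 0) h
    simpa [Col.ex, Fin.ext_iff] using this
  have h1 : a.2 = b.2 := by
    have := congrArg Finsupp.tail h
    rw [Col.ex, Col.ex, Finsupp.tail_cons, Finsupp.tail_cons] at this
    exact Subtype.ext this
  exact Prod.ext h0 h1

lemma Col.card (r J m : ℕ) : Fintype.card (Col r J m) = J * (m+r).choose r := by
  have : Fintype.card (Col r J m) = Fintype.card (Fin J × MonR r (m+1)) := rfl
  rw [this, Fintype.card_prod, Fintype.card_fin, Fintype.card_coe, card_MonR]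

lemma Col.deg {r J m : ℕ} (e : Col r J m) : e.ex.degree = e.1.1 + e.2.1.degree := by
  simp [Col.ex, Finsupp.degree_eq_sum, Fin.sum_univ_succ]

lemma Col.deg_le {r J m : ℕ} (e : Col r J m) : e.ex.degree ≤ m + J - 1 := by
  rw [Col.deg]
  have h1 := e.1.2
  have h2 := mem_MonR.1 e.2.2
  omega

lemma Col.sum_deg (r J m : ℕ) : 2 * ∑ e : Col r J m, e.ex.degree + 2 * J * (m+1+r).choose (r+1)
    = J * (m+r).choose r * (J + 1 + 2 * m) := by
  have h1 : ∑ e : Col r J m, e.ex.degree = ∑ e : Fin J × MonR r (m+1), (e.1.1 + e.2.1.degree) :=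
    Finset.sum_congr rfl fun e _ => Col.deg e
  have h2 := sum_MonR r (m+1)
  have h3 : ∑ α ∈ MonR r (m+1), (m + 1 - α.degree) + ∑ α ∈ MonR r (m+1), α.degree = (m+r).choose r * (m+1) := by
    rw [← Finset.sum_add_distrib, ← card_MonR, ← smul_eq_mul, ← Finset.sum_const]
    refine Finset.sum_congr rfl fun α hα => ?_
    have := mem_MonR.1 hα; omega
  have h4 : 2 * ∑ j : Fin J, j.1 + J = J * J := by
    have := Finset.sum_range_id_mul_two J
    rw [Fin.sum_univ_eq_sum_range (fun i => i)]
    cases J with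
    | zero => simp
    | succ J => simp at this; nlinarith
  rw [h1, Fintype.sum_prod_type]
  simp only [Finset.sum_add_distrib, Finset.sum_const, Finset.card_univ, smul_eq_mul, Fintype.card_coe, card_MonR, Fintype.card_fin]
  rw [← Finset.mul_sum, Finset.sum_coe_sort (MonR r (m+1)) (fun α => α.degree)]
  rw [h2] at h3
  set c := (m+r).choose r
  set c' := (m+1+r).choose (r+1)
  set t := ∑ j : Fin J, j.1
  set u := ∑ α ∈ MonR r (m+1), α.degree
  have : c' = c * (m+1) - u := by omega
  nlinarith

/-- from a coefficient vector to a polynomial -/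
noncomputable def colPoly {r J m : ℕ} (c : Col r J m → ℚ) : MvPolynomial (Fin (r+1)) ℚ :=
  ∑ e, monomial e.ex (c e)

lemma colPoly_coeff {r J m : ℕ} (c : Col r J m → ℚ) (e : Col r J m) : coeff e.ex (colPoly c) = c e := by
  classical
  rw [colPoly, coeff_sum, Finset.sum_eq_single e]
  · simp
  · intro b _ hb; rw [coeff_monomial, if_neg fun h => hb (Col.ex_inj h)]
  · simp

lemma colPoly_ne {r J m : ℕ} {c : Col r J m → ℚ} (hc : c ≠ 0) : colPoly c ≠ 0 := by
  intro h; apply hc; funext e; rw [← colPoly_coeff c e, h]; simp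

lemma colPoly_deg {r J m : ℕ} (c : Col r J m → ℚ) : (colPoly c).totalDegree ≤ m + J - 1 := by
  refine totalDegree_finsetSum_le fun e _ => ?_
  refine (totalDegree_monomial_le _ _).trans ?_
  exact Col.deg_le e

lemma colPoly_degOf {r J m : ℕ} (hJ : 0 < J) (c : Col r J m → ℚ) : degreeOf 0 (colPoly c) < J := by
  classical
  have : degreeOf 0 (colPoly c) ≤ J - 1 := by
    rw [degreeOf_le_iff]
    intro s hs
    rw [mem_support_iff, colPoly, coeff_sum] at hs
    obtain ⟨e, _, he⟩ := Finset.exists_ne_zero_of_sum_ne_zero hs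
    rw [coeff_monomial] at he
    have : e.ex = s := by by_contra h; simp [h] at he
    rw [← this]
    have := e.1.2
    simp [Col.ex]; omega
  omega

/-- homogenised monomial -/
noncomputable def hmon {r : ℕ} (L : ℕ) (x : Fin (r+1) → ℤ) (w : ℤ) (e : Fin (r+1) →₀ ℕ) : ℤ := (∏ j, x j ^ e j) * w ^ (L - e.degree)

lemma hmon_eq {r : ℕ} {A : Type*} [CommRing A] (L : ℕ) (x : Fin (r+1) → ℤ) (w : ℤ) (e : Fin (r+1) →₀ ℕ) (he : e.degree ≤ L)
    (v : A) (hv : (w:A) * v = 1) :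
    ((hmon L x w e : ℤ) : A) = (w:A) ^ L * eval (fun j => (x j : A) * v) (monomial e 1) := by
  rw [hmon, eval_monomial, Finsupp.prod_fintype _ _ (by simp)]
  push_cast
  simp only [mul_pow, Finset.prod_mul_distrib, one_mul]
  rw [Finset.prod_pow_eq_pow_sum, ← Finsupp.degree_eq_sum]
  conv_rhs => rw [← Nat.sub_add_cancel he, pow_add]
  have : (w:A) ^ e.degree * v ^ e.degree = 1 := by rw [← mul_pow, hv, one_pow]
  linear_combination (-(∏ j, (x j:A) ^ e j) * (w:A) ^ (L - e.degree)) * this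

lemma hmon_bound {r : ℕ} (L : ℕ) (x : Fin (r+1) → ℤ) (w : ℤ) (e : Fin (r+1) →₀ ℕ) (A Aw : ℕ)
    (hx : ∀ j, |x j| ≤ A) (hw : |w| ≤ Aw) : |hmon L x w e| ≤ (A ^ e.degree * Aw ^ (L - e.degree) : ℕ) := by
  rw [hmon, abs_mul, Finset.abs_prod]
  push_cast
  refine mul_le_mul ?_ ?_ (abs_nonneg _) (by positivity)
  · rw [Finsupp.degree_eq_sum, ← Finset.prod_pow_eq_pow_sum]
    refine Finset.prod_le_prod (fun _ _ => abs_nonneg _) fun j _ => ?_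
    rw [abs_pow]; exact pow_le_pow_left₀ (abs_nonneg _) (hx j) _
  · rw [abs_pow]; exact pow_le_pow_left₀ (abs_nonneg _) hw _

lemma colPoly_eval {r J m : ℕ} (c : Col r J m → ℚ) (x : Fin (r+1) → ℤ) (w : ℤ) (hw : w ≠ 0) 
    (h : ∑ e, c e * ((hmon (m+J-1) x w e.ex : ℤ) : ℚ) = 0) : eval (fun j => (x j : ℚ) / w) (colPoly c) = 0 := by
  have hw' : (w:ℚ) ≠ 0 := by exact_mod_cast hw
  have h1 : ∑ e, c e * ((hmon (m+J-1) x w e.ex : ℤ) : ℚ) = (w:ℚ) ^ (m+J-1) * eval (fun j => (x j : ℚ) / w) (colPoly c) := by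
    rw [colPoly, map_sum, Finset.mul_sum]
    refine Finset.sum_congr rfl fun e _ => ?_
    rw [hmon_eq (A := ℚ) _ _ _ _ (Col.deg_le e) (w:ℚ)⁻¹ (mul_inv_cancel₀ hw')]
    simp only [eval_monomial, div_eq_mul_inv]
    ring
  rw [h1] at h
  exact (mul_eq_zero.1 h).resolve_left (pow_ne_zero _ hw')

lemma oneclass {r : ℕ} {α : Type*} (S : Set α) (x : α → Fin (r+1) → ℤ) (w : α → ℤ) (J m : ℕ) (hJ : 0 < J)
    (p W : ℕ) (v : α → ZMod (p ^ W)) (f : MvPolynomial (Fin (r+1)) (ZMod (p ^ W)))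
    (hw : ∀ P ∈ S, w P ≠ 0) (hv : ∀ P ∈ S, (w P : ZMod (p ^ W)) * v P = 1)
    (hf : ∀ P ∈ S, eval (fun j => (x P j : ZMod (p ^ W)) * v P) f = 0)
    (hf' : ∀ P ∈ S, IsUnit (eval (fun j => (x P j : ZMod (p ^ W)) * v P) (pderiv 0 f)))
    (hcls : ∀ P ∈ S, ∀ P' ∈ S, ∀ j, (p : ZMod (p ^ W)) ∣ (x P j : ZMod (p ^ W)) * v P - (x P' j : ZMod (p ^ W)) * v P')
    (A Aw : ℕ) (hA : ∀ P ∈ S, ∀ j, |x P j| ≤ A) (hAw : ∀ P ∈ S, |w P| ≤ Aw)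
    (c1 c2 : ℕ) (hc1 : c1 = ∑ e : Col r J m, e.ex.degree) (hc2 : c2 = ∑ e : Col r J m, (m + J - 1 - e.ex.degree))
    (hsize : (J * (m+r).choose r).factorial * (A ^ c1 * Aw ^ c2) < p ^ (W * (J * (m+r).choose r) - (W + r).choose (r+1))) :
    ∃ G : MvPolynomial (Fin (r+1)) ℚ, G ≠ 0 ∧ G.totalDegree ≤ m + J - 1 ∧ degreeOf 0 G < J ∧
      ∀ P ∈ S, eval (fun j => (x P j : ℚ) / w P) G = 0 := by
  classical
  obtain ⟨c, hc, hc0⟩ := vanish_vec S (fun P (e : Col r J m) => hmon (m+J-1) (x P) (w P) e.ex) (by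
    intro T hT
    have h1 := det_gain (r := r) (Matrix.of fun i (e : Col r J m) => hmon (m+J-1) (x (T i)) (w (T i)) e.ex) p W f
      (fun e => monomial e.ex 1) (fun i j => (x (T i) j : ZMod (p ^ W)) * v (T i)) (fun i => (w (T i) : ZMod (p^W)) ^ (m+J-1))
      Finset.univ (fun _ => ()) (fun i _ e => hmon_eq _ _ _ _ (Col.deg_le e) _ (hv _ (hT i)))
      (fun i _ i' _ _ j => hcls _ (hT i) _ (hT i') j) (fun i _ => hf _ (hT i)) (fun i _ => hf' _ (hT i)) 1
      ((Finset.card_le_univ _).trans (by simp))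
    have h2 := det_le_prod (Matrix.of fun i (e : Col r J m) => hmon (m+J-1) (x (T i)) (w (T i)) e.ex)
      (fun e => A ^ e.ex.degree * Aw ^ (m + J - 1 - e.ex.degree))
      (fun i e => hmon_bound _ _ _ _ _ _ (hA _ (hT i)) (hAw _ (hT i)))
    rw [Finset.prod_mul_distrib, Finset.prod_pow_eq_pow_sum, Finset.prod_pow_eq_pow_sum, ← hc1, ← hc2, Col.card] at h2
    rw [Finset.card_univ, Col.card, one_mul] at h1
    refine Int.eq_zero_of_abs_lt_dvd h1 (h2.trans_lt ?_)
    exact_mod_cast hsize)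
  exact ⟨colPoly c, colPoly_ne hc, colPoly_deg c, colPoly_degOf hJ c, fun P hP =>
    colPoly_eval c _ _ (hw P hP) (hc0 P hP)⟩

end

section
open MvPolynomial

section siegel
attribute [local instance] Matrix.seminormedAddCommGroup

lemma small_vec {α ι : Type*} [Fintype ι] (S : Set α) (M : α → ι → ℤ) (H : ℕ) (hH : 1 ≤ H)
    (hM : ∀ P ∈ S, ∀ e, |M P e| ≤ H) (c : ι → ℚ) (hc : c ≠ 0)
    (hc0 : ∀ P ∈ S, ∑ e, c e * (M P e : ℚ) = 0) :
    ∃ t : ι → ℤ, t ≠ 0 ∧ (∀ e, |t e| ≤ ((Fintype.card ι * H) ^ Fintype.card ι : ℕ)) ∧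
      ∀ P ∈ S, ∑ e, M P e * t e = 0 := by
  classical
  let row : α → (ι → ℚ) := fun P e => (M P e : ℚ)
  obtain ⟨e0, he0⟩ : ∃ e, c e ≠ 0 := by
    by_contra h; push Not at h; exact hc (funext h)
  have hs1 : 1 ≤ Fintype.card ι := Fintype.card_pos_iff.2 ⟨e0⟩
  obtain ⟨b, hb1, hb2, hb3⟩ := exists_linearIndependent ℚ (row '' S)
  have hfin : Fintype b := @Fintype.ofFinite _ (LinearIndependent.finite hb3)
  choose T hT hT2 using fun i : b => hb1 i.2
  -- kernel of the subset
  have hker : ∀ t : ι → ℤ, (∀ i : b, ∑ e, M (T i) e * t e = 0) → ∀ P ∈ S, ∑ e, M P e * t e = 0 := by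
    intro t ht P hP
    let φ : (ι → ℚ) →ₗ[ℚ] ℚ := ∑ e, (t e : ℚ) • LinearMap.proj e
    have hφ : ∀ P, φ (row P) = ((∑ e, M P e * t e : ℤ) : ℚ) := by
      intro P; simp [φ, row, mul_comm]
    have h1 : Submodule.span ℚ b ≤ LinearMap.ker φ := by
      rw [Submodule.span_le]
      intro v hv
      have h3 : row (T ⟨v, hv⟩) = v := hT2 ⟨v, hv⟩
      rw [SetLike.mem_coe, LinearMap.mem_ker, ← h3, hφ, ht]; simp
    have h2 : φ (row P) = 0 := by
      apply h1; rw [hb2]; exact Submodule.subset_span ⟨P, hP, rfl⟩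
    rw [hφ] at h2; exact_mod_cast h2
  have hlt : Fintype.card b < Fintype.card ι := by
    have h1 : Fintype.card b ≤ Fintype.card ι := by
      have := hb3.fintype_card_le_finrank
      rwa [Module.finrank_fintype_fun_eq_card] at this
    refine lt_of_le_of_ne h1 fun h => ?_
    have h3 : Submodule.span ℚ b = ⊤ := by
      have := hb3.span_eq_top_of_card_eq_finrank' (by rw [Module.finrank_fintype_fun_eq_card, h])
      rwa [Subtype.range_coe] at this
    let φ : (ι → ℚ) →ₗ[ℚ] ℚ := ∑ e, c e • LinearMap.proj e
    have h1 : Submodule.span ℚ b ≤ LinearMap.ker φ := by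
      rw [Submodule.span_le]
      intro v hv
      have h3 : row (T ⟨v, hv⟩) = v := hT2 ⟨v, hv⟩
      rw [SetLike.mem_coe, LinearMap.mem_ker, ← h3]
      have := hc0 _ (hT ⟨v, hv⟩)
      simpa [φ, row] using this
    rw [h3] at h1
    have h4 : φ (Pi.single e0 1) = 0 := h1 trivial
    apply he0
    simpa [φ, Pi.single_apply] using h4
  by_cases hb0 : 0 < Fintype.card b
  · obtain ⟨t, ht0, ht1, ht2⟩ := Int.Matrix.exists_ne_zero_int_vec_norm_le (Matrix.of fun (i : b) e => M (T i) e) hlt hb0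
    refine ⟨t, ht0, ?_, hker t fun i => congrFun ht1 i⟩
    intro e
    have h1 : ‖t e‖ ≤ ‖t‖ := norm_le_pi_norm t e
    have hnorm : ‖(Matrix.of fun (i : b) e => M (T i) e)‖ ≤ H := by
      rw [Matrix.norm_le_iff (by positivity)]
      intro i e
      have := hM _ (hT i) e
      simp only [Matrix.of_apply, Int.norm_eq_abs]
      exact_mod_cast this
    have hmax : max 1 ‖(Matrix.of fun (i : b) e => M (T i) e)‖ ≤ H := max_le (by exact_mod_cast hH) hnorm
    have h3 : ‖t e‖ ≤ ((Fintype.card ι * H : ℕ) : ℝ) ^ (Fintype.card ι : ℝ) := by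
      refine h1.trans (ht2.trans ?_)
      have hsR : (1:ℝ) ≤ Fintype.card ι := by exact_mod_cast hs1
      have h5 : (Fintype.card b : ℝ) + 1 ≤ Fintype.card ι := by exact_mod_cast hlt
      calc _ ≤ ((Fintype.card ι * H : ℕ) : ℝ) ^ ((Fintype.card b : ℝ) / (Fintype.card ι - Fintype.card b)) := by
            apply Real.rpow_le_rpow (by positivity)
            · push_cast; gcongr
            · exact div_nonneg (by positivity) (by linarith)
        _ ≤ _ := by
            apply Real.rpow_le_rpow_of_exponent_le
            · exact_mod_cast Nat.one_le_iff_ne_zero.2 (by positivity)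
            · rw [div_le_iff₀ (by linarith)]
              nlinarith
    rw [Real.rpow_natCast, Int.norm_eq_abs] at h3
    exact_mod_cast h3
  · refine ⟨Pi.single e0 1, by simp, ?_, hker _ fun i => absurd (Fintype.card_pos_iff.2 ⟨i⟩) hb0⟩
    intro e
    have : |(Pi.single e0 (1:ℤ) : ι → ℤ) e| ≤ 1 := by
      rw [Pi.single_apply]; split_ifs <;> simp
    refine this.trans ?_
    exact_mod_cast Nat.one_le_pow _ _ (by positivity)
end siegel

/-- homogenised evaluation -/
noncomputable def hev {r : ℕ} (L : ℕ) (F : MvPolynomial (Fin (r+1)) ℤ) (x : Fin (r+1) → ℤ) (w : ℤ) : ℤ :=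
  ∑ m ∈ F.support, coeff m F * hmon L x w m

lemma hev_eq {r : ℕ} {A : Type*} [CommRing A] (L : ℕ) (F : MvPolynomial (Fin (r+1)) ℤ) (hF : F.totalDegree ≤ L)
    (x : Fin (r+1) → ℤ) (w : ℤ) (v : A) (hv : (w:A) * v = 1) :
    ((hev L F x w : ℤ) : A) = (w:A) ^ L * eval (fun j => (x j : A) * v) (map (Int.castRingHom A) F) := by
  conv_rhs => rw [F.as_sum, map_sum, map_sum, Finset.mul_sum]
  rw [hev]
  push_cast
  refine Finset.sum_congr rfl fun m hm => ?_
  rw [hmon_eq L x w m (tdeg_lt hF (mem_support_iff.1 hm)) v hv, map_monomial, eval_monomial, eval_monomial]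
  simp; ring

lemma hev_zero_iff {r : ℕ} {L : ℕ} {F : MvPolynomial (Fin (r+1)) ℤ} (hF : F.totalDegree ≤ L)
    {x : Fin (r+1) → ℤ} {w : ℤ} (hw : w ≠ 0) :
    hev L F x w = 0 ↔ eval (fun j => (x j : ℚ) / w) (map (Int.castRingHom ℚ) F) = 0 := by
  have hw' : (w:ℚ) ≠ 0 := by exact_mod_cast hw
  have h := hev_eq (A := ℚ) L F hF x w (w:ℚ)⁻¹ (mul_inv_cancel₀ hw')
  simp only [← div_eq_mul_inv] at h
  rw [← Int.cast_eq_zero (α := ℚ), h, mul_eq_zero]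
  exact ⟨fun h => h.resolve_left (pow_ne_zero _ hw'), Or.inr⟩

lemma hev_sum {r : ℕ} {L : ℕ} {F : MvPolynomial (Fin (r+1)) ℤ} (hF : F.totalDegree ≤ L)
    (x : Fin (r+1) → ℤ) (w : ℤ) : hev L F x w = ∑ m : MonR (r+1) (L+1), coeff m.1 F * hmon L x w m.1 := by
  rw [Finset.sum_coe_sort (MonR (r+1) (L+1)) (fun m => coeff m F * hmon L x w m), hev]
  refine Finset.sum_subset (fun m hm => mem_MonR.2 ?_) fun m _ hm => by rw [notMem_support_iff.1 hm, zero_mul]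
  have := tdeg_lt hF (mem_support_iff.1 hm); omega

lemma hmon_le {r : ℕ} (L : ℕ) (x : Fin (r+1) → ℤ) (w : ℤ) (e : Fin (r+1) →₀ ℕ) (he : e.degree ≤ L) (U : ℕ)
    (hx : ∀ j, |x j| ≤ U) (hw : |w| ≤ U) : |hmon L x w e| ≤ (U ^ L : ℕ) := by
  have := hmon_bound L x w e U U hx hw
  rwa [← pow_add, Nat.add_sub_cancel' he] at this

lemma hev_le {r : ℕ} {L : ℕ} {F : MvPolynomial (Fin (r+1)) ℤ} (hF : F.totalDegree ≤ L) (H : ℕ)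
    (hH : ∀ m, |coeff m F| ≤ H)
    (x : Fin (r+1) → ℤ) (w : ℤ) (U : ℕ) (hx : ∀ j, |x j| ≤ U) (hw : |w| ≤ U) :
    |hev L F x w| ≤ ((L+(r+1)).choose (r+1) * (H * U ^ L) : ℕ) := by
  rw [hev_sum hF]
  refine (Finset.abs_sum_le_sum_abs _ _).trans ?_
  have : ∀ m ∈ (Finset.univ : Finset (MonR (r+1) (L+1))), |coeff m.1 F * hmon L x w m.1| ≤ ((H * U ^ L : ℕ) : ℤ) := by
    intro m _
    rw [abs_mul, Nat.cast_mul]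
    exact mul_le_mul (hH _) (hmon_le L x w _ (Nat.lt_succ_iff.1 (mem_MonR.1 m.2)) U hx hw) (abs_nonneg _) (by positivity)
  refine (Finset.sum_le_sum this).trans ?_
  rw [Finset.sum_const, Finset.card_univ, Fintype.card_coe, card_MonR]
  simp

lemma height_red {r : ℕ} {α : Type*} (S : Set α) (x : α → Fin (r+1) → ℤ) (w : α → ℤ) (hw : ∀ P ∈ S, w P ≠ 0)
    (L : ℕ) (F : MvPolynomial (Fin (r+1)) ℤ) (hF : F.totalDegree ≤ L) (hF0 : F ≠ 0)
    (hS : ∀ P ∈ S, eval (fun j => (x P j : ℚ) / w P) (map (Int.castRingHom ℚ) F) = 0)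
    (U : ℕ) (hU : 1 ≤ U) (hxU : ∀ P ∈ S, ∀ j, |x P j| ≤ U) (hwU : ∀ P ∈ S, |w P| ≤ U) :
    ∃ G : MvPolynomial (Fin (r+1)) ℤ, G ≠ 0 ∧ G.totalDegree ≤ L ∧
      (∀ m, |coeff m G| ≤ (((L+(r+1)).choose (r+1) * U ^ L) ^ ((L+(r+1)).choose (r+1)) : ℕ)) ∧
      ∀ P ∈ S, eval (fun j => (x P j : ℚ) / w P) (map (Int.castRingHom ℚ) G) = 0 := by
  classical
  have hcard : Fintype.card (MonR (r+1) (L+1)) = (L+(r+1)).choose (r+1) := by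
    rw [Fintype.card_coe, card_MonR]
  obtain ⟨t, ht0, ht1, ht2⟩ := small_vec S (fun P (m : MonR (r+1) (L+1)) => hmon L (x P) (w P) m.1) (U ^ L)
    (Nat.one_le_pow _ _ hU) (fun P hP m => hmon_le L _ _ _ (Nat.lt_succ_iff.1 (mem_MonR.1 m.2)) U (hxU P hP) (hwU P hP))
    (fun m => ((coeff m.1 F : ℤ) : ℚ)) (by
      intro h
      apply hF0
      ext m
      by_cases hm : m ∈ MonR (r+1) (L+1)
      · have := congrFun h ⟨m, hm⟩
        simpa using this
      · rw [coeff_zero]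
        by_contra hne
        exact hm (mem_MonR.2 (Nat.lt_succ_iff.2 (tdeg_lt hF hne)))) (by
      intro P hP
      have := (hev_zero_iff hF (hw P hP)).2 (hS P hP)
      rw [hev_sum hF] at this
      exact_mod_cast this)
  let G : MvPolynomial (Fin (r+1)) ℤ := ∑ m : MonR (r+1) (L+1), monomial m.1 (t m)
  have hco : ∀ m : MonR (r+1) (L+1), coeff m.1 G = t m := by
    intro m
    rw [coeff_sum, Finset.sum_eq_single m]
    · simp
    · intro b _ hb
      rw [coeff_monomial, if_neg fun h => hb (Subtype.ext h)]
    · simp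
  have hco' : ∀ m, m ∉ MonR (r+1) (L+1) → coeff m G = 0 := by
    intro m hm
    rw [coeff_sum]
    refine Finset.sum_eq_zero fun b _ => ?_
    rw [coeff_monomial, if_neg]
    rintro rfl; exact hm b.2
  have hGdeg : G.totalDegree ≤ L := by
    refine totalDegree_finsetSum_le fun m _ => (totalDegree_monomial_le _ _).trans ?_
    exact Nat.lt_succ_iff.1 (mem_MonR.1 m.2)
  refine ⟨G, ?_, hGdeg, ?_, ?_⟩
  · intro h
    apply ht0; funext m; rw [← hco, h]; simp
  · intro m
    by_cases hm : m ∈ MonR (r+1) (L+1)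
    · have := ht1 ⟨m, hm⟩
      rw [hcard, ← hco ⟨m, hm⟩] at this
      exact this
    · rw [hco' m hm]; simp; positivity
  · intro P hP
    rw [← hev_zero_iff hGdeg (hw P hP), hev_sum hGdeg, ← ht2 P hP]
    refine Finset.sum_congr rfl fun m _ => ?_
    rw [hco, mul_comm]

/-- choosing a good prime by averaging -/
lemma avg_prime {α : Type*} (S : Finset α) (N : α → ℤ) (Z : ℝ) (hN : ∀ x ∈ S, N x ≠ 0 ∧ |(N x : ℝ)| ≤ Z)
    (P : ℕ) (hP : 2 ≤ P) (Q : Finset ℕ) (hQ : ∀ p ∈ Q, p.Prime ∧ P < p) (hne : Q.Nonempty)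
    (hcard : 2 * Real.log Z ≤ Q.card * Real.log P) :
    ∃ p ∈ Q, S.card ≤ 2 * (S.filter fun x => ¬ (p:ℤ) ∣ N x).card := by
  classical
  have hlogP : 0 < Real.log P := Real.log_pos (by exact_mod_cast hP)
  have h1 : ∀ x ∈ S, 2 * (Q.filter fun p : ℕ => (p:ℤ) ∣ N x).card ≤ Q.card := by
    intro x hx
    obtain ⟨hx0, hxZ⟩ := hN x hx
    have hdvd : ∏ p ∈ Q.filter (fun p : ℕ => (p:ℤ) ∣ N x), p ∣ (N x).natAbs := by
      refine Finset.prod_primes_dvd _ (fun p hp => (hQ p (Finset.mem_filter.1 hp).1).1.prime) fun p hp => ?_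
      exact Int.natCast_dvd.1 (Finset.mem_filter.1 hp).2
    have hle := Nat.le_of_dvd (Int.natAbs_pos.2 hx0) hdvd
    have hpow : P ^ (Q.filter fun p : ℕ => (p:ℤ) ∣ N x).card ≤ (N x).natAbs := by
      refine le_trans ?_ hle
      rw [← Finset.prod_const]
      exact Finset.prod_le_prod' fun p hp => (hQ p (Finset.mem_filter.1 hp).1).2.le
    have h2 : (P:ℝ) ^ (Q.filter fun p : ℕ => (p:ℤ) ∣ N x).card ≤ Z := by
      refine le_trans ?_ hxZ
      have : (P ^ (Q.filter fun p : ℕ => (p:ℤ) ∣ N x).card : ℝ) ≤ ((N x).natAbs : ℝ) := by exact_mod_cast hpow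
      rwa [Nat.cast_natAbs, Int.cast_abs] at this
    have h3 := Real.log_le_log (by positivity) h2
    rw [Real.log_pow] at h3
    have h4 : (2 * (Q.filter fun p : ℕ => (p:ℤ) ∣ N x).card : ℝ) ≤ Q.card := by
      refine le_of_mul_le_mul_right ?_ hlogP
      linarith
    exact_mod_cast h4
  by_contra hcon
  push Not at hcon
  have h5 : ∀ p ∈ Q, S.card + 1 ≤ 2 * (S.filter fun x => (p:ℤ) ∣ N x).card := by
    intro p hp
    have h6 := hcon p hp
    have h7 := Finset.card_filter_add_card_filter_not (s := S) (fun x => (p:ℤ) ∣ N x)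
    omega
  have h8 := Finset.sum_le_sum h5
  have h9 := Finset.sum_le_sum h1
  rw [Finset.sum_const, smul_eq_mul, ← Finset.mul_sum] at h8 h9
  have h10 : ∑ p ∈ Q, (S.filter fun x => (p:ℤ) ∣ N x).card = ∑ x ∈ S, (Q.filter fun p : ℕ => (p:ℤ) ∣ N x).card := by
    simp only [Finset.card_filter]
    exact Finset.sum_comm
  rw [h10] at h8
  have := hne.card_pos
  nlinarith

lemma good_prime : ∃ P0 : ℕ, 2 ≤ P0 ∧ ∀ P : ℕ, P0 ≤ P → ∀ (α : Type) (S : Finset α) (N : α → ℤ) (Z : ℝ),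
    8 * Real.log Z ≤ P → (∀ x ∈ S, N x ≠ 0 ∧ |(N x : ℝ)| ≤ Z) →
    ∃ p : ℕ, p.Prime ∧ P < p ∧ p ≤ 8 * P ∧ S.card ≤ 2 * (S.filter fun x => ¬ (p:ℤ) ∣ N x).card := by
  obtain ⟨P0, hP0⟩ := primes_count
  refine ⟨P0 + 2, by omega, fun P hP α S N Z hZ hN => ?_⟩
  have h2 : 2 ≤ P := by omega
  have h2R : (2:ℝ) ≤ P := by exact_mod_cast h2
  have h1 := hP0 P (by omega)
  set Q := (Finset.Ioc P (8 * P)).filter Nat.Prime with hQ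
  have hlog8 : Real.log (8 * P) ≤ 4 * Real.log P := by
    have : 4 * Real.log P = Real.log ((P:ℝ) ^ 4) := by rw [Real.log_pow]; norm_num
    rw [this]
    apply Real.log_le_log (by positivity)
    have : (2:ℝ) ^ 3 ≤ (P:ℝ) ^ 3 := by gcongr
    nlinarith
  have hpos : 0 < Real.log P := Real.log_pos (by linarith)
  have hne : Q.Nonempty := by
    rw [Finset.nonempty_iff_ne_empty]; intro h
    rw [h] at h1; simp at h1; linarith
  obtain ⟨p, hp, hp2⟩ := avg_prime S N Z hN P h2 Q (fun p hp => by
    rw [hQ, Finset.mem_filter, Finset.mem_Ioc] at hp; exact ⟨hp.2, hp.1.1⟩) hne (by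
    have : (Q.card:ℝ) * Real.log (8 * P) ≤ Q.card * (4 * Real.log P) := by gcongr
    linarith)
  rw [hQ, Finset.mem_filter, Finset.mem_Ioc] at hp
  exact ⟨p, hp.2, hp.1.1, hp.1.2, hp2⟩

end

section
open MvPolynomial

lemma exists_inv_zmod {p : ℕ} (hp : p.Prime) (W : ℕ) (z : ℤ) (hz : ¬ (p:ℤ) ∣ z) : ∃ v : ZMod (p ^ W), (z : ZMod (p ^ W)) * v = 1 := by
  have h1 : IsCoprime (p:ℤ) z := (Prime.coprime_iff_not_dvd (Nat.prime_iff_prime_int.1 hp)).2 hz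
  obtain ⟨a, b, hab⟩ := h1.pow_left (m := W)
  refine ⟨b, ?_⟩
  have h2 := congrArg (fun t : ℤ => (t : ZMod (p ^ W))) hab
  have h3 : ((p : ZMod (p ^ W))) ^ W = 0 := by
    have := ZMod.natCast_self (p ^ W); push_cast at this; exact this
  push_cast at h2
  rw [h3, mul_zero, zero_add] at h2
  rw [mul_comm]; exact h2

lemma isUnit_zmod {p : ℕ} (hp : p.Prime) (W : ℕ) (z : ℤ) (hz : ¬ (p:ℤ) ∣ z) : IsUnit (z : ZMod (p ^ W)) := by
  obtain ⟨v, hv⟩ := exists_inv_zmod hp W z hz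
  exact IsUnit.of_mul_eq_one v hv

lemma zeros_le {k : Type*} [Field k] [Fintype k] {r d : ℕ} {f : MvPolynomial (Fin (r+1)) k} (hf : f.totalDegree ≤ d)
    (htop : coeff (Finsupp.single 0 d) f ≠ 0) (S : Finset (Fin (r+1) → k)) (hS : ∀ P ∈ S, eval P f = 0) :
    S.card ≤ d * Fintype.card k ^ r := by
  classical
  have h1 := Finset.card_le_mul_card_image (f := fun P : Fin (r+1) → k => (Fin.tail P : Fin r → k)) S d (by
    intro y _
    exact fiber_le hf htop y _ fun P hP => ⟨hS P (Finset.mem_filter.1 hP).1, (Finset.mem_filter.1 hP).2⟩)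
  refine h1.trans (Nat.mul_le_mul_left _ ((Finset.card_le_univ _).trans ?_))
  simp

lemma class_aux {r : ℕ} {α : Type*} (S : Set α) (x : α → Fin (r+1) → ℤ) (w : α → ℤ) (J m : ℕ) (hJ : 0 < J)
    (p W d : ℕ) (hp : p.Prime) (F : MvPolynomial (Fin (r+1)) ℤ) (hF : F.totalDegree ≤ d)
    (hw : ∀ P ∈ S, ¬ (p:ℤ) ∣ w P)
    (hf : ∀ P ∈ S, eval (fun j => (x P j : ℚ) / w P) (map (Int.castRingHom ℚ) F) = 0)
    (hf' : ∀ P ∈ S, ¬ (p:ℤ) ∣ hev (d-1) (pderiv 0 F) (x P) (w P))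
    (hcls : ∀ P ∈ S, ∀ P' ∈ S, ∀ j, (p:ℤ) ∣ x P j * w P' - x P' j * w P)
    (A Aw : ℕ) (hA : ∀ P ∈ S, ∀ j, |x P j| ≤ A) (hAw : ∀ P ∈ S, |w P| ≤ Aw)
    (c1 c2 : ℕ) (hc1 : c1 = ∑ e : Col r J m, e.ex.degree) (hc2 : c2 = ∑ e : Col r J m, (m + J - 1 - e.ex.degree))
    (hsize : (J * (m+r).choose r).factorial * (A ^ c1 * Aw ^ c2) < p ^ (W * (J * (m+r).choose r) - (W + r).choose (r+1))) :
    ∃ G : MvPolynomial (Fin (r+1)) ℚ, G ≠ 0 ∧ G.totalDegree ≤ m + J - 1 ∧ degreeOf 0 G < J ∧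
      ∀ P ∈ S, eval (fun j => (x P j : ℚ) / w P) G = 0 := by
  classical
  have hw0 : ∀ P ∈ S, w P ≠ 0 := fun P hP h => hw P hP (h ▸ dvd_zero _)
  have hex : ∀ P, ∃ v : ZMod (p ^ W), P ∈ S → (w P : ZMod (p ^ W)) * v = 1 := by
    intro P
    by_cases hP : P ∈ S
    · obtain ⟨v, hv⟩ := exists_inv_zmod hp W _ (hw P hP)
      exact ⟨v, fun _ => hv⟩
    · exact ⟨0, fun h => absurd h hP⟩
  choose v hv using hex
  refine oneclass S x w J m hJ p W v (map (Int.castRingHom _) F) hw0 hv ?_ ?_ ?_ A Aw hA hAw c1 c2 hc1 hc2 hsize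
  · intro P hP
    have h1 := (hev_zero_iff hF (hw0 P hP)).2 (hf P hP)
    have h2 := hev_eq d F hF (x P) (w P) (v P) (hv P hP)
    rw [h1, Int.cast_zero] at h2
    exact ((isUnit_zmod hp W _ (hw P hP)).pow d).mul_right_eq_zero.1 h2.symm
  · intro P hP
    have h2 := hev_eq (d-1) (pderiv 0 F) ((tdeg_pderiv F 0).trans (by omega)) (x P) (w P) (v P) (hv P hP)
    have h3 := isUnit_zmod hp W _ (hf' P hP)
    rw [h2] at h3
    rw [pderiv_map]
    exact isUnit_of_mul_isUnit_right h3
  · intro P hP P' hP' j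
    obtain ⟨k, hk⟩ := hcls P hP P' hP' j
    have h1 := congrArg (fun t : ℤ => (t : ZMod (p ^ W))) hk
    push_cast at h1
    refine ⟨k * v P * v P', ?_⟩
    have e1 := hv P hP
    have e2 := hv P' hP'
    linear_combination (v P * v P') * h1 + (x P' j : ZMod (p^W)) * v P' * e1 - (x P j : ZMod (p^W)) * v P * e2

lemma curve_core {α : Type*} (S : Finset α) (x : α → Fin 2 → ℤ) (w : α → ℤ) (J m : ℕ) (hJ : 0 < J)
    (p d : ℕ) (hp : p.Prime) (hJd : J ≤ d) (F : MvPolynomial (Fin 2) ℤ) (hF : F.totalDegree ≤ d)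
    (hirr : Irreducible (map (Int.castRingHom ℚ) F))
    (htop : ¬ (p:ℤ) ∣ coeff (Finsupp.single 0 d) F)
    (hw : ∀ P ∈ S, ¬ (p:ℤ) ∣ w P)
    (hf : ∀ P ∈ S, eval (fun j => (x P j : ℚ) / w P) (map (Int.castRingHom ℚ) F) = 0)
    (hf' : ∀ P ∈ S, ¬ (p:ℤ) ∣ hev (d-1) (pderiv 0 F) (x P) (w P))
    (hinj : ∀ P ∈ S, ∀ P' ∈ S, (∀ j, (x P j : ℚ) / w P = x P' j / w P') → P = P')
    (A Aw : ℕ) (hA : ∀ P ∈ S, ∀ j, |x P j| ≤ A) (hAw : ∀ P ∈ S, |w P| ≤ Aw)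
    (hsize : (J * (m+1)) ^ 2 * (A * Aw) ^ (m + J - 1) < p ^ (J * (m+1) - 1)) :
    S.card ≤ d ^ 2 * (m + J - 1) * p := by
  classical
  have : Fact p.Prime := ⟨hp⟩
  have hirr0 := hirr.ne_zero
  have hw0 : ∀ P ∈ S, w P ≠ 0 := fun P hP h => hw P hP (h ▸ dvd_zero _)
  set s := J * (m+1) with hs
  have hs1 : 1 ≤ s := Nat.one_le_iff_ne_zero.2 (by positivity)
  obtain ⟨c1, hc1⟩ : ∃ c1, c1 = ∑ e : Col 1 J m, e.ex.degree := ⟨_, rfl⟩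
  obtain ⟨c2, hc2⟩ : ∃ c2, c2 = ∑ e : Col 1 J m, (m + J - 1 - e.ex.degree) := ⟨_, rfl⟩
  have h2c1 : 2 * c1 = s * (m + J - 1) := by
    have h1 := Col.sum_deg 1 J m
    have h2 := choose2 m
    rw [← hc1, show m + 1 + 1 = m + 2 by ring, Nat.choose_one_right] at h1
    obtain ⟨J, rfl⟩ := Nat.exists_eq_add_of_le' hJ
    rw [hs, show m + (J + 1) - 1 = m + J by omega]
    simp at h1
    nlinarith
  have hc12 : c1 + c2 = s * (m + J - 1) := by
    have h1 : Fintype.card (Col 1 J m) = s := by rw [Col.card, Nat.choose_one_right]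
    rw [← h1, hc1, hc2, ← Finset.sum_add_distrib, ← Finset.card_univ, ← smul_eq_mul, ← Finset.sum_const]
    refine Finset.sum_congr rfl fun e _ => ?_
    have := Col.deg_le e; omega
  have hc2' : c2 = c1 := by omega
  have hsz : (J * (m+1).choose 1).factorial * (A ^ c1 * Aw ^ c2) < p ^ (s * (J * (m+1).choose 1) - (s + 1).choose (1+1)) := by
    rw [Nat.choose_one_right, ← hs, hc2', ← mul_pow]
    refine lt_of_pow_lt_pow_left₀ 2 (by positivity) ?_
    have e1 : 2 * (s * s - (s+1).choose (1+1)) = s * (s - 1) := by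
      obtain ⟨t, ht⟩ := Nat.exists_eq_add_of_le' hs1
      rw [ht]
      have := choose2 t
      simp only [Nat.add_sub_cancel]
      rw [show t + 1 + 1 = t + 2 by ring, show 1 + 1 = 2 by rfl]
      rw [Nat.mul_sub, this]
      have : 2 * ((t+1)*(t+1)) = (t+1)*t + (t+2)*(t+1) := by ring
      omega
    calc (s.factorial * (A * Aw) ^ c1) ^ 2 = s.factorial ^ 2 * (A * Aw) ^ (2 * c1) := by ring
      _ ≤ (s ^ s) ^ 2 * (A * Aw) ^ (s * (m + J - 1)) := by
          rw [h2c1]; exact Nat.mul_le_mul_right _ (Nat.pow_le_pow_left (Nat.factorial_le_pow s) 2)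
      _ = (s ^ 2 * (A * Aw) ^ (m + J - 1)) ^ s := by
          rw [mul_pow (s ^ 2), ← pow_mul, ← pow_mul, ← pow_mul, mul_comm s 2, mul_comm s (m + J - 1)]
      _ < (p ^ (s - 1)) ^ s := Nat.pow_lt_pow_left hsize (by omega)
      _ = (p ^ (s * s - (s+1).choose (1+1))) ^ 2 := by rw [← pow_mul, ← pow_mul]; congr 1; rw [mul_comm, ← e1]; ring
  let cl : α → Fin 2 → ZMod p := fun P j => (x P j : ZMod p) * (w P : ZMod p)⁻¹
  have hwp : ∀ P ∈ S, (w P : ZMod p) ≠ 0 := fun P hP h => hw P hP ((ZMod.intCast_zmod_eq_zero_iff_dvd _ _).1 h)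
  have himg : (S.image cl).card ≤ d * p := by
    have := zeros_le (f := map (Int.castRingHom (ZMod p)) F) (d := d) ((totalDegree_map_le _ _).trans hF) (by
      rw [coeff_map]
      intro h; exact htop ((ZMod.intCast_zmod_eq_zero_iff_dvd _ _).1 h)) (S.image cl) (by
      intro Q hQ
      obtain ⟨P, hP, rfl⟩ := Finset.mem_image.1 hQ
      have h1 := (hev_zero_iff hF (hw0 P hP)).2 (hf P hP)
      have h2 := hev_eq d F hF (x P) (w P) (w P : ZMod p)⁻¹ (mul_inv_cancel₀ (hwp P hP))
      rw [h1, Int.cast_zero] at h2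
      exact (mul_eq_zero.1 h2.symm).resolve_left (pow_ne_zero _ (hwp P hP)))
    rwa [ZMod.card, pow_one] at this
  have htopQ : coeff (Finsupp.single 0 d) (map (Int.castRingHom ℚ) F) ≠ 0 := by
    rw [coeff_map]; intro h
    apply htop
    have : coeff (Finsupp.single 0 d) F = 0 := by simpa using h
    rw [this]; exact dvd_zero _
  have hmain := Finset.card_le_mul_card_image (f := cl) S (d * (m + J - 1)) (by
    intro c _
    obtain ⟨G, hG0, hGd, hGJ, hG⟩ := class_aux (r := 1) {P | P ∈ S ∧ cl P = c} x w J m hJ p s d hp F hF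
      (fun P hP => hw P hP.1) (fun P hP => hf P hP.1) (fun P hP => hf' P hP.1) (by
        intro P hP P' hP' j
        have h1 : cl P j = cl P' j := by rw [hP.2, hP'.2]
        rw [← ZMod.intCast_zmod_eq_zero_iff_dvd]
        push_cast
        have e1 := hwp P hP.1
        have e2 := hwp P' hP'.1
        simp only [cl] at h1
        field_simp at h1
        rw [sub_eq_zero]; linear_combination h1) A Aw (fun P hP => hA P hP.1) (fun P hP => hAw P hP.1) c1 c2 hc1 hc2 hsz
    have hrel : IsRelPrime (map (Int.castRingHom ℚ) F) G :=
      (hirr.dvd_or_isRelPrime (n := G)).resolve_left (not_dvd_of_degreeOf htopQ hG0 (hGJ.trans_le hJd))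
    have hb := bez2_points hirr0 hG0 hrel ((S.filter fun P => cl P = c).image fun P j => (x P j : ℚ) / w P) (by
      intro Q hQ
      obtain ⟨P, hP, rfl⟩ := Finset.mem_image.1 hQ
      rw [Finset.mem_filter] at hP
      exact ⟨hf P hP.1, hG P hP⟩)
    rw [Finset.card_image_of_injOn] at hb
    · refine hb.trans (Nat.mul_le_mul ((totalDegree_map_le _ _).trans hF) hGd)
    · intro P hP P' hP' h
      rw [Finset.mem_coe, Finset.mem_filter] at hP hP'
      exact hinj P hP.1 P' hP'.1 fun j => congrFun h j)
  calc S.card ≤ _ := hmain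
    _ ≤ d * (m + J - 1) * (d * p) := Nat.mul_le_mul_left _ himg
    _ = _ := by ring

end

section
open MvPolynomial

lemma loglem (ρ : ℝ) (hρ : 0 < ρ) (k : ℕ) : ∃ K : ℝ, 1 ≤ K ∧ ∀ (U : ℝ) (d : ℕ), 1 ≤ U → 1 ≤ d →
    (d:ℝ) ^ k * (1 + Real.log U) ≤ K * (U ^ ρ + (d:ℝ) ^ (k+1)) := by
  set ε := ρ / (k+1) with hε
  have hε0 : 0 < ε := by positivity
  refine ⟨max 1 ((1/ε) ^ (k+1)) + 1, by linarith [le_max_left (1:ℝ) ((1/ε) ^ (k+1))], fun U d hU hd => ?_⟩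
  set M := max 1 ((1/ε) ^ (k+1))
  have hM1 : 1 ≤ M := le_max_left _ _
  have hM2 : (1/ε) ^ (k+1) ≤ M := le_max_right _ _
  have hdR : (1:ℝ) ≤ d := by exact_mod_cast hd
  have hlog : 0 ≤ Real.log U := Real.log_nonneg hU
  have hUpos : 0 < U ^ ρ := by positivity
  have h1 : (d:ℝ) ^ k ≤ (d:ℝ) ^ (k+1) := pow_le_pow_right₀ hdR (by omega)
  have h2 : Real.log U ^ (k+1) ≤ M * U ^ ρ := by
    have h3 := Real.log_le_rpow_div (x := U) (by linarith) hε0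
    calc Real.log U ^ (k+1) ≤ (U ^ ε / ε) ^ (k+1) := pow_le_pow_left₀ hlog h3 _
      _ = (1/ε) ^ (k+1) * U ^ ρ := by
        rw [div_eq_mul_one_div, mul_pow, ← Real.rpow_natCast (U ^ ε), ← Real.rpow_mul (by linarith), mul_comm]
        congr 2
        rw [hε]; push_cast; field_simp
      _ ≤ _ := by gcongr
  have h4 : (d:ℝ) ^ k * Real.log U ≤ (d:ℝ) ^ (k+1) + Real.log U ^ (k+1) := by
    rcases le_total (Real.log U) d with h | h
    · have : (d:ℝ) ^ k * Real.log U ≤ (d:ℝ) ^ k * d := by gcongr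
      rw [← pow_succ] at this
      have : 0 ≤ Real.log U ^ (k+1) := by positivity
      linarith
    · have : (d:ℝ) ^ k * Real.log U ≤ Real.log U ^ k * Real.log U := by gcongr
      rw [← pow_succ] at this
      have : 0 ≤ (d:ℝ) ^ (k+1) := by positivity
      linarith
  have h5 : 0 ≤ (d:ℝ) ^ (k+1) := by positivity
  have h6 : (d:ℝ) ^ (k+1) ≤ M * (d:ℝ) ^ (k+1) := by nlinarith
  nlinarith

lemma logZ_bound (r : ℕ) : ∃ c : ℝ, 0 ≤ c ∧ ∀ d U s H : ℕ, 1 ≤ d → 1 ≤ U → s = (d+(r+1)).choose (r+1) → H = (s * U ^ d) ^ s →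
    Real.log ((H * U * (s * ((d * H) * U ^ d)) : ℕ) : ℝ) ≤ c * ((d:ℝ) ^ (r+2) * (1 + Real.log U)) := by
  set a : ℝ := ((r+2 : ℕ) : ℝ) with ha
  have ha1 : 1 ≤ a := by rw [ha]; exact_mod_cast (by omega : 1 ≤ r + 2)
  refine ⟨2 * a ^ (r+1) * (a * a + 1) + 4 * (a * a), by positivity, fun d U s H hd hU hs hH => ?_⟩
  have hdR : (1:ℝ) ≤ d := by exact_mod_cast hd
  have hUR : (1:ℝ) ≤ U := by exact_mod_cast hU
  have hs1 : 1 ≤ s := by rw [hs]; exact Nat.choose_pos (by omega)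
  have hH1 : 1 ≤ H := by rw [hH]; exact Nat.one_le_pow _ _ (Nat.mul_pos hs1 (Nat.pow_pos hU))
  have hsR : (1:ℝ) ≤ s := by exact_mod_cast hs1
  have hHR : (1:ℝ) ≤ H := by exact_mod_cast hH1
  have hlog : 0 ≤ Real.log U := Real.log_nonneg hUR
  have hsle : (s:ℝ) ≤ (a * d) ^ (r+1) := by
    have h1 : s ≤ ((r+2) * d) ^ (r+1) := by
      rw [hs]
      refine (Nat.choose_le_pow _ _).trans (Nat.pow_le_pow_left ?_ _)
      nlinarith
    have : ((s:ℕ):ℝ) ≤ ((((r+2) * d) ^ (r+1) : ℕ) : ℝ) := by exact_mod_cast h1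
    rw [ha]; push_cast at this ⊢; exact this
  have hlogd : Real.log d ≤ d := (Real.log_le_sub_one_of_pos (by linarith)).trans (by linarith)
  have hlogs : Real.log s ≤ a * a * d := by
    have h1 := Real.log_le_log (by linarith) hsle
    rw [Real.log_pow] at h1
    have h2 : Real.log (a * d) ≤ a * d := (Real.log_le_sub_one_of_pos (by positivity)).trans (by linarith)
    have h3 : ((r+1 : ℕ):ℝ) ≤ a := by rw [ha]; exact_mod_cast (by omega)
    calc Real.log s ≤ ((r+1 : ℕ):ℝ) * Real.log (a * d) := h1
      _ ≤ ((r+1 : ℕ):ℝ) * (a * d) := by gcongr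
      _ ≤ a * (a * d) := by gcongr
      _ = _ := by ring
  have hlogH : Real.log H = s * (Real.log s + d * Real.log U) := by
    rw [hH]; push_cast
    rw [Real.log_pow, Real.log_mul (by positivity) (by positivity), Real.log_pow]
  set l := 1 + Real.log U with hl
  have hl1 : 1 ≤ l := by linarith
  have hdp : (d:ℝ) ≤ d ^ (r+2) := le_self_pow₀ hdR (by omega)
  have hH2 : Real.log H ≤ a ^ (r+1) * (a * a + 1) * (d ^ (r+2) * l) := by
    rw [hlogH]
    calc (s:ℝ) * (Real.log s + d * Real.log U) ≤ (a * d) ^ (r+1) * (a * a * d + d * Real.log U) := by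
          have : 0 ≤ Real.log s := Real.log_nonneg hsR
          gcongr
      _ ≤ (a * d) ^ (r+1) * ((a * a + 1) * (d * l)) := by
          gcongr
          have : 0 ≤ a * a * d * Real.log U := by positivity
          rw [hl]; nlinarith
      _ = _ := by rw [mul_pow]; ring
  have hexp : Real.log ((H * U * (s * ((d * H) * U ^ d)) : ℕ) : ℝ) = 2 * Real.log H + Real.log U + Real.log s + Real.log d + d * Real.log U := by
    push_cast
    rw [Real.log_mul (by positivity) (by positivity), Real.log_mul (by positivity) (by positivity),
      Real.log_mul (by positivity) (by positivity), Real.log_mul (by positivity) (by positivity),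
      Real.log_mul (by positivity) (by positivity), Real.log_pow]
    ring
  have hdl : (d:ℝ) * l ≤ d ^ (r+2) * l := by gcongr
  have haa : 1 ≤ a * a := by nlinarith
  have h7 : Real.log U + Real.log s + Real.log d + d * Real.log U ≤ 4 * (a * a) * (d * l) := by
    have e1 : Real.log U ≤ a * a * (d * l) := by
      have : Real.log U ≤ 1 * (1 * l) := by linarith
      refine this.trans ?_
      gcongr
    have e2 : a * a * d ≤ a * a * (d * l) := by
      have : (d:ℝ) ≤ d * l := by nlinarith
      gcongr
    have e3 : (d:ℝ) ≤ a * a * (d * l) := by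
      have : (d:ℝ) ≤ 1 * (d * l) := by nlinarith
      refine this.trans ?_
      gcongr
    have e4 : d * Real.log U ≤ a * a * (d * l) := by
      have : d * Real.log U ≤ 1 * (d * l) := by rw [hl]; nlinarith
      refine this.trans ?_
      gcongr
    linarith
  have h8 : 4 * (a * a) * (d * l) ≤ 4 * (a * a) * (d ^ (r+2) * l) := by gcongr
  rw [hexp]
  nlinarith

lemma eq_C_mul_of_dvd {r : ℕ} {F G : MvPolynomial (Fin r) ℚ} (hG : G ≠ 0) (hd : G.totalDegree ≤ F.totalDegree) (h : F ∣ G) :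
    ∃ c : ℚ, c ≠ 0 ∧ G = C c * F := by
  obtain ⟨Q, rfl⟩ := h
  have hF : F ≠ 0 := left_ne_zero_of_mul hG
  have hQ : Q ≠ 0 := right_ne_zero_of_mul hG
  rw [totalDegree_mul_of_isDomain hF hQ] at hd
  have h0 : Q.totalDegree = 0 := by omega
  rw [totalDegree_eq_zero_iff_eq_C] at h0
  refine ⟨coeff 0 Q, ?_, ?_⟩
  · intro h; rw [h] at h0; simp at h0; exact hQ h0
  · rw [mul_comm]; congr 1

/-- height reduction, dichotomy -/
lemma height_red' {r : ℕ} {α : Type*} (S : Set α) (x : α → Fin (r+1) → ℤ) (w : α → ℤ) (hw : ∀ P ∈ S, w P ≠ 0)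
    (d : ℕ) (F : MvPolynomial (Fin (r+1)) ℤ) (hF : F.totalDegree ≤ d) (htop : coeff (Finsupp.single 0 d) F ≠ 0)
    (hS : ∀ P ∈ S, eval (fun j => (x P j : ℚ) / w P) (map (Int.castRingHom ℚ) F) = 0)
    (U : ℕ) (hU : 1 ≤ U) (hxU : ∀ P ∈ S, ∀ j, |x P j| ≤ U) (hwU : ∀ P ∈ S, |w P| ≤ U) :
    (∃ G : MvPolynomial (Fin (r+1)) ℚ, G ≠ 0 ∧ G.totalDegree ≤ d ∧ ¬ map (Int.castRingHom ℚ) F ∣ G ∧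
      ∀ P ∈ S, eval (fun j => (x P j : ℚ) / w P) G = 0) ∨
    (∃ F' : MvPolynomial (Fin (r+1)) ℤ, F'.totalDegree ≤ d ∧
      (∀ m, |coeff m F'| ≤ (((d+(r+1)).choose (r+1) * U ^ d) ^ ((d+(r+1)).choose (r+1)) : ℕ)) ∧
      ∃ c : ℚ, c ≠ 0 ∧ map (Int.castRingHom ℚ) F' = C c * map (Int.castRingHom ℚ) F) := by
  have hF0 : F ≠ 0 := by rintro rfl; simp at htop
  obtain ⟨G, hG0, hGd, hGH, hG⟩ := height_red S x w hw d F hF hF0 hS U hU hxU hwU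
  have hinj : Function.Injective (map (σ := Fin (r+1)) (Int.castRingHom ℚ)) := map_injective _ Int.cast_injective
  have hG0' : map (Int.castRingHom ℚ) G ≠ 0 := by
    intro h; exact hG0 (hinj (by rw [h, map_zero]))
  have hGd' := (totalDegree_map_le (Int.castRingHom ℚ) G).trans hGd
  by_cases h : map (Int.castRingHom ℚ) F ∣ map (Int.castRingHom ℚ) G
  · right
    have htopQ : coeff (Finsupp.single 0 d) (map (Int.castRingHom ℚ) F) ≠ 0 := by
      rw [coeff_map]; simpa using htop
    have hFd := tdeg_of_top ((totalDegree_map_le (Int.castRingHom ℚ) F).trans hF) htopQ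
    exact ⟨G, hGd, hGH, eq_C_mul_of_dvd hG0' (by rw [hFd]; exact hGd') h⟩
  · left
    exact ⟨_, hG0', hGd', h, hG⟩

lemma pick_prime' (r : ℕ) (ρ : ℝ) (hρ : 0 < ρ) : ∃ K : ℝ, 1 ≤ K ∧ ∀ (d : ℕ), 1 ≤ d → ∀ (F : MvPolynomial (Fin (r+1)) ℤ),
    F.totalDegree ≤ d → Irreducible (map (Int.castRingHom ℚ) F) → coeff (Finsupp.single 0 d) F ≠ 0 →
    ∀ (α : Type) (S : Finset α) (x : α → Fin (r+1) → ℤ) (w : α → ℤ), (∀ P ∈ S, w P ≠ 0) → 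
    (∀ P ∈ S, eval (fun j => (x P j : ℚ) / w P) (map (Int.castRingHom ℚ) F) = 0) →
    ∀ U : ℕ, 1 ≤ U → (∀ P ∈ S, ∀ j, |x P j| ≤ U) → (∀ P ∈ S, |w P| ≤ U) →
    ∀ Y : ℕ, K * ((U:ℝ) ^ ρ + (d:ℝ) ^ (r+3)) ≤ Y →
    ∃ (S0 T : Finset α) (G : MvPolynomial (Fin (r+1)) ℚ) (p : ℕ) (F' : MvPolynomial (Fin (r+1)) ℤ),
      S0 ⊆ S ∧ T ⊆ S ∧ S.card ≤ S0.card + 2 * T.card ∧ G ≠ 0 ∧ G.totalDegree ≤ d ∧ ¬ map (Int.castRingHom ℚ) F ∣ G ∧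
      (∀ P ∈ S0, eval (fun j => (x P j : ℚ) / w P) G = 0) ∧ p.Prime ∧ Y < p ∧ p ≤ 8 * Y ∧ F'.totalDegree ≤ d ∧
      (∃ c : ℚ, c ≠ 0 ∧ map (Int.castRingHom ℚ) F' = C c * map (Int.castRingHom ℚ) F) ∧
      ∀ P ∈ T, ¬ (p:ℤ) ∣ w P ∧ ¬ (p:ℤ) ∣ hev (d-1) (pderiv 0 F') (x P) (w P) ∧ ¬ (p:ℤ) ∣ coeff (Finsupp.single 0 d) F' ∧
        ∀ m, |coeff m F'| ≤ (((d+(r+1)).choose (r+1) * U ^ d) ^ ((d+(r+1)).choose (r+1)) : ℕ) := by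
  classical
  obtain ⟨P0, hP0, hgood⟩ := good_prime
  obtain ⟨c, hc0, hc⟩ := logZ_bound r
  obtain ⟨K1, hK1, hlog⟩ := loglem ρ hρ (r+2)
  refine ⟨P0 + 8 * c * K1 + 1, by nlinarith [(Nat.cast_nonneg P0 : (0:ℝ) ≤ P0), mul_nonneg hc0 (by linarith : 0 ≤ K1)], ?_⟩
  intro d hd F hF hirr htop α S x w hw hS U hU hxU hwU Y hY
  have hUR : (1:ℝ) ≤ U := by exact_mod_cast hU
  have hdR : (1:ℝ) ≤ d := by exact_mod_cast hd
  set V := (U:ℝ) ^ ρ + (d:ℝ) ^ (r+3) with hV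
  have hV1 : 1 ≤ V := by
    have h1 : 1 ≤ (d:ℝ) ^ (r+3) := one_le_pow₀ hdR
    have h2 : 0 ≤ (U:ℝ) ^ ρ := by positivity
    linarith
  have hcK : 0 ≤ 8 * c * K1 := by positivity
  have hYP : P0 ≤ Y := by
    have : (P0:ℝ) ≤ Y := by
      have h0 : (0:ℝ) ≤ P0 := Nat.cast_nonneg _
      refine le_trans ?_ hY
      nlinarith
    exact_mod_cast this
  have htopQ : coeff (Finsupp.single 0 d) (map (Int.castRingHom ℚ) F) ≠ 0 := by
    rw [coeff_map]; simpa using htop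
  have hFd := tdeg_of_top ((totalDegree_map_le (Int.castRingHom ℚ) F).trans hF) htopQ
  rcases height_red' (S : Set α) x w hw d F hF htop hS U hU hxU hwU with ⟨G, hG0, hGd, hGF, hG⟩ | ⟨F', hF'd, hF'H, e, he0, heF⟩
  · obtain ⟨p, hp, hp1, hp2, -⟩ := hgood Y hYP α ∅ (fun _ => 0) 1 (by simp) (by simp)
    exact ⟨S, ∅, G, p, F, subset_rfl, by simp, by simp, hG0, hGd, hGF, hG, hp, hp1, hp2, hF, ⟨1, one_ne_zero, by simp⟩, by simp⟩
  · have htop' : coeff (Finsupp.single 0 d) (map (Int.castRingHom ℚ) F') ≠ 0 := by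
      rw [heF, coeff_C_mul]; exact mul_ne_zero he0 htopQ
    have htopZ : coeff (Finsupp.single 0 d) F' ≠ 0 := by
      intro h; rw [coeff_map, h] at htop'; simp at htop'
    have hder : pderiv 0 (map (Int.castRingHom ℚ) F') ≠ 0 :=
      pderiv0_ne_zero hd (by exact_mod_cast (by omega : d ≠ 0)) htop'
    have hderd : (pderiv 0 (map (Int.castRingHom ℚ) F')).totalDegree < d := by
      have := tdeg_pderiv (map (Int.castRingHom ℚ) F') 0
      have := (totalDegree_map_le (Int.castRingHom ℚ) F').trans hF'd
      omega
    have hderF : (pderiv 0 F').totalDegree ≤ d - 1 := (tdeg_pderiv F' 0).trans (by omega)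
    obtain ⟨s, hs⟩ : ∃ s, s = (d+(r+1)).choose (r+1) := ⟨_, rfl⟩
    obtain ⟨H, hH⟩ : ∃ H, H = (s * U ^ d) ^ s := ⟨_, rfl⟩
    rw [← hs, ← hH] at hF'H
    have hderH : ∀ m, |coeff m (pderiv 0 F')| ≤ ((d * H : ℕ) : ℤ) := by
      intro m
      by_cases hm : coeff m (pderiv 0 F') = 0
      · rw [hm]; simp; positivity
      · have h1 := tdeg_lt hderF hm
        rw [coeff_pderiv, abs_mul]
        have h2 : m 0 ≤ m.degree := Finsupp.le_degree 0 m
        have h3 : |((m 0 : ℤ) + 1)| ≤ d := by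
          rw [abs_of_nonneg (by positivity)]; omega
        push_cast
        rw [mul_comm]
        exact mul_le_mul h3 (hF'H _) (abs_nonneg _) (by positivity)
    let N : α → ℤ := fun P => coeff (Finsupp.single 0 d) F' * w P * hev (d-1) (pderiv 0 F') (x P) (w P)
    have hN : ∀ P ∈ S, |(N P : ℝ)| ≤ ((H * U * (s * ((d * H) * U ^ d)) : ℕ) : ℝ) := by
      intro P hP
      have h1 := hev_le hderF (d * H) hderH (x P) (w P) U (hxU P hP) (hwU P hP)
      have h2 : ((d - 1 + (r+1)).choose (r+1) * ((d * H) * U ^ (d-1)) : ℕ) ≤ s * ((d * H) * U ^ d) := by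
        rw [hs]
        refine Nat.mul_le_mul (Nat.choose_le_choose _ (by omega)) (Nat.mul_le_mul_left _ (Nat.pow_le_pow_right hU (by omega)))
      have h3 : |N P| ≤ ((H * U * (s * ((d * H) * U ^ d)) : ℕ) : ℤ) := by
        simp only [N]
        rw [abs_mul, abs_mul, Nat.cast_mul, Nat.cast_mul]
        refine mul_le_mul (mul_le_mul (hF'H _) (hwU P hP) (abs_nonneg _) (by positivity)) (h1.trans ?_) (abs_nonneg _) (by positivity)
        exact_mod_cast h2
      rw [← Int.cast_abs]
      exact_mod_cast h3
    obtain ⟨p, hp, hp1, hp2, hp3⟩ := hgood Y hYP α (S.filter fun P => hev (d-1) (pderiv 0 F') (x P) (w P) ≠ 0) N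
      ((H * U * (s * ((d * H) * U ^ d)) : ℕ) : ℝ) (by
        have h1 := hc d U s H hd hU hs hH
        have h2 := hlog U d hUR hd
        have h0 : (0:ℝ) ≤ P0 := Nat.cast_nonneg _
        refine le_trans ?_ hY
        calc _ ≤ 8 * (c * (K1 * V)) := by
              refine mul_le_mul_of_nonneg_left (h1.trans (mul_le_mul_of_nonneg_left h2 hc0)) (by norm_num)
          _ ≤ _ := by nlinarith) (by
        intro P hP
        rw [Finset.mem_filter] at hP
        exact ⟨mul_ne_zero (mul_ne_zero htopZ (hw P hP.1)) hP.2, hN P hP.1⟩)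
    refine ⟨S.filter fun P => hev (d-1) (pderiv 0 F') (x P) (w P) = 0, (S.filter fun P => hev (d-1) (pderiv 0 F') (x P) (w P) ≠ 0).filter fun P => ¬ (p:ℤ) ∣ N P, pderiv 0 (map (Int.castRingHom ℚ) F'), p, F',
      Finset.filter_subset _ _, (Finset.filter_subset _ _).trans (Finset.filter_subset _ _), ?_, hder, hderd.le, ?_, ?_, hp, hp1, hp2, hF'd,
      ⟨e, he0, heF⟩, ?_⟩
    · have := Finset.card_filter_add_card_filter_not (s := S) (fun P => hev (d-1) (pderiv 0 F') (x P) (w P) = 0)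
      simp only [ne_eq] at hp3 ⊢
      omega
    · intro h
      exact hder (dvd_tdeg_eq_zero (by rw [hFd]; exact hderd) h)
    · intro P hP
      rw [Finset.mem_filter] at hP
      rw [pderiv_map]
      exact (hev_zero_iff hderF (hw P hP.1)).1 hP.2
    · intro P hP
      rw [Finset.mem_filter, Finset.mem_filter] at hP
      refine ⟨fun h => hP.2 ?_, fun h => hP.2 ?_, fun h => hP.2 ?_, by rw [← hs, ← hH]; exact hF'H⟩
      · exact (h.mul_left _).mul_right _
      · exact h.mul_left _
      · exact (h.mul_right _).mul_right _

lemma pick_prime (r : ℕ) (ρ : ℝ) (hρ : 0 < ρ) : ∃ K : ℝ, 1 ≤ K ∧ ∀ (d : ℕ), 1 ≤ d → ∀ (F : MvPolynomial (Fin (r+1)) ℤ),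
    F.totalDegree ≤ d → Irreducible (map (Int.castRingHom ℚ) F) → coeff (Finsupp.single 0 d) F ≠ 0 →
    ∀ (α : Type) (S : Finset α) (x : α → Fin (r+1) → ℤ) (w : α → ℤ), (∀ P ∈ S, w P ≠ 0) → 
    (∀ P ∈ S, eval (fun j => (x P j : ℚ) / w P) (map (Int.castRingHom ℚ) F) = 0) →
    ∀ U : ℕ, 1 ≤ U → (∀ P ∈ S, ∀ j, |x P j| ≤ U) → (∀ P ∈ S, |w P| ≤ U) →
    ∀ Y : ℕ, K * ((U:ℝ) ^ ρ + (d:ℝ) ^ (r+3)) ≤ Y →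
    ∃ (S0 T : Finset α) (G : MvPolynomial (Fin (r+1)) ℚ) (p : ℕ) (F' : MvPolynomial (Fin (r+1)) ℤ),
      S0 ⊆ S ∧ T ⊆ S ∧ S.card ≤ S0.card + 2 * T.card ∧ G ≠ 0 ∧ G.totalDegree ≤ d ∧ ¬ map (Int.castRingHom ℚ) F ∣ G ∧
      (∀ P ∈ S0, eval (fun j => (x P j : ℚ) / w P) G = 0) ∧ p.Prime ∧ Y < p ∧ p ≤ 8 * Y ∧ F'.totalDegree ≤ d ∧
      (∃ c : ℚ, c ≠ 0 ∧ map (Int.castRingHom ℚ) F' = C c * map (Int.castRingHom ℚ) F) ∧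
      ∀ P ∈ T, ¬ (p:ℤ) ∣ w P ∧ ¬ (p:ℤ) ∣ hev (d-1) (pderiv 0 F') (x P) (w P) ∧ ¬ (p:ℤ) ∣ coeff (Finsupp.single 0 d) F' := by
  obtain ⟨K, hK, h⟩ := pick_prime' r ρ hρ
  refine ⟨K, hK, ?_⟩
  intro d hd F hF hi ht α S x w hw hS U hU hxU hwU Y hY
  obtain ⟨S0, T, G, p, F', h1, h2, h3, h4, h5, h6, h7, h8, h9, h10, h11, h12, h13⟩ := h d hd F hF hi ht α S x w hw hS U hU hxU hwU Y hY
  exact ⟨S0, T, G, p, F', h1, h2, h3, h4, h5, h6, h7, h8, h9, h10, h11, h12, fun P hP => ⟨(h13 P hP).1, (h13 P hP).2.1, (h13 P hP).2.2.1⟩⟩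

end

section
open MvPolynomial

lemma irr_C_mul {σ : Type*} {F F' : MvPolynomial σ ℚ} {c : ℚ} (hc : c ≠ 0) (h : F' = C c * F) (hF : Irreducible F) : Irreducible F' := by
  rw [h, irreducible_isUnit_mul]
  · exact hF
  · exact (isUnit_iff_ne_zero.2 hc).map C

lemma curve_main (J m : ℕ) (hJ : 0 < J) (hs : 2 ≤ J * (m+1)) (ρ : ℝ) (hρ0 : 0 < ρ)
    (hρ : ((m + J - 1 : ℕ) : ℝ) ≤ ρ * ((J * (m+1) - 1 : ℕ) : ℝ)) :
    ∃ C : ℝ, 1 ≤ C ∧ ∀ (d : ℕ), J ≤ d → ∀ (F : MvPolynomial (Fin 2) ℤ),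
    F.totalDegree ≤ d → Irreducible (map (Int.castRingHom ℚ) F) → coeff (Finsupp.single 0 d) F ≠ 0 →
    ∀ (α : Type) (S : Finset α) (x : α → Fin 2 → ℤ) (w : α → ℤ), (∀ P ∈ S, w P ≠ 0) → 
    (∀ P ∈ S, eval (fun j => (x P j : ℚ) / w P) (map (Int.castRingHom ℚ) F) = 0) →
    (∀ P ∈ S, ∀ P' ∈ S, (∀ j, (x P j : ℚ) / w P = x P' j / w P') → P = P') →
    ∀ A Aw : ℕ, 1 ≤ A → 1 ≤ Aw → (∀ P ∈ S, ∀ j, |x P j| ≤ A) → (∀ P ∈ S, |w P| ≤ Aw) →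
    (S.card : ℝ) ≤ C * d ^ 2 * (((A * Aw : ℕ) : ℝ) ^ ρ + (d:ℝ) ^ 4) := by
  classical
  obtain ⟨K, hK1, hK⟩ := pick_prime 1 ρ hρ0
  set s := J * (m+1) with hsd
  set L := m + J - 1 with hL
  refine ⟨1 + 32 * L * (K + s ^ 2), ?_, ?_⟩
  · have : (0:ℝ) ≤ 32 * L * (K + s ^ 2) := by positivity
    linarith
  intro d hd F hF hirr htop α S x w hw hS hinj A Aw hA1 hAw1 hA hAw
  have hd1 : 1 ≤ d := by omega
  have hdR : (1:ℝ) ≤ d := by exact_mod_cast hd1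
  obtain ⟨U, hU⟩ : ∃ U, U = A * Aw := ⟨_, rfl⟩
  have hU1 : 1 ≤ U := by rw [hU]; exact Nat.mul_pos hA1 hAw1
  have hUR : (1:ℝ) ≤ U := by exact_mod_cast hU1
  have hAU : A ≤ U := by rw [hU]; nlinarith
  have hAwU : Aw ≤ U := by rw [hU]; nlinarith
  rw [← hU]
  set V := (U:ℝ) ^ ρ + (d:ℝ) ^ 4 with hV
  have hUρ : 1 ≤ (U:ℝ) ^ ρ := Real.one_le_rpow hUR hρ0.le
  have hV1 : 1 ≤ V := by
    have h1 : 1 ≤ (d:ℝ) ^ 4 := one_le_pow₀ hdR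
    linarith
  have hVU : (U:ℝ) ^ ρ ≤ V := by
    have h1 : 0 ≤ (d:ℝ) ^ 4 := by positivity
    linarith
  set K' := K + (s:ℝ) ^ 2 with hK'
  have hK'1 : 1 ≤ K' := by have : (0:ℝ) ≤ (s:ℝ)^2 := by positivity
                           linarith
  obtain ⟨Y, hY⟩ : ∃ Y, Y = ⌈K' * V⌉₊ := ⟨_, rfl⟩
  have hY1 : K' * V ≤ Y := by rw [hY]; exact Nat.le_ceil _
  have hY2 : (Y:ℝ) ≤ 2 * K' * V := by
    have := (Nat.ceil_lt_add_one (show 0 ≤ K' * V by positivity)).le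
    rw [← hY] at this
    nlinarith
  obtain ⟨S0, T, G, p, F', hS0, hT, hcard, hG0, hGd, hGF, hG, hp, hpY, hpY2, hF'd, ⟨c, hc0, hc⟩, hTp⟩ :=
    hK d hd1 F hF hirr htop α S x w hw hS U hU1 (fun P hP j => (hA P hP j).trans (by exact_mod_cast hAU))
      (fun P hP => (hAw P hP).trans (by exact_mod_cast hAwU)) Y (by
        refine le_trans ?_ hY1
        gcongr
        have : (0:ℝ) ≤ (s:ℝ)^2 := by positivity
        linarith)
  have hpR : (p:ℝ) ≤ 16 * K' * V := by
    have : (p:ℝ) ≤ 8 * Y := by exact_mod_cast hpY2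
    linarith
  have hFd : (map (Int.castRingHom ℚ) F).totalDegree ≤ d := (totalDegree_map_le _ _).trans hF
  -- S0
  have h0 : S0.card ≤ d * d := by
    have hrp : IsRelPrime (map (Int.castRingHom ℚ) F) G := (hirr.dvd_or_isRelPrime (n := G)).resolve_left hGF
    have := bez2_points hirr.ne_zero hG0 hrp (S0.image fun P j => (x P j : ℚ) / w P) (by
      intro Q hQ
      obtain ⟨P, hP, rfl⟩ := Finset.mem_image.1 hQ
      exact ⟨hS P (hS0 hP), hG P hP⟩)
    rw [Finset.card_image_of_injOn] at this
    · exact this.trans (Nat.mul_le_mul hFd hGd)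
    · intro P hP P' hP' h
      exact hinj P (hS0 hP) P' (hS0 hP') (fun j => congrFun h j)
  have h1 : T.card ≤ d ^ 2 * L * p := by
    by_cases hTe : T = ∅
    · rw [hTe]; simp
    obtain ⟨P1, hP1⟩ := Finset.nonempty_iff_ne_empty.2 hTe
    refine curve_core T x w J m hJ p d hp hd F' hF'd (irr_C_mul hc0 hc hirr) (hTp P1 hP1).2.2 (fun P hP => (hTp P hP).1)
      (fun P hP => ?_) (fun P hP => (hTp P hP).2.1) (fun P hP P' hP' => hinj P (hT hP) P' (hT hP')) A Aw
      (fun P hP => hA P (hT hP)) (fun P hP => hAw P (hT hP)) ?_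
    · rw [hc, eval_mul, hS P (hT hP), mul_zero]
    · rw [← hU, ← hsd]
      have hp2 : (s:ℝ) ^ 2 * (U:ℝ) ^ ρ < p := by
        have h1 : (Y:ℝ) < p := by exact_mod_cast hpY
        refine lt_of_le_of_lt ?_ h1
        refine le_trans ?_ hY1
        have : (s:ℝ)^2 ≤ K' := by linarith
        gcongr
      have hsn : s - 1 ≠ 0 := by omega
      have h2 : ((s:ℝ) ^ 2 * (U:ℝ) ^ ρ) ^ (s-1) < (p:ℝ) ^ (s-1) := by gcongr
      have h3 : (s:ℝ) ^ 2 * (U:ℝ) ^ L ≤ ((s:ℝ) ^ 2 * (U:ℝ) ^ ρ) ^ (s-1) := by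
        rw [mul_pow]
        have hs1 : (1:ℝ) ≤ (s:ℝ)^2 := by
          have : (2:ℝ) ≤ s := by exact_mod_cast hs
          nlinarith
        have e1 : (s:ℝ)^2 ≤ ((s:ℝ)^2)^(s-1) := le_self_pow₀ hs1 hsn
        have e2 : (U:ℝ)^L ≤ ((U:ℝ)^ρ)^(s-1) := by
          rw [← Real.rpow_natCast, ← Real.rpow_natCast, ← Real.rpow_mul (by positivity)]
          exact Real.rpow_le_rpow_of_exponent_le hUR hρ
        gcongr
      exact_mod_cast lt_of_le_of_lt h3 h2
  have h2 : (S.card:ℝ) ≤ d * d + 2 * (d ^ 2 * L * p) := by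
    have : S.card ≤ d * d + 2 * (d ^ 2 * L * p) := by omega
    exact_mod_cast this
  have h3 : (d:ℝ) ^ 2 * L * p ≤ d ^ 2 * L * (16 * K' * V) := by gcongr
  have h4 : (d:ℝ)^2 * 1 ≤ d ^ 2 * V := by gcongr
  nlinarith

end

section
open MvPolynomial

lemma tdeg_aeval_le {σ τ R : Type*} [Fintype σ] [CommRing R] (g : σ → MvPolynomial τ R) (hg : ∀ i, (g i).totalDegree ≤ 1)
    (f : MvPolynomial σ R) : (aeval g f).totalDegree ≤ f.totalDegree := by
  rw [aeval_def, eval₂_eq']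
  refine totalDegree_finsetSum_le fun m hm => ?_
  have hm' := le_totalDegree hm
  refine (totalDegree_mul _ _).trans ?_
  have h1 : (algebraMap R (MvPolynomial τ R) (coeff m f)).totalDegree = 0 := by
    rw [algebraMap_eq, totalDegree_C]
  rw [h1, zero_add]
  refine (totalDegree_finsetProd _ _).trans ?_
  refine le_trans (Finset.sum_le_sum fun i _ => (totalDegree_pow _ _).trans (Nat.mul_le_mul_left _ (hg i))) ?_
  simp only [mul_one]
  refine le_trans (le_of_eq ?_) hm'
  rw [Finsupp.sum_fintype _ _ (fun _ => rfl)]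

/-- `hom` scaling -/
lemma eval_hom_smul {σ R : Type*} [Fintype σ] [CommRing R] {f : MvPolynomial σ R} {d : ℕ} (hf : f.IsHomogeneous d) (t : R) (x : σ → R) :
    eval (fun i => t * x i) f = t ^ d * eval x f := by
  rw [eval_eq', eval_eq', Finset.mul_sum]
  refine Finset.sum_congr rfl fun m hm => ?_
  have h1 : m.degree = d := by
    have h1 := hf (mem_support_iff.1 hm)
    rwa [Finsupp.degree_eq_weight_one]
  simp only [mul_pow, Finset.prod_mul_distrib]
  rw [Finset.prod_pow_eq_pow_sum]
  have : ∑ i, m i = d := by rw [← h1]; exact (Finsupp.degree_eq_sum m).symm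
  rw [this]; ring

lemma eval_hom_e0 {r : ℕ} {R : Type*} [CommRing R] {f : MvPolynomial (Fin (r+1)) R} {d : ℕ} (hf : f.IsHomogeneous d) :
    eval (Fin.cons 1 0 : Fin (r+1) → R) f = coeff (Finsupp.single 0 d) f := by
  rw [eval_eq']
  rw [Finset.sum_eq_single (Finsupp.single 0 d)]
  · rw [Fin.prod_univ_succ]
    simp
  · intro m hm hne
    have h1 : m.degree = d := by
      have h1 := hf (mem_support_iff.1 hm)
      rwa [Finsupp.degree_eq_weight_one]
    rw [Finsupp.degree_eq_sum, Fin.sum_univ_succ] at h1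
    rw [Fin.prod_univ_succ]
    simp only [Fin.cons_zero, one_pow, one_mul, Fin.cons_succ, Pi.zero_apply]
    by_cases h : ∃ i : Fin r, m i.succ ≠ 0
    · obtain ⟨i, hi⟩ := h
      rw [Finset.prod_eq_zero (Finset.mem_univ i) (zero_pow hi), mul_zero]
    · push Not at h
      exfalso; apply hne
      ext j
      refine Fin.cases ?_ (fun i => ?_) j
      · simp only [Finsupp.single_eq_same]; simpa [h] using h1
      · rw [h i]; simp [Finsupp.single_apply, (Fin.succ_ne_zero i).symm]
  · intro h
    rw [notMem_support_iff.1 h, zero_mul]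

noncomputable def shear {r : ℕ} {R : Type*} [CommRing R] (a : Fin r → R) : MvPolynomial (Fin (r+1)) R →ₐ[R] MvPolynomial (Fin (r+1)) R :=
  aeval (Fin.cons (X 0) (fun i => X i.succ + C (a i) * X 0) : Fin (r+1) → MvPolynomial (Fin (r+1)) R)

def shearPt {r : ℕ} {R : Type*} [CommRing R] (a : Fin r → R) (y : Fin (r+1) → R) : Fin (r+1) → R :=
  Fin.cons (y 0) (fun i => y i.succ + a i * y 0)

section
variable {r : ℕ} {R : Type*} [CommRing R] (a : Fin r → R)

lemma eval_shear (y : Fin (r+1) → R) (F : MvPolynomial (Fin (r+1)) R) : eval y (shear a F) = eval (shearPt a y) F := by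
  have : (eval y).comp (shear a : _ →ₐ[R] _).toRingHom = eval (shearPt a y) := by
    refine MvPolynomial.ringHom_ext (fun c => by simp [shear]) (fun i => ?_)
    refine Fin.cases ?_ (fun i => ?_) i
    · simp [shear, shearPt]
    · simp [shear, shearPt]
  exact congrArg (fun φ => φ F) this

lemma shear_comp (F : MvPolynomial (Fin (r+1)) R) : shear (fun i => -a i) (shear a F) = F := by
  have : (shear (fun i => -a i)).comp (shear a) = AlgHom.id R _ := by
    refine MvPolynomial.algHom_ext fun i => ?_
    refine Fin.cases ?_ (fun i => ?_) i
    · simp [shear]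
    · simp [shear]
  exact congrArg (fun φ => φ F) this

noncomputable def shearEquiv : MvPolynomial (Fin (r+1)) R ≃ MvPolynomial (Fin (r+1)) R where
  toFun := shear a
  invFun := shear (fun i => -a i)
  left_inv := shear_comp a
  right_inv := fun F => by simpa using shear_comp (fun i => -a i) F

noncomputable def shearMul : MvPolynomial (Fin (r+1)) R ≃* MvPolynomial (Fin (r+1)) R :=
  { shearEquiv a with map_mul' := fun x y => map_mul (shear a) x y }

lemma shear_irred (F : MvPolynomial (Fin (r+1)) R) : Irreducible (shear a F) ↔ Irreducible F :=
  MulEquiv.irreducible_iff (shearMul a)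

lemma shear_gen_hom (i : Fin (r+1)) : ((Fin.cons (X 0) (fun i => X i.succ + C (a i) * X 0) : Fin (r+1) → MvPolynomial (Fin (r+1)) R) i).IsHomogeneous 1 := by
  refine Fin.cases ?_ (fun i => ?_) i
  · exact isHomogeneous_X R 0
  · refine (isHomogeneous_X R _).add ?_
    simpa using (isHomogeneous_C (Fin (r+1)) (a i)).mul (isHomogeneous_X R 0)

lemma shear_hom {F : MvPolynomial (Fin (r+1)) R} {d : ℕ} (h : F.IsHomogeneous d) : (shear a F).IsHomogeneous d := by
  have := h.aeval _ (shear_gen_hom a)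
  rwa [one_mul] at this

lemma shear_tdeg (F : MvPolynomial (Fin (r+1)) R) : (shear a F).totalDegree ≤ F.totalDegree :=
  tdeg_aeval_le _ (fun i => (shear_gen_hom a i).totalDegree_le) F

lemma shear_homComp (F : MvPolynomial (Fin (r+1)) R) (d : ℕ) : homogeneousComponent d (shear a F) = shear a (homogeneousComponent d F) := by
  conv_lhs => rw [← sum_homogeneousComponent F]
  rw [map_sum, map_sum]
  by_cases hd : d ≤ F.totalDegree
  · rw [Finset.sum_eq_single d]
    · exact homogeneousComponent_of_mem (shear_hom a (homogeneousComponent_isHomogeneous d F)) |>.trans (by simp)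
    · intro b _ hb
      exact (homogeneousComponent_of_mem (shear_hom a (homogeneousComponent_isHomogeneous b F))).trans (by simp [hb.symm, hb])
    · intro h; simp at h; omega
  · rw [homogeneousComponent_eq_zero _ _ (by omega), map_zero]
    refine Finset.sum_eq_zero fun b hb => ?_
    have : b ≠ d := by simp at hb; omega
    exact (homogeneousComponent_of_mem (shear_hom a (homogeneousComponent_isHomogeneous b F))).trans (by simp [this, this.symm])

lemma coeff_single_homComp (F : MvPolynomial (Fin (r+1)) R) (d : ℕ) :
    coeff (Finsupp.single 0 d) (homogeneousComponent d F) = coeff (Finsupp.single 0 d) F := by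
  rw [coeff_homogeneousComponent]; simp

lemma shear_top (F : MvPolynomial (Fin (r+1)) R) (d : ℕ) : coeff (Finsupp.single 0 d) (shear a F) = eval (Fin.cons 1 a : Fin (r+1) → R) (homogeneousComponent d F) := by
  rw [← coeff_single_homComp, shear_homComp, ← eval_hom_e0 (shear_hom a (homogeneousComponent_isHomogeneous d F)), eval_shear]
  congr 2
  funext j
  refine Fin.cases ?_ (fun i => ?_) j <;> simp [shearPt]

lemma shear_map {R' : Type*} [CommRing R'] (φ : R →+* R') (F : MvPolynomial (Fin (r+1)) R) : map φ (shear a F) = shear (fun i => φ (a i)) (map φ F) := by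
  have : (map φ).comp (shear a : _ →ₐ[R] _).toRingHom = (shear (fun i => φ (a i)) : _ →ₐ[R'] _).toRingHom.comp (map φ) := by
    refine MvPolynomial.ringHom_ext (fun c => by simp [shear]) (fun i => ?_)
    refine Fin.cases ?_ (fun i => ?_) i
    · simp [shear]
    · simp [shear]
  exact congrArg (fun ψ => ψ F) this

end

lemma exists_shear {r : ℕ} {g : MvPolynomial (Fin (r+1)) ℤ} {d : ℕ} (hg : g.IsHomogeneous d) (h0 : g ≠ 0) :
    ∃ a : Fin r → ℤ, (∀ i, 0 ≤ a i ∧ a i ≤ d) ∧ eval (Fin.cons 1 a : Fin (r+1) → ℤ) g ≠ 0 := by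
  classical
  by_contra hcon
  push Not at hcon
  let gg : Fin (r+1) → MvPolynomial (Fin r) ℤ := Fin.cons 1 X
  have hgg : ∀ i, (gg i).totalDegree ≤ 1 := by
    intro i
    refine Fin.cases ?_ (fun i => ?_) i
    · simp [gg]
    · simp [gg]
  have hev : ∀ y : Fin r → ℤ, eval y (aeval gg g) = eval (Fin.cons 1 y : Fin (r+1) → ℤ) g := by
    intro y
    have : (eval y).comp (aeval gg : _ →ₐ[ℤ] _).toRingHom = eval (Fin.cons 1 y : Fin (r+1) → ℤ) := by
      refine MvPolynomial.ringHom_ext (fun c => by simp) (fun i => ?_)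
      refine Fin.cases ?_ (fun i => ?_) i
      · simp [gg]
      · simp [gg]
    exact congrArg (fun φ => φ g) this
  have hz : aeval gg g = 0 := by
    refine eq_zero_of_eval_zero_at_prod_finset _ (fun _ => Finset.Icc 0 (d:ℤ)) (fun i => ?_) (fun x hx => ?_)
    · have h1 := degreeOf_le_totalDegree (aeval gg g) i
      have h2 := tdeg_aeval_le gg hgg g
      have h3 := hg.totalDegree_le
      rw [Int.card_Icc]; omega
    · rw [hev]
      exact hcon x (fun i => by simpa using hx i)
  have hQ : X 0 * map (Int.castRingHom ℚ) g = 0 := by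
    refine MvPolynomial.funext fun x => ?_
    rw [eval_mul, eval_X, map_zero]
    by_cases hx : x 0 = 0
    · rw [hx, zero_mul]
    · have h1 : x = fun i => x 0 * (Fin.cons 1 (fun i => x i.succ / x 0) : Fin (r+1) → ℚ) i := by
        funext i
        refine Fin.cases ?_ (fun i => ?_) i
        · simp
        · simp; field_simp
      have h2 : eval (Fin.cons 1 (fun i => x i.succ / x 0) : Fin (r+1) → ℚ) (map (Int.castRingHom ℚ) g) = 0 := by
        have : (eval (fun i => x i.succ / x 0)).comp ((map (Int.castRingHom ℚ)).comp (aeval gg : _ →ₐ[ℤ] _).toRingHom) =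
          (eval (Fin.cons 1 (fun i => x i.succ / x 0) : Fin (r+1) → ℚ)).comp (map (Int.castRingHom ℚ)) := by
          refine MvPolynomial.ringHom_ext (fun c => by simp) (fun i => ?_)
          refine Fin.cases ?_ (fun i => ?_) i
          · simp [gg]
          · simp [gg]
        have h3 := congrArg (fun φ => φ g) this
        simp only [RingHom.comp_apply] at h3
        rw [← h3]
        show eval _ (map _ (aeval gg g)) = 0
        rw [hz]; simp
      have h3 := eval_hom_smul (hg.map (Int.castRingHom ℚ)) (x 0) (Fin.cons 1 (fun i => x i.succ / x 0) : Fin (r+1) → ℚ)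
      rw [← h1, h2] at h3
      rw [h3]; simp
  have hinj : Function.Injective (map (σ := Fin (r+1)) (Int.castRingHom ℚ)) := map_injective _ Int.cast_injective
  rcases mul_eq_zero.1 hQ with h | h
  · exact X_ne_zero _ h
  · exact h0 (hinj (by rw [h, map_zero]))

lemma clear_denoms {σ : Type*} (R : MvPolynomial σ ℚ) : ∃ (c : ℚ) (F : MvPolynomial σ ℤ), c ≠ 0 ∧ map (Int.castRingHom ℚ) F = C c * R := by
  classical
  obtain ⟨b, hb⟩ := IsLocalization.exist_integer_multiples (nonZeroDivisors ℤ) R.support (fun m => coeff m R)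
  choose! z hz using hb
  refine ⟨((b:ℤ):ℚ), ∑ m ∈ R.support, monomial m (z m), ?_, ?_⟩
  · have := nonZeroDivisors.ne_zero b.2
    exact_mod_cast this
  · rw [map_sum]
    conv_rhs => rw [R.as_sum, Finset.mul_sum]
    refine Finset.sum_congr rfl fun m hm => ?_
    rw [map_monomial, C_mul_monomial]
    have := hz m hm
    simp at this
    congr 1

end

section
open MvPolynomial

lemma homComp_top_ne {σ R : Type*} [CommRing R] (F : MvPolynomial σ R) (h : F ≠ 0) : homogeneousComponent F.totalDegree F ≠ 0 := by
  classical
  obtain ⟨m, hm, hmd⟩ := Finset.exists_mem_eq_sup F.support (support_nonempty.2 h) (fun m => m.sum fun _ e => e)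
  intro h0
  have h1 : coeff m (homogeneousComponent F.totalDegree F) = coeff m F := by
    rw [coeff_homogeneousComponent, if_pos]
    exact hmd.symm
  rw [h0, coeff_zero] at h1
  exact mem_support_iff.1 hm h1.symm

lemma tdeg_map_inj {σ : Type*} (F : MvPolynomial σ ℤ) : (map (Int.castRingHom ℚ) F).totalDegree = F.totalDegree := by
  unfold totalDegree
  rw [support_map_of_injective _ Int.cast_injective]

lemma tdeg_C_mul {σ : Type*} {c : ℚ} (hc : c ≠ 0) (F : MvPolynomial σ ℚ) : (C c * F).totalDegree = F.totalDegree := by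
  by_cases hF : F = 0
  · simp [hF]
  rw [totalDegree_mul_of_isDomain (by simpa using hc) hF, totalDegree_C, zero_add]

lemma eval_cast {σ : Type*} (y : σ → ℤ) (G : MvPolynomial σ ℤ) :
    eval (fun j => (y j:ℚ)) (map (Int.castRingHom ℚ) G) = ((eval y G : ℤ) : ℚ) := by
  rw [eval_map]
  exact (eval₂_comp (Int.castRingHom ℚ) y G).symm

lemma shearPt_neg {r : ℕ} {R : Type*} [CommRing R] (a : Fin r → R) (x : Fin (r+1) → R) : shearPt a (shearPt (fun i => -a i) x) = x := by
  funext j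
  refine Fin.cases ?_ (fun i => ?_) j
  · simp [shearPt]
  · simp [shearPt]

lemma shearPt_bd {r δ : ℕ} (hδ : 1 ≤ δ) (a : Fin r → ℤ) (ha : ∀ i, 0 ≤ a i ∧ a i ≤ δ) (x : Fin (r+1) → ℤ) (B : ℕ) (h1 : ∀ j, |x j| ≤ B) (j : Fin (r+1)) :
    |shearPt (fun i => -a i) x j| ≤ ((2 * δ * B : ℕ) : ℤ) := by
  push_cast
  have hδ1 : (1:ℤ) ≤ δ := by omega
  refine Fin.cases ?_ (fun i => ?_) j
  · simp only [shearPt, Fin.cons_zero]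
    have := h1 0
    nlinarith
  · simp only [shearPt, Fin.cons_succ]
    have h2 := h1 i.succ
    have h3 : |-a i * x 0| ≤ δ * B := by
      rw [abs_mul, abs_neg, abs_of_nonneg (ha i).1]
      exact mul_le_mul (ha i).2 (h1 0) (abs_nonneg _) (by positivity)
    have := abs_add_le (x i.succ) (-a i * x 0)
    nlinarith

lemma curve_aff : ∃ K : ℝ, 1 ≤ K ∧ ∀ (δ : ℕ) (R : MvPolynomial (Fin 2) ℚ), Irreducible R → 2 ≤ R.totalDegree → R.totalDegree ≤ δ →
    ∀ (B : ℕ), 1 ≤ B → ∀ S : Finset (Fin 2 → ℤ), (∀ x ∈ S, ∀ j, |x j| ≤ B) → (∀ x ∈ S, eval (fun j => (x j : ℚ)) R = 0) →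
    (S.card : ℝ) ≤ K * (δ:ℝ) ^ 3 * ((B:ℝ) ^ (0.513:ℝ) + (δ:ℝ) ^ 4) := by
  classical
  obtain ⟨K, hK1, hK⟩ := curve_main 2 20 (by norm_num) (by norm_num) 0.513 (by norm_num) (by norm_num)
  refine ⟨2 * K, by linarith, ?_⟩
  intro δ' R hR hR2 hRδ B hB S hSB hS
  obtain ⟨c, F, hc, hF⟩ := clear_denoms R
  obtain ⟨δ, hδ⟩ : ∃ δ, δ = R.totalDegree := ⟨_, rfl⟩
  have hFδ : F.totalDegree = δ := by rw [← tdeg_map_inj, hF, tdeg_C_mul hc, hδ]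
  have hF0 : F ≠ 0 := by rintro rfl; simp at hFδ; omega
  obtain ⟨a, ha, hatop⟩ := exists_shear (homogeneousComponent_isHomogeneous δ F) (by rw [← hFδ]; exact homComp_top_ne F hF0)
  have hbd : ∀ x ∈ S, ∀ j, |shearPt (fun i => -a i) x j| ≤ ((2 * δ * B : ℕ) : ℤ) := fun x hx =>
    shearPt_bd (by omega) a ha x B (hSB x hx)
  have hsp : ∀ x : Fin 2 → ℤ, shearPt a (shearPt (fun i => -a i) x) = x := shearPt_neg a
  have hev : ∀ x ∈ S, eval (fun j => ((shearPt (fun i => -a i) x j : ℤ) : ℚ) / ((1:ℤ):ℚ)) (map (Int.castRingHom ℚ) (shear a F)) = 0 := by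
    intro x hx
    have h1 := hS x hx
    have h2 : eval (fun j => (x j : ℚ)) (map (Int.castRingHom ℚ) F) = 0 := by rw [hF, eval_mul, h1, mul_zero]
    rw [eval_cast] at h2
    simp only [Int.cast_one, div_one]
    rw [eval_cast, eval_shear, hsp]
    exact_mod_cast h2
  have h := hK δ (by omega) (shear a F) ((shear_tdeg a F).trans hFδ.le) (by
      rw [shear_map, shear_irred]; exact irr_C_mul hc hF hR) (by rw [shear_top]; exact hatop)
    (Fin 2 → ℤ) S (fun x => shearPt (fun i => -a i) x) (fun _ => 1) (by simp) hev (by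
      intro P _ P' _ h
      rw [← hsp P, ← hsp P']
      congr 1
      funext j
      have := h j
      simp at this
      exact_mod_cast this) (2 * δ * B) 1 (by have : 0 < δ * B := Nat.mul_pos (by omega) hB
                                             nlinarith) le_rfl hbd (by simp)
  refine h.trans ?_
  have hδ1 : (1:ℝ) ≤ δ := by exact_mod_cast (by omega : 1 ≤ δ)
  have hδ2 : (δ:ℝ) ≤ δ' := by exact_mod_cast (by omega : δ ≤ δ')
  have h1 : ((2 * δ * B * 1 : ℕ) : ℝ) ^ (0.513:ℝ) ≤ 2 * δ * (B:ℝ) ^ (0.513:ℝ) := by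
    push_cast
    rw [mul_one, Real.mul_rpow (by positivity) (by positivity)]
    gcongr
    calc (2 * (δ:ℝ)) ^ (0.513:ℝ) ≤ (2 * (δ:ℝ)) ^ (1:ℝ) := Real.rpow_le_rpow_of_exponent_le (by linarith) (by norm_num)
      _ = _ := by simp
  have hB0 : 0 ≤ (B:ℝ) ^ (0.513:ℝ) := by positivity
  calc K * (δ:ℝ) ^ 2 * (((2 * δ * B * 1 : ℕ) : ℝ) ^ (0.513:ℝ) + (δ:ℝ)^4) 
      ≤ K * (δ:ℝ) ^ 2 * (2 * δ * (B:ℝ) ^ (0.513:ℝ) + 2 * δ * (δ:ℝ)^4) := by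
        gcongr
        have : 0 ≤ (δ:ℝ)^4 := by positivity
        nlinarith
    _ = 2 * K * (δ:ℝ)^3 * ((B:ℝ) ^ (0.513:ℝ) + (δ:ℝ)^4) := by ring
    _ ≤ _ := by gcongr

end

section
open MvPolynomial

noncomputable def linSub {n : ℕ} {K : Type*} [CommRing K] (M : Matrix (Fin n) (Fin n) K) : MvPolynomial (Fin n) K →ₐ[K] MvPolynomial (Fin n) K :=
  aeval (fun j => ∑ k, C (M j k) * X k)

section
variable {n : ℕ} {K : Type*} [CommRing K] (M N : Matrix (Fin n) (Fin n) K)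

lemma eval_linSub (y : Fin n → K) (F : MvPolynomial (Fin n) K) : eval y (linSub M F) = eval (M.mulVec y) F := by
  have : (eval y).comp (linSub M : _ →ₐ[K] _).toRingHom = eval (M.mulVec y) := by
    refine MvPolynomial.ringHom_ext (fun c => by simp [linSub]) (fun i => ?_)
    simp [linSub, Matrix.mulVec, dotProduct]
  exact congrArg (fun φ => φ F) this

lemma linSub_comp (h : M * N = 1) (F : MvPolynomial (Fin n) K) : linSub N (linSub M F) = F := by
  have : (linSub N).comp (linSub M) = AlgHom.id K _ := by
    refine MvPolynomial.algHom_ext fun i => ?_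
    have h1 : ∀ l, ∑ k, M i k * N k l = if i = l then 1 else 0 := by
      intro l
      rw [← Matrix.mul_apply, h, Matrix.one_apply]
    have h2 : linSub N (linSub M (X i)) = ∑ l, C (∑ k, M i k * N k l) * X l := by
      simp only [linSub, aeval_X, map_sum, map_mul, algHom_C, algebraMap_eq, Finset.mul_sum, Finset.sum_mul]
      rw [Finset.sum_comm]
      simp only [mul_assoc]
    rw [AlgHom.comp_apply, h2]
    simp [h1]
  exact congrArg (fun φ => φ F) this

noncomputable def linSubMul (h : M * N = 1) (h' : N * M = 1) : MvPolynomial (Fin n) K ≃* MvPolynomial (Fin n) K where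
  toFun := linSub M
  invFun := linSub N
  left_inv := linSub_comp M N h
  right_inv := linSub_comp N M h'
  map_mul' := fun x y => map_mul (linSub M) x y

lemma linSub_irred (h : M * N = 1) (F : MvPolynomial (Fin n) K) : Irreducible (linSub M F) ↔ Irreducible F :=
  MulEquiv.irreducible_iff (linSubMul M N h (mul_eq_one_comm.1 h))

lemma linSub_gen_hom (j : Fin n) : (∑ k, C (M j k) * X k : MvPolynomial (Fin n) K).IsHomogeneous 1 := by
  refine IsHomogeneous.sum _ _ _ fun k _ => ?_
  simpa using (isHomogeneous_C (Fin n) (M j k)).mul (isHomogeneous_X K k)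

lemma linSub_hom {F : MvPolynomial (Fin n) K} {d : ℕ} (h : F.IsHomogeneous d) : (linSub M F).IsHomogeneous d := by
  have := h.aeval _ (linSub_gen_hom M)
  rwa [one_mul] at this

lemma linSub_tdeg (F : MvPolynomial (Fin n) K) : (linSub M F).totalDegree ≤ F.totalDegree :=
  tdeg_aeval_le _ (fun i => (linSub_gen_hom M i).totalDegree_le) F

lemma linSub_map {R' : Type*} [CommRing R'] (φ : K →+* R') (F : MvPolynomial (Fin n) K) : map φ (linSub M F) = linSub (M.map φ) (map φ F) := by
  have : (map φ).comp (linSub M : _ →ₐ[K] _).toRingHom = (linSub (M.map φ) : _ →ₐ[R'] _).toRingHom.comp (map φ) := by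
    refine MvPolynomial.ringHom_ext (fun c => by simp [linSub]) (fun i => ?_)
    simp [linSub]
  exact congrArg (fun ψ => ψ F) this

lemma linSub_homComp (F : MvPolynomial (Fin n) K) (d : ℕ) : homogeneousComponent d (linSub M F) = linSub M (homogeneousComponent d F) := by
  conv_lhs => rw [← sum_homogeneousComponent F]
  rw [map_sum, map_sum]
  by_cases hd : d ≤ F.totalDegree
  · rw [Finset.sum_eq_single d]
    · exact homogeneousComponent_of_mem (linSub_hom M (homogeneousComponent_isHomogeneous d F)) |>.trans (by simp)
    · intro b _ hb
      exact (homogeneousComponent_of_mem (linSub_hom M (homogeneousComponent_isHomogeneous b F))).trans (by simp [hb.symm, hb])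
    · intro h; simp at h; omega
  · rw [homogeneousComponent_eq_zero _ _ (by omega), map_zero]
    refine Finset.sum_eq_zero fun b hb => ?_
    have : b ≠ d := by simp at hb; omega
    exact (homogeneousComponent_of_mem (linSub_hom M (homogeneousComponent_isHomogeneous b F))).trans (by simp [this, this.symm])
end

/-- matrix with prescribed first column -/
lemma exists_matrix {n : ℕ} {K : Type*} [Field K] (v : Fin (n+1) → K) (hv : v ≠ 0) :
    ∃ M N : Matrix (Fin (n+1)) (Fin (n+1)) K, M * N = 1 ∧ N * M = 1 ∧ ∀ j, M j 0 = v j := by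
  obtain ⟨i, hi⟩ : ∃ i, v i ≠ 0 := by by_contra! h; exact hv (funext h)
  let M1 : Matrix (Fin (n+1)) (Fin (n+1)) K := (1 : Matrix _ _ K).updateCol i v
  have h1 : M1.det = v i := by
    simp only [M1]
    rw [← Matrix.cramer_apply, Matrix.cramer_one]; rfl
  let M : Matrix (Fin (n+1)) (Fin (n+1)) K := M1.submatrix id (Equiv.swap 0 i)
  have h2 : IsUnit M.det := by
    simp only [M]
    rw [Matrix.det_permute', h1]
    refine IsUnit.mul ?_ (isUnit_iff_ne_zero.2 hi)
    exact ((Units.isUnit (Equiv.Perm.sign (Equiv.swap 0 i))).map (Int.castRingHom K))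
  refine ⟨M, M⁻¹, Matrix.mul_nonsing_inv _ h2, Matrix.nonsing_inv_mul _ h2, fun j => ?_⟩
  simp [M, M1]

lemma homComp_mul {σ R : Type*} [CommRing R] {a b : MvPolynomial σ R} {i j : ℕ}
    (ha : a.totalDegree ≤ i) (hb : b.totalDegree ≤ j) :
    homogeneousComponent (i+j) (a*b) = homogeneousComponent i a * homogeneousComponent j b := by
  classical
  have key : ∀ (k : ℕ) (p : MvPolynomial σ R), p.totalDegree ≤ k → ∀ m, coeff m p ≠ 0 → m.degree ≤ k := by
    intro k p hp m hm
    exact (le_totalDegree (mem_support_iff.2 hm)).trans hp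
  ext m
  rw [coeff_homogeneousComponent, coeff_mul, coeff_mul]
  split_ifs with hm
  · refine Finset.sum_congr rfl fun q hq => ?_
    rw [Finset.HasAntidiagonal.mem_antidiagonal] at hq
    have hd : q.1.degree + q.2.degree = i + j := by rw [← hm, ← hq, map_add]
    rw [coeff_homogeneousComponent, coeff_homogeneousComponent]
    by_cases h1 : coeff q.1 a = 0
    · simp [h1]
    by_cases h2 : coeff q.2 b = 0
    · simp [h2]
    have e1 := key i a ha _ h1
    have e2 := key j b hb _ h2
    rw [if_pos (by omega), if_pos (by omega)]
  · symm
    refine Finset.sum_eq_zero fun q hq => ?_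
    rw [Finset.HasAntidiagonal.mem_antidiagonal] at hq
    have hd : q.1.degree + q.2.degree = m.degree := by rw [← hq, map_add]
    rw [coeff_homogeneousComponent, coeff_homogeneousComponent]
    split_ifs with h1 h2
    · omega
    all_goals simp

/-- irreducibility descends along field extension -/
lemma irred_of_map {r : ℕ} {k K : Type*} [Field k] [Field K] (φ : k →+* K) {F : MvPolynomial (Fin r) k} (h : Irreducible (map φ F)) : Irreducible F := by
  have key : ∀ a : MvPolynomial (Fin r) k, IsUnit (map φ a) → IsUnit a := by
    intro a ha
    have h0 : a ≠ 0 := by rintro rfl; simp at ha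
    rw [isUnit_iff_totalDegree_of_isReduced] at ha
    refine isUnit_of_tdeg_zero h0 ?_
    have := ha.2
    unfold totalDegree at this ⊢
    rwa [support_map_of_injective _ φ.injective] at this
  refine ⟨fun hu => h.not_isUnit (hu.map _), fun a b hab => ?_⟩
  rw [hab, map_mul] at h
  exact (h.isUnit_or_isUnit rfl).imp (key a) (key b)

lemma irred_of_top {r : ℕ} {k : Type*} [Field k] {F : MvPolynomial (Fin r) k} {d : ℕ} (hd : F.totalDegree = d)
    (h : Irreducible (homogeneousComponent d F)) : Irreducible F := by
  have hd1 : 1 ≤ d := by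
    by_contra h0
    have h0 : d = 0 := by omega
    subst h0
    rw [homogeneousComponent_zero] at h
    refine h.not_isUnit (isUnit_of_tdeg_zero h.ne_zero (totalDegree_C _))
  have hF0 : F ≠ 0 := by rintro rfl; simp at h
  refine ⟨fun hu => ?_, fun a b hab => ?_⟩
  · rw [isUnit_iff_totalDegree_of_isReduced] at hu; omega
  · have ha0 : a ≠ 0 := by rintro rfl; simp at hab; exact hF0 hab
    have hb0 : b ≠ 0 := by rintro rfl; simp at hab; exact hF0 hab
    have hdeg : d = a.totalDegree + b.totalDegree := by
      rw [← hd, hab, totalDegree_mul_of_isDomain ha0 hb0]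
    rw [hab, hdeg, homComp_mul le_rfl le_rfl] at h
    have key : ∀ a : MvPolynomial (Fin r) k, a ≠ 0 → IsUnit (homogeneousComponent a.totalDegree a) → IsUnit a := by
      intro a ha0 hu
      refine isUnit_of_tdeg_zero ha0 ?_
      have h1 := (isUnit_iff_totalDegree_of_isReduced.1 hu).2
      rw [(homogeneousComponent_isHomogeneous _ a).totalDegree (homComp_top_ne a ha0)] at h1
      exact h1
    exact (h.isUnit_or_isUnit rfl).imp (key a ha0) (key b hb0)

/-- binary forms are reducible over algebraically closed fields -/
lemma binary_red {K : Type*} [Field K] [IsAlgClosed K] {h : MvPolynomial (Fin 2) K} {d : ℕ} (hd : 2 ≤ d) (hh : h.IsHomogeneous d) : ¬ Irreducible h := by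
  intro hirr
  have h0 := hirr.ne_zero
  -- a zero
  have hz : ∃ v : Fin 2 → K, v ≠ 0 ∧ eval v h = 0 := by
    by_cases hc : coeff (Finsupp.single 0 d) h = 0
    · refine ⟨Fin.cons 1 0, fun h => ?_, ?_⟩
      · have := congrFun h 0; simp at this
      · rw [eval_hom_e0 hh, hc]
    · have h1 : (spec0 (fun _ : Fin 1 => (1:K)) h).coeff d ≠ 0 := by rw [spec0_coeff _ hh.totalDegree_le]; exact hc
      have h2 : d ≤ (spec0 (fun _ : Fin 1 => (1:K)) h).natDegree := Polynomial.le_natDegree_of_ne_zero h1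
      obtain ⟨z, hz⟩ := IsAlgClosed.exists_root (spec0 (fun _ : Fin 1 => (1:K)) h) (by
        intro h3
        have h4 : (spec0 (fun _ : Fin 1 => (1:K)) h).natDegree = 0 := Polynomial.natDegree_eq_of_degree_eq_some h3
        omega)
      refine ⟨Fin.cons z (fun _ => 1), fun h => ?_, ?_⟩
      · have := congrFun h 1; simp at this
      · rw [← eval_spec0]; exact hz
  obtain ⟨v, hv0, hv⟩ := hz
  obtain ⟨M, N, hMN, hNM, hM⟩ := exists_matrix v hv0
  have hirr' := (linSub_irred M N hMN h).2 hirr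
  have hhom := linSub_hom M hh
  have hcf : coeff (Finsupp.single 0 d) (linSub M h) = 0 := by
    rw [← eval_hom_e0 hhom, eval_linSub]
    rw [← hv]
    congr 2
    funext j
    simp [Matrix.mulVec, dotProduct, Fin.sum_univ_succ, hM]
  have hdvd : (X 1 : MvPolynomial (Fin 2) K) ∣ linSub M h := by
    rw [X_dvd_iff_modMonomial_eq_zero]
    ext m
    rw [coeff_zero]
    by_cases hm : Finsupp.single 1 1 ≤ m
    · exact coeff_modMonomial_of_le _ hm
    · rw [coeff_modMonomial_of_not_le _ hm]
      by_contra hne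
      have h1 := hhom hne
      have h1 : m.degree = d := by rwa [Finsupp.degree_eq_weight_one]
      have h2 : m 1 = 0 := by
        by_contra h3
        apply hm
        rw [Finsupp.single_le_iff]; omega
      rw [Finsupp.degree_eq_sum, Fin.sum_univ_two, h2] at h1
      have : m = Finsupp.single 0 d := by
        ext j; fin_cases j
        · simpa using h1
        · simpa using h2
      rw [this] at hne
      exact hne hcf
  obtain ⟨q, hq⟩ := hdvd
  have hdeg := hhom.totalDegree hirr'.ne_zero
  have hq0 : q ≠ 0 := by rintro rfl; rw [mul_zero] at hq; exact hirr'.ne_zero hq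
  have hX0 : (X 1 : MvPolynomial (Fin 2) K) ≠ 0 := X_ne_zero _
  rw [hq, totalDegree_mul_of_isDomain hX0 hq0, totalDegree_X] at hdeg
  rcases hirr'.isUnit_or_isUnit hq with hu | hu
  · rw [isUnit_iff_totalDegree_of_isReduced, totalDegree_X] at hu; simp at hu
  · rw [isUnit_iff_totalDegree_of_isReduced] at hu; omega

end

section
open MvPolynomial

lemma factor_count {r : ℕ} {α : Type*} (S : Finset α) (e : α → Fin r → ℚ) (M : ℝ) (hM : 0 ≤ M) (G : MvPolynomial (Fin r) ℚ) (hG : G ≠ 0)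
    (h : ∀ R, Irreducible R → R ∣ G → ((S.filter fun P => eval (e P) R = 0).card : ℝ) ≤ M * R.totalDegree) :
    ((S.filter fun P => eval (e P) G = 0).card : ℝ) ≤ M * G.totalDegree := by
  classical
  induction G using WfDvdMonoid.induction_on_irreducible with
  | zero => exact absurd rfl hG
  | unit u hu =>
    have : S.filter (fun P => eval (e P) u = 0) = ∅ := by
      refine Finset.filter_eq_empty_iff.2 fun P _ h0 => ?_
      have := hu.map (eval (e P))
      rw [h0] at this; simp at this
    rw [this]; simp; positivity
  | mul a i ha hi ih =>
    have h1 := ih ha (fun R hR hRa => h R hR (hRa.mul_left i))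
    have h2 := h i hi (dvd_mul_right i a)
    have h3 : (S.filter fun P => eval (e P) (i * a) = 0) ⊆ (S.filter fun P => eval (e P) i = 0) ∪ (S.filter fun P => eval (e P) a = 0) := by
      intro P hP
      simp only [Finset.mem_filter, Finset.mem_union, eval_mul, mul_eq_zero] at hP ⊢
      tauto
    have h4 := (Finset.card_le_card h3).trans (Finset.card_union_le _ _)
    rw [totalDegree_mul_of_isDomain hi.ne_zero ha]
    have h5 : ((S.filter fun P => eval (e P) (i * a) = 0).card : ℝ) ≤ (S.filter fun P => eval (e P) i = 0).card + (S.filter fun P => eval (e P) a = 0).card := by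
      exact_mod_cast h4
    push_cast
    linarith

lemma homComp_rename {σ τ R : Type*} [CommRing R] (g : σ → τ) (F : MvPolynomial σ R) (d : ℕ) :
    homogeneousComponent d (rename g F) = rename g (homogeneousComponent d F) := by
  conv_lhs => rw [← sum_homogeneousComponent F]
  rw [map_sum, map_sum]
  by_cases hd : d ≤ F.totalDegree
  · rw [Finset.sum_eq_single d]
    · exact homogeneousComponent_of_mem ((homogeneousComponent_isHomogeneous d F).rename_isHomogeneous) |>.trans (by simp)
    · intro b _ hb
      exact (homogeneousComponent_of_mem ((homogeneousComponent_isHomogeneous b F).rename_isHomogeneous)).trans (by simp [hb.symm, hb])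
    · intro h; simp at h; omega
  · rw [homogeneousComponent_eq_zero _ _ (by omega), map_zero]
    refine Finset.sum_eq_zero fun b hb => ?_
    have : b ≠ d := by simp at hb; omega
    exact (homogeneousComponent_of_mem ((homogeneousComponent_isHomogeneous b F).rename_isHomogeneous)).trans (by simp [this, this.symm])

lemma isUnit_of_rename_succ {r : ℕ} {k : Type*} [CommRing k] {a : MvPolynomial (Fin r) k} (h : IsUnit (rename Fin.succ a)) : IsUnit a := by
  have := h.map (aeval (Fin.cons 0 X : Fin (r+1) → MvPolynomial (Fin r) k))
  rw [aeval_rename] at this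
  have e : ((Fin.cons 0 X : Fin (r+1) → MvPolynomial (Fin r) k) ∘ Fin.succ) = X := by funext i; simp
  rw [e] at this
  simpa using this

lemma irred_of_rename_succ {r : ℕ} {k : Type*} [CommRing k] {a : MvPolynomial (Fin r) k} (h : Irreducible (rename Fin.succ a)) : Irreducible a := by
  refine ⟨fun hu => h.not_isUnit (hu.map _), fun b c hbc => ?_⟩
  rw [hbc, map_mul] at h
  exact (h.isUnit_or_isUnit rfl).imp isUnit_of_rename_succ isUnit_of_rename_succ

lemma finSuccEquiv_rename_succ {r : ℕ} {k : Type*} [CommRing k] (a : MvPolynomial (Fin r) k) :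
    finSuccEquiv k r (rename Fin.succ a) = Polynomial.C a := by
  have : ((finSuccEquiv k r).toAlgHom.comp (rename Fin.succ)).toRingHom = (Polynomial.C : MvPolynomial (Fin r) k →+* _) := by
    refine MvPolynomial.ringHom_ext (fun c => ?_) (fun i => ?_)
    · simp [finSuccEquiv_apply]
    · simp [finSuccEquiv_X_succ]
  exact congrArg (fun φ => φ a) this

/-- no irreducible `R` in the last variables divides all coefficients -/
lemma no_common {d : ℕ} (hd : 2 ≤ d) {Φ : MvPolynomial (Fin 3) ℚ} (hdeg : Φ.totalDegree = d) 
    (hirr : Irreducible (map (algebraMap ℚ (AlgebraicClosure ℚ)) (homogeneousComponent d Φ)))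
    {R : MvPolynomial (Fin 2) ℚ} (hR : Irreducible R) : ∃ k, ¬ R ∣ (finSuccEquiv ℚ 2 Φ).coeff k := by
  by_contra! hcon
  rw [← Polynomial.C_dvd_iff_dvd_coeff, ← finSuccEquiv_rename_succ, map_dvd_iff] at hcon
  have hΦ := irred_of_top hdeg (irred_of_map _ hirr)
  obtain ⟨Q, hQ⟩ := hcon
  have hu : IsUnit Q := (hΦ.isUnit_or_isUnit hQ).resolve_left fun h => hR.not_isUnit (isUnit_of_rename_succ h)
  obtain ⟨hc, hQ0⟩ := isUnit_iff_totalDegree_of_isReduced.1 hu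
  rw [totalDegree_eq_zero_iff_eq_C] at hQ0
  rw [hQ0, mul_comm] at hQ
  rw [hQ, homogeneousComponent_C_mul, homComp_rename, map_mul, map_C, map_rename, irreducible_isUnit_mul ((hc.map _).map C)] at hirr
  exact binary_red hd (IsHomogeneous.map (homogeneousComponent_isHomogeneous d R) _) (irred_of_rename_succ hirr)

lemma lines_dir {d : ℕ} (hd : 2 ≤ d) (f : MvPolynomial (Fin 3) ℚ) (hdeg : f.totalDegree = d)
    (hirr : Irreducible (map (algebraMap ℚ (AlgebraicClosure ℚ)) (homogeneousComponent d f)))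
    (v : Fin 3 → ℚ) (hv : v ≠ 0) (S : Finset (Fin 3 → ℚ)) (hS : ∀ x ∈ S, ∀ t : ℚ, eval (fun j => x j + t * v j) f = 0)
    (n : ℕ) (hn : ∀ x ∈ S, ∀ T ⊆ S, (∀ x' ∈ T, ∃ t : ℚ, ∀ j, x' j = x j + t * v j) → T.card ≤ n) : S.card ≤ n * (d * d) := by
  classical
  obtain ⟨M, N, hMN, hNM, hM⟩ := exists_matrix v hv
  set Φ := linSub M f with hΦ
  have hirr' : Irreducible (map (algebraMap ℚ (AlgebraicClosure ℚ)) (homogeneousComponent d Φ)) := by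
    rw [hΦ, linSub_homComp, linSub_map, linSub_irred _ (N.map (algebraMap ℚ (AlgebraicClosure ℚ)))]
    · exact hirr
    · rw [← Matrix.map_mul, hMN]; simp
  have hdeg' : Φ.totalDegree = d := by
    refine le_antisymm ((linSub_tdeg M f).trans hdeg.le) ?_
    by_contra h
    rw [homogeneousComponent_eq_zero _ _ (by omega)] at hirr'
    simp at hirr'
  set y : (Fin 3 → ℚ) → Fin 2 → ℚ := fun x => Fin.tail (N.mulVec x) with hy
  have hMe : ∀ t : ℚ, M.mulVec (Fin.cons t 0 : Fin 3 → ℚ) = fun j => t * v j := by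
    intro t; funext j
    simp [Matrix.mulVec, dotProduct, Fin.sum_univ_succ, hM, mul_comm]
  have hy_vanish : ∀ x ∈ S, ∀ k, eval (y x) ((finSuccEquiv ℚ 2 Φ).coeff k) = 0 := by
    intro x hx k
    have h1 : Polynomial.map (eval (y x)) (finSuccEquiv ℚ 2 Φ) = 0 := by
      refine Polynomial.funext fun s => ?_
      rw [← eval_eq_eval_mv_eval', Polynomial.eval_zero, hΦ, eval_linSub]
      have e : M.mulVec (Fin.cons s (y x) : Fin 3 → ℚ) = fun j => x j + (s - N.mulVec x 0) * v j := by
        have e1 : (Fin.cons s (y x) : Fin 3 → ℚ) = N.mulVec x + (Fin.cons (s - N.mulVec x 0) 0 : Fin 3 → ℚ) := by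
          funext j
          refine Fin.cases ?_ (fun i => ?_) j
          · simp
          · simp [hy, Fin.tail]
        rw [e1, Matrix.mulVec_add, Matrix.mulVec_mulVec, hMN, Matrix.one_mulVec, hMe]
        rfl
      rw [e]
      exact hS x hx _
    have := congrArg (fun p => p.coeff k) h1
    simpa [Polynomial.coeff_map] using this
  have hcoefdeg : ∀ k, ((finSuccEquiv ℚ 2 Φ).coeff k).totalDegree ≤ d := by
    intro k
    by_cases h : (finSuccEquiv ℚ 2 Φ).coeff k = 0
    · rw [h]; simp
    · have := totalDegree_coeff_finSuccEquiv_add_le Φ k h; omega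
  have hΦ0 : finSuccEquiv ℚ 2 Φ ≠ 0 := by
    intro h
    have : Φ = 0 := (map_eq_zero_iff _ (finSuccEquiv ℚ 2).injective).1 h
    rw [this] at hdeg'; simp at hdeg'; omega
  obtain ⟨k0, hk0⟩ : ∃ k, (finSuccEquiv ℚ 2 Φ).coeff k ≠ 0 := by
    by_contra! h; exact hΦ0 (Polynomial.ext h)
  have himg : (S.image y).card ≤ d * d := by
    have h1 := factor_count (S.image y) id (d:ℝ) (by positivity) _ hk0 (by
      intro R hR _
      obtain ⟨k, hk⟩ := no_common hd hdeg' hirr' hR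
      have h2 := bez2_points (G := (finSuccEquiv ℚ 2 Φ).coeff k) hR.ne_zero (fun h => hk (by rw [h]; exact dvd_zero _)) ((hR.dvd_or_isRelPrime (n := (finSuccEquiv ℚ 2 Φ).coeff k)).resolve_left hk)
        ((S.image y).filter fun P => eval (id P) R = 0) (by
          intro P hP
          rw [Finset.mem_filter, Finset.mem_image] at hP
          obtain ⟨⟨x, hx, rfl⟩, h⟩ := hP
          exact ⟨h, hy_vanish x hx k⟩)
      have h3 := h2.trans (Nat.mul_le_mul_left _ (hcoefdeg k))
      rw [mul_comm] at h3
      exact_mod_cast h3)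
    have h2 : (S.image y).filter (fun P => eval (id P) ((finSuccEquiv ℚ 2 Φ).coeff k0) = 0) = S.image y := by
      refine Finset.filter_true_of_mem fun P hP => ?_
      obtain ⟨x, hx, rfl⟩ := Finset.mem_image.1 hP
      exact hy_vanish x hx k0
    rw [h2] at h1
    have h3 : (S.image y).card ≤ d * ((finSuccEquiv ℚ 2 Φ).coeff k0).totalDegree := by exact_mod_cast h1
    exact h3.trans (Nat.mul_le_mul_left _ (hcoefdeg k0))
  have := Finset.card_le_mul_card_image (s := S) (f := y) n (by
    intro b hb
    obtain ⟨x, hx, rfl⟩ := Finset.mem_image.1 hb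
    refine hn x hx _ (Finset.filter_subset _ _) ?_
    intro x' hx'
    rw [Finset.mem_filter] at hx'
    refine ⟨N.mulVec x' 0 - N.mulVec x 0, fun j => ?_⟩
    have e1 : N.mulVec x' = N.mulVec x + (Fin.cons (N.mulVec x' 0 - N.mulVec x 0) 0 : Fin 3 → ℚ) := by
      funext j
      refine Fin.cases ?_ (fun i => ?_) j
      · simp
      · have := congrFun hx'.2 i
        simp only [hy, Fin.tail] at this
        simp [this]
    have e2 : x' = x + M.mulVec (Fin.cons (N.mulVec x' 0 - N.mulVec x 0) 0 : Fin 3 → ℚ) := by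
      have := congrArg M.mulVec e1
      rw [Matrix.mulVec_add, Matrix.mulVec_mulVec, Matrix.mulVec_mulVec, hMN, Matrix.one_mulVec, Matrix.one_mulVec] at this
      exact this
    rw [hMe] at e2
    exact congrFun e2 j)
  exact this.trans (Nat.mul_le_mul_left _ himg)

end

section
open MvPolynomial

def prim (v : Fin 3 → ℤ) : Prop := ∃ u : Fin 3 → ℤ, ∑ j, u j * v j = 1

lemma prim_ne {v : Fin 3 → ℤ} (h : prim v) : v ≠ 0 := by
  rintro rfl
  obtain ⟨u, hu⟩ := h
  simp at hu

lemma prim_prop {v v' : Fin 3 → ℤ} (h : prim v) (h' : prim v') (hp : ∀ i j, v i * v' j = v j * v' i) : v' = v ∨ v' = -v := by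
  obtain ⟨i0, hi0⟩ : ∃ i, v i ≠ 0 := by by_contra! hh; exact prim_ne h (funext hh)
  obtain ⟨u, hu⟩ := h
  obtain ⟨u', hu'⟩ := h'
  have h1 : ∀ i, v' i = (∑ j, u j * v' j) * v i := by
    intro i
    calc v' i = (∑ j, u j * v j) * v' i := by rw [hu, one_mul]
      _ = _ := by
        rw [Finset.sum_mul, Finset.sum_mul]
        refine Finset.sum_congr rfl fun j _ => ?_
        have := hp i j
        linear_combination (-u j) * this
  have h2 : ∀ i, v i = (∑ j, u' j * v j) * v' i := by
    intro i
    calc v i = (∑ j, u' j * v' j) * v i := by rw [hu', one_mul]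
      _ = _ := by
        rw [Finset.sum_mul, Finset.sum_mul]
        refine Finset.sum_congr rfl fun j _ => ?_
        have := hp i j
        linear_combination u' j * this
  set c := ∑ j, u j * v' j
  set c' := ∑ j, u' j * v j
  have h3 : c' * c = 1 := by
    have := h2 i0
    rw [h1 i0] at this
    have h4 : (c' * c - 1) * v i0 = 0 := by linear_combination -this
    rcases mul_eq_zero.1 h4 with h | h
    · linarith
    · exact absurd h hi0
  rcases Int.eq_one_or_neg_one_of_mul_eq_one h3 with hc' | hc'
  · left; funext i
    rw [h1 i]; rw [hc'] at h3; rw [show c = 1 by linarith, one_mul]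
  · right; funext i
    rw [h1 i]; rw [hc'] at h3; rw [show c = -1 by linarith]; simp

lemma dehom_map {k K : Type*} [CommRing k] [CommRing K] (φ : k →+* K) (g : MvPolynomial (Fin 3) k) : map φ (dehom k g) = dehom K (map φ g) := by
  have : (map φ).comp (dehom k : _ →ₐ[k] _).toRingHom = (dehom K : _ →ₐ[K] _).toRingHom.comp (map φ) := by
    refine MvPolynomial.ringHom_ext (fun c => by simp [dehom]) (fun i => ?_)
    fin_cases i <;> simp [dehom]
  exact congrArg (fun ψ => ψ g) this

lemma eval_dehom {k : Type*} [CommRing k] (y : Fin 2 → k) (g : MvPolynomial (Fin 3) k) : eval y (dehom k g) = eval ![y 0, y 1, 1] g := by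
  have : (eval y).comp (dehom k : _ →ₐ[k] _).toRingHom = eval ![y 0, y 1, 1] := by
    refine MvPolynomial.ringHom_ext (fun c => by simp [dehom]) (fun i => ?_)
    fin_cases i <;> simp [dehom]
  exact congrArg (fun ψ => ψ g) this

lemma proj_count : ∃ K : ℝ, 1 ≤ K ∧ ∀ (d : ℕ), 3 ≤ d → ∀ g : MvPolynomial (Fin 3) ℤ, g.IsHomogeneous d →
    Irreducible (map (Int.castRingHom ℚ) g) → coeff (Finsupp.single 0 d) g ≠ 0 → ∀ h : ℕ, 1 ≤ h → ∀ V : Finset (Fin 3 → ℤ),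
    (∀ v ∈ V, prim v ∧ (∀ j, |v j| ≤ h) ∧ eval v g = 0) → (V.card : ℝ) ≤ K * (d:ℝ) ^ 6 * (h:ℝ) ^ (0.72:ℝ) := by
  classical
  obtain ⟨K, hK1, hK⟩ := curve_main 3 18 (by norm_num) (by norm_num) 0.36 (by norm_num) (by norm_num)
  refine ⟨4 * K + 2, by linarith, ?_⟩
  intro d hd g hg hirr htop h hh V hV
  have hdR : (1:ℝ) ≤ d := by exact_mod_cast (by omega : 1 ≤ d)
  have hhR : (1:ℝ) ≤ h := by exact_mod_cast hh
  have hgQ := hg.map (Int.castRingHom ℚ)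
  have htopQ : coeff (Finsupp.single 0 d) (map (Int.castRingHom ℚ) g) ≠ 0 := by
    rw [coeff_map]; simpa using htop
  have hVQ : ∀ v ∈ V, ∀ t : ℚ, eval (fun j => t * (v j : ℚ)) (map (Int.castRingHom ℚ) g) = 0 := by
    intro v hv t
    rw [eval_hom_smul hgQ, eval_cast, (hV v hv).2.2]; simp
  -- half
  have half : ∀ W ⊆ V, (∀ v ∈ W, v 2 ≠ 0) → (∀ v ∈ W, ∀ v' ∈ W, v' = - v → False) → (W.card:ℝ) ≤ 2 * K * (d:ℝ)^6 * (h:ℝ) ^ (0.72:ℝ) := by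
    intro W hW hW0 hWn
    have := hK d hd (dehom ℤ g) (dehom_tdeg hg.totalDegree_le) (by rw [dehom_map]; exact dehom_irred (by omega) hgQ hirr htopQ)
      (by rw [dehom_top hg]; exact htop) (Fin 3 → ℤ) W (fun v => ![v 0, v 1]) (fun v => v 2) hW0 (by
        intro v hv
        rw [dehom_map, eval_dehom]
        have h1 := hVQ v (hW hv) (1 / v 2)
        rw [← h1]
        congr 2
        funext j
        have h2 : (v 2 : ℚ) ≠ 0 := by exact_mod_cast hW0 v hv
        fin_cases j
        · simp; field_simp
        · simp; field_simp
        · simp; field_simp) (by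
        intro v hv v' hv' heq
        have n1 : (v 2 : ℚ) ≠ 0 := by exact_mod_cast hW0 v hv
        have n2 : (v' 2 : ℚ) ≠ 0 := by exact_mod_cast hW0 v' hv'
        have e0 := heq 0
        have e1 := heq 1
        simp at e0 e1
        have h0 : ∀ i, v i * v' 2 = v' i * v 2 := by
          intro i
          fin_cases i
          · rw [div_eq_div_iff n1 n2] at e0; exact_mod_cast e0
          · rw [div_eq_div_iff n1 n2] at e1; exact_mod_cast e1
          · simp; ring
        have h1 : ∀ i j, v i * v' j = v j * v' i := by
          intro i j
          have a := h0 i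
          have b := h0 j
          have : (v i * v' j - v j * v' i) * v 2 = 0 := by linear_combination v j * a - v i * b
          rcases mul_eq_zero.1 this with h | h
          · linarith
          · exact absurd h (hW0 v hv)
        rcases prim_prop (hV v (hW hv)).1 (hV v' (hW hv')).1 h1 with h | h
        · exact h.symm
        · exact (hWn v hv v' hv' h).elim) h h hh hh (by
        intro v hv j
        have := (hV v (hW hv)).2.1
        fin_cases j
        · exact this 0
        · exact this 1) (fun v hv => (hV v (hW hv)).2.1 2)
    refine this.trans ?_
    have e1 : (((h * h : ℕ) : ℝ)) ^ (0.36:ℝ) = (h:ℝ) ^ (0.72:ℝ) := by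
      push_cast
      rw [Real.mul_rpow (by positivity) (by positivity), ← Real.rpow_add (by positivity)]
      norm_num
    rw [e1]
    have e2 : 1 ≤ (h:ℝ) ^ (0.72:ℝ) := Real.one_le_rpow hhR (by norm_num)
    have e3 : 1 ≤ (d:ℝ)^4 := one_le_pow₀ hdR
    have e4 : (h:ℝ) ^ (0.72:ℝ) + (d:ℝ)^4 ≤ 2 * ((d:ℝ)^4 * (h:ℝ) ^ (0.72:ℝ)) := by nlinarith
    calc K * (d:ℝ)^2 * ((h:ℝ) ^ (0.72:ℝ) + (d:ℝ)^4) ≤ K * (d:ℝ)^2 * (2 * ((d:ℝ)^4 * (h:ℝ) ^ (0.72:ℝ))) := by gcongr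
      _ = _ := by ring
  have hpos := half (V.filter fun v => 0 < v 2) (Finset.filter_subset _ _) (fun v hv => (Finset.mem_filter.1 hv).2.ne') (by
    intro v hv v' hv' h
    have a := (Finset.mem_filter.1 hv).2
    have b := (Finset.mem_filter.1 hv').2
    rw [h] at b; simp at b; omega)
  have hneg := half (V.filter fun v => v 2 < 0) (Finset.filter_subset _ _) (fun v hv => (Finset.mem_filter.1 hv).2.ne) (by
    intro v hv v' hv' h
    have a := (Finset.mem_filter.1 hv).2
    have b := (Finset.mem_filter.1 hv').2
    rw [h] at b; simp at b; omega)
  have hzero : (V.filter fun v => v 2 = 0).card ≤ 2 * d := by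
    set Z := V.filter fun v => v 2 = 0 with hZ
    have hZ1 : ∀ v ∈ Z, v 1 ≠ 0 := by
      intro v hv h1
      rw [hZ, Finset.mem_filter] at hv
      have h2 := (hV v hv.1).2.2
      have h3 : v = fun j => v 0 * (Fin.cons 1 0 : Fin 3 → ℤ) j := by
        funext j; fin_cases j
        · simp
        · simpa using h1
        · change v 2 = v 0 * 0
          rw [mul_zero]; exact hv.2
      rw [h3, eval_hom_smul hg, eval_hom_e0 hg] at h2
      rcases mul_eq_zero.1 h2 with h | h
      · have h4 := pow_eq_zero_iff (by omega : d ≠ 0) |>.1 h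
        apply prim_ne (hV v hv.1).1
        funext j; fin_cases j
        · exact h4
        · exact h1
        · exact hv.2
      · exact htop h
    let P : Polynomial ℚ := spec0 (![1, 0] : Fin 2 → ℚ) (map (Int.castRingHom ℚ) g)
    have hPd : P.natDegree ≤ d := spec0_natDegree _ hgQ.totalDegree_le
    have hP0 : P ≠ 0 := by
      intro h
      apply htopQ
      rw [← spec0_coeff (![1, 0] : Fin 2 → ℚ) hgQ.totalDegree_le]
      change P.coeff d = 0
      rw [h]; simp
    have himg : (Z.image fun v => (v 0 : ℚ) / v 1) ⊆ P.roots.toFinset := by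
      intro q hq
      obtain ⟨v, hv, rfl⟩ := Finset.mem_image.1 hq
      rw [Multiset.mem_toFinset, Polynomial.mem_roots hP0, Polynomial.IsRoot.def]
      change (spec0 _ _).eval _ = 0
      rw [eval_spec0]
      have hvZ := hv
      rw [hZ, Finset.mem_filter] at hv
      have h1 := hVQ v hv.1 (1 / v 1)
      have h2 : (v 1 : ℚ) ≠ 0 := by exact_mod_cast hZ1 v hvZ
      have e : (Fin.cons ((v 0 : ℚ) / v 1) (![1, 0] : Fin 2 → ℚ) : Fin 3 → ℚ) = fun j => (1 / v 1 : ℚ) * v j := by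
        funext j
        fin_cases j
        · simp; field_simp
        · simp; field_simp
        · change (0:ℚ) = 1 / v 1 * ((v 2 : ℤ) : ℚ)
          rw [hv.2]; simp
      rw [e]; exact h1
    have h1 : (Z.image fun v => (v 0 : ℚ) / v 1).card ≤ d :=
      (Finset.card_le_card himg).trans ((Multiset.toFinset_card_le _).trans ((Polynomial.card_roots' _).trans hPd))
    have h2 := Finset.card_le_mul_card_image (s := Z) (f := fun v => (v 0 : ℚ) / v 1) 2 (by
      intro q hq
      obtain ⟨v, hv, rfl⟩ := Finset.mem_image.1 hq
      refine (Finset.card_le_card (t := {v, -v}) ?_).trans Finset.card_le_two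
      intro v' hv'
      rw [Finset.mem_filter] at hv'
      have n1 : (v 1 : ℚ) ≠ 0 := by exact_mod_cast hZ1 v hv
      have n2 : (v' 1 : ℚ) ≠ 0 := by exact_mod_cast hZ1 v' hv'.1
      have e := hv'.2
      rw [div_eq_div_iff n2 n1] at e
      have e' : v' 0 * v 1 = v 0 * v' 1 := by exact_mod_cast e
      have z1 := (Finset.mem_filter.1 hv).2
      have z2 := (Finset.mem_filter.1 hv'.1).2
      have := prim_prop (hV v (Finset.mem_filter.1 hv).1).1 (hV v' (Finset.mem_filter.1 hv'.1).1).1 (by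
        intro i j
        fin_cases i <;> fin_cases j <;> simp [z1, z2] <;> linarith)
      simpa using this)
    exact h2.trans (Nat.mul_le_mul_left _ h1)
  have hsplit : V.card ≤ (V.filter fun v => 0 < v 2).card + (V.filter fun v => v 2 < 0).card + (V.filter fun v => v 2 = 0).card := by
    have : V ⊆ ((V.filter fun v => 0 < v 2) ∪ (V.filter fun v => v 2 < 0)) ∪ (V.filter fun v => v 2 = 0) := by
      intro v hv
      simp only [Finset.mem_union, Finset.mem_filter]
      rcases lt_trichotomy (v 2) 0 with h | h | h <;> tauto
    refine (Finset.card_le_card this).trans ((Finset.card_union_le _ _).trans ?_)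
    have := Finset.card_union_le (V.filter fun v => 0 < v 2) (V.filter fun v => v 2 < 0)
    omega
  have hsplitR : (V.card:ℝ) ≤ (V.filter fun v => 0 < v 2).card + (V.filter fun v => v 2 < 0).card + (V.filter fun v => v 2 = 0).card := by
    exact_mod_cast hsplit
  have hzR : ((V.filter fun v => v 2 = 0).card:ℝ) ≤ 2 * d := by exact_mod_cast hzero
  have e2 : 1 ≤ (h:ℝ) ^ (0.72:ℝ) := Real.one_le_rpow hhR (by norm_num)
  have e3 : (d:ℝ) ≤ (d:ℝ)^6 := le_self_pow₀ hdR (by norm_num)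
  have e4 : (d:ℝ) ≤ (d:ℝ)^6 * (h:ℝ) ^ (0.72:ℝ) := by nlinarith
  nlinarith

end

section
open MvPolynomial

theorem lead_line {d : ℕ} (F : MvPolynomial (Fin 3) ℚ) (hd : F.totalDegree ≤ d) (v x : Fin 3 → ℚ) (hv : v ≠ 0)
    (h : ∀ t : ℚ, eval (fun j => x j + t * v j) F = 0) : eval v (homogeneousComponent d F) = 0 := by
  obtain ⟨M, N, hMN, hNM, hM⟩ := exists_matrix v hv
  have hx : M.mulVec (N.mulVec x) = x := by rw [Matrix.mulVec_mulVec, hMN, Matrix.one_mulVec]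
  have he : M.mulVec (Fin.cons 1 0 : Fin 3 → ℚ) = v := by
    funext j
    rw [← hM j, Matrix.mulVec, dotProduct, Fin.sum_univ_succ]
    simp
  have h0 : spec0 (fun i : Fin 2 => N.mulVec x i.succ) (linSub M F) = 0 := by
    apply Polynomial.funext
    intro t
    rw [eval_spec0, eval_linSub, Polynomial.eval_zero]
    have e : (Fin.cons t (fun i : Fin 2 => N.mulVec x i.succ) : Fin 3 → ℚ) = N.mulVec x + (t - N.mulVec x 0) • (Fin.cons 1 0 : Fin 3 → ℚ) := by
      funext j
      refine Fin.cases ?_ (fun i => ?_) j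
      · simp
      · simp
    rw [e, Matrix.mulVec_add, Matrix.mulVec_smul, hx, he]
    exact h _
  have h1 := spec0_coeff (fun i : Fin 2 => N.mulVec x i.succ) (F := linSub M F) (d := d) ((linSub_tdeg M F).trans hd)
  rw [h0, Polynomial.coeff_zero] at h1
  rw [← he, ← eval_linSub, ← linSub_homComp, eval_hom_e0 (homogeneousComponent_isHomogeneous d _), coeff_single_homComp]
  exact h1.symm

theorem prim_decomp (w : Fin 3 → ℤ) (hw : w ≠ 0) : ∃ (g : ℤ) (v : Fin 3 → ℤ), g ≠ 0 ∧ prim v ∧ ∀ j, w j = g * v j := by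
  obtain ⟨g, hg⟩ := (IsPrincipalIdealRing.principal (Ideal.span (Set.range w))).principal
  have h1 : ∀ j, ∃ a, w j = g * a := by
    intro j
    have : w j ∈ Ideal.span (Set.range w) := Ideal.subset_span ⟨j, rfl⟩
    rw [hg] at this
    obtain ⟨a, ha⟩ := Submodule.mem_span_singleton.1 this
    exact ⟨a, by rw [← ha, smul_eq_mul, mul_comm]⟩
  choose v hv using h1
  have hg0 : g ≠ 0 := by
    intro h
    apply hw
    funext j
    rw [hv j, h, zero_mul]; rfl
  refine ⟨g, v, hg0, ?_, hv⟩
  have h2 : g ∈ Ideal.span (Set.range w) := by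
    rw [hg]; exact Submodule.mem_span_singleton_self g
  obtain ⟨u, hu⟩ := (Submodule.mem_span_range_iff_exists_fun ℤ).1 h2
  refine ⟨u, ?_⟩
  apply mul_left_cancel₀ hg0
  rw [mul_one, Finset.mul_sum]
  conv_rhs => rw [← hu]
  refine Finset.sum_congr rfl fun j _ => ?_
  rw [smul_eq_mul, hv j]; ring

theorem inv_sum : ∃ C : ℝ, 0 ≤ C ∧ ∀ (α : Type) (V : Finset α) (k : α → ℕ) (M : ℝ), 0 ≤ M → (∀ v ∈ V, 1 ≤ k v) →
    (∀ h : ℕ, 1 ≤ h → ((V.filter fun v => k v ≤ h).card : ℝ) ≤ M * (h:ℝ) ^ (0.72:ℝ)) →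
    ∑ v ∈ V, (1:ℝ) / k v ≤ C * M := by
  set r : ℝ := (2:ℝ) ^ (-0.28:ℝ) with hr
  have hr0 : 0 ≤ r := by positivity
  have hr1 : r < 1 := Real.rpow_lt_one_of_one_lt_of_neg (by norm_num) (by norm_num)
  have hsum := summable_geometric_of_lt_one hr0 hr1
  refine ⟨2 * ∑' n : ℕ, r ^ n, by positivity, ?_⟩
  intro α V k M hM hk hcount
  classical
  obtain ⟨L, hL⟩ : ∃ L, ∀ v ∈ V, Nat.log 2 (k v) ∈ Finset.range L := by
    refine ⟨(V.sup fun v => Nat.log 2 (k v)) + 1, fun v hv => ?_⟩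
    rw [Finset.mem_range]
    exact Nat.lt_succ_of_le (Finset.le_sup (f := fun v => Nat.log 2 (k v)) hv)
  rw [← Finset.sum_fiberwise_of_maps_to hL]
  have key : ∀ i ∈ Finset.range L, ∑ v ∈ V.filter (fun v => Nat.log 2 (k v) = i), (1:ℝ) / k v ≤ 2 * M * r ^ i := by
    intro i _
    have h1 : ∀ v ∈ V.filter (fun v => Nat.log 2 (k v) = i), (1:ℝ) / k v ≤ 1 / 2 ^ i := by
      intro v hv
      obtain ⟨hv1, rfl⟩ := Finset.mem_filter.1 hv
      have : 2 ^ Nat.log 2 (k v) ≤ k v := Nat.pow_log_le_self 2 (by have := hk v hv1; omega)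
      have : (2:ℝ) ^ Nat.log 2 (k v) ≤ k v := by exact_mod_cast this
      exact one_div_le_one_div_of_le (by positivity) this
    refine (Finset.sum_le_card_nsmul _ _ _ h1).trans ?_
    rw [nsmul_eq_mul]
    have h2 : ((V.filter (fun v => Nat.log 2 (k v) = i)).card : ℝ) ≤ M * ((2 ^ (i+1) : ℕ):ℝ) ^ (0.72:ℝ) := by
      refine le_trans ?_ (hcount (2^(i+1)) Nat.one_le_two_pow)
      exact_mod_cast Finset.card_le_card (fun v hv => by
        rw [Finset.mem_filter] at hv ⊢
        refine ⟨hv.1, ?_⟩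
        rw [← hv.2]
        exact (Nat.lt_pow_succ_log_self (by norm_num) _).le)
    have h3 : ((2 ^ (i+1) : ℕ):ℝ) ^ (0.72:ℝ) ≤ 2 * (2 ^ i * r ^ i) := by
      have e1 : (2:ℝ) * r = 2 ^ (0.72:ℝ) := by
        rw [hr]
        nth_rewrite 1 [← Real.rpow_one 2]
        rw [← Real.rpow_add (by norm_num)]; norm_num
      rw [← mul_pow, e1]
      push_cast
      rw [← Real.rpow_natCast, ← Real.rpow_natCast, ← Real.rpow_mul (by norm_num), ← Real.rpow_mul (by norm_num)]
      have e2 : (2:ℝ) * 2 ^ (0.72 * (i:ℝ)) = 2 ^ (1 + 0.72 * (i:ℝ)) := by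
        rw [Real.rpow_add (by norm_num), Real.rpow_one]
      rw [e2]
      apply Real.rpow_le_rpow_of_exponent_le (by norm_num)
      push_cast
      linarith
    have h4 : M * ((2 ^ (i+1) : ℕ):ℝ) ^ (0.72:ℝ) ≤ M * (2 * (2 ^ i * r ^ i)) := by gcongr
    calc _ ≤ (M * (2 * (2 ^ i * r ^ i))) * (1 / 2^i) := by gcongr; exact h2.trans h4
      _ = _ := by field_simp
  refine (Finset.sum_le_sum key).trans ?_
  rw [← Finset.mul_sum]
  have := hsum.sum_le_tsum (Finset.range L) (fun i _ => by positivity)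
  nlinarith

theorem line_n (B : ℕ) (v : Fin 3 → ℤ) (hp : prim v) (k : ℕ) (hk1 : 1 ≤ k) (j0 : Fin 3) (hk : |v j0| = k)
    (x : Fin 3 → ℤ) (hx : ∀ j, |x j| ≤ (B:ℤ)) (T : Finset (Fin 3 → ℤ)) (hT : ∀ x' ∈ T, ∀ j, |x' j| ≤ (B:ℤ))
    (h : ∀ x' ∈ T, ∃ t : ℚ, ∀ j, (x' j : ℚ) = x j + t * v j) : T.card ≤ 4 * B / k + 1 := by
  obtain ⟨u, hu⟩ := hp
  have h1 : ∀ x' ∈ T, ∀ j, x' j = x j + (∑ i, u i * (x' i - x i)) * v j := by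
    intro x' hx' j
    obtain ⟨t, ht⟩ := h x' hx'
    have e : ((∑ i, u i * (x' i - x i) : ℤ) : ℚ) = t := by
      have huQ : ∑ i, (u i : ℚ) * v i = 1 := by exact_mod_cast hu
      push_cast
      calc ∑ i, (u i : ℚ) * ((x' i : ℚ) - x i) = ∑ i, t * ((u i : ℚ) * v i) := by
            refine Finset.sum_congr rfl fun i _ => ?_
            rw [ht i]; ring
        _ = t := by rw [← Finset.mul_sum, huQ, mul_one]
    have := ht j
    rw [← e] at this
    exact_mod_cast this
  let φ : (Fin 3 → ℤ) → ℤ := fun x' => ∑ i, u i * (x' i - x i)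
  have hinj : Set.InjOn φ T := by
    intro a ha b hb hab
    funext j
    rw [h1 a ha j, h1 b hb j]
    change x j + φ a * v j = x j + φ b * v j
    rw [hab]
  have hmem : ∀ x' ∈ T, φ x' ∈ Finset.Icc (-(2 * B / k : ℤ)) (2 * B / k) := by
    intro x' hx'
    have e := h1 x' hx' j0
    change x' j0 = x j0 + φ x' * v j0 at e
    have e1 : |φ x'| * k ≤ 2 * B := by
      rw [← hk, ← abs_mul]
      have : φ x' * v j0 = x' j0 - x j0 := by linarith
      rw [this]
      have a := hT x' hx' j0
      have b := hx j0
      rw [abs_le] at a b ⊢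
      constructor <;> linarith
    rw [Finset.mem_Icc, ← abs_le]
    exact (Int.le_ediv_iff_mul_le (by exact_mod_cast hk1)).2 e1
  have hc := Finset.card_le_card_of_injOn φ hmem hinj
  rw [Int.card_Icc] at hc
  have e3 : (2 * B / k : ℤ) = ((2 * B / k : ℕ) : ℤ) := by push_cast; rfl
  rw [e3] at hc
  have e4 : 2 * (2 * B / k) ≤ 4 * B / k := by
    rw [Nat.le_div_iff_mul_le hk1]
    have := Nat.div_mul_le_self (2*B) k
    nlinarith
  omega

theorem lines_total : ∃ K : ℝ, 1 ≤ K ∧ ∀ (d : ℕ), 3 ≤ d → ∀ f : MvPolynomial (Fin 3) ℤ, f.totalDegree = d →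
    Irreducible (map (algebraMap ℚ (AlgebraicClosure ℚ)) (homogeneousComponent d (map (Int.castRingHom ℚ) f))) →
    coeff (Finsupp.single 0 d) f ≠ 0 →
    ∀ B : ℕ, 1 ≤ B → ∀ S L : Finset (Fin 3 → ℤ), L ⊆ S → (∀ x ∈ S, ∀ j, |x j| ≤ (B:ℤ)) →
    (∀ x ∈ L, ∃ x' ∈ S, x' ≠ x ∧ ∀ t : ℚ, eval (fun j => (x j : ℚ) + t * ((x' j : ℚ) - x j)) (map (Int.castRingHom ℚ) f) = 0) →
    (L.card : ℝ) ≤ K * (d:ℝ)^8 * B := by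
  classical
  obtain ⟨K, hK1, hK⟩ := proj_count
  obtain ⟨C, hC0, hC⟩ := inv_sum
  refine ⟨6 * C * K + 1, by nlinarith [mul_nonneg hC0 (by linarith : (0:ℝ) ≤ K)], ?_⟩
  intro d hd f hdeg hirr htop B hB S L hLS hS hL
  set g := homogeneousComponent d f with hg
  have hgh : g.IsHomogeneous d := homogeneousComponent_isHomogeneous d f
  have hgmap : map (Int.castRingHom ℚ) g = homogeneousComponent d (map (Int.castRingHom ℚ) f) := by
    ext m
    rw [coeff_map, hg, coeff_homogeneousComponent, coeff_homogeneousComponent, coeff_map]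
    split_ifs <;> simp
  have hgirr : Irreducible (map (Int.castRingHom ℚ) g) := by
    rw [hgmap]; exact irred_of_map _ hirr
  have hgtop : coeff (Finsupp.single 0 d) g ≠ 0 := by
    rw [hg, coeff_single_homComp]; exact htop
  have hdegQ : (map (Int.castRingHom ℚ) f).totalDegree = d := by rw [tdeg_map_inj, hdeg]
  set V : Finset (Fin 3 → ℤ) := (Fintype.piFinset fun _ => Finset.Icc (-(2 * B : ℤ)) (2 * B)).filter
    (fun v => prim v ∧ eval v g = 0) with hV
  let k : (Fin 3 → ℤ) → ℕ := fun v => Finset.univ.sup fun j => (v j).natAbs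
  have hkj : ∀ v j, |v j| ≤ (k v : ℤ) := by
    intro v j
    rw [Int.abs_eq_natAbs]
    exact_mod_cast Finset.le_sup (f := fun j => (v j).natAbs) (Finset.mem_univ j)
  have hkex : ∀ v, ∃ j, |v j| = (k v : ℤ) := by
    intro v
    obtain ⟨j, _, hj⟩ := Finset.exists_mem_eq_sup (Finset.univ : Finset (Fin 3)) ⟨0, Finset.mem_univ 0⟩ (fun j => (v j).natAbs)
    refine ⟨j, ?_⟩
    rw [Int.abs_eq_natAbs]
    exact_mod_cast hj.symm
  have hk1 : ∀ v ∈ V, 1 ≤ k v := by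
    intro v hv
    by_contra h
    have h0 : k v = 0 := by omega
    apply prim_ne (Finset.mem_filter.1 hv).2.1
    funext j
    have := hkj v j
    rw [h0] at this
    simpa using this
  have hk2 : ∀ v ∈ V, k v ≤ 2 * B := by
    intro v hv
    obtain ⟨j, hj⟩ := hkex v
    have h1 := Fintype.mem_piFinset.1 (Finset.mem_filter.1 hv).1 j
    rw [Finset.mem_Icc, ← abs_le, hj] at h1
    exact_mod_cast h1
  let Sv : (Fin 3 → ℤ) → Finset (Fin 3 → ℤ) := fun v => S.filter fun x => ∀ t : ℚ, eval (fun j => (x j : ℚ) + t * v j) (map (Int.castRingHom ℚ) f) = 0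
  have hcover : L ⊆ V.biUnion Sv := by
    intro x hx
    obtain ⟨x', hx', hne, hline⟩ := hL x hx
    obtain ⟨c, v, hc, hp, hv⟩ := prim_decomp (fun j => x' j - x j) (by
      intro h
      apply hne
      funext j
      have := congrFun h j
      simp at this; omega)
    have hline' : ∀ t : ℚ, eval (fun j => (x j : ℚ) + t * v j) (map (Int.castRingHom ℚ) f) = 0 := by
      intro t
      have hcQ : (c:ℚ) ≠ 0 := by exact_mod_cast hc
      rw [← hline (t / c)]
      congr 2
      funext j
      have : ((x' j : ℚ) - x j) = c * v j := by exact_mod_cast hv j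
      rw [this]; field_simp
    rw [Finset.mem_biUnion]
    refine ⟨v, ?_, Finset.mem_filter.2 ⟨hLS hx, hline'⟩⟩
    rw [hV, Finset.mem_filter]
    refine ⟨?_, hp, ?_⟩
    · rw [Fintype.mem_piFinset]
      intro j
      rw [Finset.mem_Icc, ← abs_le]
      have h1 : |v j| ≤ |c * v j| := by
        rw [abs_mul]
        have := Int.one_le_abs hc
        nlinarith [abs_nonneg (v j)]
      rw [← hv j] at h1
      have a := hS x (hLS hx) j
      have b := hS x' hx' j
      refine h1.trans ?_
      rw [abs_le] at a b ⊢
      constructor <;> linarith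
    · have h0 : (fun j => (v j : ℚ)) ≠ 0 := by
        intro h
        apply prim_ne hp
        funext j
        have : (v j : ℚ) = 0 := congrFun h j
        exact Int.cast_eq_zero.1 this
      have := lead_line _ hdegQ.le (fun j => (v j : ℚ)) (fun j => (x j : ℚ)) h0 hline'
      rw [← hgmap, eval_cast] at this
      exact_mod_cast this
  have hSv : ∀ v ∈ V, ((Sv v).card : ℝ) ≤ 6 * B * (d:ℝ)^2 * (1 / k v) := by
    intro v hv
    have hvp := (Finset.mem_filter.1 hv).2.1
    have hcast : Function.Injective (fun (x : Fin 3 → ℤ) (j : Fin 3) => (x j : ℚ)) := by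
      intro a b hab
      funext j
      have : (a j : ℚ) = b j := congrFun hab j
      exact_mod_cast this
    have h0 : (fun j => (v j : ℚ)) ≠ 0 := by
        intro h
        apply prim_ne hvp
        funext j
        have : (v j : ℚ) = 0 := congrFun h j
        exact Int.cast_eq_zero.1 this
    have h1 := lines_dir (by omega : 2 ≤ d) (map (Int.castRingHom ℚ) f) hdegQ hirr (fun j => (v j : ℚ)) h0
      ((Sv v).image fun x j => (x j : ℚ)) (by
        intro y hy t
        obtain ⟨x, hx, rfl⟩ := Finset.mem_image.1 hy
        exact (Finset.mem_filter.1 hx).2 t) (4 * B / k v + 1) (by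
        intro y hy T hT h
        obtain ⟨x, hx, rfl⟩ := Finset.mem_image.1 hy
        obtain ⟨j0, hj0⟩ := hkex v
        obtain ⟨T', hT', rfl⟩ := Finset.subset_image_iff.1 hT
        rw [Finset.card_image_of_injective _ hcast]
        refine line_n B v hvp (k v) (hk1 v hv) j0 hj0 x (hS x (Finset.mem_filter.1 hx).1) T' ?_ ?_
        · intro x' hx'
          exact hS x' (Finset.mem_filter.1 (hT' hx')).1
        · intro x' hx'
          exact h _ (Finset.mem_image_of_mem _ hx'))
    rw [Finset.card_image_of_injective _ hcast] at h1
    have hkR : (1:ℝ) ≤ k v := by exact_mod_cast hk1 v hv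
    have h2 : ((4 * B / k v + 1 : ℕ) : ℝ) ≤ 6 * B * (1 / k v) := by
      push_cast
      have e1 : ((4 * B / k v : ℕ) : ℝ) ≤ ((4 * B : ℕ):ℝ) / k v := Nat.cast_div_le
      have e2 : (k v : ℝ) ≤ 2 * B := by exact_mod_cast hk2 v hv
      have e3 : (1:ℝ) ≤ 2 * B / k v := by rw [le_div_iff₀ (by linarith)]; linarith
      push_cast at e1
      calc _ ≤ 4 * (B:ℝ) / k v + 2 * B / k v := by linarith
        _ = _ := by ring
    calc ((Sv v).card : ℝ) ≤ (((4 * B / k v + 1) * (d * d) : ℕ):ℝ) := by exact_mod_cast h1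
      _ = ((4 * B / k v + 1 : ℕ) : ℝ) * (d:ℝ)^2 := by push_cast; ring
      _ ≤ (6 * B * (1 / k v)) * (d:ℝ)^2 := by gcongr
      _ = _ := by ring
  have hsum := hC (Fin 3 → ℤ) V k (K * (d:ℝ)^6) (by positivity) hk1 (by
    intro h hh
    refine hK d hd g hgh hgirr hgtop h hh _ ?_
    intro v hv
    rw [Finset.mem_filter] at hv
    have h1 := Finset.mem_filter.1 hv.1
    refine ⟨h1.2.1, fun j => (hkj v j).trans (by exact_mod_cast hv.2), h1.2.2⟩)
  have hcard : (L.card : ℝ) ≤ ∑ v ∈ V, ((Sv v).card : ℝ) := by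
    exact_mod_cast (Finset.card_le_card hcover).trans Finset.card_biUnion_le
  calc (L.card : ℝ) ≤ ∑ v ∈ V, 6 * B * (d:ℝ)^2 * (1 / k v) := hcard.trans (Finset.sum_le_sum hSv)
    _ = 6 * B * (d:ℝ)^2 * ∑ v ∈ V, (1:ℝ) / k v := by rw [Finset.mul_sum]
    _ ≤ 6 * B * (d:ℝ)^2 * (C * (K * (d:ℝ)^6)) := by gcongr
    _ = 6 * C * K * (d:ℝ)^8 * B := by ring
    _ ≤ _ := by gcongr; linarith

end

section
open MvPolynomial

lemma degree_one_cases {r : ℕ} (m : Fin r →₀ ℕ) (h : m.degree ≤ 1) : m = 0 ∨ ∃ j, m = Finsupp.single j 1 := by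
  by_cases h0 : m = 0
  · exact Or.inl h0
  · right
    obtain ⟨j, hj⟩ := Finsupp.ne_iff.1 h0
    refine ⟨j, ?_⟩
    rw [Finsupp.degree_eq_sum] at h
    have hj' : m j ≠ 0 := hj
    have h1 := Finset.add_sum_erase Finset.univ (fun i => m i) (Finset.mem_univ j)
    ext i
    by_cases hij : j = i
    · subst hij; rw [Finsupp.single_eq_same]; omega
    · rw [Finsupp.single_eq_of_ne (Ne.symm hij)]
      have h2 : m i ≤ ∑ i ∈ Finset.univ.erase j, m i :=
        Finset.single_le_sum (f := fun i => m i) (fun _ _ => Nat.zero_le _) (Finset.mem_erase.2 ⟨Ne.symm hij, Finset.mem_univ i⟩)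
      omega

lemma lin_form {r : ℕ} (Q : MvPolynomial (Fin r) ℚ) (h : Q.totalDegree ≤ 1) :
    ∃ (c : ℚ) (a : Fin r → ℚ), ∀ y, eval y Q = c + ∑ i, a i * y i := by
  have h1 : ∀ m ∈ Q.support, ∃ (c : ℚ) (a : Fin r → ℚ), ∀ y : Fin r → ℚ, coeff m Q * ∏ i, y i ^ m i = c + ∑ i, a i * y i := by
    intro m hm
    have := tdeg_lt h (mem_support_iff.1 hm)
    rcases degree_one_cases m this with h0 | ⟨j, hj⟩
    · refine ⟨coeff m Q, 0, fun y => ?_⟩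
      rw [h0]; simp
    · refine ⟨0, Pi.single j (coeff m Q), fun y => ?_⟩
      rw [zero_add, Finset.sum_eq_single j, Finset.prod_eq_single j]
      · rw [hj]; simp
      · intro i _ hi; rw [hj, Finsupp.single_eq_of_ne hi, pow_zero]
      · simp
      · intro i _ hi; simp [hi]
      · simp
  choose! c a hca using h1
  refine ⟨∑ m ∈ Q.support, c m, fun i => ∑ m ∈ Q.support, a m i, fun y => ?_⟩
  rw [eval_eq', Finset.sum_congr rfl (fun m hm => hca m hm y), Finset.sum_add_distrib, Finset.sum_comm]
  simp_rw [Finset.sum_mul]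

/-- parametrisation of the zero set of an irreducible linear form in two variables -/
lemma lin_param (R : MvPolynomial (Fin 2) ℚ) (hR : R ≠ 0) (h : R.totalDegree ≤ 1) (y0 : Fin 2 → ℚ) (hy0 : eval y0 R = 0) :
    ∃ (k : Fin 2) (α β : Fin 2 → ℚ), α k = 1 ∧ β k = 0 ∧ ∀ y, eval y R = 0 → ∀ i, y i = β i + α i * y k := by
  obtain ⟨c, a, ha⟩ := lin_form R h
  by_cases h0 : a 0 = 0
  · have h1 : a 1 ≠ 0 := by
      intro h1
      apply hR
      apply MvPolynomial.funext
      intro y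
      rw [map_zero, ha, Fin.sum_univ_two, h0, h1]
      rw [ha, Fin.sum_univ_two, h0, h1] at hy0
      linarith
    refine ⟨0, ![1, 0], ![0, -c / a 1], rfl, rfl, ?_⟩
    intro y hy i
    rw [ha, Fin.sum_univ_two, h0] at hy
    fin_cases i
    · simp
    · simp; field_simp; linarith
  · refine ⟨1, ![- a 1 / a 0, 1], ![-c / a 0, 0], rfl, rfl, ?_⟩
    intro y hy i
    rw [ha, Fin.sum_univ_two] at hy
    fin_cases i
    · simp; field_simp; linarith
    · simp

lemma lin_line {r : ℕ} (Q : MvPolynomial (Fin r) ℚ) (h : Q.totalDegree ≤ 1) (y y' : Fin r → ℚ) (h1 : eval y Q = 0) (h2 : eval y' Q = 0)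
    (t : ℚ) : eval (fun i => y i + t * (y' i - y i)) Q = 0 := by
  obtain ⟨c, a, ha⟩ := lin_form Q h
  rw [ha] at *
  have : ∑ i, a i * (y i + t * (y' i - y i)) = ∑ i, a i * y i + t * (∑ i, a i * y' i - ∑ i, a i * y i) := by
    rw [← Finset.sum_sub_distrib, Finset.mul_sum, ← Finset.sum_add_distrib]
    exact Finset.sum_congr rfl fun i _ => by ring
  rw [this]
  have e : ∑ i, a i * y' i - ∑ i, a i * y i = 0 := by linarith
  rw [e]; linarith

/-- no two distinct points of `S` lie on a line contained in the surface -/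
def NL (f : MvPolynomial (Fin 3) ℤ) (S : Finset (Fin 3 → ℤ)) : Prop :=
  ∀ x ∈ S, ∀ x' ∈ S, x' ≠ x → ¬ ∀ t : ℚ, eval (fun j => (x j : ℚ) + t * ((x' j : ℚ) - x j)) (map (Int.castRingHom ℚ) f) = 0

lemma fiberZ {d : ℕ} {f : MvPolynomial (Fin 3) ℤ} (hf : f.totalDegree ≤ d)
    (htop : coeff (Finsupp.single 0 d) f ≠ 0) (y : Fin 2 → ℤ) (S : Finset (Fin 3 → ℤ))
    (hS : ∀ P ∈ S, eval P f = 0 ∧ Fin.tail P = y) : S.card ≤ d := by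
  classical
  have hcast : Function.Injective (fun (x : Fin 3 → ℤ) (j : Fin 3) => (x j : ℚ)) := by
    intro a b hab
    funext j
    have : (a j : ℚ) = b j := congrFun hab j
    exact_mod_cast this
  rw [← Finset.card_image_of_injective S hcast]
  refine fiber_le (f := map (Int.castRingHom ℚ) f) (by rw [tdeg_map_inj]; exact hf) (by
    rw [coeff_map]; simpa using htop) (fun i => (y i : ℚ)) _ ?_
  intro P hP
  obtain ⟨x, hx, rfl⟩ := Finset.mem_image.1 hP
  refine ⟨by rw [eval_cast, (hS x hx).1]; simp, ?_⟩
  rw [← (hS x hx).2]; rfl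

theorem plane_count : ∃ K : ℝ, 1 ≤ K ∧ ∀ (d : ℕ), 1 ≤ d → ∀ f : MvPolynomial (Fin 3) ℤ, f.totalDegree ≤ d →
    coeff (Finsupp.single 0 d) f ≠ 0 →
    ∀ B : ℕ, 1 ≤ B → ∀ S : Finset (Fin 3 → ℤ), (∀ x ∈ S, ∀ j, |x j| ≤ (B:ℤ)) → (∀ x ∈ S, eval x f = 0) → NL f S →
    ∀ (e : ℕ), d ≤ e → ∀ R : MvPolynomial (Fin 2) ℚ, Irreducible R → R.totalDegree ≤ e →
    ((S.filter fun x => eval (fun i : Fin 2 => (x i.succ : ℚ)) R = 0).card : ℝ) ≤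
      (K * d * (e:ℝ)^2 * ((B:ℝ)^(0.513:ℝ) + (e:ℝ)^4)) * R.totalDegree := by
  classical
  obtain ⟨K, hK1, hK⟩ := curve_aff
  refine ⟨K, hK1, ?_⟩
  intro d hd f hdeg htop B hB S hSB hS hNL e hde R hR hRe
  have hdR : (1:ℝ) ≤ d := by exact_mod_cast hd
  have hdeR : (d:ℝ) ≤ e := by exact_mod_cast hde
  have hBp : (1:ℝ) ≤ (B:ℝ)^(0.513:ℝ) := Real.one_le_rpow (by exact_mod_cast hB) (by norm_num)
  set T := S.filter fun x => eval (fun i : Fin 2 => (x i.succ : ℚ)) R = 0 with hT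
  have hR1 : 1 ≤ R.totalDegree := by
    by_contra h
    exact hR.not_isUnit (isUnit_of_tdeg_zero hR.ne_zero (by omega))
  have hTS : ∀ x ∈ T, x ∈ S := fun x hx => (Finset.mem_filter.1 hx).1
  have hTR : ∀ x ∈ T, eval (fun i : Fin 2 => (x i.succ : ℚ)) R = 0 := fun x hx => (Finset.mem_filter.1 hx).2
  by_cases hR2 : 2 ≤ R.totalDegree
  · have h1 := hK R.totalDegree R hR hR2 le_rfl B hB (T.image Fin.tail) (by
      intro y hy j
      obtain ⟨x, hx, rfl⟩ := Finset.mem_image.1 hy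
      exact hSB x (hTS x hx) _) (by
      intro y hy
      obtain ⟨x, hx, rfl⟩ := Finset.mem_image.1 hy
      exact hTR x hx)
    have h2 := Finset.card_le_mul_card_image (s := T) (f := Fin.tail) d (by
      intro y hy
      refine fiberZ hdeg htop y _ ?_
      intro P hP
      rw [Finset.mem_filter] at hP
      exact ⟨hS P (hTS P hP.1), hP.2⟩)
    have h3 : (T.card : ℝ) ≤ d * (T.image Fin.tail).card := by exact_mod_cast h2
    have hRR : (R.totalDegree : ℝ) ≤ e := by exact_mod_cast hRe
    calc (T.card : ℝ) ≤ d * (K * (R.totalDegree:ℝ) ^ 3 * ((B:ℝ) ^ (0.513:ℝ) + (R.totalDegree:ℝ) ^ 4)) := h3.trans (by gcongr)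
      _ = (K * d * (R.totalDegree:ℝ)^2 * ((B:ℝ)^(0.513:ℝ) + (R.totalDegree:ℝ)^4)) * R.totalDegree := by ring
      _ ≤ _ := by gcongr
  · have hR1' : R.totalDegree = 1 := by omega
    rcases T.eq_empty_or_nonempty with h0 | ⟨x0, hx0⟩
    · rw [h0]; simp; positivity
    obtain ⟨k, α, β, hα, hβ, hpar⟩ := lin_param R hR.ne_zero hR1'.le _ (hTR x0 hx0)
    set F := map (Int.castRingHom ℚ) f with hF
    have hFdeg : F.totalDegree ≤ d := by rw [hF, tdeg_map_inj]; exact hdeg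
    let gg : Fin 3 → MvPolynomial (Fin 2) ℚ := Fin.cons (X 0) (fun i => C (β i) + C (α i) * X 1)
    have hgg : ∀ i, (gg i).totalDegree ≤ 1 := by
      intro i
      refine Fin.cases ?_ (fun i => ?_) i
      · simp [gg]
      · simp only [gg, Fin.cons_succ]
        refine (totalDegree_add _ _).trans ?_
        rw [totalDegree_C]
        refine max_le (by omega) ((totalDegree_mul _ _).trans ?_)
        rw [totalDegree_C, totalDegree_X]
    set h := aeval gg F with hh
    have hhdeg : h.totalDegree ≤ d := (tdeg_aeval_le gg hgg F).trans hFdeg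
    have heval : ∀ z : Fin 2 → ℚ, eval z h = eval (Fin.cons (z 0) (fun i => β i + α i * z 1) : Fin 3 → ℚ) F := by
      intro z
      rw [hh, ← MvPolynomial.coe_aeval_eq_eval, ← MvPolynomial.coe_aeval_eq_eval]
      change aeval z (aeval gg F) = aeval _ F
      rw [← AlgHom.comp_apply, MvPolynomial.comp_aeval]
      congr 2
      funext i
      refine Fin.cases ?_ (fun i => ?_) i
      · simp [gg]
      · simp [gg]
    have hh0 : h ≠ 0 := by
      intro h0
      have e1 : spec0 β F = 0 := by
        apply Polynomial.funext
        intro t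
        rw [eval_spec0, Polynomial.eval_zero]
        have := heval ![t, 0]
        rw [h0, map_zero] at this
        rw [this]
        congr 2
        funext i
        refine Fin.cases ?_ (fun i => ?_) i
        · simp
        · simp
      have e2 := spec0_coeff β hFdeg
      rw [e1, hF, coeff_map] at e2
      simp at e2
      exact htop (by exact_mod_cast e2.symm)
    let pz : (Fin 3 → ℤ) → Fin 2 → ℤ := fun x => ![x 0, x k.succ]
    have hrec : ∀ x ∈ T, (fun j => (x j : ℚ)) = (Fin.cons ((pz x 0 : ℤ) : ℚ) (fun i => β i + α i * ((pz x 1 : ℤ) : ℚ)) : Fin 3 → ℚ) := by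
      intro x hx
      funext j
      refine Fin.cases ?_ (fun i => ?_) j
      · simp [pz]
      · simp only [Fin.cons_succ]
        exact hpar _ (hTR x hx) i
    have hpinj : Set.InjOn pz T := by
      intro x hx x' hx' hxx
      have e1 := hrec x hx
      rw [hxx, ← hrec x' hx'] at e1
      funext j
      have : (x j : ℚ) = x' j := congrFun e1 j
      exact_mod_cast this
    have hall : T.filter (fun x => eval (fun i => (pz x i : ℚ)) h = 0) = T := by
      rw [Finset.filter_eq_self]
      intro x hx
      rw [heval, ← hrec x hx, hF, eval_cast, hS x (hTS x hx)]; simp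
    have hfc := factor_count T (fun x i => (pz x i : ℚ)) (K * (d:ℝ)^2 * ((B:ℝ)^(0.513:ℝ) + (d:ℝ)^4)) (by positivity) h hh0 (by
      intro Q hQ hQh
      have hQd : Q.totalDegree ≤ d := by
        obtain ⟨q, hq⟩ := hQh
        have : q ≠ 0 := by rintro rfl; exact hh0 (by rw [hq, mul_zero])
        rw [hq, totalDegree_mul_of_isDomain hQ.ne_zero this] at hhdeg
        omega
      have hQ1 : 1 ≤ Q.totalDegree := by
        by_contra h
        exact hQ.not_isUnit (isUnit_of_tdeg_zero hQ.ne_zero (by omega))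
      set U := T.filter (fun x => eval (fun i => (pz x i : ℚ)) Q = 0) with hU
      by_cases hQ2 : 2 ≤ Q.totalDegree
      · have h1 := hK Q.totalDegree Q hQ hQ2 le_rfl B hB (U.image pz) (by
          intro y hy j
          obtain ⟨x, hx, rfl⟩ := Finset.mem_image.1 hy
          have hxS := hTS x (Finset.mem_filter.1 hx).1
          fin_cases j
          · exact hSB x hxS _
          · exact hSB x hxS _) (by
          intro y hy
          obtain ⟨x, hx, rfl⟩ := Finset.mem_image.1 hy
          exact (Finset.mem_filter.1 hx).2)
        rw [Finset.card_image_of_injOn (hpinj.mono (by exact_mod_cast Finset.filter_subset _ _))] at h1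
        have hRR : (Q.totalDegree : ℝ) ≤ d := by exact_mod_cast hQd
        calc (U.card : ℝ) ≤ K * (Q.totalDegree:ℝ) ^ 3 * ((B:ℝ) ^ (0.513:ℝ) + (Q.totalDegree:ℝ) ^ 4) := h1
          _ = (K * (Q.totalDegree:ℝ)^2 * ((B:ℝ)^(0.513:ℝ) + (Q.totalDegree:ℝ)^4)) * Q.totalDegree := by ring
          _ ≤ _ := by gcongr
      · have hQ1' : Q.totalDegree = 1 := by omega
        have hU1 : U.card ≤ 1 := by
          rw [Finset.card_le_one]
          intro x hx x' hx'
          by_contra hne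
          rw [hU, Finset.mem_filter] at hx hx'
          refine hNL x (hTS x hx.1) x' (hTS x' hx'.1) (Ne.symm hne) ?_
          intro t
          have e1 := lin_line Q hQ1'.le _ _ hx.2 hx'.2 t
          have e2 : eval (fun i => (pz x i : ℚ) + t * ((pz x' i : ℚ) - (pz x i : ℚ))) h = 0 := by
            obtain ⟨q, hq⟩ := hQh
            rw [hq, map_mul, e1, zero_mul]
          rw [heval] at e2
          rw [← e2]
          congr 2
          funext j
          have c1 := congrFun (hrec x hx.1) j
          have c2 := congrFun (hrec x' hx'.1) j
          rw [c1, c2]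
          refine Fin.cases ?_ (fun i => ?_) j
          · simp
          · simp; ring
        have hU1R : (U.card : ℝ) ≤ 1 := by exact_mod_cast hU1
        refine hU1R.trans ?_
        rw [hQ1', Nat.cast_one, mul_one]
        have : (1:ℝ) ≤ (d:ℝ)^2 := one_le_pow₀ hdR
        have : (1:ℝ) ≤ (B:ℝ)^(0.513:ℝ) + (d:ℝ)^4 := by nlinarith [pow_nonneg (by linarith : (0:ℝ) ≤ d) 4]
        calc (1:ℝ) = 1 * 1 * 1 := by norm_num
          _ ≤ _ := by gcongr)
    rw [hall] at hfc
    rw [hR1', Nat.cast_one, mul_one]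
    have hhR : (h.totalDegree : ℝ) ≤ d := by exact_mod_cast hhdeg
    calc (T.card : ℝ) ≤ (K * (d:ℝ)^2 * ((B:ℝ)^(0.513:ℝ) + (d:ℝ)^4)) * d := hfc.trans (by gcongr)
      _ = K * d * (d:ℝ)^2 * ((B:ℝ)^(0.513:ℝ) + (d:ℝ)^4) := by ring
      _ ≤ _ := by gcongr

/-- points of `S` on a second surface -/
theorem elim_count : ∃ K : ℝ, 1 ≤ K ∧ ∀ (d : ℕ), 1 ≤ d → ∀ f : MvPolynomial (Fin 3) ℤ, f.totalDegree ≤ d →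
    coeff (Finsupp.single 0 d) f ≠ 0 → Irreducible (map (Int.castRingHom ℚ) f) →
    ∀ B : ℕ, 1 ≤ B → ∀ S : Finset (Fin 3 → ℤ), (∀ x ∈ S, ∀ j, |x j| ≤ (B:ℤ)) → (∀ x ∈ S, eval x f = 0) → NL f S →
    ∀ (e : ℕ), d ≤ e → ∀ G : MvPolynomial (Fin 3) ℚ, G ≠ 0 → ¬ map (Int.castRingHom ℚ) f ∣ G → 2 * (d * G.totalDegree) ≤ e →
    (∀ x ∈ S, eval (fun i => (x i : ℚ)) G = 0) →
    (S.card : ℝ) ≤ K * d * (e:ℝ)^3 * ((B:ℝ)^(0.513:ℝ) + (e:ℝ)^4) := by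
  classical
  obtain ⟨K, hK1, hK⟩ := plane_count
  refine ⟨K, hK1, ?_⟩
  intro d hd f hdeg htop hirr B hB S hSB hS hNL e hde G hG hGf hGe hSG
  set F := map (Int.castRingHom ℚ) f with hF
  have hFdeg : F.totalDegree ≤ d := by rw [hF, tdeg_map_inj]; exact hdeg
  have hF1 : 1 ≤ F.totalDegree := by
    by_contra h
    exact hirr.not_isUnit (isUnit_of_tdeg_zero hirr.ne_zero (by omega))
  rcases S.eq_empty_or_nonempty with h0 | ⟨x0, hx0⟩
  · rw [h0]; simp; positivity
  have hG1 : 1 ≤ G.totalDegree := by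
    by_contra h
    have hu := isUnit_of_tdeg_zero hG (by omega)
    have := hu.map (eval (fun i => (x0 i : ℚ)))
    rw [hSG x0 hx0] at this
    exact not_isUnit_zero this
  have hrp : IsRelPrime F G := (hirr.dvd_or_isRelPrime (n := G)).resolve_left hGf
  obtain ⟨q, hq0, hqd, hq⟩ := bez3_elim hirr.ne_zero hG hF1 hG1 hrp
  have hqe : q.totalDegree ≤ e := by
    refine hqd.trans (le_trans ?_ hGe)
    gcongr
  obtain ⟨a, b, hab⟩ := Ideal.mem_span_pair.1 hq
  have hqx : ∀ x ∈ S, eval (fun i : Fin 2 => (x i.succ : ℚ)) q = 0 := by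
    intro x hx
    have h1 := congrArg (eval (fun i => (x i : ℚ))) hab
    rw [map_add, map_mul, map_mul, hSG x hx, hF, eval_cast, hS x hx, eval_rename] at h1
    simp at h1
    exact h1.symm
  have hfc := factor_count S (fun x (i : Fin 2) => (x i.succ : ℚ)) (K * d * (e:ℝ)^2 * ((B:ℝ)^(0.513:ℝ) + (e:ℝ)^4)) (by positivity) q hq0 (by
    intro R hR hRq
    refine hK d hd f hdeg htop B hB S hSB hS hNL e hde R hR ?_
    obtain ⟨w, hw⟩ := hRq
    have : w ≠ 0 := by rintro rfl; exact hq0 (by rw [hw, mul_zero])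
    rw [hw, totalDegree_mul_of_isDomain hR.ne_zero this] at hqe
    omega)
  rw [Finset.filter_eq_self.2 hqx] at hfc
  have : (q.totalDegree : ℝ) ≤ e := by exact_mod_cast hqe
  calc (S.card : ℝ) ≤ _ := hfc
    _ ≤ (K * d * (e:ℝ)^2 * ((B:ℝ)^(0.513:ℝ) + (e:ℝ)^4)) * e := by gcongr
    _ = _ := by ring

end

section
open MvPolynomial

lemma NL.mono {f : MvPolynomial (Fin 3) ℤ} {S T : Finset (Fin 3 → ℤ)} (h : NL f S) (hT : T ⊆ S) : NL f T :=
  fun x hx x' hx' => h x (hT hx) x' (hT hx')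

set_option maxHeartbeats 1000000 in
lemma surf_main (J m W : ℕ) (hJ : 0 < J) (ρ : ℝ) (hρ0 : 0 < ρ) (c1 : ℕ)
    (hc : 2 * c1 + 2 * J * (m+1+2).choose 3 = J * (m+2).choose 2 * (J + 1 + 2 * m))
    (hE1 : W * (J * (m+2).choose 2) - (W + 2).choose 3 ≠ 0)
    (hρ : (c1 : ℝ) ≤ ρ * ((W * (J * (m+2).choose 2) - (W + 2).choose 3 : ℕ) : ℝ)) :
    ∃ C : ℝ, 1 ≤ C ∧ ∀ (d : ℕ), J ≤ d → ∀ f : MvPolynomial (Fin 3) ℤ, f.totalDegree ≤ d →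
    coeff (Finsupp.single 0 d) f ≠ 0 → Irreducible (map (Int.castRingHom ℚ) f) →
    ∀ B : ℕ, 1 ≤ B → ∀ S : Finset (Fin 3 → ℤ), (∀ x ∈ S, ∀ j, |x j| ≤ (B:ℤ)) → (∀ x ∈ S, eval x f = 0) → NL f S →
    (S.card : ℝ) ≤ C * ((d:ℝ)^7 * ((B:ℝ)^(0.513:ℝ) + (d:ℝ)^8) +
       (d:ℝ)^5 * ((B:ℝ)^ρ + (d:ℝ)^5)^2 * ((B:ℝ)^(0.513:ℝ) + (d:ℝ)^4)) := by
  classical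
  obtain ⟨K, hK1, hK⟩ := pick_prime 2 ρ hρ0
  obtain ⟨K2, hK21, hK2⟩ := elim_count
  set s := J * (m+2).choose 2 with hsd
  set L := m + J - 1 with hL
  set E := W * s - (W + 2).choose 3 with hE
  obtain ⟨N, hN⟩ : ∃ N, N = s.factorial := ⟨_, rfl⟩
  have hN1 : 1 ≤ N := by rw [hN]; exact Nat.succ_le_of_lt (Nat.factorial_pos s)
  set K' := K + (N:ℝ) with hK'
  set q : ℝ := 2 * (L + 1) with hq
  have hq1 : 1 ≤ q := by rw [hq]; have : (0:ℝ) ≤ L := by positivity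
                         linarith
  refine ⟨K2 * 128 + 2 * (16 * K')^2 * (K2 * q^3 * q^4), ?_, ?_⟩
  · have : (0:ℝ) ≤ 2 * (16 * K')^2 * (K2 * q^3 * q^4) := by positivity
    linarith
  intro d hd f hF htop hirr B hB S hSB hS hNL
  have hd1 : 1 ≤ d := by omega
  have hdR : (1:ℝ) ≤ d := by exact_mod_cast hd1
  have hBR : (1:ℝ) ≤ B := by exact_mod_cast hB
  set V := (B:ℝ) ^ ρ + (d:ℝ) ^ 5 with hV
  have hBρ : 1 ≤ (B:ℝ) ^ ρ := Real.one_le_rpow hBR hρ0.le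
  have hV1 : 1 ≤ V := by
    have h1 : 1 ≤ (d:ℝ) ^ 5 := one_le_pow₀ hdR
    linarith
  have hVU : (B:ℝ) ^ ρ ≤ V := by
    have h1 : 0 ≤ (d:ℝ) ^ 5 := by positivity
    linarith
  have hNR : (1:ℝ) ≤ N := by exact_mod_cast hN1
  have hK'1 : 1 ≤ K' := by linarith
  obtain ⟨Y, hY⟩ : ∃ Y, Y = ⌈K' * V⌉₊ := ⟨_, rfl⟩
  have hY1 : K' * V ≤ Y := by rw [hY]; exact Nat.le_ceil _
  have hY2 : (Y:ℝ) ≤ 2 * K' * V := by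
    have := (Nat.ceil_lt_add_one (show 0 ≤ K' * V by positivity)).le
    rw [← hY] at this
    nlinarith
  obtain ⟨S0, T, G, p, F', hS0, hT, hcard, hG0, hGd, hGF, hG, hp, hpY, hpY2, hF'd, ⟨c, hc0, hcc⟩, hTp⟩ :=
    hK d hd1 f hF hirr htop (Fin 3 → ℤ) S (fun x => x) (fun _ => 1) (fun _ _ => one_ne_zero) (by
        intro P hP
        simp only [Int.cast_one, div_one]
        rw [eval_cast, hS P hP]; simp) B hB (fun P hP j => hSB P hP j)
      (fun P hP => by simpa using hB) Y (by
        refine le_trans ?_ hY1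
        have : K ≤ K' := by linarith
        gcongr)
  simp only [Int.cast_one, div_one] at hG
  have hpR : (p:ℝ) ≤ 16 * K' * V := by
    have : (p:ℝ) ≤ 8 * Y := by exact_mod_cast hpY2
    linarith
  -- S0
  have h0 : (S0.card : ℝ) ≤ K2 * d * ((2 * (d * d) : ℕ):ℝ)^3 * ((B:ℝ)^(0.513:ℝ) + ((2 * (d * d) : ℕ):ℝ)^4) :=
    hK2 d hd1 f hF htop hirr B hB S0 (fun x hx => hSB x (hS0 hx)) (fun x hx => hS x (hS0 hx)) (hNL.mono hS0)
      (2 * (d * d)) (by rw [← mul_assoc]; exact Nat.le_mul_of_pos_left d (by omega)) G hG0 hGF (by gcongr) hG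
  have h0' : (S0.card : ℝ) ≤ K2 * 128 * ((d:ℝ)^7 * ((B:ℝ)^(0.513:ℝ) + (d:ℝ)^8)) := by
    refine h0.trans ?_
    push_cast
    have e1 : (0:ℝ) ≤ (B:ℝ)^(0.513:ℝ) := by positivity
    have e2 : (B:ℝ)^(0.513:ℝ) + (2 * ((d:ℝ) * d))^4 ≤ 16 * ((B:ℝ)^(0.513:ℝ) + (d:ℝ)^8) := by
      have : (2 * ((d:ℝ) * d))^4 = 16 * (d:ℝ)^8 := by ring
      rw [this]; linarith
    calc K2 * d * (2 * ((d:ℝ) * d))^3 * ((B:ℝ)^(0.513:ℝ) + (2 * ((d:ℝ) * d))^4)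
        ≤ K2 * d * (2 * ((d:ℝ) * d))^3 * (16 * ((B:ℝ)^(0.513:ℝ) + (d:ℝ)^8)) := by gcongr
      _ = _ := by ring
  set D0 := K2 * d * ((2 * (d * (L+1)) : ℕ):ℝ)^3 * ((B:ℝ)^(0.513:ℝ) + ((2 * (d * (L+1)) : ℕ):ℝ)^4) with hD0
  have hD00 : 0 ≤ D0 := by positivity
  have h1 : (T.card : ℝ) ≤ D0 * (d * (p:ℝ)^2) := by
    by_cases hTe : T = ∅
    · rw [hTe]; simp; positivity
    obtain ⟨P1, hP1⟩ := Finset.nonempty_iff_ne_empty.2 hTe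
    have : Fact p.Prime := ⟨hp⟩
    have hF'z : ∀ P ∈ T, eval (fun j => (P j : ℚ)) (map (Int.castRingHom ℚ) F') = 0 := by
      intro P hP
      rw [hcc, eval_mul, eval_cast, hS P (hT hP)]; simp
    let cl : (Fin 3 → ℤ) → Fin 3 → ZMod p := fun P j => (P j : ZMod p)
    have himg : (T.image cl).card ≤ d * p ^ 2 := by
      have := zeros_le (f := map (Int.castRingHom (ZMod p)) F') (d := d) ((totalDegree_map_le _ _).trans hF'd) (by
        rw [coeff_map]
        intro h; exact (hTp P1 hP1).2.2 ((ZMod.intCast_zmod_eq_zero_iff_dvd _ _).1 h)) (T.image cl) (by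
        intro Q hQ
        obtain ⟨P, hP, rfl⟩ := Finset.mem_image.1 hQ
        have h1 := hF'z P hP
        rw [eval_cast] at h1
        have h2 : eval P F' = 0 := by exact_mod_cast h1
        have h3 := congrArg (Int.castRingHom (ZMod p)) h2
        rw [map_zero, ← eval₂_id, eval₂_eq_eval_map] at h3
        have h4 := MvPolynomial.map_eval (Int.castRingHom (ZMod p)) P F'
        rw [h2, map_zero] at h4
        exact h4.symm)
      rwa [ZMod.card] at this
    have hfib : ∀ Q ∈ T.image cl, ((T.filter fun P => cl P = Q).card : ℝ) ≤ D0 := by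
      intro Q _
      set T' := T.filter fun P => cl P = Q with hT'
      have hT'T : T' ⊆ T := Finset.filter_subset _ _
      obtain ⟨G', hG'0, hG'd, hG'J, hG'⟩ := class_aux (r := 2) (T' : Set (Fin 3 → ℤ)) (fun x => x) (fun _ => 1) J m hJ p W d hp F' hF'd
        (fun P hP => (hTp P (hT'T hP)).1) (by
          intro P hP
          simp only [Int.cast_one, div_one]
          exact hF'z P (hT'T hP)) (fun P hP => (hTp P (hT'T hP)).2.1) (by
          intro P hP P' hP' j
          have e1 := (Finset.mem_filter.1 (Finset.mem_coe.1 hP)).2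
          have e2 := (Finset.mem_filter.1 (Finset.mem_coe.1 hP')).2
          rw [mul_one, mul_one, ← ZMod.intCast_zmod_eq_zero_iff_dvd]
          have e3 : (P j : ZMod p) = P' j := congrFun (e1.trans e2.symm) j
          push_cast
          rw [e3, sub_self]) B 1 (fun P hP j => hSB P (hT (hT'T hP)) j) (fun P hP => by simp) c1 _ (by
          have h1 := Col.sum_deg 2 J m
          rw [← hsd, ← hc] at h1
          change 2 * _ + 2 * J * (m+1+2).choose 3 = _ at h1
          linarith) rfl (by
          change s.factorial * (B^c1 * 1 ^ _) < p ^ E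
          rw [one_pow, mul_one, ← hN]
          have hp2 : (N:ℝ) * (B:ℝ) ^ ρ < p := by
            have h1 : (Y:ℝ) < p := by exact_mod_cast hpY
            refine lt_of_le_of_lt ?_ h1
            refine le_trans ?_ hY1
            have : (N:ℝ) ≤ K' := by linarith
            gcongr
          have h2 : ((N:ℝ) * (B:ℝ) ^ ρ) ^ E < (p:ℝ) ^ E := by gcongr
          have h3 : (N:ℝ) * (B:ℝ) ^ c1 ≤ ((N:ℝ) * (B:ℝ) ^ ρ) ^ E := by
            rw [mul_pow]
            have e1 : (N:ℝ) ≤ (N:ℝ)^E := le_self_pow₀ hNR hE1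
            have e2 : (B:ℝ)^c1 ≤ ((B:ℝ)^ρ)^E := by
              rw [← Real.rpow_natCast, ← Real.rpow_natCast, ← Real.rpow_mul (by positivity)]
              exact Real.rpow_le_rpow_of_exponent_le hBR hρ
            gcongr
          exact_mod_cast lt_of_le_of_lt h3 h2)
      simp only [Int.cast_one, div_one] at hG'
      have hnd : ¬ map (Int.castRingHom ℚ) f ∣ G' := by
        refine not_dvd_of_degreeOf (d := d) ?_ hG'0 (by omega)
        rw [coeff_map]
        intro h
        exact htop (by simpa using h)
      refine hK2 d hd1 f hF htop hirr B hB T' (fun x hx => hSB x (hT (hT'T hx))) (fun x hx => hS x (hT (hT'T hx)))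
        (hNL.mono (hT'T.trans hT)) (2 * (d * (L+1))) (by rw [show 2 * (d * (L+1)) = (2 * (L+1)) * d by ring]; exact Nat.le_mul_of_pos_left d (by omega)) G' hG'0 hnd ?_ (fun x hx => hG' x (Finset.mem_coe.2 hx))
      refine Nat.mul_le_mul_left _ (Nat.mul_le_mul_left _ (hG'd.trans ?_))
      exact Nat.le_succ L
    have hsum : (T.card : ℝ) = ∑ Q ∈ T.image cl, ((T.filter fun P => cl P = Q).card : ℝ) := by
      exact_mod_cast Finset.card_eq_sum_card_fiberwise (fun P hP => Finset.mem_image_of_mem cl hP)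
    rw [hsum]
    refine (Finset.sum_le_card_nsmul _ _ _ hfib).trans ?_
    rw [nsmul_eq_mul, mul_comm]
    have : ((T.image cl).card : ℝ) ≤ d * (p:ℝ)^2 := by exact_mod_cast himg
    gcongr
  have hD0' : D0 ≤ (K2 * q^3 * q^4) * ((d:ℝ)^4 * ((B:ℝ)^(0.513:ℝ) + (d:ℝ)^4)) := by
    have e0 : ((2 * (d * (L+1)) : ℕ):ℝ) = q * d := by push_cast; rw [hq]; ring
    rw [hD0, e0]
    have e1 : (0:ℝ) ≤ (B:ℝ)^(0.513:ℝ) := by positivity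
    have e3 : 1 ≤ q^4 := one_le_pow₀ hq1
    have e2 : (B:ℝ)^(0.513:ℝ) + (q * d)^4 ≤ q^4 * ((B:ℝ)^(0.513:ℝ) + (d:ℝ)^4) := by
      rw [mul_pow, mul_add]
      have := le_mul_of_one_le_left e1 e3
      linarith
    calc K2 * d * (q * d)^3 * ((B:ℝ)^(0.513:ℝ) + (q * d)^4) ≤ K2 * d * (q * d)^3 * (q^4 * ((B:ℝ)^(0.513:ℝ) + (d:ℝ)^4)) := by gcongr
      _ = _ := by ring
  have h1' : (T.card : ℝ) ≤ (16 * K')^2 * (K2 * q^3 * q^4) * ((d:ℝ)^5 * V^2 * ((B:ℝ)^(0.513:ℝ) + (d:ℝ)^4)) := by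
    calc (T.card : ℝ) ≤ D0 * (d * (p:ℝ)^2) := h1
      _ ≤ ((K2 * q^3 * q^4) * ((d:ℝ)^4 * ((B:ℝ)^(0.513:ℝ) + (d:ℝ)^4))) * (d * (16 * K' * V)^2) := by gcongr
      _ = _ := by ring
  have hcardR : (S.card : ℝ) ≤ S0.card + 2 * T.card := by exact_mod_cast hcard
  set X1 := (d:ℝ)^7 * ((B:ℝ)^(0.513:ℝ) + (d:ℝ)^8)
  set X2 := (d:ℝ)^5 * V^2 * ((B:ℝ)^(0.513:ℝ) + (d:ℝ)^4)
  have hX1 : 0 ≤ X1 := by positivity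
  have hX2 : 0 ≤ X2 := by positivity
  have hM : (0:ℝ) ≤ (16 * K')^2 * (K2 * q^3 * q^4) := by positivity
  set M := (16 * K')^2 * (K2 * q^3 * q^4)
  have : (K2 * 128 + 2 * (16 * K')^2 * (K2 * q^3 * q^4)) = K2 * 128 + 2 * M := by ring
  rw [this]
  have a1 := mul_nonneg (by positivity : 0 ≤ K2 * 128) hX2
  have a2 := mul_nonneg hM hX1
  calc (S.card : ℝ) ≤ K2 * 128 * X1 + 2 * (M * X2) := by linarith
    _ ≤ (K2 * 128 + 2 * M) * (X1 + X2) := by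
      have e : (K2 * 128 + 2 * M) * (X1 + X2) = K2 * 128 * X1 + 2 * (M * X2) + (K2 * 128 * X2 + 2 * (M * X1)) := by ring
      rw [e]; linarith

end

section
open MvPolynomial

lemma trivial_count {d : ℕ} {f : MvPolynomial (Fin 3) ℤ} (hf : f.totalDegree ≤ d)
    (htop : coeff (Finsupp.single 0 d) f ≠ 0) (B : ℕ) (S : Finset (Fin 3 → ℤ)) (hSB : ∀ x ∈ S, ∀ j, |x j| ≤ (B:ℤ))
    (hS : ∀ x ∈ S, eval x f = 0) : S.card ≤ d * (2 * B + 1)^2 := by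
  classical
  have h2 := Finset.card_le_mul_card_image (s := S) (f := Fin.tail) d (by
    intro y hy
    refine fiberZ hf htop y _ ?_
    intro P hP
    rw [Finset.mem_filter] at hP
    exact ⟨hS P hP.1, hP.2⟩)
  refine h2.trans (Nat.mul_le_mul_left _ ?_)
  have h3 : S.image Fin.tail ⊆ Fintype.piFinset fun _ : Fin 2 => Finset.Icc (-(B:ℤ)) B := by
    intro y hy
    obtain ⟨x, hx, rfl⟩ := Finset.mem_image.1 hy
    rw [Fintype.mem_piFinset]
    intro i
    rw [Finset.mem_Icc, ← abs_le]
    exact hSB x hx _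
  refine (Finset.card_le_card h3).trans ?_
  rw [Fintype.card_piFinset, Fin.prod_univ_two, Int.card_Icc, sq]
  apply Nat.le_of_eq
  congr 1 <;> omega

theorem split_lines : ∃ K : ℝ, 1 ≤ K ∧ ∀ (d : ℕ), 3 ≤ d → ∀ f : MvPolynomial (Fin 3) ℤ, f.totalDegree = d →
    Irreducible (map (algebraMap ℚ (AlgebraicClosure ℚ)) (homogeneousComponent d (map (Int.castRingHom ℚ) f))) →
    coeff (Finsupp.single 0 d) f ≠ 0 →
    ∀ B : ℕ, 1 ≤ B → ∀ S : Finset (Fin 3 → ℤ), (∀ x ∈ S, ∀ j, |x j| ≤ (B:ℤ)) →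
    ∃ S' ⊆ S, NL f S' ∧ (S.card : ℝ) ≤ S'.card + K * (d:ℝ)^8 * B := by
  classical
  obtain ⟨K, hK1, hK⟩ := lines_total
  refine ⟨K, hK1, ?_⟩
  intro d hd f hdeg hirr htop B hB S hSB
  set L := S.filter fun x => ∃ x' ∈ S, x' ≠ x ∧ ∀ t : ℚ, eval (fun j => (x j : ℚ) + t * ((x' j : ℚ) - x j)) (map (Int.castRingHom ℚ) f) = 0 with hL
  refine ⟨S \ L, Finset.sdiff_subset, ?_, ?_⟩
  · intro x hx x' hx' hne h
    rw [Finset.mem_sdiff] at hx hx'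
    exact hx.2 (Finset.mem_filter.2 ⟨hx.1, x', hx'.1, hne, h⟩)
  · have h1 := hK d hd f hdeg hirr htop B hB S L (Finset.filter_subset _ _) hSB (fun x hx => (Finset.mem_filter.1 hx).2)
    have h2 : S.card = (S \ L).card + L.card := (Finset.card_sdiff_add_card_eq_card (Finset.filter_subset _ _)).symm
    have h3 : (S.card : ℝ) = (S \ L).card + L.card := by exact_mod_cast h2
    linarith

lemma surf_large : ∃ C : ℝ, 1 ≤ C ∧ ∀ (d : ℕ), 100 ≤ d → ∀ f : MvPolynomial (Fin 3) ℤ, f.totalDegree ≤ d →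
    coeff (Finsupp.single 0 d) f ≠ 0 → Irreducible (map (Int.castRingHom ℚ) f) →
    ∀ B : ℕ, 1 ≤ B → ∀ S : Finset (Fin 3 → ℤ), (∀ x ∈ S, ∀ j, |x j| ≤ (B:ℤ)) → (∀ x ∈ S, eval x f = 0) → NL f S →
    (S.card : ℝ) ≤ C * ((d:ℝ)^7 * ((B:ℝ)^(0.513:ℝ) + (d:ℝ)^8) +
       (d:ℝ)^5 * ((B:ℝ)^(0.18:ℝ) + (d:ℝ)^5)^2 * ((B:ℝ)^(0.513:ℝ) + (d:ℝ)^4)) := by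
  have k1 : (100 + 1 + 2).choose 3 = 176851 := by have := choose3 100; norm_num at this ⊢; omega
  have k2 : (100 + 2).choose 2 = 5151 := by have := choose2 100; norm_num at this ⊢; omega
  have k3 : (1015 + 2).choose 3 = 174795180 := by have := choose3 1014; norm_num at this ⊢; omega
  exact surf_main 100 100 1015 (by norm_num) 0.18 (by norm_num) 59837450
    (by rw [k1, k2]) (by rw [k2, k3]; norm_num) (by rw [k2, k3]; norm_num)

theorem large_main : ∃ C : ℝ, 1 ≤ C ∧ ∀ (d : ℕ), 100 ≤ d → ∀ f : MvPolynomial (Fin 3) ℤ, f.totalDegree = d →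
    Irreducible (map (algebraMap ℚ (AlgebraicClosure ℚ)) (homogeneousComponent d (map (Int.castRingHom ℚ) f))) →
    Irreducible (map (Int.castRingHom ℚ) f) →
    coeff (Finsupp.single 0 d) f ≠ 0 →
    ∀ B : ℕ, 1 ≤ B → ∀ S : Finset (Fin 3 → ℤ), (∀ x ∈ S, ∀ j, |x j| ≤ (B:ℤ)) → (∀ x ∈ S, eval x f = 0) →
    (S.card : ℝ) ≤ C * (d:ℝ)^13 * B := by
  obtain ⟨K, hK1, hK⟩ := split_lines
  obtain ⟨C, hC1, hC⟩ := surf_large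
  refine ⟨9 + K + 10 * C, by linarith, ?_⟩
  intro d hd f hdeg hirr hirr' htop B hB S hSB hS
  have hdR : (1:ℝ) ≤ d := by exact_mod_cast (by omega : 1 ≤ d)
  have hBR : (1:ℝ) ≤ B := by exact_mod_cast hB
  have hd0 : (0:ℝ) ≤ d := by linarith
  rcases le_total ((B:ℝ)) ((d:ℝ)^12) with hBd | hBd
  · have h1 := trivial_count hdeg.le htop B S hSB hS
    have h2 : (S.card : ℝ) ≤ d * (2 * B + 1)^2 := by exact_mod_cast h1
    have h3 : (2 * (B:ℝ) + 1)^2 ≤ (3 * B)^2 := by gcongr; linarith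
    calc (S.card : ℝ) ≤ d * (3 * B)^2 := h2.trans (by gcongr)
      _ = 9 * d * B * B := by ring
      _ ≤ 9 * d * (d:ℝ)^12 * B := by gcongr
      _ = 9 * (d:ℝ)^13 * B := by ring
      _ ≤ _ := by gcongr; linarith
  · obtain ⟨S', hS', hNL, hcard⟩ := hK d (by omega) f hdeg hirr htop B hB S hSB
    have h1 := hC d hd f hdeg.le htop hirr' B hB S' (fun x hx => hSB x (hS' hx)) (fun x hx => hS x (hS' hx)) hNL
    have hpow : ∀ a b : ℝ, 0 ≤ a → a + b / 12 ≤ 1 → 0 ≤ b → (B:ℝ)^a * (d:ℝ)^b ≤ B := by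
      intro a b ha hab hb
      have e1 : (d:ℝ)^b ≤ (B:ℝ)^(b/12) := by
        calc (d:ℝ)^b = ((d:ℝ)^(12:ℕ))^(b/12) := by
              rw [← Real.rpow_natCast, ← Real.rpow_mul hd0]; congr 1; push_cast; ring
          _ ≤ _ := Real.rpow_le_rpow (by positivity) hBd (by positivity)
      calc (B:ℝ)^a * (d:ℝ)^b ≤ (B:ℝ)^a * (B:ℝ)^(b/12) := by gcongr
        _ = (B:ℝ)^(a + b/12) := by rw [Real.rpow_add (by linarith)]
        _ ≤ (B:ℝ)^(1:ℝ) := Real.rpow_le_rpow_of_exponent_le hBR hab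
        _ = B := Real.rpow_one _
    have q1 := hpow 0.513 2 (by norm_num) (by norm_num) (by norm_num)
    have q2 := hpow 0.873 0 (by norm_num) (by norm_num) (by norm_num)
    have q3 := hpow 0.36 0 (by norm_num) (by norm_num) (by norm_num)
    have q4 := hpow 0 6 (by norm_num) (by norm_num) (by norm_num)
    rw [Real.rpow_zero, mul_one] at q2 q3
    rw [Real.rpow_zero, one_mul] at q4
    have e2 : (d:ℝ)^(2:ℝ) = (d:ℝ)^2 := by exact_mod_cast Real.rpow_natCast (d:ℝ) 2
    have e6 : (d:ℝ)^(6:ℝ) = (d:ℝ)^6 := by exact_mod_cast Real.rpow_natCast (d:ℝ) 6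
    rw [e2] at q1
    rw [e6] at q4
    set b := (B:ℝ)^(0.513:ℝ) with hb
    set u := (B:ℝ)^(0.18:ℝ) with hu
    have hb0 : 0 ≤ b := by positivity
    have hu0 : 0 ≤ u := by positivity
    have hu2 : u^2 = (B:ℝ)^(0.36:ℝ) := by
      rw [hu, ← Real.rpow_natCast, ← Real.rpow_mul (by linarith)]; norm_num
    have hub : u^2 * b = (B:ℝ)^(0.873:ℝ) := by
      rw [hu2, hb, ← Real.rpow_add (by linarith)]; norm_num
    rw [← hub] at q2
    rw [← hu2] at q3
    have dp : ∀ i j : ℕ, i ≤ j → (d:ℝ)^i ≤ (d:ℝ)^j := fun i j h => pow_le_pow_right₀ hdR h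
    have hV : (u + (d:ℝ)^5)^2 ≤ 2 * (u^2 + (d:ℝ)^10) := by nlinarith [sq_nonneg (u - (d:ℝ)^5)]
    have t1 : (d:ℝ)^7 * b ≤ (d:ℝ)^13 * B := by
      calc (d:ℝ)^7 * b ≤ (d:ℝ)^13 * (b * (d:ℝ)^2) := by
            have : 1 * b ≤ (d:ℝ)^2 * b := by gcongr; exact one_le_pow₀ hdR
            have h7 := dp 7 13 (by norm_num)
            calc (d:ℝ)^7 * b ≤ (d:ℝ)^13 * b := by gcongr
              _ ≤ _ := by gcongr; linarith
        _ ≤ _ := by gcongr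
    have t2 : (d:ℝ)^15 ≤ (d:ℝ)^13 * B := by
      calc (d:ℝ)^15 ≤ (d:ℝ)^19 := dp _ _ (by norm_num)
        _ = (d:ℝ)^13 * (d:ℝ)^6 := by ring
        _ ≤ _ := by gcongr
    have t3 : (d:ℝ)^5 * (u^2 * b) ≤ (d:ℝ)^13 * B := by
      have := dp 5 13 (by norm_num); gcongr
    have t4 : (d:ℝ)^9 * u^2 ≤ (d:ℝ)^13 * B := by
      have := dp 9 13 (by norm_num); gcongr
    have t5 : (d:ℝ)^15 * b ≤ (d:ℝ)^13 * B := by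
      calc (d:ℝ)^15 * b = (d:ℝ)^13 * (b * (d:ℝ)^2) := by ring
        _ ≤ _ := by gcongr
    have t6 : (d:ℝ)^19 ≤ (d:ℝ)^13 * B := by
      calc (d:ℝ)^19 = (d:ℝ)^13 * (d:ℝ)^6 := by ring
        _ ≤ _ := by gcongr
    have h2 : (d:ℝ)^7 * (b + (d:ℝ)^8) + (d:ℝ)^5 * (u + (d:ℝ)^5)^2 * (b + (d:ℝ)^4) ≤ 10 * ((d:ℝ)^13 * B) := by
      calc (d:ℝ)^7 * (b + (d:ℝ)^8) + (d:ℝ)^5 * (u + (d:ℝ)^5)^2 * (b + (d:ℝ)^4)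
          ≤ (d:ℝ)^7 * (b + (d:ℝ)^8) + (d:ℝ)^5 * (2 * (u^2 + (d:ℝ)^10)) * (b + (d:ℝ)^4) := by gcongr
        _ = (d:ℝ)^7 * b + (d:ℝ)^15 + 2 * ((d:ℝ)^5 * (u^2 * b)) + 2 * ((d:ℝ)^9 * u^2) + 2 * ((d:ℝ)^15 * b) + 2 * (d:ℝ)^19 := by ring
        _ ≤ _ := by linarith
    have h3 : (d:ℝ)^8 * B ≤ (d:ℝ)^13 * B := by have := dp 8 13 (by norm_num); gcongr
    have h4 : C * ((d:ℝ)^7 * (b + (d:ℝ)^8) + (d:ℝ)^5 * (u + (d:ℝ)^5)^2 * (b + (d:ℝ)^4)) ≤ C * (10 * ((d:ℝ)^13 * B)) := by gcongr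
    have h5 : K * ((d:ℝ)^8 * B) ≤ K * ((d:ℝ)^13 * B) := by gcongr
    have h6 : (0:ℝ) ≤ (d:ℝ)^13 * B := by positivity
    calc (S.card : ℝ) ≤ C * (10 * ((d:ℝ)^13 * B)) + K * ((d:ℝ)^13 * B) := by linarith
      _ ≤ (9 + K + 10 * C) * ((d:ℝ)^13 * B) := by
        have e : (9 + K + 10 * C) * ((d:ℝ)^13 * B) = 9 * ((d:ℝ)^13 * B) + (C * (10 * ((d:ℝ)^13 * B)) + K * ((d:ℝ)^13 * B)) := by ring
        rw [e]; linarith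
      _ = _ := by ring

end

section
open MvPolynomial

/-! ## Global determinant method for fixed degree -/

lemma gain_aff {ι : Type*} [Fintype ι] [DecidableEq ι] (ex : ι → Fin 3 →₀ ℕ) (x : ι → Fin 3 → ℤ)
    (f : MvPolynomial (Fin 3) ℤ) (q W n : ℕ) (good : Finset ι)
    (hf : ∀ i ∈ good, eval (x i) f = 0) (hf' : ∀ i ∈ good, IsCoprime (eval (x i) (pderiv 0 f)) (q:ℤ))
    {Cl : Type*} [DecidableEq Cl] (cls : ι → Cl)
    (hcls : ∀ i ∈ good, ∀ i' ∈ good, cls i = cls i' → ∀ j, (q:ℤ) ∣ x i j - x i' j)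
    (hn : (good.image cls).card ≤ n) :
    (q:ℤ) ^ (W * good.card - n * (W + 2).choose 3) ∣ (Matrix.of fun i e => ∏ j, x i j ^ ex e j).det := by
  have hev : ∀ (g : MvPolynomial (Fin 3) ℤ) (i : ι), eval (fun j => ((x i j : ℤ) : ZMod (q ^ W))) (map (Int.castRingHom _) g)
      = ((eval (x i) g : ℤ) : ZMod (q^W)) := fun g i => (MvPolynomial.map_eval (Int.castRingHom (ZMod (q ^ W))) (x i) g).symm
  refine det_gain (r := 2) _ q W (map (Int.castRingHom _) f) (fun e => map (Int.castRingHom _) (monomial (ex e) 1))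
    (fun i j => (x i j : ZMod (q ^ W))) (fun _ => 1) good cls ?_ ?_ ?_ ?_ n hn
  · intro i _ e
    rw [one_mul, hev, eval_monomial, Finsupp.prod_fintype _ _ (by simp)]
    simp
  · intro i hi i' hi' h j
    obtain ⟨k, hk⟩ := hcls i hi i' hi' h j
    exact ⟨k, by rw [← Int.cast_sub, hk]; push_cast; ring⟩
  · intro i hi
    rw [hev, hf i hi]; simp
  · intro i hi
    rw [pderiv_map, hev]
    have h1 : IsCoprime (eval (x i) (pderiv 0 f)) ((q:ℤ)^W) := (hf' i hi).pow_right
    obtain ⟨a, b, hab⟩ := h1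
    have h2 := congrArg (fun t : ℤ => (t : ZMod (q ^ W))) hab
    push_cast at h2
    have h3 : (q : ZMod (q^W)) ^ W = 0 := by have := ZMod.natCast_self (q ^ W); push_cast at this; exact this
    rw [h3, mul_zero, add_zero] at h2
    exact IsUnit.of_mul_eq_one _ (by rw [mul_comm]; exact h2)

lemma gain_real (s n u : ℝ) (hn : 0 ≤ n) (hu : 1 ≤ u) (h : n * u^2 ≤ 2 * s) (W : ℕ) (hW : W = ⌊u⌋₊) :
    s * (2 * u / 3 - 3) ≤ W * s - n * ((W + 2).choose 3 : ℕ) := by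
  have hW1 : (W:ℝ) ≤ u := by rw [hW]; exact Nat.floor_le (by linarith)
  have hW2 : u - 1 ≤ W := by rw [hW]; have := Nat.lt_floor_add_one u; linarith
  have hW0 : (0:ℝ) ≤ W := by positivity
  have hs : 0 ≤ s := by have : 0 ≤ n * u^2 := by positivity
                        linarith
  have hc : 6 * (((W + 2).choose 3 : ℕ) : ℝ) ≤ u * (u+1) * (u+2) := by
    rcases Nat.eq_zero_or_pos W with h0 | h0
    · rw [h0]; simp; positivity
    · obtain ⟨V, rfl⟩ := Nat.exists_eq_add_of_le' h0
      have h1 := choose3 V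
      have h2 : 6 * (((V + 3).choose 3 : ℕ) : ℝ) = (V+3) * (V+2) * (V+1) := by exact_mod_cast h1
      rw [show V + 1 + 2 = V + 3 by ring, h2]
      push_cast at hW1
      calc ((V:ℝ)+3) * (V+2) * (V+1) = (V+1) * ((V+1) + 1) * ((V+1) + 2) := by ring
        _ ≤ _ := by gcongr
  have h3 : n * (((W + 2).choose 3 : ℕ) : ℝ) ≤ s * ((u + 5) / 3) := by
    have e1 : (u+1) * (u+2) ≤ u * (u + 5) := by nlinarith
    have e2 : u * (u+1) * (u+2) ≤ u^2 * (u + 5) := by nlinarith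
    have e3 : n * (6 * (((W + 2).choose 3 : ℕ) : ℝ)) ≤ n * (u^2 * (u+5)) := mul_le_mul_of_nonneg_left (hc.trans e2) hn
    have e4 : n * u^2 * (u+5) ≤ 2 * s * (u + 5) := by gcongr
    linarith
  have h4 : (u-1) * s ≤ W * s := by gcongr
  have h5 : s ≤ s * u := le_mul_of_one_le_right hs hu
  linarith

lemma log_det (N : ℤ) (hN : N ≠ 0) (Q : Finset ℕ) (hQ : ∀ l ∈ Q, l.Prime) (E : ℕ → ℕ) (hE : ∀ l ∈ Q, (l:ℤ) ^ E l ∣ N)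
    (p : ℕ) (hp : p.Prime) (hpQ : p ∉ Q) (j E0 : ℕ) (hE0 : (((p ^ j : ℕ) : ℤ)) ^ E0 ∣ N) :
    ∑ l ∈ Q, (E l : ℝ) * Real.log l + E0 * Real.log ((p ^ j : ℕ) : ℝ) ≤ Real.log |(N:ℝ)| := by
  have h1 : (∏ l ∈ Q, l ^ E l) ∣ N.natAbs := by
    refine Finset.prod_dvd_of_isRelPrime ?_ ?_
    · intro a ha b hb hab
      exact (Nat.coprime_iff_isRelPrime.1 (Nat.Coprime.pow _ _ ((Nat.coprime_primes (hQ a ha) (hQ b hb)).2 hab)))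
    · intro l hl
      have := hE l hl
      rw [← Nat.cast_pow] at this
      exact Int.natCast_dvd.1 this
  have h2 : (p ^ j) ^ E0 ∣ N.natAbs := by
    rw [← Nat.cast_pow] at hE0
    exact Int.natCast_dvd.1 hE0
  have h3 : Nat.Coprime (∏ l ∈ Q, l ^ E l) ((p ^ j) ^ E0) := by
    refine Nat.Coprime.prod_left fun l hl => ?_
    refine Nat.Coprime.pow _ _ (Nat.Coprime.pow_right _ ((Nat.coprime_primes (hQ l hl) hp).2 ?_))
    rintro rfl; exact hpQ hl
  have h4 := Nat.le_of_dvd (Int.natAbs_pos.2 hN) (h3.mul_dvd_of_dvd_of_dvd h1 h2)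
  have h5 : Real.log ((((∏ l ∈ Q, l ^ E l) * (p ^ j) ^ E0 : ℕ)) : ℝ) ≤ Real.log |(N:ℝ)| := by
    have hpos : 0 < (∏ l ∈ Q, l ^ E l) * (p ^ j) ^ E0 := by
      refine Nat.mul_pos (Finset.prod_pos fun l hl => pow_pos (hQ l hl).pos _) (pow_pos (pow_pos hp.pos _) _)
    refine Real.log_le_log (by exact_mod_cast hpos) ?_
    rw [← Int.cast_abs, Int.abs_eq_natAbs]
    exact_mod_cast h4
  refine le_trans (le_of_eq ?_) h5
  rw [Nat.cast_mul, Real.log_mul, Nat.cast_prod, Real.log_prod, Nat.cast_pow (p^j), Real.log_pow]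
  · congr 1
    refine Finset.sum_congr rfl fun l hl => ?_
    rw [Nat.cast_pow, Real.log_pow]
  · intro l hl
    have := (hQ l hl).ne_zero
    positivity
  · rw [Nat.cast_ne_zero]; exact Finset.prod_ne_zero_iff.2 fun l hl => pow_ne_zero _ (hQ l hl).ne_zero
  · have := hp.ne_zero
    positivity

lemma sum_log_div (N : ℤ) (hN : N ≠ 0) (Y : ℕ) (hY : 1 ≤ Y) (Q : Finset ℕ) (hQ : ∀ l ∈ Q, l.Prime ∧ Y ≤ l ∧ (l:ℤ) ∣ N) :
    ∑ l ∈ Q, Real.log l / l ≤ Real.log |(N:ℝ)| / Y := by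
  have hYR : (1:ℝ) ≤ Y := by exact_mod_cast hY
  have hd : ∏ l ∈ Q, l ∣ N.natAbs := Finset.prod_primes_dvd _ (fun l hl => (hQ l hl).1.prime) fun l hl => Int.natCast_dvd.1 (hQ l hl).2.2
  have hle := Nat.le_of_dvd (Int.natAbs_pos.2 hN) hd
  have h5 : Real.log ((((∏ l ∈ Q, l : ℕ)) : ℝ)) ≤ Real.log |(N:ℝ)| := by
    have hpos : 0 < (∏ l ∈ Q, l) := Finset.prod_pos fun l hl => (hQ l hl).1.pos
    refine Real.log_le_log (by exact_mod_cast hpos) ?_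
    rw [← Int.cast_abs, Int.abs_eq_natAbs]
    exact_mod_cast hle
  rw [Nat.cast_prod, Real.log_prod (fun l hl => by exact_mod_cast (hQ l hl).1.ne_zero)] at h5
  calc ∑ l ∈ Q, Real.log l / l ≤ ∑ l ∈ Q, Real.log l / Y := by
        refine Finset.sum_le_sum fun l hl => ?_
        have h1 : (1:ℝ) ≤ l := by exact_mod_cast (hQ l hl).1.one_lt.le
        have h2 : (Y:ℝ) ≤ l := by exact_mod_cast (hQ l hl).2.1
        exact div_le_div_of_nonneg_left (Real.log_nonneg h1) (by linarith) h2
    _ = (∑ l ∈ Q, Real.log l) / Y := by rw [Finset.sum_div]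
    _ ≤ _ := by gcongr

end

section
open MvPolynomial

lemma log_det_upper (d D : ℕ) (hd : 1 ≤ d) (B : ℕ) (hB : 1 ≤ B) (x : Col 2 d D → Fin 3 → ℤ)
    (hx : ∀ i j, |x i j| ≤ (B:ℤ)) (hdet : (Matrix.of fun i (e : Col 2 d D) => ∏ j, x i j ^ e.ex j).det ≠ 0) :
    Real.log |(((Matrix.of fun i (e : Col 2 d D) => ∏ j, x i j ^ e.ex j).det : ℤ) : ℝ)| ≤
      ((d * (D+2).choose 2 : ℕ) : ℝ) * (Real.log ((d * (D+2).choose 2 : ℕ) : ℝ) + (2 * D / 3 + d / 2) * Real.log B) := by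
  obtain ⟨s, hs⟩ : ∃ s, s = d * (D+2).choose 2 := ⟨_, rfl⟩
  have hs1 : 1 ≤ s := by
    rw [hs]; exact Nat.mul_pos hd (Nat.choose_pos (by omega))
  have hsR : (1:ℝ) ≤ s := by exact_mod_cast hs1
  have hBR : (1:ℝ) ≤ B := by exact_mod_cast hB
  have h1 := det_le_prod (Matrix.of fun i (e : Col 2 d D) => ∏ j, x i j ^ e.ex j) (fun e => B ^ e.ex.degree) (by
    intro i e
    simp only [Matrix.of_apply]
    have := hmon_bound (r := 2) e.ex.degree (x i) 1 e.ex B 1 (hx i) (by simp)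
    simpa [hmon] using this)
  rw [Col.card, ← hs, Finset.prod_pow_eq_pow_sum] at h1
  obtain ⟨c1, hc1⟩ : ∃ c1, c1 = ∑ e : Col 2 d D, e.ex.degree := ⟨_, rfl⟩
  have h2 := Col.sum_deg 2 d D
  rw [← hc1] at h1 h2
  rw [← hs]
  have hc : (c1 : ℝ) ≤ s * (2 * D / 3 + d / 2) := by
    have e1 := choose3 D
    have e2 := choose2 D
    have h2' : 2 * (c1:ℝ) + 2 * d * ((D + 3).choose 3 : ℕ) = d * ((D+2).choose 2 : ℕ) * (d + 1 + 2 * D) := by exact_mod_cast h2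
    have e1' : 6 * (((D + 3).choose 3 : ℕ) : ℝ) = (D+3) * (D+2) * (D+1) := by exact_mod_cast e1
    have e2' : 2 * (((D + 2).choose 2 : ℕ) : ℝ) = (D+2) * (D+1) := by exact_mod_cast e2
    have e3 : (s:ℝ) = d * ((D+2).choose 2 : ℕ) := by rw [hs]; push_cast; rfl
    have e4 : 6 * (((D + 3).choose 3 : ℕ) : ℝ) = (D+3) * (2 * (((D + 2).choose 2 : ℕ) : ℝ)) := by rw [e1', e2']; ring
    have e5 : 2 * (c1:ℝ) = s * (d - 1 + 4 * D / 3) := by rw [e3]; linear_combination h2' - (d / 3 : ℝ) * e4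
    have e6 : (s:ℝ) * (d - 1 + 4 * D / 3) ≤ s * (d + 4 * D / 3) := by gcongr; linarith
    linarith
  have h3 : |(((Matrix.of fun i (e : Col 2 d D) => ∏ j, x i j ^ e.ex j).det : ℤ) : ℝ)| ≤ (s:ℝ) ^ s * (B:ℝ) ^ c1 := by
    rw [← Int.cast_abs]
    refine le_trans (Int.cast_le.2 h1) ?_
    push_cast
    have : (s.factorial : ℝ) ≤ (s:ℝ)^s := by exact_mod_cast Nat.factorial_le_pow s
    gcongr
  have hpos : 0 < |(((Matrix.of fun i (e : Col 2 d D) => ∏ j, x i j ^ e.ex j).det : ℤ) : ℝ)| := abs_pos.2 (by exact_mod_cast hdet)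
  refine (Real.log_le_log hpos h3).trans ?_
  rw [Real.log_mul (by positivity) (by positivity), Real.log_pow, Real.log_pow, mul_add]
  have hlB := Real.log_nonneg hBR
  have := mul_le_mul_of_nonneg_right hc hlB
  linarith

/-- combination of all local gains -/
lemma det_ineq (d D : ℕ) (hd : 5 ≤ d) (hD : 1 ≤ D) (f : MvPolynomial (Fin 3) ℤ) (B : ℕ) (hB : 1 ≤ B)
    (Z : ℝ) (Y : ℕ) (hY : 1 ≤ Y) (c : ℤ)
    (hmod : ∀ l : ℕ, l.Prime → Y < l → ¬ (l:ℤ) ∣ c → ∀ S : Finset (Fin 3 → ZMod l),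
      (∀ P ∈ S, eval P (map (Int.castRingHom (ZMod l)) f) = 0 ∧ eval P (pderiv 0 (map (Int.castRingHom (ZMod l)) f)) ≠ 0) →
      20 * S.card ≤ 21 * l ^ 2)
    (x : Col 2 d D → Fin 3 → ℤ) (hx : ∀ i j, |x i j| ≤ (B:ℤ)) (hxf : ∀ i, eval (x i) f = 0)
    (hx0 : ∀ i, eval (x i) (pderiv 0 f) ≠ 0) (hxZ : ∀ i, |((eval (x i) (pderiv 0 f) : ℤ):ℝ)| ≤ Z)
    (p : ℕ) (hp : p.Prime) (j : ℕ) (hpx : ∀ i, ¬ (p:ℤ) ∣ eval (x i) (pderiv 0 f))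
    (hcls : ∀ i i' k, ((p ^ j : ℕ):ℤ) ∣ x i k - x i' k)
    (hdet : (Matrix.of fun i (e : Col 2 d D) => ∏ j, x i j ^ e.ex j).det ≠ 0)
    (Q : Finset ℕ) (hQ : ∀ l ∈ Q, l.Prime ∧ Y < l ∧ l ≤ D ∧ l ≠ p ∧ ¬ (l:ℤ) ∣ c) :
    4.36 / 3 * (∑ l ∈ Q, Real.log l / l + Real.log ((p ^ j : ℕ):ℝ)) ≤
      (3 * Real.log ((p ^ j : ℕ):ℝ) + Real.log ((d * (D+2).choose 2 : ℕ) : ℝ)) / D + (2 / 3 + d / (2 * D)) * Real.log B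
       + 3 * Real.log 4 + 2.18 * Real.log Z / Y := by
  classical
  have hup := log_det_upper d D (by omega) B hB x hx hdet
  obtain ⟨N, hN⟩ : ∃ N, N = (Matrix.of fun i (e : Col 2 d D) => ∏ j, x i j ^ e.ex j).det := ⟨_, rfl⟩
  obtain ⟨s, hs⟩ : ∃ s, s = d * (D+2).choose 2 := ⟨_, rfl⟩
  have hcard : Fintype.card (Col 2 d D) = s := by rw [Col.card, hs]
  rw [← hs, ← hN] at hup
  rw [← hs]
  have hDR : (1:ℝ) ≤ D := by exact_mod_cast hD
  have hdR : (5:ℝ) ≤ d := by exact_mod_cast hd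
  have hYR : (1:ℝ) ≤ Y := by exact_mod_cast hY
  have hs5 : 5 * (D:ℝ)^2 ≤ 2 * s := by
    have e2 := choose2 D
    have e2' : 2 * (((D + 2).choose 2 : ℕ) : ℝ) = (D+2) * (D+1) := by exact_mod_cast e2
    have e3 : (s:ℝ) = d * ((D+2).choose 2 : ℕ) := by rw [hs]; push_cast; rfl
    have e4 : 2 * (s:ℝ) = d * ((D+2) * (D+1)) := by rw [e3, ← e2']; ring
    rw [e4]
    calc 5 * (D:ℝ)^2 ≤ d * (D:ℝ)^2 := by gcongr
      _ ≤ _ := by gcongr; nlinarith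
  have hs0 : (0:ℝ) < s := by have : 0 < (D:ℝ)^2 := by positivity
                             linarith
  let bad : ℕ → Finset (Col 2 d D) := fun l => Finset.univ.filter fun i => (l:ℤ) ∣ eval (x i) (pderiv 0 f)
  let good : ℕ → Finset (Col 2 d D) := fun l => Finset.univ.filter fun i => ¬ (l:ℤ) ∣ eval (x i) (pderiv 0 f)
  have hgb : ∀ l, ((good l).card : ℝ) = s - (bad l).card := by
    intro l
    have h1 : (bad l).card + (good l).card = s := by
      rw [← hcard, ← Finset.card_univ]; exact Finset.card_filter_add_card_filter_not _
    have h2 : ((bad l).card : ℝ) + (good l).card = s := by exact_mod_cast h1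
    linarith
  have hgain : ∀ l, ∃ E : ℕ, l ∈ Q → (l:ℤ)^E ∣ N ∧ (s:ℝ) * (4.36/3 * D / l - 3) - 2.18 * D / l * (bad l).card ≤ (E:ℝ) := by
    intro l
    by_cases hl : l ∈ Q
    swap
    · exact ⟨0, fun h => absurd h hl⟩
    obtain ⟨hlp, hlY, hlD, -, hlc⟩ := hQ l hl
    have : Fact l.Prime := ⟨hlp⟩
    let cls : Col 2 d D → Fin 3 → ZMod l := fun i k => (x i k : ZMod l)
    obtain ⟨n, hn⟩ : ∃ n, n = ((good l).image cls).card := ⟨_, rfl⟩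
    have hn2 : 20 * n ≤ 21 * l ^ 2 := by
      rw [hn]
      refine hmod l hlp hlY hlc _ ?_
      intro P hP
      obtain ⟨i, hi, rfl⟩ := Finset.mem_image.1 hP
      have hi' := (Finset.mem_filter.1 hi).2
      have e1 : ∀ g : MvPolynomial (Fin 3) ℤ, eval (cls i) (map (Int.castRingHom (ZMod l)) g) = ((eval (x i) g : ℤ) : ZMod l) :=
        fun g => (MvPolynomial.map_eval (Int.castRingHom (ZMod l)) (x i) g).symm
      refine ⟨by rw [e1, hxf]; simp, ?_⟩
      rw [pderiv_map, e1]
      intro h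
      exact hi' ((ZMod.intCast_zmod_eq_zero_iff_dvd _ _).1 h)
    have hlR : (0:ℝ) < l := by exact_mod_cast hlp.pos
    set u : ℝ := 2.18 * D / l with hu
    have hu1 : 1 ≤ u := by
      rw [hu, le_div_iff₀ hlR]
      have : (l:ℝ) ≤ D := by exact_mod_cast hlD
      linarith
    obtain ⟨W, hW⟩ : ∃ W, W = ⌊u⌋₊ := ⟨_, rfl⟩
    have hWu : (W:ℝ) ≤ u := by rw [hW]; exact Nat.floor_le (by linarith)
    have hg := gain_aff Col.ex x f l W n (good l) (fun i _ => hxf i) (by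
      intro i hi
      have hi' := (Finset.mem_filter.1 hi).2
      have hpr : Prime (l:ℤ) := Nat.prime_iff_prime_int.1 hlp
      exact ((Prime.coprime_iff_not_dvd hpr).2 hi').symm) cls (by
      intro i _ i' _ h k
      rw [← ZMod.intCast_zmod_eq_zero_iff_dvd]
      push_cast
      exact sub_eq_zero.2 (congrFun h k)) hn.ge
    rw [← hN] at hg
    refine ⟨_, fun _ => ⟨hg, ?_⟩⟩
    have hnu : (n:ℝ) * u^2 ≤ 2 * s := by
      have h1 : 20 * (n:ℝ) ≤ 21 * (l:ℝ)^2 := by exact_mod_cast hn2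
      have h2 : (l:ℝ)^2 * u^2 = 2.18^2 * (D:ℝ)^2 := by rw [hu]; field_simp
      have h3 : 20 * ((n:ℝ) * u^2) ≤ 21 * ((l:ℝ)^2 * u^2) := by
        have := mul_le_mul_of_nonneg_right h1 (sq_nonneg u); linarith
      rw [h2] at h3
      have h4 : 0 ≤ (D:ℝ)^2 := by positivity
      linarith
    have h5 := gain_real s n u (by positivity) hu1 hnu W hW
    have h6 : (W:ℝ) * (good l).card - n * ((W+2).choose 3 : ℕ) ≤ ((W * (good l).card - n * (W + 2).choose 3 : ℕ) : ℝ) := by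
      have : W * (good l).card ≤ (W * (good l).card - n * (W + 2).choose 3) + n * (W+2).choose 3 := by omega
      have h7 : (W:ℝ) * (good l).card ≤ ((W * (good l).card - n * (W + 2).choose 3 : ℕ) : ℝ) + n * ((W+2).choose 3 : ℕ) := by exact_mod_cast this
      linarith
    refine le_trans ?_ h6
    rw [hgb]
    have h8 : (W:ℝ) * (bad l).card ≤ u * (bad l).card := by gcongr
    have h9 : (4.36/3 * D / l : ℝ) = 2 * u / 3 := by rw [hu]; ring
    rw [h9]
    linarith
  choose E hE using hgain
  have hgain0 : ∃ E0 : ℕ, ((p ^ j : ℕ):ℤ)^E0 ∣ N ∧ (s:ℝ) * (4.36/3 * D - 3) ≤ (E0:ℝ) := by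
    set u : ℝ := 2.18 * D with hu
    have hu1 : 1 ≤ u := by rw [hu]; linarith
    obtain ⟨W, hW⟩ : ∃ W, W = ⌊u⌋₊ := ⟨_, rfl⟩
    have hg := gain_aff Col.ex x f (p^j) W 1 Finset.univ (fun i _ => hxf i) (by
      intro i _
      have hpr : Prime (p:ℤ) := Nat.prime_iff_prime_int.1 hp
      push_cast
      exact (((Prime.coprime_iff_not_dvd hpr).2 (hpx i)).symm).pow_right) (fun _ => ()) (by
      intro i _ i' _ _ k
      exact hcls i i' k) (Finset.card_le_one.2 (by simp))
    rw [← hN, Finset.card_univ, hcard] at hg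
    refine ⟨_, hg, ?_⟩
    have hnu : (1:ℝ) * u^2 ≤ 2 * s := by
      have h4 : 0 ≤ (D:ℝ)^2 := by positivity
      rw [hu, one_mul, mul_pow]
      linarith
    have h5 := gain_real s 1 u (by positivity) hu1 hnu W hW
    have h6 : (W:ℝ) * s - 1 * ((W+2).choose 3 : ℕ) ≤ ((W * s - 1 * (W + 2).choose 3 : ℕ) : ℝ) := by
      have : W * s ≤ (W * s - 1 * (W + 2).choose 3) + 1 * (W+2).choose 3 := by omega
      have h7 : (W:ℝ) * s ≤ ((W * s - 1 * (W + 2).choose 3 : ℕ) : ℝ) + 1 * ((W+2).choose 3 : ℕ) := by exact_mod_cast this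
      linarith
    have h9 : (4.36/3 * D : ℝ) = 2 * u / 3 := by rw [hu]; ring
    rw [h9]
    linarith
  obtain ⟨E0, hE0, hE0'⟩ := hgain0
  have hlow := log_det N (by rw [hN]; exact hdet) Q (fun l hl => (hQ l hl).1) E (fun l hl => (hE l hl).1) p hp
    (fun h => (hQ p h).2.2.2.1 rfl) j E0 hE0
  have hq0 : 0 ≤ Real.log ((p ^ j : ℕ):ℝ) := Real.log_natCast_nonneg _
  set q := Real.log ((p ^ j : ℕ):ℝ) with hq
  have hll : ∀ l ∈ Q, 0 ≤ Real.log l := fun l _ => Real.log_natCast_nonneg _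
  have a1 : ∑ l ∈ Q, (s * (4.36/3 * D / l - 3) - 2.18 * D / l * (bad l).card) * Real.log l ≤ ∑ l ∈ Q, (E l : ℝ) * Real.log l :=
    Finset.sum_le_sum fun l hl => mul_le_mul_of_nonneg_right (hE l hl).2 (hll l hl)
  have a2 : ∑ l ∈ Q, (s * (4.36/3 * D / l - 3) - 2.18 * D / l * (bad l).card) * Real.log l
     = s * D * (4.36/3 * ∑ l ∈ Q, Real.log l / l) - 3 * s * ∑ l ∈ Q, Real.log l - 2.18 * D * ∑ l ∈ Q, Real.log l / l * (bad l).card := by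
    rw [Finset.mul_sum, Finset.mul_sum, Finset.mul_sum, Finset.mul_sum, ← Finset.sum_sub_distrib, ← Finset.sum_sub_distrib]
    exact Finset.sum_congr rfl fun l _ => by ring
  have a3 : ∑ l ∈ Q, Real.log l ≤ Real.log 4 * D := by
    refine le_trans ?_ (Chebyshev.theta_le_log4_mul_x (x := D) (by positivity))
    rw [Chebyshev.theta_eq_sum_Icc, Nat.floor_natCast]
    refine Finset.sum_le_sum_of_subset_of_nonneg ?_ fun l _ _ => Real.log_natCast_nonneg _
    intro l hl
    obtain ⟨h1, h2, h3, -⟩ := hQ l hl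
    rw [Finset.mem_filter, Finset.mem_Icc]
    exact ⟨⟨by omega, h3⟩, h1⟩
  have a4 : ∑ l ∈ Q, Real.log l / l * (bad l).card ≤ s * (Real.log Z / Y) := by
    have e1 : ∑ l ∈ Q, Real.log l / l * (bad l).card = ∑ i : Col 2 d D, ∑ l ∈ Q.filter (fun l : ℕ => (l:ℤ) ∣ eval (x i) (pderiv 0 f)), Real.log l / l := by
      simp_rw [Finset.sum_filter]
      rw [Finset.sum_comm]
      refine Finset.sum_congr rfl fun l _ => ?_
      rw [← Finset.sum_filter, Finset.sum_const, nsmul_eq_mul, mul_comm]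
    rw [e1, ← hcard, ← Finset.card_univ, ← nsmul_eq_mul]
    refine Finset.sum_le_card_nsmul _ _ _ fun i _ => ?_
    refine (sum_log_div _ (hx0 i) Y hY _ fun l hl => ?_).trans ?_
    · rw [Finset.mem_filter] at hl
      obtain ⟨h1, h2, h3, -⟩ := hQ l hl.1
      exact ⟨h1, h2.le, hl.2⟩
    · have : Real.log |((eval (x i) (pderiv 0 f) : ℤ):ℝ)| ≤ Real.log Z :=
        Real.log_le_log (abs_pos.2 (by exact_mod_cast hx0 i)) (hxZ i)
      gcongr
  have a5 : s * (4.36/3 * D - 3) * q ≤ E0 * q := mul_le_mul_of_nonneg_right hE0' hq0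
  have a6 : 3 * s * ∑ l ∈ Q, Real.log l ≤ 3 * s * (Real.log 4 * D) := mul_le_mul_of_nonneg_left a3 (by positivity)
  have a7 : 2.18 * D * ∑ l ∈ Q, Real.log l / l * (bad l).card ≤ 2.18 * D * (s * (Real.log Z / Y)) := mul_le_mul_of_nonneg_left a4 (by positivity)
  set G := ∑ l ∈ Q, Real.log l / l
  have hfin : (s:ℝ) * D * (4.36/3 * (G + q)) ≤ s * D * ((3 * q + Real.log s) / D + (2 / 3 + d / (2 * D)) * Real.log B
       + 3 * Real.log 4 + 2.18 * Real.log Z / Y) := by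
    have e : (s:ℝ) * D * ((3 * q + Real.log s) / D + (2 / 3 + d / (2 * D)) * Real.log B
       + 3 * Real.log 4 + 2.18 * Real.log Z / Y) = 3 * s * q + s * (Real.log s + (2 * D / 3 + d / 2) * Real.log B) + 3 * s * (Real.log 4 * D) + 2.18 * D * (s * (Real.log Z / Y)) := by
      field_simp
      ring
    rw [e]
    linarith
  exact le_of_mul_le_mul_left hfin (by positivity)

end

section
open MvPolynomial

lemma mertens_restrict (D Y : ℕ) (hY : 1 ≤ Y) (c : ℤ) (hc : c ≠ 0) (p : ℕ) (Cm : ℝ)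
    (hm : Real.log D - Cm ≤ ∑ p ∈ (Finset.Ioc 0 D).filter Nat.Prime, Real.log p / p) :
    Real.log D - Cm - ∑ l ∈ Finset.range (Y+1), Real.log l / l - 1 - Real.log |(c:ℝ)| / Y ≤
    ∑ l ∈ (Finset.Ioc 0 D).filter (fun l : ℕ => l.Prime ∧ Y < l ∧ l ≤ D ∧ l ≠ p ∧ ¬ (l:ℤ) ∣ c), Real.log l / l := by
  classical
  have hnn : ∀ l : ℕ, 0 ≤ Real.log l / l := fun l => div_nonneg (Real.log_natCast_nonneg _) (by positivity)
  set P := (Finset.Ioc 0 D).filter Nat.Prime with hP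
  have h1 := Finset.sum_filter_add_sum_filter_not P (fun l => l ≤ Y) (fun l : ℕ => Real.log l / l)
  set P1 := P.filter fun l => ¬ l ≤ Y with hP1
  have h2 := Finset.sum_filter_add_sum_filter_not P1 (fun l : ℕ => (l:ℤ) ∣ c) (fun l : ℕ => Real.log l / l)
  set P2 := P1.filter fun l : ℕ => ¬ (l:ℤ) ∣ c with hP2
  have h3 := Finset.sum_filter_add_sum_filter_not P2 (fun l : ℕ => l = p) (fun l : ℕ => Real.log l / l)
  have e1 : ∑ l ∈ P.filter (fun l => l ≤ Y), Real.log l / l ≤ ∑ l ∈ Finset.range (Y+1), Real.log l / l := by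
    refine Finset.sum_le_sum_of_subset_of_nonneg ?_ fun l _ _ => hnn l
    intro l hl
    rw [Finset.mem_filter] at hl
    rw [Finset.mem_range]; omega
  have e2 : ∑ l ∈ P1.filter (fun l : ℕ => (l:ℤ) ∣ c), Real.log l / l ≤ Real.log |(c:ℝ)| / Y := by
    refine sum_log_div c hc Y hY _ ?_
    intro l hl
    rw [Finset.mem_filter, hP1, Finset.mem_filter, hP, Finset.mem_filter] at hl
    exact ⟨hl.1.1.2, by omega, hl.2⟩
  have e3 : ∑ l ∈ P2.filter (fun l : ℕ => l = p), Real.log l / l ≤ 1 := by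
    have : ∑ l ∈ P2.filter (fun l : ℕ => l = p), Real.log l / l ≤ ∑ l ∈ {p}, Real.log l / l := by
      refine Finset.sum_le_sum_of_subset_of_nonneg ?_ fun l _ _ => hnn l
      intro l hl
      rw [Finset.mem_filter] at hl
      simp [hl.2]
    refine this.trans ?_
    rw [Finset.sum_singleton]
    rcases Nat.eq_zero_or_pos p with h | h
    · simp [h]
    · have hp : (0:ℝ) < p := by exact_mod_cast h
      rw [div_le_one hp]
      have := Real.log_le_sub_one_of_pos hp
      linarith
  have e4 : P2.filter (fun l => ¬ l = p) = (Finset.Ioc 0 D).filter (fun l : ℕ => l.Prime ∧ Y < l ∧ l ≤ D ∧ l ≠ p ∧ ¬ (l:ℤ) ∣ c) := by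
    ext l
    simp only [hP2, hP1, hP, Finset.mem_filter, Finset.mem_Ioc]
    constructor
    · rintro ⟨⟨⟨⟨a, b⟩, c⟩, d⟩, e⟩; exact ⟨a, b, by omega, a.2, e, d⟩
    · rintro ⟨a, b, c, _, d, e⟩; exact ⟨⟨⟨⟨a, b⟩, by omega⟩, e⟩, d⟩
  rw [e4] at h3
  linarith

/-- points in one residue class mod `p^j` lie on an auxiliary surface of small degree -/
lemma surf_class (d : ℕ) (hd : 5 ≤ d) (Cz κ : ℝ) (hCz : 1 ≤ Cz) (hκ : 0 ≤ κ) : ∃ K : ℕ, 1 ≤ K ∧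
    ∀ f : MvPolynomial (Fin 3) ℤ, f.totalDegree ≤ d → ∀ B : ℕ, 1 ≤ B →
    coeff (Finsupp.single 0 d) f * rupDelta d (dehom ℤ (homogeneousComponent d f)) ≠ 0 →
    |((coeff (Finsupp.single 0 d) f * rupDelta d (dehom ℤ (homogeneousComponent d f)) : ℤ) : ℝ)| ≤ Cz * (B:ℝ)^κ →
    ∀ (p : ℕ), p.Prime → ∀ (j : ℕ) (T : Set (Fin 3 → ℤ)), (∀ x ∈ T, ∀ k, |x k| ≤ (B:ℤ)) → (∀ x ∈ T, eval x f = 0) →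
    (∀ x ∈ T, |((eval x (pderiv 0 f) : ℤ):ℝ)| ≤ Cz * (B:ℝ)^κ) → (∀ x ∈ T, ¬ (p:ℤ) ∣ eval x (pderiv 0 f)) →
    (∀ x ∈ T, ∀ y ∈ T, ∀ k, ((p ^ j : ℕ):ℤ) ∣ x k - y k) →
    ∀ D : ℕ, K ≤ D → (K:ℝ) * (B:ℝ)^(0.47:ℝ) ≤ D * ((p ^ j : ℕ) : ℝ) →
    ∃ G : MvPolynomial (Fin 3) ℚ, G ≠ 0 ∧ G.totalDegree ≤ D + d ∧ degreeOf 0 G < d ∧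
      ∀ x ∈ T, eval (fun j => (x j : ℚ)) G = 0 := by
  classical
  obtain ⟨Y1, hY1⟩ := surf_mod d (by omega)
  obtain ⟨Cm, hCm0, hCm⟩ := mertens
  obtain ⟨Y, hY⟩ : ∃ Y, Y = Y1 + 1 + ⌈1000 * κ⌉₊ := ⟨_, rfl⟩
  have hYκ : 1000 * κ ≤ Y := by
    have := Nat.le_ceil (1000 * κ)
    rw [hY]; push_cast; have : (0:ℝ) ≤ Y1 := by positivity
    linarith
  have hYp : 1 ≤ Y := by omega
  have hYR : (1:ℝ) ≤ Y := by exact_mod_cast hYp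
  set CY := ∑ l ∈ Finset.range (Y+1), Real.log l / l with hCY
  have hCY0 : 0 ≤ CY := Finset.sum_nonneg fun l _ => div_nonneg (Real.log_natCast_nonneg _) (by positivity)
  have hlz : 0 ≤ Real.log Cz := Real.log_nonneg hCz
  have hl4 : 0 ≤ Real.log 4 := Real.log_nonneg (by norm_num)
  set K1 := 4.36/3 * (Cm + CY + 1) + 3 * d + 2 + 3 * Real.log 4 + 4 * Real.log Cz with hK1
  have hK10 : 0 < K1 := by have : (0:ℝ) ≤ d := by positivity
                           have : 0 ≤ 4.36/3 * (Cm + CY + 1) := by positivity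
                           linarith
  refine ⟨⌈Real.exp K1⌉₊ + 1000 * d, by omega, ?_⟩
  intro f hf B hB hc0 hcZ p hp j T hTB hTf hTZ hTp hTc D hD hDq
  set K := ⌈Real.exp K1⌉₊ + 1000 * d with hKd
  have hKexp : Real.exp K1 ≤ K := by
    have := Nat.le_ceil (Real.exp K1)
    rw [hKd]; push_cast; have : (0:ℝ) ≤ d := by positivity
    linarith
  have hD1000 : 1000 * d ≤ D := by omega
  have hD1000R : 1000 * (d:ℝ) ≤ D := by exact_mod_cast hD1000
  have hdR : (5:ℝ) ≤ d := by exact_mod_cast hd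
  have hDR : (1000:ℝ) ≤ D := by linarith
  have hBR : (1:ℝ) ≤ B := by exact_mod_cast hB
  set c := coeff (Finsupp.single 0 d) f * rupDelta d (dehom ℤ (homogeneousComponent d f)) with hc
  obtain ⟨v, hv0, hv⟩ := vanish_vec (ι := Col 2 d D) T (fun x e => ∏ k, x k ^ e.ex k) (by
    intro x hxT
    by_contra hdet
    have hmod : ∀ l : ℕ, l.Prime → Y < l → ¬ (l:ℤ) ∣ c → ∀ S : Finset (Fin 3 → ZMod l),
      (∀ P ∈ S, eval P (map (Int.castRingHom (ZMod l)) f) = 0 ∧ eval P (pderiv 0 (map (Int.castRingHom (ZMod l)) f)) ≠ 0) →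
      20 * S.card ≤ 21 * l ^ 2 := by
      intro l hl hlY hlc S hS
      have : Fact l.Prime := ⟨hl⟩
      refine hY1 f hf l (by omega) ?_ ?_ S hS
      · intro h
        exact hlc (Dvd.dvd.mul_right ((ZMod.intCast_zmod_eq_zero_iff_dvd _ _).1 h) _)
      · intro h
        exact hlc (Dvd.dvd.mul_left ((ZMod.intCast_zmod_eq_zero_iff_dvd _ _).1 h) _)
    have hmain := det_ineq d D hd (by omega) f B hB (Cz * (B:ℝ)^κ) Y hYp c hmod x (fun i => hTB _ (hxT i)) (fun i => hTf _ (hxT i))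
      (fun i h => hTp _ (hxT i) (h ▸ dvd_zero _)) (fun i => hTZ _ (hxT i)) p hp j (fun i => hTp _ (hxT i))
      (fun i i' k => hTc _ (hxT i) _ (hxT i') k) hdet
      ((Finset.Ioc 0 D).filter (fun l : ℕ => l.Prime ∧ Y < l ∧ l ≤ D ∧ l ≠ p ∧ ¬ (l:ℤ) ∣ c)) (fun l hl => (Finset.mem_filter.1 hl).2)
    have hG := mertens_restrict D Y hYp c hc0 p Cm (hCm D (by omega))
    rw [← hCY] at hG
    set G := ∑ l ∈ (Finset.Ioc 0 D).filter (fun l : ℕ => l.Prime ∧ Y < l ∧ l ≤ D ∧ l ≠ p ∧ ¬ (l:ℤ) ∣ c), Real.log l / l with hGd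
    have hq0 : 0 ≤ Real.log ((p ^ j : ℕ):ℝ) := Real.log_natCast_nonneg _
    have hqpos : (0:ℝ) < ((p ^ j : ℕ):ℝ) := by exact_mod_cast pow_pos hp.pos j
    set q := Real.log ((p ^ j : ℕ):ℝ) with hq
    have hb0 : 0 ≤ Real.log B := Real.log_nonneg hBR
    set b := Real.log B with hb
    have hlD : 0 ≤ Real.log D := Real.log_natCast_nonneg _
    set lD := Real.log D with hlDd
    have hZ : Real.log (Cz * (B:ℝ)^κ) = Real.log Cz + κ * b := by
      rw [Real.log_mul (by positivity) (by positivity), Real.log_rpow (by positivity)]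
    have hZY : Real.log (Cz * (B:ℝ)^κ) / Y ≤ Real.log Cz + b / 1000 := by
      rw [hZ, div_le_iff₀ (by linarith)]
      have e1 : Real.log Cz * 1 ≤ Real.log Cz * Y := by gcongr
      have e2 : (1000 * κ) * b ≤ Y * b := by gcongr
      linarith
    have hcY : Real.log |(c:ℝ)| / Y ≤ Real.log Cz + b / 1000 := by
      refine le_trans ?_ hZY
      have : Real.log |(c:ℝ)| ≤ Real.log (Cz * (B:ℝ)^κ) := Real.log_le_log (abs_pos.2 (by exact_mod_cast hc0)) hcZ
      gcongr
    have hDq' : 0.47 * b + K1 ≤ lD + q := by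
      have e1 : Real.exp K1 * (B:ℝ)^(0.47:ℝ) ≤ D * ((p ^ j : ℕ) : ℝ) := le_trans (by gcongr) hDq
      have e2 := Real.log_le_log (by positivity) e1
      rw [Real.log_mul (by positivity) (by positivity), Real.log_exp, Real.log_rpow (by positivity), Real.log_mul (by positivity) hqpos.ne'] at e2
      linarith
    have hD0 : (0:ℝ) < D := by linarith
    have f1 : 3 * q / D ≤ 0.003 * q := by
      rw [div_le_iff₀ hD0]
      have := mul_le_mul_of_nonneg_left hDR hq0
      linarith
    have f2 : Real.log ((d * (D+2).choose 2 : ℕ) : ℝ) / D ≤ 3 * d + 2 := by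
      have e2 := choose2 D
      have e2' : 2 * (((D + 2).choose 2 : ℕ) : ℝ) = (D+2) * (D+1) := by exact_mod_cast e2
      have e3 : ((d * (D+2).choose 2 : ℕ) : ℝ) ≤ 3 * d * (D:ℝ)^2 := by
        push_cast
        have : (((D + 2).choose 2 : ℕ) : ℝ) ≤ 3 * (D:ℝ)^2 := by nlinarith
        calc (d:ℝ) * ((D + 2).choose 2 : ℕ) ≤ d * (3 * (D:ℝ)^2) := by gcongr
          _ = _ := by ring
      have epos : (0:ℝ) < ((d * (D+2).choose 2 : ℕ) : ℝ) := by
        exact_mod_cast Nat.mul_pos (by omega) (Nat.choose_pos (by omega))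
      have e4 := Real.log_le_log epos e3
      rw [Real.log_mul (by positivity) (by positivity), Real.log_pow] at e4
      push_cast at e4
      have e5 := Real.log_le_sub_one_of_pos (by positivity : (0:ℝ) < 3 * d)
      have e6 := Real.log_le_sub_one_of_pos hD0
      rw [div_le_iff₀ hD0]
      have e7 : 3 * (d:ℝ) * 1 ≤ 3 * d * D := by gcongr; linarith
      push_cast at e4 ⊢
      linarith
    have f3 : (d:ℝ) / (2 * D) * b ≤ 0.0005 * b := by
      refine mul_le_mul_of_nonneg_right ?_ hb0
      rw [div_le_iff₀ (by positivity)]; linarith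
    rw [add_div, add_mul, mul_div_assoc] at hmain
    rw [mul_div_assoc] at f1
    rw [mul_div_assoc] at hmain
    linarith)
  refine ⟨colPoly v, colPoly_ne hv0, (colPoly_deg v).trans (by omega), colPoly_degOf (by omega) v, ?_⟩
  intro x hx
  have := colPoly_eval v x 1 one_ne_zero (by
    have h1 := hv x hx
    rw [← h1]
    refine Finset.sum_congr rfl fun e _ => ?_
    simp [hmon])
  simpa using this

end

section
open MvPolynomial

lemma factor_assoc {α : Type*} (S : Finset α) (R : α → MvPolynomial (Fin 2) ℚ) (hR : ∀ x ∈ S, Irreducible (R x)) (M : ℕ) (G : MvPolynomial (Fin 2) ℚ) (hG : G ≠ 0)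
    (h : ∀ R0 : MvPolynomial (Fin 2) ℚ, Irreducible R0 → R0 ∣ G → ∀ S' ⊆ S, (∀ x ∈ S', R x ∣ R0) → S'.card ≤ M * R0.totalDegree) :
    ∀ S' ⊆ S, (∀ x ∈ S', R x ∣ G) → S'.card ≤ M * G.totalDegree := by
  classical
  induction G using WfDvdMonoid.induction_on_irreducible with
  | zero => exact absurd rfl hG
  | unit u hu =>
    intro S' hS hd
    have : S' = ∅ := by
      rw [Finset.eq_empty_iff_forall_notMem]
      intro x hx
      exact (hR x (hS hx)).not_isUnit (isUnit_of_dvd_unit (hd x hx) hu)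
    rw [this]; simp
  | mul a i ha hi ih =>
    intro S' hS hd
    have h1 := ih ha (fun R hR hRa => h R hR (hRa.mul_left i)) (S'.filter fun x => R x ∣ a) ((Finset.filter_subset _ _).trans hS) (fun x hx => (Finset.mem_filter.1 hx).2)
    have h2 := h i hi (dvd_mul_right i a) (S'.filter fun x => R x ∣ i) ((Finset.filter_subset _ _).trans hS) (fun x hx => (Finset.mem_filter.1 hx).2)
    have h3 : S' ⊆ (S'.filter fun x => R x ∣ i) ∪ (S'.filter fun x => R x ∣ a) := by
      intro x hx
      have := (hR x (hS hx)).prime.dvd_or_dvd (hd x hx)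
      simp only [Finset.mem_filter, Finset.mem_union]
      tauto
    have h4 := (Finset.card_le_card h3).trans (Finset.card_union_le _ _)
    rw [totalDegree_mul_of_isDomain hi.ne_zero ha, mul_add]
    omega

lemma tail_card {d : ℕ} {f : MvPolynomial (Fin 3) ℤ} (hf : f.totalDegree ≤ d)
    (htop : coeff (Finsupp.single 0 d) f ≠ 0) (T : Finset (Fin 3 → ℤ)) (hT : ∀ x ∈ T, eval x f = 0)
    [DecidableEq (Fin 2 → ℚ)] :
    T.card ≤ d * (T.image (fun x (i : Fin 2) => (x i.succ : ℚ))).card := by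
  classical
  refine Finset.card_le_mul_card_image (s := T) (f := fun x (i : Fin 2) => (x i.succ : ℚ)) d ?_
  intro y hy
  obtain ⟨x0, hx0, rfl⟩ := Finset.mem_image.1 hy
  refine fiberZ hf htop (Fin.tail x0) _ ?_
  intro P hP
  rw [Finset.mem_filter] at hP
  refine ⟨hT P hP.1, ?_⟩
  funext i
  have := congrFun hP.2 i
  simp only [Fin.tail]
  exact_mod_cast this

lemma level_count {d : ℕ} {f : MvPolynomial (Fin 3) ℤ} (hf : f.totalDegree ≤ d)
    (htop : coeff (Finsupp.single 0 d) f ≠ 0) (U : Finset (Fin 3 → ℤ)) (hU : ∀ x ∈ U, eval x f = 0)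
    (R : (Fin 3 → ℤ) → MvPolynomial (Fin 2) ℚ) (hR : ∀ x ∈ U, Irreducible (R x))
    (hRx : ∀ x ∈ U, eval (fun i : Fin 2 => (x i.succ : ℚ)) (R x) = 0)
    (G H : MvPolynomial (Fin 2) ℚ) (hG : G ≠ 0) (hH : H ≠ 0)
    (hGx : ∀ x ∈ U, eval (fun i : Fin 2 => (x i.succ : ℚ)) G = 0)
    (hRG : ∀ x ∈ U, ¬ R x ∣ G) (hRH : ∀ x ∈ U, R x ∣ H) :
    U.card ≤ d * G.totalDegree * H.totalDegree := by
  classical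
  refine factor_assoc U R hR _ H hH ?_ U (Finset.Subset.refl _) hRH
  intro R0 hR0 hR0H S' hS' hSR
  rcases S'.eq_empty_or_nonempty with h0 | ⟨x0, hx0⟩
  · rw [h0]; simp
  have hng : ¬ R0 ∣ G := fun h => hRG x0 (hS' hx0) ((hSR x0 hx0).trans h)
  have h1 := tail_card hf htop S' (fun x hx => hU x (hS' hx))
  have h2 := bez2_points hG hR0.ne_zero ((hR0.dvd_or_isRelPrime (n := G)).resolve_left hng).symm (S'.image (fun x (i : Fin 2) => (x i.succ : ℚ))) (by
    intro P hP
    obtain ⟨x, hx, rfl⟩ := Finset.mem_image.1 hP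
    refine ⟨hGx x (hS' hx), ?_⟩
    obtain ⟨c, hc⟩ := hSR x hx
    rw [hc, map_mul, hRx x (hS' hx), zero_mul])
  calc S'.card ≤ d * (S'.image (fun x (i : Fin 2) => (x i.succ : ℚ))).card := h1
    _ ≤ d * (G.totalDegree * R0.totalDegree) := by gcongr
    _ = _ := by ring

lemma proj_aux {d : ℕ} (hd : 1 ≤ d) {f : MvPolynomial (Fin 3) ℤ} (hf : f.totalDegree ≤ d)
    (htop : coeff (Finsupp.single 0 d) f ≠ 0) (hirr : Irreducible (map (Int.castRingHom ℚ) f))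
    (G : MvPolynomial (Fin 3) ℚ) (hG : G ≠ 0) (hG0 : degreeOf 0 G < d) (e : ℕ) (hGe : G.totalDegree ≤ e) :
    ∃ q : MvPolynomial (Fin 2) ℚ, q ≠ 0 ∧ q.totalDegree ≤ 2 * (d * e) ∧
      ∀ x : Fin 3 → ℤ, eval x f = 0 → eval (fun i => (x i : ℚ)) G = 0 → eval (fun i : Fin 2 => (x i.succ : ℚ)) q = 0 := by
  classical
  set F := map (Int.castRingHom ℚ) f with hF
  have hFdeg : F.totalDegree ≤ d := by rw [hF, tdeg_map_inj]; exact hf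
  have hF1 : 1 ≤ F.totalDegree := by
    by_contra h
    exact hirr.not_isUnit (isUnit_of_tdeg_zero hirr.ne_zero (by omega))
  by_cases hG1 : 1 ≤ G.totalDegree
  · have hGf : ¬ F ∣ G := not_dvd_of_degreeOf (d := d) (by rw [hF, coeff_map]; simpa using htop) hG hG0
    have hrp : IsRelPrime F G := (hirr.dvd_or_isRelPrime (n := G)).resolve_left hGf
    obtain ⟨q, hq0, hqd, hq⟩ := bez3_elim hirr.ne_zero hG hF1 hG1 hrp
    refine ⟨q, hq0, hqd.trans (by gcongr), ?_⟩
    obtain ⟨a, b, hab⟩ := Ideal.mem_span_pair.1 hq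
    intro x hx hxG
    have h1 := congrArg (eval (fun i => (x i : ℚ))) hab
    rw [map_add, map_mul, map_mul, hxG, hF, eval_cast, hx, eval_rename] at h1
    simp at h1
    exact h1.symm
  · refine ⟨1, one_ne_zero, by simp, fun x _ hx => ?_⟩
    have hu := isUnit_of_tdeg_zero hG (by omega)
    have := hu.map (eval (fun i => (x i : ℚ)))
    rw [hx] at this
    exact absurd this not_isUnit_zero
lemma eval_sub_dvd {r : ℕ} (f : MvPolynomial (Fin r) ℤ) (n : ℕ) (x y : Fin r → ℤ) (h : ∀ i, (n:ℤ) ∣ x i - y i) :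
    (n:ℤ) ∣ eval x f - eval y f := by
  rw [← ZMod.intCast_zmod_eq_zero_iff_dvd]
  push_cast
  have e : ∀ z : Fin r → ℤ, ((eval z f : ℤ) : ZMod n) = eval (fun i => (z i : ZMod n)) (map (Int.castRingHom (ZMod n)) f) := by
    intro z
    have := MvPolynomial.map_eval (Int.castRingHom (ZMod n)) z f
    simpa [Function.comp_def] using this
  rw [e, e, sub_eq_zero]
  congr 2
  funext i
  have := h i
  rw [← ZMod.intCast_zmod_eq_zero_iff_dvd] at this
  push_cast at this
  exact sub_eq_zero.1 this

lemma lift_unique (f : MvPolynomial (Fin 3) ℤ) {p : ℕ} (hp : p.Prime) (k : ℕ) (x y : Fin 3 → ℤ) (hx : eval x f = 0) (hy : eval y f = 0)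
    (hd : ¬ (p:ℤ) ∣ eval x (pderiv 0 f)) (h0 : (p:ℤ) ∣ y 0 - x 0) (ht : ∀ i : Fin 2, ((p^k:ℕ):ℤ) ∣ y i.succ - x i.succ) :
    ((p^k:ℕ):ℤ) ∣ y 0 - x 0 := by
  obtain ⟨c, hc⟩ := taylor0 f (Fin.tail x) (x 0) (y 0)
  rw [Fin.cons_self_tail, hx] at hc
  have h1 := eval_sub_dvd f (p^k) y (Fin.cons (y 0) (Fin.tail x)) (by
    intro i
    refine Fin.cases ?_ (fun i => ?_) i
    · simp
    · simpa [Fin.tail] using ht i)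
  rw [hy, hc] at h1
  have h2 : ((p^k:ℕ):ℤ) ∣ (y 0 - x 0) * (eval x (pderiv 0 f) + c * (y 0 - x 0)) := by
    have e : (y 0 - x 0) * (eval x (pderiv 0 f) + c * (y 0 - x 0)) = -(0 - (0 + (y 0 - x 0) * eval x (pderiv 0 f) + c * (y 0 - x 0) ^ 2)) := by ring
    rw [e]
    exact (dvd_neg.2 h1)
  have h3 : ¬ (p:ℤ) ∣ eval x (pderiv 0 f) + c * (y 0 - x 0) := by
    intro h
    exact hd ((dvd_add_left (h0.mul_left c)).1 h)
  have h4 : IsCoprime ((p^k:ℕ):ℤ) (eval x (pderiv 0 f) + c * (y 0 - x 0)) := by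
    push_cast
    exact IsCoprime.pow_left ((Prime.coprime_iff_not_dvd (Nat.prime_iff_prime_int.1 hp)).2 h3)
  exact h4.dvd_of_dvd_mul_right h2

lemma class_card {d : ℕ} {f : MvPolynomial (Fin 3) ℤ} (hf : f.totalDegree ≤ d) {p : ℕ} (hp : p.Prime)
    (htop : ¬ (p:ℤ) ∣ coeff (Finsupp.single 0 d) f) (k : ℕ) (hk : 1 ≤ k) (T : Finset (Fin 3 → ℤ)) (hT : ∀ x ∈ T, eval x f = 0)
    (hd : ∀ x ∈ T, ¬ (p:ℤ) ∣ eval x (pderiv 0 f)) :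
    (T.image (fun x i => x i % ((p^k:ℕ):ℤ))).card ≤ d * (p^k)^2 := by
  classical
  have := Fact.mk hp
  set cls : (Fin 3 → ℤ) → Fin 3 → ℤ := fun x i => x i % ((p^k:ℕ):ℤ) with hcls
  have hpk : 0 < ((p^k:ℕ):ℤ) := by exact_mod_cast pow_pos hp.pos k
  have hm : ∀ a b : ℤ, a % ((p^k:ℕ):ℤ) = b % ((p^k:ℕ):ℤ) ↔ ((p^k:ℕ):ℤ) ∣ a - b := fun a b =>
    ⟨fun h => Int.ModEq.dvd (show b ≡ a [ZMOD _] from h.symm), fun h => (Int.modEq_iff_dvd.2 h).symm⟩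
  have h1 := Finset.card_le_mul_card_image (s := T.image cls) (f := Fin.tail) d (by
    intro c hc
    obtain ⟨b, hb, hbc⟩ := Finset.mem_image.1 hc
    obtain ⟨x0, hx0, rfl⟩ := Finset.mem_image.1 hb
    set W := (T.image cls).filter (fun a => Fin.tail a = c) with hW
    let red : (Fin 3 → ℤ) → Fin 3 → ZMod p := fun a i => (a i : ZMod p)
    have hpp : ((p:ℕ):ℤ) ∣ ((p^k:ℕ):ℤ) := by exact_mod_cast dvd_pow_self p (by omega)
    have hred : ∀ x, red (cls x) = red x := by
      intro x
      funext i
      simp only [red, cls]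
      rw [← sub_eq_zero, ← Int.cast_sub, ZMod.intCast_zmod_eq_zero_iff_dvd]
      exact hpp.trans (Int.modEq_iff_dvd.1 (Int.mod_modEq (x i) _).symm)
    have hinj : Set.InjOn red W := by
      intro a ha b hb hab
      rw [Finset.mem_coe, hW, Finset.mem_filter] at ha hb
      obtain ⟨x, hx, rfl⟩ := Finset.mem_image.1 ha.1
      obtain ⟨y, hy, rfl⟩ := Finset.mem_image.1 hb.1
      have htl : ∀ i : Fin 2, ((p^k:ℕ):ℤ) ∣ x i.succ - y i.succ := by
        intro i
        have := congrFun (ha.2.trans hb.2.symm) i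
        exact (hm _ _).1 this
      rw [hred, hred] at hab
      have h0 : (p:ℤ) ∣ x 0 - y 0 := by
        have := congrFun hab 0
        simp only [red] at this
        rw [← sub_eq_zero, ← Int.cast_sub, ZMod.intCast_zmod_eq_zero_iff_dvd] at this
        exact this
      have := lift_unique f hp k y x (hT y hy) (hT x hx) (hd y hy) h0 htl
      funext i
      refine Fin.cases ?_ (fun i => ?_) i
      · exact (hm _ _).2 this
      · exact (hm _ _).2 (htl i)
    rw [← Finset.card_image_of_injOn hinj]
    refine fiber_le (f := map (Int.castRingHom (ZMod p)) f) ((totalDegree_map_le _ _).trans hf) ?_ (fun i => (c i : ZMod p)) _ ?_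
    · rw [coeff_map]
      intro h
      exact htop ((ZMod.intCast_zmod_eq_zero_iff_dvd _ _).1 h)
    · intro P hP
      obtain ⟨a, ha, rfl⟩ := Finset.mem_image.1 hP
      rw [hW, Finset.mem_filter] at ha
      obtain ⟨x, hx, rfl⟩ := Finset.mem_image.1 ha.1
      constructor
      · rw [hred]
        have := MvPolynomial.map_eval (Int.castRingHom (ZMod p)) x f
        rw [hT x hx] at this
        simpa [Function.comp_def, red] using this.symm
      · funext i
        have := congrFun ha.2 i
        rw [← this]
        simp [red, Fin.tail])
  refine h1.trans (Nat.mul_le_mul_left d ?_)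
  have h2 : (T.image cls).image Fin.tail ⊆ Fintype.piFinset (fun _ : Fin 2 => Finset.Ico (0:ℤ) ((p^k:ℕ):ℤ)) := by
    intro c hc
    obtain ⟨b, hb, rfl⟩ := Finset.mem_image.1 hc
    obtain ⟨x, hx, rfl⟩ := Finset.mem_image.1 hb
    rw [Fintype.mem_piFinset]
    intro i
    rw [Finset.mem_Ico]
    exact ⟨Int.emod_nonneg _ hpk.ne', Int.emod_lt_of_pos _ hpk⟩
  refine (Finset.card_le_card h2).trans ?_
  rw [Fintype.card_piFinset]
  rw [Finset.prod_const, Int.card_Ico, sub_zero, Int.toNat_natCast, Finset.card_univ, Fintype.card_fin]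

end

section
open MvPolynomial

lemma tdeg_le_of_dvd' {r : ℕ} {a b : MvPolynomial (Fin r) ℚ} (h : a ∣ b) (hb : b ≠ 0) : a.totalDegree ≤ b.totalDegree := by
  obtain ⟨c, rfl⟩ := h
  rw [totalDegree_mul_of_isDomain (left_ne_zero_of_mul hb) (right_ne_zero_of_mul hb)]
  omega

lemma exists_irred_zero {r : ℕ} (G : MvPolynomial (Fin r) ℚ) (hG : G ≠ 0) (y : Fin r → ℚ) (h : eval y G = 0) :
    ∃ R, Irreducible R ∧ R ∣ G ∧ eval y R = 0 := by
  induction G using WfDvdMonoid.induction_on_irreducible with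
  | zero => exact absurd rfl hG
  | unit u hu =>
    have := hu.map (eval y)
    rw [h] at this; simp at this
  | mul a i ha hi ih =>
    rw [map_mul, mul_eq_zero] at h
    rcases h with h | h
    · exact ⟨i, hi, dvd_mul_right i a, h⟩
    · obtain ⟨R, h1, h2, h3⟩ := ih ha h
      exact ⟨R, h1, h2.mul_left i, h3⟩

lemma tree_count {d : ℕ} {f : MvPolynomial (Fin 3) ℤ} (hf : f.totalDegree ≤ d)
    (htop : coeff (Finsupp.single 0 d) f ≠ 0) (T : Finset (Fin 3 → ℤ)) (hT : ∀ x ∈ T, eval x f = 0)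
    (p : ℕ) (J : ℕ) (E N : ℕ → ℕ) (M : ℕ)
    (hpoly : ∀ j ≤ J, ∀ c : Fin 3 → ℤ, ∃ G : MvPolynomial (Fin 2) ℚ, G ≠ 0 ∧ G.totalDegree ≤ E j ∧
      ∀ y ∈ T, (fun i => y i % ((p^j:ℕ):ℤ)) = c → eval (fun i : Fin 2 => (y i.succ : ℚ)) G = 0)
    (hclass : ∀ j, 1 ≤ j → j ≤ J → (T.image (fun x i => x i % ((p^j:ℕ):ℤ))).card ≤ N j)
    (hM : ∀ R : MvPolynomial (Fin 2) ℚ, Irreducible R → R.totalDegree ≤ E J →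
      (T.filter fun x => eval (fun i : Fin 2 => (x i.succ : ℚ)) R = 0).card ≤ M * R.totalDegree) :
    T.card ≤ M * E 0 + ∑ j ∈ Finset.range J, N (j+1) * (d * E j * E (j+1)) := by
  classical
  set cls : ℕ → (Fin 3 → ℤ) → Fin 3 → ℤ := fun j x i => x i % ((p^j:ℕ):ℤ) with hcls
  have hpoly' : ∀ j c, ∃ G : MvPolynomial (Fin 2) ℚ, G ≠ 0 ∧ (j ≤ J → G.totalDegree ≤ E j ∧
      ∀ y ∈ T, cls j y = c → eval (fun i : Fin 2 => (y i.succ : ℚ)) G = 0) := by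
    intro j c
    by_cases hj : j ≤ J
    · obtain ⟨G, h1, h2, h3⟩ := hpoly j hj c
      exact ⟨G, h1, fun _ => ⟨h2, h3⟩⟩
    · exact ⟨1, one_ne_zero, fun h => absurd h hj⟩
  choose G hG0 hG using hpoly'
  have hRex : ∀ x, ∃ R : MvPolynomial (Fin 2) ℚ, x ∈ T → Irreducible R ∧ R ∣ G J (cls J x) ∧ eval (fun i : Fin 2 => (x i.succ : ℚ)) R = 0 := by
    intro x
    by_cases hx : x ∈ T
    · obtain ⟨R, hR⟩ := exists_irred_zero (G J (cls J x)) (hG0 _ _) _ ((hG J _ le_rfl).2 x hx rfl)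
      exact ⟨R, fun _ => hR⟩
    · exact ⟨0, fun h => absurd h hx⟩
  choose R hR using hRex
  set T0 := T.filter fun x => R x ∣ G 0 (cls 0 x) with hT0
  set U : ℕ → Finset (Fin 3 → ℤ) := fun j => T.filter fun x => ¬ R x ∣ G j (cls j x) ∧ R x ∣ G (j+1) (cls (j+1) x) with hU
  have hcover : T ⊆ T0 ∪ (Finset.range J).biUnion U := by
    intro x hx
    rw [Finset.mem_union, Finset.mem_biUnion]
    by_contra! hcon
    obtain ⟨h1, h2⟩ := hcon
    have h3 : ∀ n ≤ J, ¬ R x ∣ G n (cls n x) := by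
      intro n
      induction n with
      | zero =>
        intro _ h
        exact h1 (Finset.mem_filter.2 ⟨hx, h⟩)
      | succ n ih =>
        intro hn h
        exact h2 n (Finset.mem_range.2 (by omega)) (Finset.mem_filter.2 ⟨hx, ih (by omega), h⟩)
    exact h3 J le_rfl (hR x hx).2.1
  have hc0 : T0.card ≤ M * E 0 := by
    rcases T0.eq_empty_or_nonempty with h0 | ⟨x0, hx0⟩
    · rw [h0]; simp
    have hsame : ∀ x, cls 0 x = cls 0 x0 := by
      intro x; funext i; simp [cls]
    refine (factor_assoc T0 R (fun x hx => (hR x (Finset.mem_filter.1 hx).1).1) M (G 0 (cls 0 x0)) (hG0 _ _) ?_ T0 (Finset.Subset.refl _) ?_).trans ?_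
    · intro R0 hR0 hR0G S' hS' hSR
      rcases S'.eq_empty_or_nonempty with h0 | ⟨x1, hx1⟩
      · rw [h0]; simp
      have hx1T := (Finset.mem_filter.1 (hS' hx1)).1
      have hR1 := hR x1 hx1T
      have hdeg : R0.totalDegree ≤ E J := by
        have a1 : R0 ∣ R x1 := (hR1.1.associated_of_dvd hR0 (hSR x1 hx1)).symm.dvd
        exact (tdeg_le_of_dvd' (a1.trans hR1.2.1) (hG0 _ _)).trans (hG J _ le_rfl).1
      refine le_trans (Finset.card_le_card ?_) (hM R0 hR0 hdeg)
      intro x hx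
      have hxT := (Finset.mem_filter.1 (hS' hx)).1
      refine Finset.mem_filter.2 ⟨hxT, ?_⟩
      obtain ⟨c, hc⟩ := hSR x hx
      rw [hc, map_mul, (hR x hxT).2.2, zero_mul]
    · intro x hx
      have := (Finset.mem_filter.1 hx).2
      rwa [hsame x] at this
    · exact Nat.mul_le_mul_left _ (hG 0 _ (Nat.zero_le _)).1
  have hcU : ∀ j ∈ Finset.range J, (U j).card ≤ N (j+1) * (d * E j * E (j+1)) := by
    intro j hj
    have hj' := Finset.mem_range.1 hj
    have h1 := Finset.card_le_mul_card_image (s := U j) (f := cls (j+1)) (d * E j * E (j+1)) (by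
      intro c hc
      obtain ⟨x0, hx0, rfl⟩ := Finset.mem_image.1 hc
      set V := (U j).filter fun x => cls (j+1) x = cls (j+1) x0 with hV
      have hVT : ∀ x ∈ V, x ∈ T := fun x hx => (Finset.mem_filter.1 (Finset.mem_filter.1 hx).1).1
      have hVc : ∀ x ∈ V, cls (j+1) x = cls (j+1) x0 := fun x hx => (Finset.mem_filter.1 hx).2
      have hVc' : ∀ x ∈ V, cls j x = cls j x0 := by
        intro x hx
        funext i
        have := congrFun (hVc x hx) i
        simp only [cls] at this ⊢
        exact Int.ModEq.of_dvd (by exact_mod_cast pow_dvd_pow p (Nat.le_succ j)) this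
      refine (level_count hf htop V (fun x hx => hT x (hVT x hx)) R (fun x hx => (hR x (hVT x hx)).1)
        (fun x hx => (hR x (hVT x hx)).2.2) (G j (cls j x0)) (G (j+1) (cls (j+1) x0)) (hG0 _ _) (hG0 _ _) ?_ ?_ ?_).trans ?_
      · intro x hx
        exact (hG j _ hj'.le).2 x (hVT x hx) (hVc' x hx)
      · intro x hx
        have := (Finset.mem_filter.1 (Finset.mem_filter.1 hx).1).2.1
        rwa [hVc' x hx] at this
      · intro x hx
        have := (Finset.mem_filter.1 (Finset.mem_filter.1 hx).1).2.2
        rwa [hVc x hx] at this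
      · have a1 := (hG j (cls j x0) hj'.le).1
        have a2 := (hG (j+1) (cls (j+1) x0) hj').1
        gcongr)
    refine h1.trans ?_
    rw [mul_comm]
    refine Nat.mul_le_mul_right _ ((Finset.card_le_card ?_).trans (hclass (j+1) (by omega) (by omega)))
    exact Finset.image_subset_image (Finset.filter_subset _ _)
  calc T.card ≤ (T0 ∪ (Finset.range J).biUnion U).card := Finset.card_le_card hcover
    _ ≤ T0.card + ((Finset.range J).biUnion U).card := Finset.card_union_le _ _
    _ ≤ T0.card + ∑ j ∈ Finset.range J, (U j).card := by gcongr; exact Finset.card_biUnion_le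
    _ ≤ _ := by gcongr with j hj; exact hcU j hj

end

section
open MvPolynomial

theorem tree_main (d : ℕ) (hd : 5 ≤ d) (Cz κ Cp : ℝ) (hCz : 1 ≤ Cz) (hκ : 0 ≤ κ) (hCp : 1 ≤ Cp) :
    ∃ Cc : ℝ, 1 ≤ Cc ∧ ∀ f : MvPolynomial (Fin 3) ℤ, f.totalDegree ≤ d → Irreducible (map (Int.castRingHom ℚ) f) →
    ∀ B : ℕ, 1 ≤ B →
    coeff (Finsupp.single 0 d) f * rupDelta d (dehom ℤ (homogeneousComponent d f)) ≠ 0 →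
    |((coeff (Finsupp.single 0 d) f * rupDelta d (dehom ℤ (homogeneousComponent d f)) : ℤ) : ℝ)| ≤ Cz * (B:ℝ)^κ →
    ∀ p : ℕ, p.Prime → (B:ℝ)^(0.02:ℝ) ≤ p → (p:ℝ) ≤ Cp * (B:ℝ)^(0.02:ℝ) →
    ¬ (p:ℤ) ∣ coeff (Finsupp.single 0 d) f →
    ∀ T : Finset (Fin 3 → ℤ), (∀ x ∈ T, ∀ k, |x k| ≤ (B:ℤ)) → (∀ x ∈ T, eval x f = 0) → NL f T →
    (∀ x ∈ T, |((eval x (pderiv 0 f) : ℤ) : ℝ)| ≤ Cz * (B:ℝ)^κ) →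
    (∀ x ∈ T, ¬ (p:ℤ) ∣ eval x (pderiv 0 f)) →
    (T.card : ℝ) ≤ Cc * B := by
  classical
  obtain ⟨K, hK1, hK⟩ := surf_class d hd Cz κ hCz hκ
  obtain ⟨K', hK'1, hK'⟩ := plane_count
  obtain ⟨A, hA⟩ : ∃ z : ℕ, z = 2 * K + 1 + d := ⟨_, rfl⟩
  obtain ⟨e, he⟩ : ∃ z : ℕ, z = 4 * (d * A) := ⟨_, rfl⟩
  obtain ⟨C1, hC1⟩ : ∃ z : ℝ, z = K' * d * (e:ℝ)^2 * (1 + (e:ℝ)^4) + 1 := ⟨_, rfl⟩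
  obtain ⟨Q0, hQ0⟩ : ∃ z : ℝ, z = Cp^24 := ⟨_, rfl⟩
  have hQ01 : 1 ≤ Q0 := by rw [hQ0]; exact one_le_pow₀ hCp
  obtain ⟨C2, hC2⟩ : ∃ z : ℝ, z = (d:ℝ)^2 * Cp * (4 * (d * A) * Q0)^2 := ⟨_, rfl⟩
  have hdR : (1:ℝ) ≤ d := by exact_mod_cast (by omega : 1 ≤ d)
  have hAR : (1:ℝ) ≤ A := by exact_mod_cast (by omega : 1 ≤ A)
  have hKR : (1:ℝ) ≤ K := by exact_mod_cast hK1
  have hC10 : 1 ≤ C1 := by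
    have : 0 ≤ K' * d * (e:ℝ)^2 * (1 + (e:ℝ)^4) := by positivity
    linarith
  have hC20 : 0 ≤ C2 := by rw [hC2]; positivity
  refine ⟨C1 * (4 * (d * A)) + 24 * C2, ?_, ?_⟩
  · have h1 : (1:ℝ) ≤ d * A := one_le_mul_of_one_le_of_one_le hdR hAR
    have h2 : (1:ℝ) ≤ C1 * (4 * (d * A)) := one_le_mul_of_one_le_of_one_le hC10 (by linarith)
    linarith
  intro f hf hirr B hB hne hbd p hp hp1 hp2 hptop T hTB hT hNL hder hpder
  have htop : coeff (Finsupp.single 0 d) f ≠ 0 := left_ne_zero_of_mul hne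
  have hBR : (1:ℝ) ≤ B := by exact_mod_cast hB
  have hB0 : (0:ℝ) < B := by linarith
  obtain ⟨w, hw⟩ : ∃ z : ℝ, z = (B:ℝ)^(0.47:ℝ) := ⟨_, rfl⟩
  have hw1 : 1 ≤ w := by rw [hw]; exact Real.one_le_rpow hBR (by norm_num)
  have hpR : (1:ℝ) ≤ p := by exact_mod_cast hp.one_lt.le
  have hp0 : (0:ℝ) < p := by linarith
  obtain ⟨Q, hQ⟩ : ∃ z : ℝ, z = Q0 * (B:ℝ)^(0.48:ℝ) := ⟨_, rfl⟩
  have hpw : ∀ j ≤ 24, (p:ℝ)^j ≤ Q := by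
    intro j hj
    calc (p:ℝ)^j ≤ (p:ℝ)^24 := pow_le_pow_right₀ hpR hj
      _ ≤ (Cp * (B:ℝ)^(0.02:ℝ))^24 := by gcongr
      _ = Q := by
        rw [mul_pow, ← Real.rpow_natCast ((B:ℝ)^(0.02:ℝ)), ← Real.rpow_mul hB0.le, hQ, hQ0]
        norm_num
  have hwQ : w ≤ Q := by
    calc w ≤ (B:ℝ)^(0.48:ℝ) := by rw [hw]; exact Real.rpow_le_rpow_of_exponent_le hBR (by norm_num)
      _ ≤ Q := by rw [hQ]; exact le_mul_of_one_le_left (by positivity) hQ01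
  have hp24 : w ≤ (p:ℝ)^24 := by
    calc w ≤ (B:ℝ)^(0.48:ℝ) := by rw [hw]; exact Real.rpow_le_rpow_of_exponent_le hBR (by norm_num)
      _ = ((B:ℝ)^(0.02:ℝ))^24 := by
        rw [← Real.rpow_natCast ((B:ℝ)^(0.02:ℝ)), ← Real.rpow_mul hB0.le]; norm_num
      _ ≤ _ := by gcongr
  obtain ⟨D, hD⟩ : ∃ D : ℕ → ℕ, ∀ j, D j = K + ⌈(K:ℝ) * w / (p:ℝ)^j⌉₊ := ⟨_, fun _ => rfl⟩
  obtain ⟨E, hE⟩ : ∃ E : ℕ → ℕ, ∀ j, E j = 2 * (d * (D j + d)) := ⟨_, fun _ => rfl⟩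
  obtain ⟨N, hN⟩ : ∃ N : ℕ → ℕ, ∀ j, N j = d * (p^j)^2 := ⟨_, fun _ => rfl⟩
  have hEj : ∀ j, (E j : ℝ) * (p:ℝ)^j ≤ 2 * (d * A) * ((p:ℝ)^j + w) := by
    intro j
    have hpj : (0:ℝ) < (p:ℝ)^j := by positivity
    have h1 : (⌈(K:ℝ) * w / (p:ℝ)^j⌉₊ : ℝ) * (p:ℝ)^j ≤ K * w + (p:ℝ)^j := by
      have := (Nat.ceil_lt_add_one (show 0 ≤ (K:ℝ) * w / (p:ℝ)^j by positivity)).le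
      calc _ ≤ ((K:ℝ) * w / (p:ℝ)^j + 1) * (p:ℝ)^j := by gcongr
        _ = _ := by field_simp
    have h2 : ((D j : ℝ) + d) * (p:ℝ)^j ≤ A * ((p:ℝ)^j + w) := by
      have e1 : (D j : ℝ) = K + (⌈(K:ℝ) * w / (p:ℝ)^j⌉₊ : ℝ) := by rw [hD]; push_cast; ring
      have e2 : (A:ℝ) = 2 * K + 1 + d := by rw [hA]; push_cast; ring
      have h3 : 0 ≤ (K:ℝ) * (p:ℝ)^j := by positivity
      have h4 : 0 ≤ ((K:ℝ) + 1 + d) * w := by positivity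
      rw [e1, e2]
      linarith
    have e3 : (E j : ℝ) = 2 * (d * ((D j : ℝ) + d)) := by rw [hE]; push_cast; ring
    rw [e3]
    calc 2 * (d * ((D j : ℝ) + d)) * (p:ℝ)^j = 2 * d * (((D j : ℝ) + d) * (p:ℝ)^j) := by ring
      _ ≤ 2 * d * (A * ((p:ℝ)^j + w)) := by gcongr
      _ = _ := by ring
  have hEQ : ∀ j ≤ 24, (E j : ℝ) * (p:ℝ)^j ≤ 4 * (d * A) * Q := by
    intro j hj
    calc _ ≤ 2 * (d * A) * ((p:ℝ)^j + w) := hEj j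
      _ ≤ 2 * (d * A) * (Q + Q) := by gcongr; exact hpw j hj
      _ = _ := by ring
  have hE24 : E 24 ≤ e := by
    have h1 : (E 24 : ℝ) * (p:ℝ)^24 ≤ (4 * (d * A)) * (p:ℝ)^24 := by
      calc _ ≤ 2 * (d * A) * ((p:ℝ)^24 + w) := hEj 24
        _ ≤ 2 * (d * A) * ((p:ℝ)^24 + (p:ℝ)^24) := by gcongr
        _ = _ := by ring
    have h2 := le_of_mul_le_mul_right h1 (by positivity)
    rw [he]
    exact_mod_cast h2
  have hE0 : (E 0 : ℝ) ≤ 4 * (d * A) * w := by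
    have := hEj 0
    rw [pow_zero, mul_one] at this
    calc (E 0 : ℝ) ≤ _ := this
      _ ≤ 2 * (d * A) * (w + w) := by gcongr
      _ = _ := by ring
  obtain ⟨M, hM⟩ : ∃ z : ℕ, z = ⌈K' * d * (e:ℝ)^2 * ((B:ℝ)^(0.513:ℝ) + (e:ℝ)^4)⌉₊ := ⟨_, rfl⟩
  have hB513 : (1:ℝ) ≤ (B:ℝ)^(0.513:ℝ) := Real.one_le_rpow hBR (by norm_num)
  have hMb : (M:ℝ) ≤ C1 * (B:ℝ)^(0.513:ℝ) := by
    have h1 := (Nat.ceil_lt_add_one (show 0 ≤ K' * d * (e:ℝ)^2 * ((B:ℝ)^(0.513:ℝ) + (e:ℝ)^4) by positivity)).le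
    rw [← hM] at h1
    calc (M:ℝ) ≤ _ := h1
      _ ≤ K' * d * (e:ℝ)^2 * ((B:ℝ)^(0.513:ℝ) + (e:ℝ)^4 * (B:ℝ)^(0.513:ℝ)) + (B:ℝ)^(0.513:ℝ) := by
        gcongr
        exact le_mul_of_one_le_right (by positivity) hB513
      _ = _ := by rw [hC1]; ring
  have hde : d ≤ e := by
    rw [he]
    have : d * 1 ≤ d * A := Nat.mul_le_mul_left d (by omega)
    omega
  have key := tree_count hf htop T hT p 24 E N M (by
    intro j hj c
    have hpj : (0:ℝ) < (p:ℝ)^j := by positivity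
    obtain ⟨G, hG0, hGd, hG1, hGT⟩ := hK f hf B hB hne hbd p hp j {y | y ∈ T ∧ (fun i => y i % ((p^j:ℕ):ℤ)) = c}
      (fun x hx => hTB x hx.1) (fun x hx => hT x hx.1) (fun x hx => hder x hx.1) (fun x hx => hpder x hx.1)
      (by
        intro x hx y hy k
        have := (congrFun hx.2 k).trans (congrFun hy.2 k).symm
        exact Int.ModEq.dvd (show y k ≡ x k [ZMOD _] from this.symm)) (D j) (by rw [hD]; omega) (by
        have h1 := Nat.le_ceil ((K:ℝ) * w / (p:ℝ)^j)
        have h2 : (K:ℝ) * w / (p:ℝ)^j ≤ D j := by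
          refine h1.trans ?_
          rw [hD]; push_cast; linarith
        rw [div_le_iff₀ hpj] at h2
        push_cast
        rw [← hw]
        exact h2)
    obtain ⟨q, hq0, hqd, hq⟩ := proj_aux (by omega) hf htop hirr G hG0 hG1 _ hGd
    exact ⟨q, hq0, hqd.trans (hE j).ge, fun y hy hyc => hq y (hT y hy) (hGT y ⟨hy, hyc⟩)⟩) (by
    intro j hj _
    rw [hN]
    exact class_card hf hp hptop j hj T hT hpder) (by
    intro R hR hRe
    have h1 := hK' d (by omega) f hf htop B hB T hTB hT hNL e hde R hR (hRe.trans hE24)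
    have h2 := Nat.le_ceil (K' * d * (e:ℝ)^2 * ((B:ℝ)^(0.513:ℝ) + (e:ℝ)^4))
    rw [← hM] at h2
    have h3 : ((T.filter fun x => eval (fun i : Fin 2 => (x i.succ : ℚ)) R = 0).card : ℝ) ≤ M * R.totalDegree :=
      h1.trans (by gcongr)
    exact_mod_cast h3)
  have keyR : (T.card : ℝ) ≤ M * E 0 + ∑ j ∈ Finset.range 24, (N (j+1) : ℝ) * (d * E j * E (j+1)) := by
    exact_mod_cast key
  clear key
  have hBle : ∀ t : ℝ, t ≤ 1 → (B:ℝ)^t ≤ B := fun t ht => by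
    calc (B:ℝ)^t ≤ (B:ℝ)^(1:ℝ) := Real.rpow_le_rpow_of_exponent_le hBR ht
      _ = B := Real.rpow_one _
  have hQn : 0 ≤ 4 * ((d:ℝ) * A) * Q := le_trans (by positivity) (hEQ 0 (by omega))
  have hterm : ∀ j ∈ Finset.range 24, (N (j+1) : ℝ) * (d * E j * E (j+1)) ≤ C2 * B := by
    intro j hj
    have hj' := Finset.mem_range.1 hj
    have e1 : (N (j+1) : ℝ) * (d * E j * E (j+1)) = (d:ℝ)^2 * p * ((E j * (p:ℝ)^j) * (E (j+1) * (p:ℝ)^(j+1))) := by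
      rw [hN]; push_cast; ring
    rw [e1]
    calc (d:ℝ)^2 * p * ((E j * (p:ℝ)^j) * (E (j+1) * (p:ℝ)^(j+1)))
        ≤ (d:ℝ)^2 * (Cp * (B:ℝ)^(0.02:ℝ)) * ((4 * (d * A) * Q) * (4 * (d * A) * Q)) := by
          refine mul_le_mul (mul_le_mul_of_nonneg_left hp2 (by positivity)) (mul_le_mul (hEQ j (by omega)) (hEQ (j+1) (by omega)) (by positivity) hQn) (by positivity) (by positivity)
      _ = C2 * ((B:ℝ)^(0.02:ℝ) * ((B:ℝ)^(0.48:ℝ) * (B:ℝ)^(0.48:ℝ))) := by rw [hC2, hQ]; ring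
      _ = C2 * (B:ℝ)^(0.98:ℝ) := by
        rw [← Real.rpow_add hB0, ← Real.rpow_add hB0]; norm_num
      _ ≤ C2 * B := mul_le_mul_of_nonneg_left (hBle _ (by norm_num)) hC20
  have hfirst : (M:ℝ) * E 0 ≤ C1 * (4 * (d * A)) * B := by
    calc (M:ℝ) * E 0 ≤ (C1 * (B:ℝ)^(0.513:ℝ)) * (4 * (d * A) * w) := mul_le_mul hMb hE0 (by positivity) (by positivity)
      _ = C1 * (4 * (d * A)) * ((B:ℝ)^(0.513:ℝ) * (B:ℝ)^(0.47:ℝ)) := by rw [hw]; ring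
      _ = C1 * (4 * (d * A)) * (B:ℝ)^(0.983:ℝ) := by rw [← Real.rpow_add hB0]; norm_num
      _ ≤ C1 * (4 * (d * A)) * B := mul_le_mul_of_nonneg_left (hBle _ (by norm_num)) (by positivity)
  have hsum := Finset.sum_le_sum hterm
  rw [Finset.sum_const, Finset.card_range, nsmul_eq_mul] at hsum
  push_cast at hsum
  linarith

end

section
open MvPolynomial

lemma homComp_map {r : ℕ} {R S : Type*} [CommRing R] [CommRing S] (φ : R →+* S) (d : ℕ) (f : MvPolynomial (Fin r) R) :
    homogeneousComponent d (map φ f) = map φ (homogeneousComponent d f) := by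
  ext m
  rw [coeff_homogeneousComponent, coeff_map, coeff_map, coeff_homogeneousComponent]
  split_ifs <;> simp

lemma map_int_alg {r : ℕ} (g : MvPolynomial (Fin r) ℤ) :
    map (algebraMap ℚ (AlgebraicClosure ℚ)) (map (Int.castRingHom ℚ) g) = map (Int.castRingHom (AlgebraicClosure ℚ)) g := by
  rw [map_map]
  congr 1

lemma delta_ne {d : ℕ} (hd : 1 ≤ d) {f : MvPolynomial (Fin 3) ℤ}
    (hirr : Irreducible (map (algebraMap ℚ (AlgebraicClosure ℚ)) (homogeneousComponent d (map (Int.castRingHom ℚ) f))))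
    (htop : coeff (Finsupp.single 0 d) f ≠ 0) : rupDelta d (dehom ℤ (homogeneousComponent d f)) ≠ 0 := by
  have hc : coeff (Finsupp.single 0 d) (homogeneousComponent d f) ≠ 0 := by
    rw [coeff_homogeneousComponent, if_pos (by simp)]; exact htop
  have hh := homogeneousComponent_isHomogeneous d f
  refine rup_ne hd (dehom_tdeg hh.totalDegree_le) ?_ (by rw [dehom_top hh]; exact hc)
  rw [dehom_map]
  rw [homComp_map, map_int_alg] at hirr
  refine dehom_irred hd (hh.map _) hirr ?_
  rw [coeff_map]
  simpa using hc

lemma dehom_coeff_le {d : ℕ} {f : MvPolynomial (Fin 3) ℤ} (H : ℕ) (hH : ∀ m, |coeff m f| ≤ (H:ℤ)) (m : Fin 2 →₀ ℕ) :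
    |coeff m (dehom ℤ (homogeneousComponent d f))| ≤ (H:ℤ) := by
  have hh := homogeneousComponent_isHomogeneous d f
  by_cases h0 : coeff m (dehom ℤ (homogeneousComponent d f)) = 0
  · rw [h0]; simp
  have hm := tdeg_lt (dehom_tdeg hh.totalDegree_le) h0
  have hup : (up d m).degree = d := by
    rw [deg3, up_zero, up_one, up_two]
    rw [deg2] at hm ⊢
    omega
  have := dehom_coeff hh (up d m) hup
  rw [pm_up] at this
  rw [this, coeff_homogeneousComponent, if_pos hup]
  exact hH _

lemma hev_one {r : ℕ} (L : ℕ) (F : MvPolynomial (Fin (r+1)) ℤ) (hF : F.totalDegree ≤ L) (x : Fin (r+1) → ℤ) :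
    hev L F x 1 = eval x F := by
  have := hev_eq (A := ℤ) L F hF x 1 1 (by simp)
  simpa using this

lemma zbound (d : ℕ) (hd : 1 ≤ d) : ∃ Cz κ : ℝ, 1 ≤ Cz ∧ 0 ≤ κ ∧ ∀ f : MvPolynomial (Fin 3) ℤ, f.totalDegree ≤ d → ∀ B : ℕ, 1 ≤ B →
    (∀ m, |coeff m f| ≤ (((d+(2+1)).choose (2+1) * B ^ d) ^ ((d+(2+1)).choose (2+1)) : ℕ)) →
    |((coeff (Finsupp.single 0 d) f * rupDelta d (dehom ℤ (homogeneousComponent d f)) : ℤ) : ℝ)| ≤ Cz * (B:ℝ)^κ ∧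
    ∀ x : Fin 3 → ℤ, (∀ k, |x k| ≤ (B:ℤ)) → |((eval x (pderiv 0 f) : ℤ) : ℝ)| ≤ Cz * (B:ℝ)^κ := by
  obtain ⟨C1, κ1, h1⟩ := poly_val_bound (rupP d)
  obtain ⟨s, hs⟩ : ∃ s, s = (d+(2+1)).choose (2+1) := ⟨_, rfl⟩
  have hs1 : 1 ≤ s := by rw [hs]; exact Nat.choose_pos (by omega)
  obtain ⟨a1, ha1⟩ : ∃ a : ℕ, a = s^s * (C1 * (s^s)^κ1) := ⟨_, rfl⟩
  obtain ⟨k1, hk1⟩ : ∃ a : ℕ, a = d*s + (d*s)*κ1 := ⟨_, rfl⟩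
  obtain ⟨a2, ha2⟩ : ∃ a : ℕ, a = (d-1+(2+1)).choose (2+1) * (d * s^s) := ⟨_, rfl⟩
  obtain ⟨k2, hk2⟩ : ∃ a : ℕ, a = d*s + (d-1) := ⟨_, rfl⟩
  refine ⟨((a1 + a2 + 1 : ℕ) : ℝ), ((k1 + k2 : ℕ) : ℝ), by push_cast; linarith [(Nat.cast_nonneg a1 : (0:ℝ) ≤ a1), (Nat.cast_nonneg a2 : (0:ℝ) ≤ a2)], by positivity, ?_⟩
  intro f hf B hB hco
  rw [← hs] at hco
  obtain ⟨H, hH⟩ : ∃ H, H = (s * B ^ d) ^ s := ⟨_, rfl⟩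
  rw [← hH] at hco
  have hHe : H = s^s * B^(d*s) := by rw [hH, mul_pow, pow_mul]
  have hH1 : 1 ≤ H := by rw [hH]; exact Nat.one_le_pow _ _ (Nat.mul_pos hs1 (pow_pos hB d))
  rw [Real.rpow_natCast]
  have fin1 : ∀ (z : ℤ) (a k : ℕ), |z| ≤ ((a * B^k : ℕ) : ℤ) → a ≤ a1 + a2 + 1 → k ≤ k1 + k2 → |(z:ℝ)| ≤ ((a1+a2+1 : ℕ):ℝ) * (B:ℝ)^(k1+k2) := by
    intro z a k hz ha hk
    have : a * B^k ≤ (a1+a2+1) * B^(k1+k2) := Nat.mul_le_mul ha (Nat.pow_le_pow_right hB hk)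
    have h2 : |z| ≤ (((a1+a2+1) * B^(k1+k2) : ℕ) : ℤ) := hz.trans (by exact_mod_cast this)
    have h3 : ((|z| : ℤ) : ℝ) ≤ (((a1+a2+1) * B^(k1+k2) : ℕ) : ℝ) := by exact_mod_cast h2
    rw [Int.cast_abs] at h3
    rw [Nat.cast_mul, Nat.cast_pow] at h3
    exact h3
  constructor
  · refine fin1 _ a1 k1 ?_ (by omega) (by omega)
    rw [abs_mul, rupP_spec (dehom_tdeg (homogeneousComponent_isHomogeneous d f).totalDegree_le)]
    have h2 := h1 (fun m => coeff m (dehom ℤ (homogeneousComponent d f))) H (by exact_mod_cast hH1) (dehom_coeff_le H hco)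
    refine (mul_le_mul (hco _) h2 (abs_nonneg _) (by positivity)).trans (le_of_eq ?_)
    rw [ha1, hk1, hHe]
    push_cast
    rw [pow_add, mul_pow, pow_mul (B:ℤ) (d*s) κ1]
    ring
  · intro x hx
    refine fin1 _ a2 k2 ?_ (by omega) (by omega)
    have hderF : (pderiv 0 f).totalDegree ≤ d - 1 := (tdeg_pderiv f 0).trans (by omega)
    have hderH : ∀ m, |coeff m (pderiv 0 f)| ≤ ((d * H : ℕ) : ℤ) := by
      intro m
      by_cases hm : coeff m (pderiv 0 f) = 0
      · rw [hm]; simp; positivity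
      · have h1 := tdeg_lt hderF hm
        rw [coeff_pderiv, abs_mul]
        have h2 : m 0 ≤ m.degree := Finsupp.le_degree 0 m
        have h3 : |((m 0 : ℤ) + 1)| ≤ d := by
          rw [abs_of_nonneg (by positivity)]; omega
        push_cast
        rw [mul_comm]
        exact mul_le_mul h3 (hco _) (abs_nonneg _) (by positivity)
    have h2 := hev_le hderF (d*H) hderH x 1 B hx (by simpa using hB)
    rw [hev_one _ _ hderF] at h2
    refine h2.trans (le_of_eq ?_)
    rw [ha2, hk2, hHe]
    congr 1
    rw [pow_add]
    ring

set_option maxHeartbeats 400000 in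
theorem small_main (d : ℕ) (hd : 5 ≤ d) : ∃ Cc : ℝ, 1 ≤ Cc ∧ ∀ f : MvPolynomial (Fin 3) ℤ, f.totalDegree = d →
    Irreducible (map (algebraMap ℚ (AlgebraicClosure ℚ)) (homogeneousComponent d (map (Int.castRingHom ℚ) f))) →
    Irreducible (map (Int.castRingHom ℚ) f) →
    coeff (Finsupp.single 0 d) f ≠ 0 →
    ∀ B : ℕ, 1 ≤ B → ∀ S : Finset (Fin 3 → ℤ), (∀ x ∈ S, ∀ j, |x j| ≤ (B:ℤ)) → (∀ x ∈ S, eval x f = 0) →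
    (S.card : ℝ) ≤ Cc * B := by
  classical
  have hd1 : 1 ≤ d := by omega
  have hdR : (1:ℝ) ≤ d := by exact_mod_cast hd1
  obtain ⟨K1, hK11, hK1⟩ := split_lines
  obtain ⟨K, hKge, hK⟩ := pick_prime' 2 0.02 (by norm_num)
  obtain ⟨K2, hK21, hK2⟩ := elim_count
  obtain ⟨Cz, κ, hCz, hκ, hz⟩ := zbound d hd1
  obtain ⟨Cp, hCp⟩ : ∃ z : ℝ, z = 8 * (K * (1 + (d:ℝ)^5) + 1) := ⟨_, rfl⟩
  have hCp1 : 1 ≤ Cp := by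
    have : 0 ≤ K * (1 + (d:ℝ)^5) := by positivity
    linarith
  obtain ⟨C3, hC31, hC3⟩ := tree_main d hd Cz κ Cp hCz hκ hCp1
  obtain ⟨C0, hC0⟩ : ∃ z : ℝ, z = K2 * d * ((2 * (d * d) : ℕ):ℝ)^3 * (1 + ((2 * (d * d) : ℕ):ℝ)^4) := ⟨_, rfl⟩
  have hC00 : 0 ≤ C0 := by rw [hC0]; positivity
  refine ⟨K1 * (d:ℝ)^8 + C0 + 2 * C3, ?_, ?_⟩
  · have : 0 ≤ K1 * (d:ℝ)^8 := by positivity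
    linarith
  intro f hdeg hirr hirr' htop B hB S hSB hS
  have hBR : (1:ℝ) ≤ B := by exact_mod_cast hB
  obtain ⟨S', hS', hNL, hcard1⟩ := hK1 d (by omega) f hdeg hirr htop B hB S hSB
  have hB02 : (1:ℝ) ≤ (B:ℝ)^(0.02:ℝ) := Real.one_le_rpow hBR (by norm_num)
  obtain ⟨Y, hY⟩ : ∃ Y, Y = ⌈K * ((B:ℝ)^(0.02:ℝ) + (d:ℝ)^5)⌉₊ := ⟨_, rfl⟩
  have hY1 : K * ((B:ℝ)^(0.02:ℝ) + (d:ℝ)^5) ≤ Y := by rw [hY]; exact Nat.le_ceil _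
  have hY2 : 8 * (Y:ℝ) ≤ Cp * (B:ℝ)^(0.02:ℝ) := by
    have h1 := (Nat.ceil_lt_add_one (show 0 ≤ K * ((B:ℝ)^(0.02:ℝ) + (d:ℝ)^5) by positivity)).le
    rw [← hY] at h1
    have h2 : (d:ℝ)^5 * 1 ≤ (d:ℝ)^5 * (B:ℝ)^(0.02:ℝ) := by gcongr
    have h3 : K * ((d:ℝ)^5 * 1) ≤ K * ((d:ℝ)^5 * (B:ℝ)^(0.02:ℝ)) := by gcongr
    rw [hCp]
    linarith
  obtain ⟨S0, T, G, p, F', hS0, hT, hcard, hG0, hGd, hGF, hG, hp, hpY, hpY2, hF'd, ⟨c, hc0, hcc⟩, hTp⟩ :=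
    hK d hd1 f hdeg.le hirr' htop (Fin 3 → ℤ) S' (fun x => x) (fun _ => 1) (fun _ _ => one_ne_zero) (by
        intro P hP
        simp only [Int.cast_one, div_one]
        rw [eval_cast, hS P (hS' hP)]; simp) B hB (fun P hP j => hSB P (hS' hP) j)
      (fun P hP => by simpa using hB) Y hY1
  simp only [Int.cast_one, div_one] at hG
  have hSB' : ∀ x ∈ S', ∀ j, |x j| ≤ (B:ℤ) := fun x hx => hSB x (hS' hx)
  have hSz' : ∀ x ∈ S', eval x f = 0 := fun x hx => hS x (hS' hx)
  have hBle : ∀ t : ℝ, t ≤ 1 → (B:ℝ)^t ≤ B := fun t ht => by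
    calc (B:ℝ)^t ≤ (B:ℝ)^(1:ℝ) := Real.rpow_le_rpow_of_exponent_le hBR ht
      _ = B := Real.rpow_one _
  have h0 : (S0.card : ℝ) ≤ C0 * B := by
    have h1 : (S0.card : ℝ) ≤ K2 * d * ((2 * (d * d) : ℕ):ℝ)^3 * ((B:ℝ)^(0.513:ℝ) + ((2 * (d * d) : ℕ):ℝ)^4) :=
      hK2 d hd1 f hdeg.le htop hirr' B hB S0 (fun x hx => hSB' x (hS0 hx)) (fun x hx => hSz' x (hS0 hx)) (hNL.mono hS0)
        (2 * (d * d)) (by rw [← mul_assoc]; exact Nat.le_mul_of_pos_left d (by omega)) G hG0 hGF (by gcongr) hG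
    have h2 : (B:ℝ)^(0.513:ℝ) + ((2 * (d * d) : ℕ):ℝ)^4 ≤ (1 + ((2 * (d * d) : ℕ):ℝ)^4) * B := by
      have e1 := hBle 0.513 (by norm_num)
      have e2 : ((2 * (d * d) : ℕ):ℝ)^4 * 1 ≤ ((2 * (d * d) : ℕ):ℝ)^4 * B := by gcongr
      linarith
    calc (S0.card : ℝ) ≤ _ := h1
      _ ≤ K2 * d * ((2 * (d * d) : ℕ):ℝ)^3 * ((1 + ((2 * (d * d) : ℕ):ℝ)^4) * B) := by gcongr
      _ = C0 * B := by rw [hC0]; ring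
  have hTc : (T.card : ℝ) ≤ C3 * B := by
    rcases T.eq_empty_or_nonempty with hTe | ⟨x0, hx0⟩
    · rw [hTe]; simp; positivity
    obtain ⟨-, -, hptop, hco⟩ := hTp x0 hx0
    have htop' : coeff (Finsupp.single 0 d) F' ≠ 0 := by
      intro h; rw [h] at hptop; exact hptop (dvd_zero _)
    have hirrF : Irreducible (map (Int.castRingHom ℚ) F') := by
      rw [hcc, irreducible_isUnit_mul ((isUnit_iff_ne_zero.2 hc0).map C)]
      exact hirr'
    have hirrT : Irreducible (map (algebraMap ℚ (AlgebraicClosure ℚ)) (homogeneousComponent d (map (Int.castRingHom ℚ) F'))) := by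
      rw [hcc, homogeneousComponent_C_mul, map_mul, map_C, irreducible_isUnit_mul (((isUnit_iff_ne_zero.2 hc0).map _).map C)]
      exact hirr
    obtain ⟨hz1, hz2⟩ := hz F' hF'd B hB hco
    have hTB : ∀ x ∈ T, ∀ j, |x j| ≤ (B:ℤ) := fun x hx => hSB' x (hT hx)
    have hTz : ∀ x ∈ T, eval x F' = 0 := by
      intro x hx
      have e1 := eval_cast x F'
      rw [hcc, map_mul, eval_cast, hSz' x (hT hx)] at e1
      simp at e1
      exact_mod_cast e1.symm
    have hderF : (pderiv 0 F').totalDegree ≤ d - 1 := (tdeg_pderiv F' 0).trans (by omega)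
    have hYp : (Y:ℝ) ≤ p := by exact_mod_cast hpY.le
    have hpp : (p:ℝ) ≤ 8 * Y := by exact_mod_cast hpY2
    refine hC3 F' hF'd hirrF B hB (mul_ne_zero htop' (delta_ne hd1 hirrT htop')) hz1 p hp ?_ (hpp.trans hY2) hptop T hTB hTz ?_
      (fun x hx => hz2 x (hTB x hx)) ?_
    · refine le_trans ?_ (hY1.trans hYp)
      have e1 : 0 ≤ (d:ℝ)^5 := by positivity
      calc (B:ℝ)^(0.02:ℝ) ≤ 1 * ((B:ℝ)^(0.02:ℝ) + (d:ℝ)^5) := by linarith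
        _ ≤ _ := by gcongr
    · intro x hx x' hx' hne hall
      refine hNL x (hT hx) x' (hT hx') hne fun t => ?_
      have := hall t
      rw [hcc, map_mul, eval_C] at this
      exact (mul_eq_zero.1 this).resolve_left hc0
    · intro x hx
      have := (hTp x hx).2.1
      rwa [hev_one _ _ hderF] at this
  have hcardR : (S'.card : ℝ) ≤ S0.card + 2 * T.card := by exact_mod_cast hcard
  linarith

end

section
open MvPolynomial

lemma main_aux {d : ℕ} (hd : 5 ≤ d) {f : MvPolynomial (Fin 3) ℤ} (hf : f.totalDegree = d)
    (hirr : Irreducible (map (Int.castRingHom (AlgebraicClosure ℚ)) (homogeneousComponent d f)))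
    (M : ℝ) (hM : 0 ≤ M)
    (H : ∀ f : MvPolynomial (Fin 3) ℤ, f.totalDegree = d →
      Irreducible (map (algebraMap ℚ (AlgebraicClosure ℚ)) (homogeneousComponent d (map (Int.castRingHom ℚ) f))) →
      Irreducible (map (Int.castRingHom ℚ) f) →
      coeff (Finsupp.single 0 d) f ≠ 0 →
      ∀ B : ℕ, 1 ≤ B → ∀ S : Finset (Fin 3 → ℤ), (∀ x ∈ S, ∀ j, |x j| ≤ (B:ℤ)) → (∀ x ∈ S, eval x f = 0) →
      (S.card : ℝ) ≤ M * B) (B : ℝ) (hB : 1 ≤ B) :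
    (Set.ncard {x : Fin 3 → ℤ | (∀ i, |(x i : ℝ)| ≤ B) ∧ MvPolynomial.eval x f = 0} : ℝ) ≤ M * (2 * d) * B := by
  classical
  set T := {x : Fin 3 → ℤ | (∀ i, |(x i : ℝ)| ≤ B) ∧ MvPolynomial.eval x f = 0} with hT
  have hBn : 1 ≤ ⌊B⌋₊ := Nat.le_floor (by simpa using hB)
  have hBle : ((⌊B⌋₊ : ℕ) : ℝ) ≤ B := Nat.floor_le (by linarith)
  have hbox : ∀ x ∈ T, ∀ j, |x j| ≤ ((⌊B⌋₊ : ℕ) : ℤ) := by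
    intro x hx j
    have h1 : |(x j : ℝ)| ≤ B := hx.1 j
    have h2 : (((x j).natAbs : ℕ) : ℝ) ≤ B := by
      rw [Nat.cast_natAbs]; push_cast; exact h1
    have h3 := Nat.le_floor h2
    rw [Int.abs_eq_natAbs]
    exact_mod_cast h3
  have hfin : T.Finite := by
    refine Set.Finite.subset (Set.finite_Icc (fun _ : Fin 3 => -((⌊B⌋₊ : ℕ) : ℤ)) (fun _ => ((⌊B⌋₊ : ℕ) : ℤ))) ?_
    intro x hx
    exact ⟨fun j => (abs_le.1 (hbox x hx j)).1, fun j => (abs_le.1 (hbox x hx j)).2⟩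
  have hne : homogeneousComponent d f ≠ 0 := by
    intro h
    rw [h, map_zero] at hirr
    exact hirr.ne_zero rfl
  obtain ⟨a, ha, hatop⟩ := exists_shear (homogeneousComponent_isHomogeneous d f) hne
  have htop : coeff (Finsupp.single 0 d) (shear a f) ≠ 0 := by rw [shear_top]; exact hatop
  have hdeg : (shear a f).totalDegree = d := tdeg_of_top ((shear_tdeg a f).trans hf.le) htop
  have hi1 : Irreducible (map (algebraMap ℚ (AlgebraicClosure ℚ)) (homogeneousComponent d (map (Int.castRingHom ℚ) (shear a f)))) := by
    rw [homComp_map, map_int_alg, shear_homComp, shear_map, shear_irred]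
    exact hirr
  have hi2 : Irreducible (map (Int.castRingHom ℚ) (shear a f)) :=
    irred_of_top (by rw [tdeg_map_inj, hdeg]) (irred_of_map _ hi1)
  have hinj : Function.Injective (shearPt (fun i => -a i) : (Fin 3 → ℤ) → _) :=
    Function.LeftInverse.injective (g := shearPt a) (shearPt_neg a)
  have key := H (shear a f) hdeg hi1 hi2 htop (2 * d * ⌊B⌋₊) (by
      have : 1 ≤ 2 * d := by omega
      exact Nat.one_le_iff_ne_zero.2 (by positivity)) (hfin.toFinset.image (shearPt (fun i => -a i))) (by
    intro y hy j
    obtain ⟨x, hx, rfl⟩ := Finset.mem_image.1 hy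
    exact shearPt_bd (by omega) a ha x _ (hbox x (hfin.mem_toFinset.1 hx)) j) (by
    intro y hy
    obtain ⟨x, hx, rfl⟩ := Finset.mem_image.1 hy
    rw [eval_shear, shearPt_neg]
    exact (hfin.mem_toFinset.1 hx).2)
  rw [Finset.card_image_of_injective _ hinj, ← Set.ncard_eq_toFinset_card T hfin] at key
  refine key.trans ?_
  push_cast
  rw [mul_assoc M]
  refine mul_le_mul_of_nonneg_left ?_ hM
  exact mul_le_mul_of_nonneg_left hBle (by positivity)

theorem final_bound :
    ∃ c : ℝ, 0 < c ∧
      ∀ (d : ℕ) (f : MvPolynomial (Fin 3) ℤ) (B : ℝ),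
        5 ≤ d → f.totalDegree = d →
        Irreducible (MvPolynomial.map (Int.castRingHom (AlgebraicClosure ℚ))
          (MvPolynomial.homogeneousComponent d f)) →
        1 ≤ B →
        (Set.ncard {x : Fin 3 → ℤ | (∀ i, |(x i : ℝ)| ≤ B) ∧ MvPolynomial.eval x f = 0} : ℝ) ≤ c * (d : ℝ) ^ 14 * B := by
  obtain ⟨C0, hC0, hL⟩ := large_main
  choose Cs hCs1 hCs using small_main
  let Ct : ℕ → ℝ := fun d => if h : 5 ≤ d then Cs d h else 0
  have hCt : ∀ d, 0 ≤ Ct d := by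
    intro d
    by_cases h : 5 ≤ d
    · simp only [Ct, dif_pos h]; linarith [hCs1 d h]
    · simp only [Ct, dif_neg h]; exact le_rfl
  have hsum : 0 ≤ ∑ d ∈ Finset.range 100, Ct d := Finset.sum_nonneg fun d _ => hCt d
  refine ⟨2 * C0 + 2 * ∑ d ∈ Finset.range 100, Ct d, by linarith, ?_⟩
  intro d f B hd hf hirr hB
  have hd1 : (1:ℝ) ≤ d := by exact_mod_cast (by omega : 1 ≤ d)
  by_cases h100 : 100 ≤ d
  · refine (main_aux hd hf hirr (C0 * (d:ℝ)^13) (by positivity) (hL d h100) B hB).trans ?_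
    refine mul_le_mul_of_nonneg_right ?_ (by linarith)
    have h14 : (0:ℝ) ≤ (∑ d ∈ Finset.range 100, Ct d) * (d:ℝ)^14 := by positivity
    nlinarith
  · refine (main_aux hd hf hirr (Cs d hd) (by linarith [hCs1 d hd]) (hCs d hd) B hB).trans ?_
    refine mul_le_mul_of_nonneg_right ?_ (by linarith)
    have h1 : Cs d hd ≤ ∑ d ∈ Finset.range 100, Ct d := by
      have h2 := Finset.single_le_sum (f := Ct) (fun i _ => hCt i) (Finset.mem_range.2 (by omega : d < 100))
      simpa only [Ct, dif_pos hd] using h2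
    have h3 : (d:ℝ) ≤ (d:ℝ)^14 := le_self_pow₀ hd1 (by norm_num)
    have h4 : Cs d hd * d ≤ (∑ d ∈ Finset.range 100, Ct d) * (d:ℝ)^14 := mul_le_mul h1 h3 (by linarith) hsum
    have h5 : 0 ≤ C0 * (d:ℝ)^14 := by positivity
    nlinarith

end

/-- **Affine surfaces in `𝔸³`.** There is an absolute constant `c > 0` such that for
every `f ∈ ℤ[y_1,y_2,y_3]` of degree `d ≥ 5` whose homogeneous part of highest degree
is irreducible over the algebraic closure of `ℚ`, and every `B ≥ 1`, one has
`N_aff(f,B) ≤ c·d^14·B`. -/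
theorem affine_surface_bound :
    ∃ c : ℝ, 0 < c ∧
      ∀ (d : ℕ) (f : MvPolynomial (Fin 3) ℤ) (B : ℝ),
        5 ≤ d → f.totalDegree = d →
        Irreducible (MvPolynomial.map (Int.castRingHom (AlgebraicClosure ℚ))
          (MvPolynomial.homogeneousComponent d f)) →
        1 ≤ B →
        (Naff f B : ℝ) ≤ c * (d : ℝ) ^ 14 * B := by
  exact final_bound
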